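/- Let X ⊆ ℚ_p^m and Y ⊆ ℚ_p^n be infinite subanalytic sets. Then there exists a subanalytic bijection X → Y if and only if dim(X) = dim(Y). -/

import Mathlib

open Filter MeasureTheory
open scoped ENNReal

namespace PadicSub

variable (p : ℕ) [Fact p.Prime]

/-- The coefficients (indexed by multi-indices) of a restricted power series:
they tend to `0` along the cofinite filter. -/
def IsRestrictedCoeffs {m : ℕ} (a : (Fin m → ℕ) → ℚ_[p]) : Prop :=
  Filter.Tendsto a Filter.cofinite (nhds 0)

/-- The restricted analytic function associated to a family of coefficients:
the sum of the power series on `ℤ_p^m`, and `0` outside `ℤ_p^m`. -/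
noncomputable def ranalFn {m : ℕ} (a : (Fin m → ℕ) → ℚ_[p]) (x : Fin m → ℚ_[p]) : ℚ_[p] :=
  if ∀ j, ‖x j‖ ≤ 1 then ∑' i : (Fin m → ℕ), a i * ∏ j, x j ^ i j else 0

/-- `D`-functions: the functions obtained from restricted analytic functions, polynomial
maps, and the inverse function (with the convention `0⁻¹ = 0`) by repeated composition. -/
inductive IsDFunction : {m : ℕ} → ((Fin m → ℚ_[p]) → ℚ_[p]) → Prop where
  | ranal {m : ℕ} (a : (Fin m → ℕ) → ℚ_[p]) (ha : IsRestrictedCoeffs p a) :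
      IsDFunction (ranalFn p a)
  | poly {m : ℕ} (q : MvPolynomial (Fin m) ℚ_[p]) :
      IsDFunction (fun x => MvPolynomial.eval x q)
  | inv : IsDFunction (fun x : Fin 1 → ℚ_[p] => (x 0)⁻¹)
  | comp {m n : ℕ} (f : (Fin n → ℚ_[p]) → ℚ_[p]) (g : Fin n → (Fin m → ℚ_[p]) → ℚ_[p]) :
      IsDFunction f → (∀ i, IsDFunction (g i)) →
      IsDFunction (fun x => f (fun i => g i x))

/-- `P_n`: the set of nonzero `n`-th powers in `ℚ_p`. -/
def Pset (n : ℕ) : Set ℚ_[p] := {x | ∃ y : ℚ_[p], y ≠ 0 ∧ y ^ n = x}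

/-- The coset `μ P_n`. -/
def cosetP (μ : ℚ_[p]) (n : ℕ) : Set ℚ_[p] := {x | ∃ y ∈ Pset p n, x = μ * y}

/-- A (globally) subanalytic subset of `ℚ_p^m`: a finite union of finite intersections of
sets of the form `{x | f x = 0}` and `{x | f x ∈ P_n}`, `f` a `D`-function, `n > 0`. -/
def IsSubanalytic {m : ℕ} (X : Set (Fin m → ℚ_[p])) : Prop :=
  ∃ (r s : ℕ) (F : Fin r → Fin s → Set (Fin m → ℚ_[p])),
    (∀ i j, (∃ f, IsDFunction p f ∧ F i j = {x | f x = 0}) ∨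
            (∃ f n, IsDFunction p f ∧ 0 < n ∧ F i j = {x | f x ∈ Pset p n})) ∧
    X = ⋃ i, ⋂ j, F i j

/-- A semialgebraic subset of `ℚ_p^m`: a finite union of finite intersections of
sets of the form `{x | f x = 0}` and `{x | f x ∈ P_n}`, `f` a polynomial, `n > 0`. -/
def IsSemialgebraic {m : ℕ} (X : Set (Fin m → ℚ_[p])) : Prop :=
  ∃ (r s : ℕ) (F : Fin r → Fin s → Set (Fin m → ℚ_[p])),
    (∀ i j, (∃ f : MvPolynomial (Fin m) ℚ_[p], F i j = {x | MvPolynomial.eval x f = 0}) ∨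
            (∃ (f : MvPolynomial (Fin m) ℚ_[p]) (n : ℕ), 0 < n ∧
              F i j = {x | MvPolynomial.eval x f ∈ Pset p n})) ∧
    X = ⋃ i, ⋂ j, F i j

/-- The graph of the restriction to `X` of a map `ℚ_p^m → ℚ_p^n`, inside `ℚ_p^(m+n)`. -/
def graphMap {m n : ℕ} (X : Set (Fin m → ℚ_[p])) (F : (Fin m → ℚ_[p]) → (Fin n → ℚ_[p])) :
    Set (Fin (m + n) → ℚ_[p]) :=
  {z | (fun i => z (Fin.castAdd n i)) ∈ X ∧
    F (fun i => z (Fin.castAdd n i)) = fun j => z (Fin.natAdd m j)}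

/-- The graph of the restriction to `X` of a function `ℚ_p^m → ℚ_p`, inside `ℚ_p^(m+1)`. -/
def graphFun {m : ℕ} (X : Set (Fin m → ℚ_[p])) (f : (Fin m → ℚ_[p]) → ℚ_[p]) :
    Set (Fin (m + 1) → ℚ_[p]) :=
  {z | (fun i : Fin m => z i.castSucc) ∈ X ∧ f (fun i : Fin m => z i.castSucc) = z (Fin.last m)}

/-- A function `ℚ_p^m → ℚ_p` is subanalytic on `X` if its graph over `X` is subanalytic. -/
def IsSubanalyticFnOn {m : ℕ} (X : Set (Fin m → ℚ_[p])) (f : (Fin m → ℚ_[p]) → ℚ_[p]) : Prop :=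
  IsSubanalytic p (graphFun p X f)

/-- A (totally defined) subanalytic function `ℚ_p^m → ℚ_p`. -/
def IsSubanalyticFn {m : ℕ} (f : (Fin m → ℚ_[p]) → ℚ_[p]) : Prop :=
  IsSubanalyticFnOn p Set.univ f

/-- A function `ℚ_p^m → ℚ_p` is semialgebraic on `X` if its graph over `X` is
semialgebraic. -/
def IsSemialgebraicFnOn {m : ℕ} (X : Set (Fin m → ℚ_[p])) (f : (Fin m → ℚ_[p]) → ℚ_[p]) :
    Prop :=
  IsSemialgebraic p (graphFun p X f)

/-- A subanalytic subset of `ℚ_p` (one-variable version). -/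
def IsSubanalytic1 (X : Set ℚ_[p]) : Prop :=
  IsSubanalytic p {z : Fin 1 → ℚ_[p] | z 0 ∈ X}

/-- A semialgebraic subset of `ℚ_p` (one-variable version). -/
def IsSemialgebraic1 (X : Set ℚ_[p]) : Prop :=
  IsSemialgebraic p {z : Fin 1 → ℚ_[p] | z 0 ∈ X}

/-- A function `ℚ_p → ℚ_p` subanalytic on `X ⊆ ℚ_p`: its graph over `X` is a subanalytic
subset of `ℚ_p²`. -/
def IsSubanalyticFnOn1 (X : Set ℚ_[p]) (f : ℚ_[p] → ℚ_[p]) : Prop :=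
  IsSubanalytic p {z : Fin 2 → ℚ_[p] | z 0 ∈ X ∧ f (z 0) = z 1}

/-- A function `ℚ_p → ℚ_p` semialgebraic on `X ⊆ ℚ_p`: its graph over `X` is a
semialgebraic subset of `ℚ_p²`. -/
def IsSemialgebraicFnOn1 (X : Set ℚ_[p]) (f : ℚ_[p] → ℚ_[p]) : Prop :=
  IsSemialgebraic p {z : Fin 2 → ℚ_[p] | z 0 ∈ X ∧ f (z 0) = z 1}

/-- Interpretation of the symbols `□ᵢ` in the definition of cells: `true` means `<` and
`false` means "no condition". -/
def sqRel (b : Bool) (x y : ℝ) : Prop := b = true → x < y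

/-- A cell in `ℚ_p`, presented with its center `γ` and coset data `μ`, `n`. -/
def IsCell1 (A : Set ℚ_[p]) (γ μ : ℚ_[p]) (n : ℕ) : Prop :=
  0 < n ∧ A.Nonempty ∧
  ∃ (α β : ℚ_[p]) (b₁ b₂ : Bool), α ≠ 0 ∧ β ≠ 0 ∧
    A = {t | sqRel b₁ ‖α‖ ‖t - γ‖ ∧ sqRel b₂ ‖t - γ‖ ‖β‖ ∧ t - γ ∈ cosetP p μ n}

/-- Subanalytic cells in `ℚ_p^(m+1)`, defined inductively, presented with their center
`γ : ℚ_p^m → ℚ_p` and coset data `μ`, `n`.  The projection of the cell onto the first `m`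
coordinates is required to be a cell. -/
inductive IsCell : {m : ℕ} → Set (Fin (m + 1) → ℚ_[p]) →
    ((Fin m → ℚ_[p]) → ℚ_[p]) → ℚ_[p] → ℕ → Prop where
  | base (n : ℕ) (hn : 0 < n) (μ γ0 α β : ℚ_[p]) (hα : α ≠ 0) (hβ : β ≠ 0)
      (b₁ b₂ : Bool) (A : Set (Fin 1 → ℚ_[p])) (hne : A.Nonempty)
      (hA : A = {z | sqRel b₁ ‖α‖ ‖z 0 - γ0‖ ∧ sqRel b₂ ‖z 0 - γ0‖ ‖β‖ ∧
        z 0 - γ0 ∈ cosetP p μ n}) :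
      IsCell A (fun _ => γ0) μ n
  | succ {m : ℕ} {D : Set (Fin (m + 1) → ℚ_[p])} {γD : (Fin m → ℚ_[p]) → ℚ_[p]}
      {μD : ℚ_[p]} {nD : ℕ} (hD : IsCell D γD μD nD)
      (n : ℕ) (hn : 0 < n) (μ : ℚ_[p]) (α β γ : (Fin (m + 1) → ℚ_[p]) → ℚ_[p])
      (hα : IsSubanalyticFn p α) (hβ : IsSubanalyticFn p β) (hγ : IsSubanalyticFn p γ)
      (hα0 : ∀ x, α x ≠ 0) (hβ0 : ∀ x, β x ≠ 0)
      (b₁ b₂ : Bool) (A : Set (Fin (m + 2) → ℚ_[p]))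
      (hA : A = {z | (fun i : Fin (m + 1) => z i.castSucc) ∈ D ∧
          sqRel b₁ ‖α (fun i : Fin (m + 1) => z i.castSucc)‖
            ‖z (Fin.last (m + 1)) - γ (fun i : Fin (m + 1) => z i.castSucc)‖ ∧
          sqRel b₂ ‖z (Fin.last (m + 1)) - γ (fun i : Fin (m + 1) => z i.castSucc)‖
            ‖β (fun i : Fin (m + 1) => z i.castSucc)‖ ∧
          z (Fin.last (m + 1)) - γ (fun i : Fin (m + 1) => z i.castSucc) ∈ cosetP p μ n})
      (hproj : (fun (z : Fin (m + 2) → ℚ_[p]) (i : Fin (m + 1)) => z i.castSucc) '' A = D) :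
      IsCell A γ μ n

/-- Analytic cells in `ℚ_p^(m+1)`: as subanalytic cells, but at each stage of the inductive
definition the functions `α`, `β`, `γ` are moreover analytic on the projection of the cell. -/
inductive IsAnalyticCell : {m : ℕ} → Set (Fin (m + 1) → ℚ_[p]) →
    ((Fin m → ℚ_[p]) → ℚ_[p]) → ℚ_[p] → ℕ → Prop where
  | base (n : ℕ) (hn : 0 < n) (μ γ0 α β : ℚ_[p]) (hα : α ≠ 0) (hβ : β ≠ 0)
      (b₁ b₂ : Bool) (A : Set (Fin 1 → ℚ_[p])) (hne : A.Nonempty)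
      (hA : A = {z | sqRel b₁ ‖α‖ ‖z 0 - γ0‖ ∧ sqRel b₂ ‖z 0 - γ0‖ ‖β‖ ∧
        z 0 - γ0 ∈ cosetP p μ n}) :
      IsAnalyticCell A (fun _ => γ0) μ n
  | succ {m : ℕ} {D : Set (Fin (m + 1) → ℚ_[p])} {γD : (Fin m → ℚ_[p]) → ℚ_[p]}
      {μD : ℚ_[p]} {nD : ℕ} (hD : IsAnalyticCell D γD μD nD)
      (n : ℕ) (hn : 0 < n) (μ : ℚ_[p]) (α β γ : (Fin (m + 1) → ℚ_[p]) → ℚ_[p])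
      (hα : IsSubanalyticFn p α) (hβ : IsSubanalyticFn p β) (hγ : IsSubanalyticFn p γ)
      (hαan : AnalyticOn ℚ_[p] α D) (hβan : AnalyticOn ℚ_[p] β D)
      (hγan : AnalyticOn ℚ_[p] γ D)
      (hα0 : ∀ x, α x ≠ 0) (hβ0 : ∀ x, β x ≠ 0)
      (b₁ b₂ : Bool) (A : Set (Fin (m + 2) → ℚ_[p]))
      (hA : A = {z | (fun i : Fin (m + 1) => z i.castSucc) ∈ D ∧
          sqRel b₁ ‖α (fun i : Fin (m + 1) => z i.castSucc)‖
            ‖z (Fin.last (m + 1)) - γ (fun i : Fin (m + 1) => z i.castSucc)‖ ∧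
          sqRel b₂ ‖z (Fin.last (m + 1)) - γ (fun i : Fin (m + 1) => z i.castSucc)‖
            ‖β (fun i : Fin (m + 1) => z i.castSucc)‖ ∧
          z (Fin.last (m + 1)) - γ (fun i : Fin (m + 1) => z i.castSucc) ∈ cosetP p μ n})
      (hproj : (fun (z : Fin (m + 2) → ℚ_[p]) (i : Fin (m + 1)) => z i.castSucc) '' A = D) :
      IsAnalyticCell A γ μ n

/-- Generators of the algebra of subanalytic constructible functions on `ℚ_p^m`:
`ℤ`-valued valuations of nonvanishing subanalytic functions, and (`ℚ`-valued) norms of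
subanalytic functions. -/
def constructibleGens (m : ℕ) : Set ((Fin m → ℚ_[p]) → ℚ) :=
  {g | ∃ h : (Fin m → ℚ_[p]) → ℚ_[p], IsSubanalyticFn p h ∧ (∀ x, h x ≠ 0) ∧
        g = fun x => ((h x).valuation : ℚ)} ∪
  {g | ∃ h : (Fin m → ℚ_[p]) → ℚ_[p], IsSubanalyticFn p h ∧
        g = fun x => (padicNormE (h x) : ℚ)}

/-- The `ℚ`-algebra `C(ℚ_p^m)` of subanalytic constructible functions on `ℚ_p^m`. -/
noncomputable def ConstructibleAlg (m : ℕ) : Subalgebra ℚ ((Fin m → ℚ_[p]) → ℚ) :=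
  Algebra.adjoin ℚ (constructibleGens p m)

/-- `ℤ_p^m` as a subset of `ℚ_p^m`. -/
def ZpSet (m : ℕ) : Set (Fin m → ℚ_[p]) := {x | ∀ j, ‖x j‖ ≤ 1}

/-- A simple subset of `ℤ^n × ℚ_p^m`. -/
def IsSimpleSet (n m : ℕ) (A : Set ((Fin n → ℤ) × (Fin m → ℚ_[p]))) : Prop :=
  IsSubanalytic p {z : Fin (n + m) → ℚ_[p] |
    (∀ i : Fin n, z (Fin.castAdd m i) ≠ 0) ∧
    ((fun i : Fin n => (z (Fin.castAdd m i)).valuation),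
      fun j : Fin m => z (Fin.natAdd n j)) ∈ A}

/-- A simple function `ℤ^n × ℚ_p^m → ℤ`: one whose graph is a simple set. -/
def IsSimpleFn (n m : ℕ) (h : (Fin n → ℤ) × (Fin m → ℚ_[p]) → ℤ) : Prop :=
  IsSimpleSet p (n + 1) m
    {w | w.1 (Fin.last n) = h (fun i : Fin n => w.1 i.castSucc, w.2)}

/-- Generators of `C_simple(ℤ^n × ℚ_p^m)`: simple functions, and `p^h` for `h` simple. -/
def simpleGens (n m : ℕ) : Set ((Fin n → ℤ) × (Fin m → ℚ_[p]) → ℚ) :=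
  {g | ∃ h, IsSimpleFn p n m h ∧ g = fun w => (h w : ℚ)} ∪
  {g | ∃ h, IsSimpleFn p n m h ∧ g = fun w => (p : ℚ) ^ (h w)}

/-- The `ℚ`-algebra `C_simple(ℤ^n × ℚ_p^m)`. -/
noncomputable def SimpleAlg (n m : ℕ) : Subalgebra ℚ ((Fin n → ℤ) × (Fin m → ℚ_[p]) → ℚ) :=
  Algebra.adjoin ℚ (simpleGens p n m)

noncomputable instance : MeasurableSpace ℚ_[p] := borel _
instance : BorelSpace ℚ_[p] := ⟨rfl⟩

end PadicSub

section
namespace PadicSub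

/-! ### Boolean algebras of sets generated by a family -/

/-- The Boolean algebra of sets generated by `G`. -/
inductive BoolGen {X : Type*} (G : Set (Set X)) : Set X → Prop where
  | base (S : Set X) (h : S ∈ G) : BoolGen G S
  | univ : BoolGen G Set.univ
  | compl (S : Set X) (h : BoolGen G S) : BoolGen G Sᶜ
  | inter (S T : Set X) (hS : BoolGen G S) (hT : BoolGen G T) : BoolGen G (S ∩ T)

namespace BoolGen

variable {X Y : Type*} {G H : Set (Set X)} {S T : Set X}

theorem congr (hS : BoolGen G S) (h : ∀ x, x ∈ S ↔ x ∈ T) : BoolGen G T := by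
  have : S = T := Set.ext h
  rwa [← this]

theorem union (hS : BoolGen G S) (hT : BoolGen G T) : BoolGen G (S ∪ T) := by
  have := BoolGen.compl _ (BoolGen.inter _ _ (BoolGen.compl _ hS) (BoolGen.compl _ hT))
  simpa [Set.compl_inter] using this

theorem empty : BoolGen G ∅ := by
  simpa using BoolGen.compl _ (BoolGen.univ (G := G))

theorem diff (hS : BoolGen G S) (hT : BoolGen G T) : BoolGen G (S \ T) :=
  BoolGen.inter _ _ hS (BoolGen.compl _ hT)

theorem preimage {G : Set (Set X)} {H : Set (Set Y)} (φ : Y → X)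
    (h : ∀ S ∈ G, BoolGen H (φ ⁻¹' S)) {S : Set X} (hS : BoolGen G S) :
    BoolGen H (φ ⁻¹' S) := by
  induction hS with
  | base S hS => exact h S hS
  | univ => exact BoolGen.univ
  | compl S _ ih => exact BoolGen.compl _ ih
  | inter S T _ _ ihS ihT => exact BoolGen.inter _ _ ihS ihT

theorem mono (h : ∀ S ∈ G, BoolGen H S) (hS : BoolGen G S) : BoolGen H S :=
  preimage id h hS

theorem and {P Q : X → Prop} (hP : BoolGen G {x | P x}) (hQ : BoolGen G {x | Q x}) :
    BoolGen G {x | P x ∧ Q x} := BoolGen.inter _ _ hP hQ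

theorem or {P Q : X → Prop} (hP : BoolGen G {x | P x}) (hQ : BoolGen G {x | Q x}) :
    BoolGen G {x | P x ∨ Q x} := union hP hQ

theorem not {P : X → Prop} (hP : BoolGen G {x | P x}) :
    BoolGen G {x | ¬ P x} := BoolGen.compl _ hP

theorem const (P : Prop) : BoolGen G {_x : X | P} := by
  by_cases h : P
  · simpa [h] using BoolGen.univ (G := G)
  · simpa [h] using empty (G := G)

theorem imp {P Q : X → Prop} (hP : BoolGen G {x | P x}) (hQ : BoolGen G {x | Q x}) :
    BoolGen G {x | P x → Q x} := by
  have := or (not hP) hQ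
  convert this using 3
  exact imp_iff_not_or

theorem iff {P Q : X → Prop} (hP : BoolGen G {x | P x}) (hQ : BoolGen G {x | Q x}) :
    BoolGen G {x | P x ↔ Q x} := by
  have := and (imp hP hQ) (imp hQ hP)
  convert this using 3
  exact iff_iff_implies_and_implies

theorem all_finite {ι : Type*} [Finite ι] {P : ι → X → Prop}
    (h : ∀ i, BoolGen G {x | P i x}) : BoolGen G {x | ∀ i, P i x} := by
  classical
  have := Fintype.ofFinite ι
  have key : ∀ s : Finset ι, BoolGen G {x | ∀ i ∈ s, P i x} := by
    intro s
    induction s using Finset.induction_on with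
    | empty => simpa using BoolGen.univ (G := G)
    | insert a s _ ih =>
      have := and (h a) ih
      convert this using 3
      simp
  simpa using key Finset.univ

theorem ex_finite {ι : Type*} [Finite ι] {P : ι → X → Prop}
    (h : ∀ i, BoolGen G {x | P i x}) : BoolGen G {x | ∃ i, P i x} := by
  have := not (all_finite (fun i => not (h i)))
  simpa using this

theorem all_mem {ι : Type*} {s : Set ι} (hs : s.Finite) {P : ι → X → Prop}
    (h : ∀ i ∈ s, BoolGen G {x | P i x}) : BoolGen G {x | ∀ i ∈ s, P i x} := by
  have := hs.to_subtype
  have := all_finite (ι := s) (P := fun i x => P i x) (fun i => h i i.2)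
  simpa using this

theorem ex_mem {ι : Type*} {s : Set ι} (hs : s.Finite) {P : ι → X → Prop}
    (h : ∀ i ∈ s, BoolGen G {x | P i x}) : BoolGen G {x | ∃ i ∈ s, P i x} := by
  have := not (all_mem hs (fun i hi => not (h i hi)))
  simpa using this

end BoolGen

end PadicSub
end

section
namespace PadicSub

section arith

variable {p : ℕ} [Fact p.Prime]
local notation "ϖ" => (p : ℚ_[p])

/-! ### Approximation in `ℚ_p` -/

theorem norm_p_pos : 0 < ‖ϖ‖ := by
  rw [Padic.norm_p]; have := (Fact.out : p.Prime).pos; positivity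

theorem norm_p_lt_one : ‖ϖ‖ < 1 := Padic.norm_p_lt_one

theorem p_ne_zero' : ϖ ≠ 0 := norm_pos_iff.1 norm_p_pos

theorem norm_ppow_le_one (k : ℕ) : ‖ϖ ^ k‖ ≤ 1 := by
  rw [norm_pow]; exact pow_le_one₀ (norm_nonneg _) norm_p_lt_one.le

theorem norm_ppow_lt_one {k : ℕ} (hk : 1 ≤ k) : ‖ϖ ^ k‖ < 1 := by
  rw [norm_pow]; exact pow_lt_one₀ (norm_nonneg _) norm_p_lt_one (by omega)

theorem norm_ppow_pos (k : ℕ) : 0 < ‖ϖ ^ k‖ := by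
  rw [norm_pow]; exact pow_pos norm_p_pos k

theorem norm_ppow_anti {k l : ℕ} (h : k ≤ l) : ‖ϖ ^ l‖ ≤ ‖ϖ ^ k‖ := by
  rw [norm_pow, norm_pow]; exact pow_le_pow_of_le_one (norm_nonneg _) norm_p_lt_one.le h

theorem exists_ppow_lt {ε : ℝ} (hε : 0 < ε) : ∃ k : ℕ, 1 ≤ k ∧ ‖ϖ ^ k‖ < ε := by
  obtain ⟨k, hk⟩ := exists_pow_lt_of_lt_one hε (norm_p_lt_one (p := p))
  refine ⟨k + 1, by omega, lt_of_le_of_lt (norm_ppow_anti (Nat.le_succ k)) ?_⟩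
  rwa [norm_pow]

theorem na_add (x y : ℚ_[p]) : ‖x + y‖ ≤ max ‖x‖ ‖y‖ := Padic.nonarchimedean x y

theorem na_sub (x y : ℚ_[p]) : ‖x - y‖ ≤ max ‖x‖ ‖y‖ := by
  have := na_add x (-y); rwa [norm_neg, ← sub_eq_add_neg] at this

theorem norm_add_eq_left {x y : ℚ_[p]} (h : ‖y‖ < ‖x‖) : ‖x + y‖ = ‖x‖ := by
  rw [Padic.add_eq_max_of_ne h.ne', max_eq_left h.le]

theorem norm_eq_of_sub_lt {x y : ℚ_[p]} (h : ‖x - y‖ < ‖y‖) : ‖x‖ = ‖y‖ := by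
  have := norm_add_eq_left h; rwa [add_sub_cancel] at this

/-- `x` approximates `y` to relative precision `p^-k`. -/
def App (k : ℕ) (x y : ℚ_[p]) : Prop := ‖x - y‖ ≤ ‖ϖ ^ k‖ * ‖y‖

theorem app_iff {k : ℕ} {x y : ℚ_[p]} :
    App k x y ↔ ∃ u : ℚ_[p], ‖u‖ ≤ 1 ∧ x = y * (1 + p ^ k * u) := by
  constructor
  · intro h
    by_cases hy : y = 0
    · subst hy
      have : x = 0 := by
        have h' : ‖x - 0‖ ≤ 0 := by simpa [App] using h
        simpa using h'
      exact ⟨0, by simp, by simp [this]⟩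
    · refine ⟨(x - y) / (p ^ k * y), ?_, ?_⟩
      · rw [norm_div, norm_mul]
        exact div_le_one_of_le₀ h (by positivity)
      · have := p_ne_zero' (p := p)
        field_simp
        ring
  · rintro ⟨u, hu, rfl⟩
    have : y * (1 + p ^ k * u) - y = p ^ k * y * u := by ring
    rw [App, this, norm_mul, norm_mul]
    exact mul_le_of_le_one_right (by positivity) hu

namespace App

variable {k l : ℕ} {x y z x' y' c : ℚ_[p]}

theorem refl (k : ℕ) (x : ℚ_[p]) : App k x x := by
  rw [App, sub_self, norm_zero]; positivity

theorem mono (hkl : k ≤ l) (h : App l x y) : App k x y :=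
  h.trans (mul_le_mul_of_nonneg_right (norm_ppow_anti hkl) (norm_nonneg _))

theorem mul (h : App k x y) (h' : App k x' y') : App k (x * x') (y * y') := by
  rw [app_iff] at *
  obtain ⟨u, hu, rfl⟩ := h
  obtain ⟨v, hv, rfl⟩ := h'
  refine ⟨u + v + p ^ k * (u * v), ?_, by ring⟩
  refine (na_add _ _).trans (max_le ((na_add _ _).trans (max_le hu hv)) ?_)
  rw [norm_mul, norm_mul]
  exact mul_le_one₀ (norm_ppow_le_one k) (by positivity) (mul_le_one₀ hu (norm_nonneg _) hv)

theorem pow (h : App k x y) (n : ℕ) : App k (x ^ n) (y ^ n) := by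
  induction n with
  | zero => simpa using App.refl k (1 : ℚ_[p])
  | succ n ih => rw [pow_succ, pow_succ]; exact ih.mul h

theorem mul_left (c : ℚ_[p]) (h : App k x y) : App k (c * x) (c * y) := (App.refl k c).mul h

theorem mul_right (c : ℚ_[p]) (h : App k x y) : App k (x * c) (y * c) := h.mul (App.refl k c)

theorem norm_le (h : App k x y) : ‖x‖ ≤ ‖y‖ := by
  have h1 : ‖x - y‖ ≤ ‖y‖ := h.trans (mul_le_of_le_one_left (norm_nonneg _) (norm_ppow_le_one k))
  have := na_add (x - y) y
  rw [sub_add_cancel] at this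
  exact this.trans (max_le h1 le_rfl)

theorem trans (h : App k x y) (h' : App k y z) : App k x z := by
  have e : x - z = (x - y) + (y - z) := by ring
  rw [App, e]
  refine (na_add _ _).trans (max_le (le_trans h ?_) h')
  exact mul_le_mul_of_nonneg_left h'.norm_le (norm_nonneg _)

theorem norm_eq (hk : 1 ≤ k) (h : App k x y) : ‖x‖ = ‖y‖ := by
  by_cases hy : y = 0
  · subst hy
    have := h.norm_le
    simp at this
    simp [this]
  · refine norm_eq_of_sub_lt (lt_of_le_of_lt h ?_)
    exact mul_lt_of_lt_one_left (norm_pos_iff.2 hy) (norm_ppow_lt_one hk)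

theorem symm (hk : 1 ≤ k) (h : App k x y) : App k y x := by
  rw [App, norm_sub_rev, h.norm_eq hk]; exact h

theorem eq_zero_iff (hk : 1 ≤ k) (h : App k x y) : x = 0 ↔ y = 0 := by
  rw [← norm_eq_zero, h.norm_eq hk, norm_eq_zero]

theorem inv (hk : 1 ≤ k) (h : App k x y) : App k x⁻¹ y⁻¹ := by
  by_cases hy : y = 0
  · have := (h.eq_zero_iff hk).2 hy
    subst this; subst hy; exact App.refl _ _
  · have hx : x ≠ 0 := fun h0 => hy ((h.eq_zero_iff hk).1 h0)
    have := (h.symm hk).mul_left (x⁻¹ * y⁻¹)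
    have e1 : x⁻¹ * y⁻¹ * y = x⁻¹ := by field_simp
    have e2 : x⁻¹ * y⁻¹ * x = y⁻¹ := by field_simp
    rwa [e1, e2] at this

theorem add_small (h : App k x y) (hz : ‖z‖ ≤ ‖ϖ ^ k‖ * ‖y‖) : App k (x + z) y := by
  have e : x + z - y = (x - y) + z := by ring
  rw [App, e]
  exact (na_add _ _).trans (max_le h hz)

theorem of_small (hz : ‖z‖ ≤ ‖ϖ ^ k‖ * ‖y‖) : App k (y + z) y :=
  (App.refl k y).add_small hz

end App

/-! ### Powers -/

theorem one_mem_Pset (n : ℕ) : (1 : ℚ_[p]) ∈ Pset p n := ⟨1, one_ne_zero, one_pow n⟩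

theorem mul_mem_Pset {n : ℕ} {x y : ℚ_[p]} (hx : x ∈ Pset p n) (hy : y ∈ Pset p n) :
    x * y ∈ Pset p n := by
  obtain ⟨a, ha, rfl⟩ := hx
  obtain ⟨b, hb, rfl⟩ := hy
  exact ⟨a * b, mul_ne_zero ha hb, mul_pow a b n⟩

theorem inv_mem_Pset {n : ℕ} {x : ℚ_[p]} (hx : x ∈ Pset p n) : x⁻¹ ∈ Pset p n := by
  obtain ⟨a, ha, rfl⟩ := hx
  exact ⟨a⁻¹, inv_ne_zero ha, inv_pow a n⟩

theorem ne_zero_of_mem_Pset {n : ℕ} {x : ℚ_[p]} (hx : x ∈ Pset p n) : x ≠ 0 := by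
  obtain ⟨a, ha, rfl⟩ := hx; exact pow_ne_zero n ha

theorem pow_mem_Pset {x : ℚ_[p]} (hx : x ≠ 0) (n : ℕ) : x ^ n ∈ Pset p n := ⟨x, hx, rfl⟩

theorem mem_Pset_one {x : ℚ_[p]} : x ∈ Pset p 1 ↔ x ≠ 0 :=
  ⟨ne_zero_of_mem_Pset, fun h => ⟨x, h, pow_one x⟩⟩

theorem mul_mem_Pset_iff {n : ℕ} {x y : ℚ_[p]} (hx : x ∈ Pset p n) :
    x * y ∈ Pset p n ↔ y ∈ Pset p n := by
  refine ⟨fun h => ?_, mul_mem_Pset hx⟩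
  have := mul_mem_Pset (inv_mem_Pset hx) h
  rwa [inv_mul_cancel_left₀ (ne_zero_of_mem_Pset hx)] at this

theorem Pset_dvd {m n : ℕ} (h : m ∣ n) : Pset p n ⊆ Pset p m := by
  obtain ⟨c, rfl⟩ := h
  rintro x ⟨y, hy, rfl⟩
  exact ⟨y ^ c, pow_ne_zero _ hy, by rw [← pow_mul, mul_comm]⟩

/-- Precise Hensel: `1 + z` with `‖z‖ < ‖n‖^2` is an `n`-th power. -/
theorem one_add_mem_Pset {n : ℕ} (_hn : 0 < n) {z : ℚ_[p]} (hz : ‖z‖ < ‖(n : ℚ_[p])‖ ^ 2) :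
    1 + z ∈ Pset p n := by
  have hn1 : ‖(n : ℚ_[p])‖ ≤ 1 := by simpa using Padic.norm_int_le_one (p := p) (n : ℤ)
  have hz1 : ‖z‖ < 1 := lt_of_lt_of_le hz (pow_le_one₀ (norm_nonneg _) hn1)
  have hz2 : ‖1 + z‖ = 1 := by rw [norm_add_eq_left] <;> simp [hz1]
  set w : ℤ_[p] := ⟨1 + z, hz2.le⟩ with hw
  have key := hensels_lemma (p := p) (R := ℤ_[p]) (F := Polynomial.X ^ n - Polynomial.C w) (a := 1) ?_
  · obtain ⟨y, hy, -⟩ := key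
    simp only [Polynomial.coe_aeval_eq_eval, Polynomial.eval_sub, Polynomial.eval_pow, Polynomial.eval_X,
      Polynomial.eval_C, sub_eq_zero] at hy
    have hy' : (y : ℚ_[p]) ^ n = 1 + z := by
      have := congrArg (fun t : ℤ_[p] => (t : ℚ_[p])) hy
      simpa using this
    refine ⟨y, ?_, hy'⟩
    intro h0
    have h3 : ‖(y : ℚ_[p]) ^ n‖ = 1 := by rw [hy', hz2]
    rw [h0, zero_pow (by omega)] at h3
    simp at h3
  · simp only [Polynomial.coe_aeval_eq_eval, Polynomial.eval_sub, Polynomial.eval_pow, Polynomial.eval_X,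
      Polynomial.eval_C, Polynomial.derivative_sub, Polynomial.derivative_X_pow,
      Polynomial.derivative_C, sub_zero, one_pow, Polynomial.eval_mul, mul_one]
    have e1 : ‖(1 : ℤ_[p]) - w‖ = ‖z‖ := by
      rw [PadicInt.norm_def, PadicInt.coe_sub, PadicInt.coe_one]
      change ‖1 - (1 + z)‖ = ‖z‖
      rw [sub_add_cancel_left, norm_neg]
    have e2 : ‖(((n : ℕ) : ℤ_[p]))‖ = ‖(n : ℚ_[p])‖ := by
      rw [PadicInt.norm_def]; simp
    simp only [e1, e2]
    exact hz

theorem exists_app_Pset (n : ℕ) (hn : 0 < n) :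
    ∃ k : ℕ, 1 ≤ k ∧ ∀ x y : ℚ_[p], App k x y → (x ∈ Pset p n ↔ y ∈ Pset p n) := by
  have hpos : 0 < ‖(n : ℚ_[p])‖ ^ 2 := by
    have : (n : ℚ_[p]) ≠ 0 := by exact_mod_cast hn.ne'
    positivity
  obtain ⟨k, hk1, hk⟩ := exists_ppow_lt (p := p) hpos
  refine ⟨k, hk1, fun x y h => ?_⟩
  obtain ⟨u, hu, rfl⟩ := app_iff.1 h
  have : 1 + p ^ k * u ∈ Pset p n := by
    refine one_add_mem_Pset hn (lt_of_le_of_lt ?_ hk)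
    rw [norm_mul]
    exact mul_le_of_le_one_right (norm_nonneg _) hu
  rw [mul_comm, mul_mem_Pset_iff this]

/-- The norm of an element of `P_N` which is a unit, for well chosen `N`. -/
theorem exists_Pset_app (k : ℕ) :
    ∃ N : ℕ, 0 < N ∧ ∀ x y : ℚ_[p], ‖x‖ = ‖y‖ → x * y⁻¹ ∈ Pset p N → App k x y := by
  have hp := (Fact.out : p.Prime)
  refine ⟨Nat.totient (p ^ k), Nat.totient_pos.2 (pow_pos hp.pos k), ?_⟩
  intro x y hxy hmem
  have hy : y ≠ 0 := by
    rintro rfl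
    exact ne_zero_of_mem_Pset hmem (by simp)
  obtain ⟨t, ht, hte⟩ := hmem
  have hNpos : 0 < Nat.totient (p ^ k) := Nat.totient_pos.2 (pow_pos hp.pos k)
  have hnt : ‖t‖ = 1 := by
    have : ‖t‖ ^ (Nat.totient (p ^ k)) = 1 := by
      rw [← norm_pow, hte, norm_mul, norm_inv, hxy, mul_inv_cancel₀ (norm_ne_zero_iff.2 hy)]
    exact (pow_eq_one_iff_of_nonneg (norm_nonneg _) hNpos.ne').1 this
  set s : ℤ_[p] := ⟨t, hnt.le⟩ with hs
  have hsu : IsUnit s := PadicInt.isUnit_iff.2 (by simpa [hs] using hnt)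
  have h1 : PadicInt.toZModPow k (s ^ Nat.totient (p ^ k) - 1) = 0 := by
    obtain ⟨v, hv⟩ := hsu.map (PadicInt.toZModPow (p := p) k)
    rw [map_sub, map_pow, map_one, ← hv, ← Units.val_pow_eq_pow_val, ZMod.pow_totient]
    simp
  have h2 : s ^ Nat.totient (p ^ k) - 1 ∈ Ideal.span {(p : ℤ_[p]) ^ k} := by
    rw [← PadicInt.ker_toZModPow]; exact h1
  obtain ⟨u, hu⟩ := Ideal.mem_span_singleton.1 h2
  refine app_iff.2 ⟨(u : ℚ_[p]), u.norm_le_one, ?_⟩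
  have h3 : t ^ Nat.totient (p ^ k) - 1 = p ^ k * (u : ℚ_[p]) := by
    have := congrArg (fun t : ℤ_[p] => (t : ℚ_[p])) hu
    rw [PadicInt.coe_sub, PadicInt.coe_pow, PadicInt.coe_mul, PadicInt.coe_pow] at this
    simpa using this
  have h4 : x = y * t ^ Nat.totient (p ^ k) := by rw [hte]; field_simp
  rw [h4, ← h3]; ring

/-- `x` and `y` have the same class modulo `P_n`. -/
def SameCl (n : ℕ) (x y : ℚ_[p]) : Prop := ∀ c : ℚ_[p], c * x ∈ Pset p n ↔ c * y ∈ Pset p n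

theorem exists_valuation_norm (x : ℚ_[p]) (hx : x ≠ 0) : ∃ e : ℤ, ‖x‖ = ‖ϖ ^ e‖ := by
  refine ⟨x.valuation, ?_⟩
  rw [Padic.norm_eq_zpow_neg_valuation hx, norm_zpow, Padic.norm_p, zpow_neg, inv_zpow]

theorem norm_ppow_zlt {e f : ℤ} : ‖ϖ ^ e‖ < ‖ϖ ^ f‖ ↔ f < e := by
  rw [norm_zpow, norm_zpow]
  exact zpow_lt_zpow_iff_right_of_lt_one₀ norm_p_pos norm_p_lt_one

theorem norm_ppow_zle {e f : ℤ} : ‖ϖ ^ e‖ ≤ ‖ϖ ^ f‖ ↔ f ≤ e := by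
  rw [norm_zpow, norm_zpow]
  exact zpow_le_zpow_iff_right_of_lt_one₀ norm_p_pos norm_p_lt_one

theorem norm_lt_imp_le {x y : ℚ_[p]} (h : ‖x‖ < ‖y‖) : ‖x‖ ≤ ‖ϖ‖ * ‖y‖ := by
  by_cases hx : x = 0
  · subst hx; rw [norm_zero]; positivity
  have hy : y ≠ 0 := by rintro rfl; rw [norm_zero] at h; exact absurd h (not_lt.2 (norm_nonneg _))
  obtain ⟨e, he⟩ := exists_valuation_norm x hx
  obtain ⟨f, hf⟩ := exists_valuation_norm y hy
  rw [he, hf] at h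
  rw [he, hf, ← norm_mul, mul_comm, ← zpow_add_one₀ p_ne_zero', norm_ppow_zle]
  have := norm_ppow_zlt.1 h
  omega

/-- Finitely many representatives for the classes modulo `P_n`. -/
theorem exists_reps (n : ℕ) (hn : 0 < n) :
    ∃ L : Set ℚ_[p], L.Finite ∧ (∀ c ∈ L, c ≠ 0) ∧ ∀ x : ℚ_[p], x ≠ 0 → ∃ c ∈ L, c * x ∈ Pset p n := by
  obtain ⟨k, hk1, hk⟩ := exists_app_Pset (p := p) n hn
  have htb : TotallyBounded (Metric.closedBall (0 : ℚ_[p]) 1) :=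
    (isCompact_closedBall (0 : ℚ_[p]) 1).totallyBounded
  obtain ⟨t, ht, hcov⟩ := Metric.totallyBounded_iff.1 htb (‖ϖ ^ (k + n)‖)
    (norm_ppow_pos _)
  refine ⟨(fun z => z⁻¹) '' {z ∈ t | z ≠ 0}, (ht.subset (Set.sep_subset _ _)).image _, ?_, ?_⟩
  · rintro c ⟨z, hz, rfl⟩; exact inv_ne_zero hz.2
  · intro x hx
    obtain ⟨e, he⟩ := exists_valuation_norm x hx
    set q := e / (n : ℤ)
    set r := e % (n : ℤ)
    have hnz : (n : ℤ) ≠ 0 := by exact_mod_cast hn.ne'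
    have hr0 : 0 ≤ r := Int.emod_nonneg e hnz
    have hrn : r < n := Int.emod_lt_of_pos e (by exact_mod_cast hn)
    have hq : e = r + n * q := (Int.emod_add_mul_ediv e n).symm
    set y := x * (ϖ ^ (-q)) ^ n with hy
    have hpp : (ϖ ^ (-q)) ^ n = ϖ ^ (-(n * q) : ℤ) := by
      rw [← zpow_natCast, ← zpow_mul]; congr 1; ring
    have hyn : ‖y‖ = ‖ϖ ^ r‖ := by
      rw [hy, norm_mul, he, ← norm_mul, hpp, ← zpow_add₀ p_ne_zero']
      congr 2; omega
    have hy1 : y ∈ Metric.closedBall (0 : ℚ_[p]) 1 := by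
      rw [mem_closedBall_zero_iff, hyn]
      have := (norm_ppow_zle (p := p) (e := r) (f := 0)).2 hr0
      simpa using this
    obtain ⟨z, hz, hyz⟩ := Set.mem_iUnion₂.1 (hcov hy1)
    rw [Metric.mem_ball, dist_eq_norm] at hyz
    have hylow : ‖ϖ ^ n‖ ≤ ‖y‖ := by
      rw [hyn, ← zpow_natCast, norm_ppow_zle]; omega
    have happ : App k z y := by
      rw [App, norm_sub_rev]
      refine hyz.le.trans ?_
      rw [pow_add, norm_mul]
      exact mul_le_mul_of_nonneg_left hylow (norm_nonneg _)
    have hy0 : y ≠ 0 := mul_ne_zero hx (pow_ne_zero _ (zpow_ne_zero _ p_ne_zero'))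
    have hz0 : z ≠ 0 := fun h => hy0 ((happ.eq_zero_iff hk1).1 h)
    refine ⟨z⁻¹, ⟨z, ⟨hz, hz0⟩, rfl⟩, ?_⟩
    have h1 : App k (z⁻¹ * y) 1 := by
      have := (happ.symm hk1).mul_left z⁻¹
      rwa [inv_mul_cancel₀ hz0] at this
    have h2 : z⁻¹ * y ∈ Pset p n := (hk _ _ h1).2 (one_mem_Pset n)
    have h3 : (ϖ ^ (-q)) ^ n ∈ Pset p n := pow_mem_Pset (zpow_ne_zero _ p_ne_zero') n
    rw [hy, ← mul_assoc, mul_comm] at h2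
    exact (mul_mem_Pset_iff h3).1 h2

theorem SameCl.of_mul_inv {n : ℕ} {x y : ℚ_[p]} (hy : y ≠ 0) (h : x * y⁻¹ ∈ Pset p n) :
    SameCl n x y := by
  intro c
  have : c * x = (x * y⁻¹) * (c * y) := by field_simp
  rw [this, mul_mem_Pset_iff h]

theorem SameCl.zero_iff {n : ℕ} {x y : ℚ_[p]} (h : SameCl n x y) : x = 0 ↔ y = 0 := by
  constructor
  · rintro rfl
    by_contra hy
    have := (h y⁻¹).2 (by rw [inv_mul_cancel₀ hy]; exact one_mem_Pset n)
    exact ne_zero_of_mem_Pset this (by simp)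
  · rintro rfl
    by_contra hy
    have := (h x⁻¹).1 (by rw [inv_mul_cancel₀ hy]; exact one_mem_Pset n)
    exact ne_zero_of_mem_Pset this (by simp)

theorem SameCl.mul_inv_mem {n : ℕ} {x y : ℚ_[p]} (hy : y ≠ 0) (h : SameCl n x y) :
    x * y⁻¹ ∈ Pset p n := by
  rw [mul_comm, h y⁻¹, inv_mul_cancel₀ hy]; exact one_mem_Pset n

theorem SameCl.mul {n : ℕ} {x y x' y' : ℚ_[p]} (h : SameCl n x y) (h' : SameCl n x' y') :
    SameCl n (x * x') (y * y') := by
  intro c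
  rw [show c * (x * x') = (c * x') * x by ring, h, show c * x' * y = (c * y) * x' by ring, h',
    show c * y * y' = c * (y * y') by ring]

theorem SameCl.refl (n : ℕ) (x : ℚ_[p]) : SameCl n x x := fun _ => Iff.rfl

theorem SameCl.pow {n : ℕ} {x y : ℚ_[p]} (h : SameCl n x y) (e : ℕ) :
    SameCl n (x ^ e) (y ^ e) := by
  induction e with
  | zero => simpa using SameCl.refl n (1 : ℚ_[p])
  | succ e ih => rw [pow_succ, pow_succ]; exact ih.mul h

/-- The norm comparison is expressible by power conditions. -/
theorem norm_le_iff_Pset (x y : ℚ_[p]) :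
    ‖x‖ ≤ ‖y‖ ↔ x = 0 ∨ y ^ (p + 1) + p * x ^ (p + 1) ∈ Pset p (p + 1) := by
  by_cases hx : x = 0
  · simp [hx]
  simp only [hx, false_or]
  have hp := (Fact.out : p.Prime)
  constructor
  · intro h
    have hy : y ≠ 0 := by
      rintro rfl; rw [norm_zero] at h; exact hx (norm_le_zero_iff.1 h)
    have e : y ^ (p + 1) + p * x ^ (p + 1) = y ^ (p + 1) * (1 + p * (x / y) ^ (p + 1)) := by
      rw [div_pow]; have := pow_ne_zero (p + 1) hy; field_simp
    rw [e, mul_mem_Pset_iff (pow_mem_Pset hy _)]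
    refine one_add_mem_Pset (by omega) ?_
    have h1 : ‖((p + 1 : ℕ) : ℚ_[p])‖ = 1 := by
      push_cast
      rw [add_comm, norm_add_eq_left] <;> rw [norm_one]
      exact norm_p_lt_one
    rw [h1, one_pow, norm_mul, norm_pow, norm_div]
    refine lt_of_le_of_lt ?_ (norm_p_lt_one (p := p))
    exact mul_le_of_le_one_right (norm_nonneg _)
      (pow_le_one₀ (by positivity) (div_le_one_of_le₀ h (norm_nonneg _)))
  · rintro ⟨t, ht, hte⟩
    by_contra hlt
    rw [not_le] at hlt
    have h1 : ‖y ^ (p + 1)‖ < ‖ϖ * x ^ (p + 1)‖ := by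
      have h2 := norm_lt_imp_le hlt
      rw [norm_pow, norm_mul, norm_pow]
      have hxp : 0 < ‖x‖ := norm_pos_iff.2 hx
      calc ‖y‖ ^ (p + 1) ≤ (‖ϖ‖ * ‖x‖) ^ (p + 1) :=
            pow_le_pow_left₀ (norm_nonneg _) h2 _
        _ = ‖ϖ‖ ^ (p + 1) * ‖x‖ ^ (p + 1) := mul_pow _ _ _
        _ < ‖ϖ‖ * ‖x‖ ^ (p + 1) := by
          refine mul_lt_mul_of_pos_right ?_ (by positivity)
          have := pow_lt_pow_right_of_lt_one₀ norm_p_pos (norm_p_lt_one (p := p))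
            (show 1 < p + 1 by have := hp.pos; omega)
          simpa using this
    have h3 : ‖t ^ (p + 1)‖ = ‖ϖ * x ^ (p + 1)‖ := by
      rw [hte, add_comm, norm_add_eq_left h1]
    obtain ⟨e, he⟩ := exists_valuation_norm t ht
    obtain ⟨f, hf⟩ := exists_valuation_norm x hx
    have h4 : ‖ϖ ^ (e * (p + 1 : ℕ) : ℤ)‖ = ‖ϖ ^ (f * (p + 1 : ℕ) + 1 : ℤ)‖ := by
      rw [zpow_add_one₀ p_ne_zero', zpow_mul, zpow_mul, zpow_natCast, zpow_natCast, norm_pow,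
        norm_mul, norm_pow, ← he, ← hf, mul_comm, ← norm_pow, ← norm_pow, ← norm_mul, h3]
    have h5 : e * (p + 1 : ℕ) = f * (p + 1 : ℕ) + 1 := by
      apply le_antisymm
      · exact norm_ppow_zle.1 h4.symm.le
      · exact norm_ppow_zle.1 h4.le
    have h6 : ((p + 1 : ℕ) : ℤ) ∣ 1 := ⟨e - f, by push_cast at *; linarith⟩
    have h7 := Int.eq_one_of_dvd_one (by positivity) h6
    have := hp.pos
    omega

end arith

end PadicSub
end

section
namespace PadicSub

section defs

variable {p : ℕ} [Fact p.Prime] {Ω Ω' Ω'' : Type}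

/-- Algebras of functions on `Ω`. -/
abbrev FAlg (p : ℕ) [Fact p.Prime] (Ω : Type) := Subalgebra ℚ_[p] (Ω → ℚ_[p])

/-- The sets definable (without quantifiers) from an algebra of functions. -/
abbrev DefS (A : FAlg p Ω) (S : Set Ω) : Prop :=
  BoolGen {S | ∃ f ∈ A, ∃ n : ℕ, 0 < n ∧ S = {ω | f ω ∈ Pset p n}} S

theorem DefS.mono {A B : FAlg p Ω} (h : A ≤ B) {S : Set Ω} (hS : DefS A S) : DefS B S := by
  refine BoolGen.mono ?_ hS
  rintro S ⟨f, hf, n, hn, rfl⟩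
  exact BoolGen.base _ ⟨f, h hf, n, hn, rfl⟩

theorem DefS.comp {A : FAlg p Ω} {B : FAlg p Ω'} {φ : Ω' → Ω} (h : ∀ f ∈ A, f ∘ φ ∈ B)
    {S : Set Ω} (hS : DefS A S) : DefS B (φ ⁻¹' S) := by
  refine BoolGen.preimage φ ?_ hS
  rintro S ⟨f, hf, n, hn, rfl⟩
  exact BoolGen.base _ ⟨_, h f hf, n, hn, rfl⟩

theorem DefS.pow {A : FAlg p Ω} {f : Ω → ℚ_[p]} (hf : f ∈ A) {n : ℕ} (hn : 0 < n) :
    DefS A {ω | f ω ∈ Pset p n} := BoolGen.base _ ⟨f, hf, n, hn, rfl⟩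

theorem const_mem (A : FAlg p Ω) (c : ℚ_[p]) : (fun _ => c) ∈ A := A.algebraMap_mem c

theorem DefS.cpow {A : FAlg p Ω} {f : Ω → ℚ_[p]} (hf : f ∈ A) (c : ℚ_[p]) {n : ℕ} (hn : 0 < n) :
    DefS A {ω | c * f ω ∈ Pset p n} :=
  DefS.pow (f := fun ω => c * f ω) (A.mul_mem (const_mem A c) hf) hn

theorem DefS.ne_zero {A : FAlg p Ω} {f : Ω → ℚ_[p]} (hf : f ∈ A) : DefS A {ω | f ω ≠ 0} := by
  have := DefS.pow hf one_pos
  simpa only [mem_Pset_one] using this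

theorem DefS.eq_zero {A : FAlg p Ω} {f : Ω → ℚ_[p]} (hf : f ∈ A) : DefS A {ω | f ω = 0} := by
  have := BoolGen.not (DefS.ne_zero hf)
  simpa using this

theorem DefS.eq {A : FAlg p Ω} {f g : Ω → ℚ_[p]} (hf : f ∈ A) (hg : g ∈ A) :
    DefS A {ω | f ω = g ω} := by
  have := DefS.eq_zero (A.sub_mem hf hg)
  simpa [sub_eq_zero] using this

theorem DefS.norm_le {A : FAlg p Ω} {f g : Ω → ℚ_[p]} (hf : f ∈ A) (hg : g ∈ A) :
    DefS A {ω | ‖f ω‖ ≤ ‖g ω‖} := by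
  have h2 := DefS.pow (A.add_mem (A.pow_mem hg (p + 1)) (A.mul_mem (const_mem A (p : ℚ_[p]))
    (A.pow_mem hf (p + 1)))) (Nat.succ_pos p)
  have := BoolGen.or (DefS.eq_zero hf) h2
  simp only [norm_le_iff_Pset]
  exact this

theorem DefS.norm_lt {A : FAlg p Ω} {f g : Ω → ℚ_[p]} (hf : f ∈ A) (hg : g ∈ A) :
    DefS A {ω | ‖f ω‖ < ‖g ω‖} := by
  have := BoolGen.not (DefS.norm_le hg hf)
  simpa using this

theorem DefS.norm_eq {A : FAlg p Ω} {f g : Ω → ℚ_[p]} (hf : f ∈ A) (hg : g ∈ A) :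
    DefS A {ω | ‖f ω‖ = ‖g ω‖} := by
  have := BoolGen.and (DefS.norm_le hf hg) (DefS.norm_le hg hf)
  simpa only [← le_antisymm_iff] using this

theorem DefS.app {A : FAlg p Ω} {f g : Ω → ℚ_[p]} (hf : f ∈ A) (hg : g ∈ A) (k : ℕ) :
    DefS A {ω | App k (f ω) (g ω)} := by
  have := DefS.norm_le (A.sub_mem hf hg) (A.mul_mem (const_mem A ((p : ℚ_[p]) ^ k)) hg)
  simpa only [App, Pi.mul_apply, Pi.sub_apply, norm_mul] using this

/-- The smallest algebra containing `B` and `g`. -/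
noncomputable def adj (B : FAlg p Ω) (g : Ω → ℚ_[p]) : FAlg p Ω := Algebra.adjoin ℚ_[p] (insert g (B : Set (Ω → ℚ_[p])))

theorem le_adj (B : FAlg p Ω) (g : Ω → ℚ_[p]) : B ≤ adj B g := fun _ hf =>
  Algebra.subset_adjoin (Set.mem_insert_of_mem _ hf)

theorem mem_adj (B : FAlg p Ω) (g : Ω → ℚ_[p]) : g ∈ adj B g :=
  Algebra.subset_adjoin (Set.mem_insert _ _)

theorem adj_le {B C : FAlg p Ω} {g : Ω → ℚ_[p]} (h : B ≤ C) (hg : g ∈ C) : adj B g ≤ C := by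
  refine Algebra.adjoin_le ?_
  rintro f (rfl | hf)
  · exact hg
  · exact h hf

/-- `g` is strongly definable over `A`. -/
def Cl (A : FAlg p Ω) (g : Ω → ℚ_[p]) : Prop :=
  ∀ (Ω' : Type) (φ : Ω' → Ω) (B : FAlg p Ω'), (∀ f ∈ A, f ∘ φ ∈ B) →
    ∀ S, DefS (adj B (g ∘ φ)) S → DefS B S

theorem Cl.of_mem {A : FAlg p Ω} {g : Ω → ℚ_[p]} (hg : g ∈ A) : Cl A g :=
  fun _ _ _ h _ hS => DefS.mono (adj_le le_rfl (h g hg)) hS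

theorem Cl.two {A : FAlg p Ω} {g g' h : Ω → ℚ_[p]} (hg : Cl A g) (hg' : Cl A g')
    (hh : ∀ (Ω' : Type) (φ : Ω' → Ω) (B : FAlg p Ω'), g ∘ φ ∈ B → g' ∘ φ ∈ B → h ∘ φ ∈ B) :
    Cl A h := by
  intro Ω' φ B hB S hS
  refine hg Ω' φ B hB S (hg' Ω' φ _ (fun f hf => le_adj _ _ (hB f hf)) S (DefS.mono ?_ hS))
  refine adj_le ((le_adj _ _).trans (le_adj _ _)) (hh _ _ _ ?_ ?_)
  · exact le_adj _ _ (mem_adj _ _)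
  · exact mem_adj _ _

/-- The algebra of functions strongly definable over `A`. -/
def cl (A : FAlg p Ω) : FAlg p Ω where
  carrier := {g | Cl A g}
  mul_mem' hf hg := hf.two hg fun _ _ B h h' => B.mul_mem h h'
  one_mem' := Cl.of_mem A.one_mem
  add_mem' hf hg := hf.two hg fun _ _ B h h' => B.add_mem h h'
  zero_mem' := Cl.of_mem A.zero_mem
  algebraMap_mem' c := Cl.of_mem (A.algebraMap_mem c)

theorem le_cl (A : FAlg p Ω) : A ≤ cl A := fun _ h => Cl.of_mem h

theorem exists_finset_of_mem_adjoin {B : Set (Ω → ℚ_[p])} {U : Set (Ω → ℚ_[p])} {f : Ω → ℚ_[p]}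
    (hf : f ∈ Algebra.adjoin ℚ_[p] (B ∪ U)) :
    ∃ T : Set (Ω → ℚ_[p]), T.Finite ∧ T ⊆ U ∧ f ∈ Algebra.adjoin ℚ_[p] (B ∪ T) := by
  have mono : ∀ {T T' : Set (Ω → ℚ_[p])}, T ⊆ T' → Algebra.adjoin ℚ_[p] (B ∪ T) ≤
      Algebra.adjoin ℚ_[p] (B ∪ T') := fun h => Algebra.adjoin_mono (Set.union_subset_union_right B h)
  induction hf using Algebra.adjoin_induction with
  | mem x hx =>
    rcases hx with hx | hx
    · exact ⟨∅, Set.finite_empty, Set.empty_subset _, Algebra.subset_adjoin (Or.inl hx)⟩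
    · exact ⟨{x}, Set.finite_singleton _, Set.singleton_subset_iff.2 hx,
        Algebra.subset_adjoin (Or.inr rfl)⟩
  | algebraMap r =>
    exact ⟨∅, Set.finite_empty, Set.empty_subset _, Subalgebra.algebraMap_mem _ r⟩
  | add x y _ _ ihx ihy =>
    obtain ⟨T, hT, hTU, hx⟩ := ihx
    obtain ⟨T', hT', hTU', hy⟩ := ihy
    exact ⟨T ∪ T', hT.union hT', Set.union_subset hTU hTU',
      Subalgebra.add_mem _ (mono Set.subset_union_left hx) (mono Set.subset_union_right hy)⟩
  | mul x y _ _ ihx ihy =>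
    obtain ⟨T, hT, hTU, hx⟩ := ihx
    obtain ⟨T', hT', hTU', hy⟩ := ihy
    exact ⟨T ∪ T', hT.union hT', Set.union_subset hTU hTU',
      Subalgebra.mul_mem _ (mono Set.subset_union_left hx) (mono Set.subset_union_right hy)⟩

theorem DefS.finset_of_adjoin {B : Set (Ω → ℚ_[p])} {U : Set (Ω → ℚ_[p])} {S : Set Ω}
    (hS : DefS (Algebra.adjoin ℚ_[p] (B ∪ U)) S) :
    ∃ T : Set (Ω → ℚ_[p]), T.Finite ∧ T ⊆ U ∧ DefS (Algebra.adjoin ℚ_[p] (B ∪ T)) S := by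
  have mono : ∀ {T T' : Set (Ω → ℚ_[p])}, T ⊆ T' → Algebra.adjoin ℚ_[p] (B ∪ T) ≤
      Algebra.adjoin ℚ_[p] (B ∪ T') := fun h => Algebra.adjoin_mono (Set.union_subset_union_right B h)
  induction hS with
  | base S hS =>
    obtain ⟨f, hf, n, hn, rfl⟩ := hS
    obtain ⟨T, hT, hTU, hf⟩ := exists_finset_of_mem_adjoin hf
    exact ⟨T, hT, hTU, DefS.pow hf hn⟩
  | univ => exact ⟨∅, Set.finite_empty, Set.empty_subset _, BoolGen.univ⟩
  | compl S _ ih =>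
    obtain ⟨T, hT, hTU, h⟩ := ih
    exact ⟨T, hT, hTU, BoolGen.compl _ h⟩
  | inter S S' _ _ ih ih' =>
    obtain ⟨T, hT, hTU, h⟩ := ih
    obtain ⟨T', hT', hTU', h'⟩ := ih'
    exact ⟨T ∪ T', hT.union hT', Set.union_subset hTU hTU',
      BoolGen.inter _ _ (DefS.mono (mono Set.subset_union_left) h)
        (DefS.mono (mono Set.subset_union_right) h')⟩

theorem DefS.of_adjoin_cl {A : FAlg p Ω} {B : FAlg p Ω'} {φ : Ω' → Ω} (hφ : ∀ f ∈ A, f ∘ φ ∈ B)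
    {S : Set Ω'}
    (hS : DefS (Algebra.adjoin ℚ_[p] ((B : Set (Ω' → ℚ_[p])) ∪ {h | ∃ g ∈ cl A, h = g ∘ φ})) S) :
    DefS B S := by
  obtain ⟨T, hT, hTU, h⟩ := DefS.finset_of_adjoin hS
  clear hS
  induction T, hT using Set.Finite.induction_on generalizing S with
  | empty =>
    rw [Set.union_empty, Algebra.adjoin_eq] at h; exact h
  | insert ha hT ih =>
    rename_i a T
    obtain ⟨g, hg, rfl⟩ := hTU (Set.mem_insert _ _)
    refine ih ((Set.subset_insert _ _).trans hTU) ?_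
    refine hg Ω' φ _ (fun f hf => Algebra.subset_adjoin (Or.inl (hφ f hf))) S (DefS.mono ?_ h)
    refine Algebra.adjoin_le ?_
    rintro f (hf | rfl | hf)
    · exact le_adj _ _ (Algebra.subset_adjoin (Or.inl hf))
    · exact mem_adj _ _
    · exact le_adj _ _ (Algebra.subset_adjoin (Or.inr hf))

theorem DefS.of_cl {A : FAlg p Ω} {S : Set Ω} (hS : DefS (cl A) S) : DefS A S := by
  refine DefS.of_adjoin_cl (A := A) (B := A) (φ := id) (fun f hf => hf) (DefS.mono ?_ hS)
  intro f hf
  exact Algebra.subset_adjoin (Or.inr ⟨f, hf, rfl⟩)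

theorem cl_comp {A : FAlg p Ω} {B : FAlg p Ω'} {φ : Ω' → Ω} (h : ∀ f ∈ A, f ∘ φ ∈ cl B)
    {g : Ω → ℚ_[p]} (hg : g ∈ cl A) : g ∘ φ ∈ cl B := by
  intro Ω'' ψ C hC S hS
  refine DefS.of_adjoin_cl (A := B) (φ := ψ) hC ?_
  refine hg Ω'' (φ ∘ ψ) _ ?_ S (DefS.mono ?_ hS)
  · intro f hf
    exact Algebra.subset_adjoin (Or.inr ⟨_, h f hf, rfl⟩)
  · refine adj_le ?_ (mem_adj _ _)
    intro f hf
    exact le_adj _ _ (Algebra.subset_adjoin (Or.inl hf))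

theorem cl_mono {A B : FAlg p Ω} (h : A ≤ cl B) : cl A ≤ cl B := fun _ hg =>
  cl_comp (φ := id) (fun _ hf => h hf) hg

theorem cl_idem (A : FAlg p Ω) : cl (cl A) ≤ cl A := cl_mono le_rfl

/-! ### Polynomials with coefficients in an algebra of functions -/

/-- Evaluation of the coefficients at `ω`. -/
noncomputable def evHom (A : FAlg p Ω) (ω : Ω) : A →+* ℚ_[p] := (Pi.evalRingHom (fun _ : Ω => ℚ_[p]) ω).comp A.val.toRingHom

@[simp] theorem evHom_apply (A : FAlg p Ω) (ω : Ω) (a : A) : evHom A ω a = a.1 ω := rfl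

/-- Evaluation of a polynomial with coefficients in `A`. -/
noncomputable def ev {A : FAlg p Ω} (F : Polynomial A) (ω : Ω) (t : ℚ_[p]) : ℚ_[p] :=
  F.eval₂ (evHom A ω) t

section ev
variable {A : FAlg p Ω} (F G : Polynomial A) (ω : Ω) (t : ℚ_[p])
theorem ev_add : ev (F + G) ω t = ev F ω t + ev G ω t := Polynomial.eval₂_add _ _
theorem ev_mul : ev (F * G) ω t = ev F ω t * ev G ω t := Polynomial.eval₂_mul _ _
theorem ev_sub : ev (F - G) ω t = ev F ω t - ev G ω t := Polynomial.eval₂_sub _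
theorem ev_C (a : A) : ev (Polynomial.C a) ω t = a.1 ω := by simp [ev]
theorem ev_X : ev (Polynomial.X : Polynomial A) ω t = t := by simp [ev]
theorem ev_pow (n : ℕ) : ev (F ^ n) ω t = ev F ω t ^ n := Polynomial.eval₂_pow _ _ _
theorem ev_comp : ev (F.comp G) ω t = ev F ω (ev G ω t) := by simp [ev, Polynomial.eval₂_comp]
theorem ev_eq_map : ev F ω t = (F.map (evHom A ω)).eval t := (Polynomial.eval_map _ _).symm
end ev

theorem ev_mem {A B : FAlg p Ω} (h : A ≤ B) (F : Polynomial A) {g : Ω → ℚ_[p]} (hg : g ∈ B) :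
    (fun ω => ev F ω (g ω)) ∈ B := by
  induction F using Polynomial.induction_on' with
  | add F G hF hG => simp only [ev_add]; exact B.add_mem hF hG
  | monomial n a =>
    have : (fun ω => ev (Polynomial.monomial n a) ω (g ω)) = a.1 * g ^ n := by
      funext ω; simp [ev]
    rw [this]
    exact B.mul_mem (h a.2) (B.pow_mem hg n)

theorem exists_ev_of_mem_adj {B : FAlg p Ω} {g f : Ω → ℚ_[p]} (hf : f ∈ adj B g) :
    ∃ F : Polynomial B, ∀ ω, f ω = ev F ω (g ω) := by
  induction hf using Algebra.adjoin_induction with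
  | mem x hx =>
    rcases hx with rfl | hx
    · exact ⟨Polynomial.X, fun ω => (ev_X _ _).symm⟩
    · exact ⟨Polynomial.C ⟨x, hx⟩, fun ω => (ev_C _ _ (⟨x, hx⟩ : B)).symm⟩
  | algebraMap r => exact ⟨Polynomial.C (algebraMap _ _ r), fun ω => (ev_C _ _ (algebraMap _ B r)).symm⟩
  | add x y _ _ ihx ihy =>
    obtain ⟨F, hF⟩ := ihx
    obtain ⟨G, hG⟩ := ihy
    exact ⟨F + G, fun ω => by rw [ev_add, ← hF, ← hG]; rfl⟩
  | mul x y _ _ ihx ihy =>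
    obtain ⟨F, hF⟩ := ihx
    obtain ⟨G, hG⟩ := ihy
    exact ⟨F * G, fun ω => by rw [ev_mul, ← hF, ← hG]; rfl⟩

/-- Membership criterion for `cl A`. -/
theorem mem_cl_of_ev {A : FAlg p Ω} {g : Ω → ℚ_[p]}
    (h : ∀ (Ω' : Type) (φ : Ω' → Ω) (B : FAlg p Ω'), cl B ≤ B → (∀ f ∈ A, f ∘ φ ∈ B) →
      ∀ (F : Polynomial B) (n : ℕ), 0 < n → DefS B {ω | ev F ω (g (φ ω)) ∈ Pset p n}) :
    g ∈ cl A := by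
  intro Ω' φ B hB S hS
  apply DefS.of_cl
  have hS' : DefS (adj (cl B) (g ∘ φ)) S :=
    DefS.mono (adj_le ((le_cl B).trans (le_adj _ _)) (mem_adj _ _)) hS
  refine BoolGen.mono ?_ hS'
  rintro S ⟨f, hf, n, hn, rfl⟩
  obtain ⟨F, hF⟩ := exists_ev_of_mem_adj hf
  simp only [hF]
  exact h Ω' φ (cl B) (cl_idem B) (fun f hf => le_cl _ (hB f hf)) F n hn

theorem DefS.ev {A B : FAlg p Ω} (hAB : A ≤ B) (F : Polynomial A) {g : Ω → ℚ_[p]} (hg : g ∈ cl B) {n : ℕ}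
    (hn : 0 < n) : DefS B {ω | ev F ω (g ω) ∈ Pset p n} :=
  DefS.of_cl (DefS.pow (ev_mem (hAB.trans (le_cl B)) F hg) hn)

theorem cl_inv {A : FAlg p Ω} {g : Ω → ℚ_[p]} (hg : g ∈ cl A) : (fun ω => (g ω)⁻¹) ∈ cl A := by
  refine mem_cl_of_ev fun Ω' φ B hBc hB F n hn => ?_
  have hg' : g ∘ φ ∈ cl B := cl_comp (fun f hf => le_cl _ (hB f hf)) hg
  have h0 : DefS B {ω | g (φ ω) = 0} := DefS.of_cl (DefS.eq_zero hg')
  have h1 : DefS B {ω | PadicSub.ev F ω 0 ∈ Pset p n} :=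
    DefS.ev le_rfl F (g := fun _ => 0) (const_mem _ 0) hn
  set D := F.natDegree
  have h2 : DefS B {ω | PadicSub.ev (F.reverse * Polynomial.X ^ (D * (n - 1))) ω (g (φ ω)) ∈ Pset p n} :=
    DefS.ev le_rfl _ (g := g ∘ φ) hg' hn
  have := BoolGen.or (BoolGen.and h0 h1) (BoolGen.and (BoolGen.not h0) h2)
  refine (congrArg (DefS B) ?_).mp this
  ext ω
  simp only [Set.mem_ofPred_eq]
  by_cases hz : g (φ ω) = 0
  · simp [hz]
  · simp only [hz, false_and, not_false_eq_true, true_and, false_or]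
    have hx : Invertible (g (φ ω))⁻¹ := invertibleOfNonzero (inv_ne_zero hz)
    have h3 : PadicSub.ev F.reverse ω (g (φ ω)) = PadicSub.ev F ω ((g (φ ω))⁻¹) * (g (φ ω)) ^ D := by
      have := Polynomial.eval₂_reverse_mul_pow (evHom B ω) ((g (φ ω))⁻¹) F
      rw [invOf_eq_inv, inv_inv] at this
      rw [PadicSub.ev, PadicSub.ev, ← this, mul_assoc, ← mul_pow, inv_mul_cancel₀ hz, one_pow, mul_one]
    have h4 : (PadicSub.ev (F.reverse * Polynomial.X ^ (D * (n - 1))) ω (g (φ ω))) =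
        (g (φ ω) ^ D) ^ n * PadicSub.ev F ω ((g (φ ω))⁻¹) := by
      obtain ⟨m, rfl⟩ : ∃ m, n = m + 1 := ⟨n - 1, by omega⟩
      rw [ev_mul, ev_pow, ev_X, h3]; simp only [Nat.add_sub_cancel]; ring
    rw [h4, mul_mem_Pset_iff (pow_mem_Pset (pow_ne_zero _ hz) n)]

theorem cl_ite {A : FAlg p Ω} {S : Set Ω} [DecidablePred (· ∈ S)] (hS : DefS A S)
    {g g' : Ω → ℚ_[p]} (hg : g ∈ cl A)
    (hg' : g' ∈ cl A) : (fun ω => if ω ∈ S then g ω else g' ω) ∈ cl A := by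
  refine mem_cl_of_ev fun Ω' φ B hBc hB F n hn => ?_
  have h1 : g ∘ φ ∈ cl B := cl_comp (fun f hf => le_cl _ (hB f hf)) hg
  have h2 : g' ∘ φ ∈ cl B := cl_comp (fun f hf => le_cl _ (hB f hf)) hg'
  have hS' : DefS B {ω | φ ω ∈ S} := DefS.comp hB hS
  have := BoolGen.or (BoolGen.and hS' (DefS.ev le_rfl F h1 hn))
    (BoolGen.and (BoolGen.not hS') (DefS.ev le_rfl F h2 hn))
  refine (congrArg (DefS B) ?_).mp this
  ext ω
  simp only [Set.mem_ofPred_eq]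
  by_cases hz : φ ω ∈ S <;> simp [hz]

/-- Piecewise membership for finite covers. -/
theorem cl_cover {A : FAlg p Ω} {ι : Type*} [Finite ι] {S : ι → Set Ω} (hS : ∀ i, DefS A (S i))
    (hcov : ∀ ω, ∃ i, ω ∈ S i) {g : Ω → ℚ_[p]}
    (h : ∀ i, ∃ g' ∈ cl A, ∀ ω ∈ S i, g ω = g' ω) : g ∈ cl A := by
  refine mem_cl_of_ev fun Ω' φ B hBc hB F n hn => ?_
  choose g' hg' he using h
  have : DefS B {ω | ∃ i, φ ω ∈ S i ∧ ev F ω (g' i (φ ω)) ∈ Pset p n} :=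
    BoolGen.ex_finite fun i => BoolGen.and (DefS.comp hB (hS i))
      (DefS.ev le_rfl F (g := g' i ∘ φ) (cl_comp (fun f hf => le_cl _ (hB f hf)) (hg' i)) hn)
  refine (congrArg (DefS B) ?_).mp this
  ext ω
  simp only [Set.mem_ofPred_eq]
  constructor
  · rintro ⟨i, hi, h⟩
    rwa [he i _ hi]
  · intro h
    obtain ⟨i, hi⟩ := hcov (φ ω)
    exact ⟨i, hi, by rwa [← he i _ hi]⟩

end defs

end PadicSub
end

section
namespace PadicSub

section interp

open Polynomial

variable {p : ℕ} [Fact p.Prime]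
local notation "ϖ" => (p : ℚ_[p])

theorem exists_ppow_mul_le (M : ℝ) : ∃ κ : ℕ, ‖ϖ ^ κ‖ * M ≤ 1 := by
  obtain ⟨k, -, hk⟩ := exists_ppow_lt (p := p) (ε := 1 / (|M| + 1)) (by positivity)
  refine ⟨k, ?_⟩
  have h1 : M ≤ |M| + 1 := (le_abs_self M).trans (by linarith)
  calc ‖ϖ ^ k‖ * M ≤ ‖ϖ ^ k‖ * (|M| + 1) :=
        mul_le_mul_of_nonneg_left h1 (norm_nonneg _)
    _ ≤ 1 / (|M| + 1) * (|M| + 1) := mul_le_mul_of_nonneg_right hk.le (by positivity)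
    _ = 1 := by field_simp

theorem norm_nat_le_one (n : ℕ) : ‖(n : ℚ_[p])‖ ≤ 1 := by
  simpa using Padic.norm_int_le_one (p := p) (n : ℤ)

theorem norm_sum_le_of {ι : Type*} (s : Finset ι) (f : ι → ℚ_[p]) {M : ℝ} (hM : 0 ≤ M)
    (h : ∀ i ∈ s, ‖f i‖ ≤ M) : ‖∑ i ∈ s, f i‖ ≤ M := by
  classical
  induction s using Finset.induction_on with
  | empty => simpa using hM
  | insert a s ha ih =>
    rw [Finset.sum_insert ha]
    refine (na_add _ _).trans (max_le (h a (Finset.mem_insert_self _ _)) ?_)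
    exact ih fun i hi => h i (Finset.mem_insert_of_mem hi)

/-- Lagrange basis at `0, …, D`. -/
noncomputable def lagB (p : ℕ) [Fact p.Prime] (D : ℕ) (i : ℕ) : ℚ_[p][X] :=
  Lagrange.basis (Finset.range (D + 1)) (fun n : ℕ => (n : ℚ_[p])) i

theorem lag_expand (D : ℕ) (G : ℚ_[p][X]) (hG : G.natDegree ≤ D) :
    G = ∑ i ∈ Finset.range (D + 1), C (G.eval (i : ℚ_[p])) * lagB p D i := by
  have hinj : Set.InjOn (fun n : ℕ => (n : ℚ_[p])) (Finset.range (D + 1)) :=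
    fun a _ b _ h => Nat.cast_injective (R := ℚ_[p]) h
  have hdeg : G.degree < (Finset.range (D + 1)).card := by
    rw [Finset.card_range]
    refine lt_of_le_of_lt degree_le_natDegree ?_
    exact_mod_cast Nat.lt_succ_of_le hG
  have := Lagrange.eq_interpolate hinj hdeg
  conv_lhs => rw [this]
  rw [Lagrange.interpolate_apply]
  rfl

/-- An antiderivative. -/
theorem exists_antideriv (P : ℚ_[p][X]) : ∃ Q : ℚ_[p][X], derivative Q = P := by
  induction P using Polynomial.induction_on' with
  | add P Q hP hQ =>
    obtain ⟨P', rfl⟩ := hP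
    obtain ⟨Q', rfl⟩ := hQ
    exact ⟨P' + Q', derivative_add⟩
  | monomial n a =>
    refine ⟨monomial (n + 1) (a / (n + 1)), ?_⟩
    rw [derivative_monomial]
    have : ((n : ℚ_[p]) + 1) ≠ 0 := by exact_mod_cast Nat.succ_ne_zero n
    simp only [Nat.add_sub_cancel, Nat.cast_add, Nat.cast_one]
    congr 1
    field_simp

theorem integral_bound (D : ℕ) : ∃ κ : ℕ, ∀ (G : ℚ_[p][X]), G.natDegree ≤ D + 1 → ∀ M : ℝ, 0 ≤ M →
    (∀ n : ℕ, ‖(derivative G).eval (n : ℚ_[p])‖ ≤ ‖ϖ ^ κ‖ * M) →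
    ‖G.eval 1 - G.eval 0‖ ≤ M := by
  choose B hB using fun i => exists_antideriv (lagB p D i)
  obtain ⟨κ, hκ⟩ := exists_ppow_mul_le (p := p)
    (∑ i ∈ Finset.range (D + 1), ‖(B i).eval 1 - (B i).eval 0‖)
  refine ⟨κ, fun G hG M hM h => ?_⟩
  have hd : (derivative G).natDegree ≤ D := (natDegree_derivative_le G).trans (by omega)
  have he := lag_expand D _ hd
  set Q := ∑ i ∈ Finset.range (D + 1), C ((derivative G).eval (i : ℚ_[p])) * B i with hQ
  have hQd : derivative (G - Q) = 0 := by
    rw [derivative_sub, hQ, derivative_sum, sub_eq_zero]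
    conv_lhs => rw [he]
    refine Finset.sum_congr rfl fun i _ => ?_
    rw [derivative_C_mul, hB]
  have hc := derivative_eq_zero.1 hQd
  rw [natDegree_eq_zero] at hc
  obtain ⟨c, hc⟩ := hc
  have h1 : G.eval 1 - G.eval 0 = Q.eval 1 - Q.eval 0 := by
    have e : G = Q + C c := by rw [hc]; ring
    rw [e]; simp
  rw [h1, hQ, eval_finsetSum, eval_finsetSum, ← Finset.sum_sub_distrib]
  refine norm_sum_le_of _ _ hM fun i hi => ?_
  rw [eval_mul, eval_mul, eval_C, eval_C, ← mul_sub, norm_mul]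
  calc _ ≤ (‖ϖ ^ κ‖ * M) * ∑ i ∈ Finset.range (D + 1), ‖(B i).eval 1 - (B i).eval 0‖ := by
        refine mul_le_mul (h i) ?_ (norm_nonneg _) (by positivity)
        exact Finset.single_le_sum (f := fun i => ‖(B i).eval 1 - (B i).eval 0‖)
          (fun i _ => norm_nonneg _) hi
    _ = M * (‖ϖ ^ κ‖ * ∑ i ∈ Finset.range (D + 1), ‖(B i).eval 1 - (B i).eval 0‖) := by ring
    _ ≤ M * 1 := mul_le_mul_of_nonneg_left hκ hM
    _ = M := mul_one M

/-- A polynomial whose derivative is nearly constant on a ball is nearly linear there. -/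
theorem interp (D : ℕ) : ∃ κ : ℕ, ∀ (k : ℕ) (f : ℚ_[p][X]), f.natDegree ≤ D + 1 →
    ∀ (y c : ℚ_[p]) (ρ : ℝ),
    (∀ x, ‖x - y‖ ≤ ρ → App (k + κ) ((derivative f).eval x) c) →
    ∀ s t, ‖s - y‖ ≤ ρ → ‖t - y‖ ≤ ρ → App k (f.eval t - f.eval s) (c * (t - s)) := by
  obtain ⟨κ, hκ⟩ := integral_bound (p := p) D
  refine ⟨κ, fun k f hf y c ρ h s t hs ht => ?_⟩
  set G : ℚ_[p][X] := f.comp (C s + C (t - s) * X) - C (c * (t - s)) * X with hG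
  have hGd : G.natDegree ≤ D + 1 := by
    refine (natDegree_sub_le _ _).trans (max_le ?_ ?_)
    · refine (natDegree_comp_le).trans ?_
      have : (C s + C (t - s) * X).natDegree ≤ 1 := by compute_degree
      exact (Nat.mul_le_mul hf this).trans (by omega)
    · have : (C (c * (t - s)) * X).natDegree ≤ 1 := by compute_degree
      omega
  have key := hκ G hGd (‖ϖ ^ k‖ * ‖c * (t - s)‖) (by positivity) ?_
  · have e : G.eval 1 - G.eval 0 = f.eval t - f.eval s - c * (t - s) := by
      simp [hG]; ring
    rw [e] at key
    exact key
  · intro n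
    have e : (derivative G).eval (n : ℚ_[p]) =
        ((derivative f).eval (s + (t - s) * n) - c) * (t - s) := by
      simp [hG, derivative_comp]; ring
    rw [e, norm_mul]
    have hb : ‖s + (t - s) * n - y‖ ≤ ρ := by
      have e2 : s + (t - s) * n - y = (s - y) + ((t - y) - (s - y)) * n := by ring
      rw [e2]
      refine (na_add _ _).trans (max_le hs ?_)
      rw [norm_mul]
      refine (mul_le_of_le_one_right (norm_nonneg _) (norm_nat_le_one n)).trans ?_
      exact (na_sub _ _).trans (max_le ht hs)
    have := h _ hb
    rw [App, pow_add, norm_mul] at this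
    calc _ ≤ (‖ϖ ^ k‖ * ‖ϖ ^ κ‖ * ‖c‖) * ‖t - s‖ :=
          mul_le_mul_of_nonneg_right this (norm_nonneg _)
      _ = _ := by rw [norm_mul]; ring

/-- A polynomial bounded on a ball is Lipschitz there. -/
theorem lipschitz_ball (D : ℕ) : ∃ κ : ℕ, ∀ (f : ℚ_[p][X]), f.natDegree ≤ D →
    ∀ (s τ : ℚ_[p]) (M : ℝ), 0 ≤ M → (∀ x, ‖x - s‖ ≤ ‖τ‖ → ‖f.eval x‖ ≤ M) →
    ∀ z : ℚ_[p], ‖z‖ ≤ 1 → ‖f.eval (s + (p ^ κ * z) * τ) - f.eval s‖ ≤ M * ‖z‖ := by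
  choose q hq using fun i => X_dvd_sub_C (p := lagB p D i)
  have hbd : ∀ i, ∃ M : ℝ, 0 ≤ M ∧ ∀ z : ℚ_[p], ‖z‖ ≤ 1 → ‖(q i).eval z‖ ≤ M := by
    intro i
    refine ⟨∑ j ∈ Finset.range ((q i).natDegree + 1), ‖(q i).coeff j‖,
      Finset.sum_nonneg fun _ _ => norm_nonneg _, fun z hz => ?_⟩
    rw [eval_eq_sum_range]
    refine (norm_sum_le _ _).trans (Finset.sum_le_sum fun j _ => ?_)
    rw [norm_mul, norm_pow]
    exact mul_le_of_le_one_right (norm_nonneg _) (pow_le_one₀ (norm_nonneg _) hz)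
  choose M0 hM0 hM1 using hbd
  obtain ⟨κ, hκ⟩ := exists_ppow_mul_le (p := p) (∑ i ∈ Finset.range (D + 1), M0 i)
  refine ⟨κ, fun f hf s τ M hM h z hz => ?_⟩
  set G : ℚ_[p][X] := f.comp (C s + C τ * X) with hG
  have hGd : G.natDegree ≤ D := by
    refine (natDegree_comp_le).trans ?_
    have : (C s + C τ * X).natDegree ≤ 1 := by compute_degree
    exact (Nat.mul_le_mul hf this).trans (by omega)
  have he := lag_expand D G hGd
  set w : ℚ_[p] := p ^ κ * z with hw
  have hw1 : ‖w‖ ≤ 1 := by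
    rw [hw, norm_mul]; exact mul_le_one₀ (norm_ppow_le_one κ) (norm_nonneg _) hz
  have h1 : f.eval (s + w * τ) - f.eval s = G.eval w - G.eval 0 := by
    rw [hG, eval_comp, eval_comp, mul_comm w τ]; simp
  have hGi : ∀ n : ℕ, ‖G.eval (n : ℚ_[p])‖ ≤ M := by
    intro n
    have : G.eval (n : ℚ_[p]) = f.eval (s + τ * n) := by simp [hG]
    rw [this]
    refine h _ ?_
    rw [add_sub_cancel_left, norm_mul]
    exact mul_le_of_le_one_right (norm_nonneg _) (norm_nat_le_one n)
  have h2 : G.eval w - G.eval 0 = ∑ i ∈ Finset.range (D + 1),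
      G.eval (i : ℚ_[p]) * (w * (q i).eval w) := by
    conv_lhs => rw [he]
    rw [eval_finsetSum, eval_finsetSum, ← Finset.sum_sub_distrib]
    refine Finset.sum_congr rfl fun i _ => ?_
    have := congrArg (eval w) (hq i)
    simp only [eval_sub, eval_C, eval_mul, eval_X, coeff_zero_eq_eval_zero] at this
    rw [eval_mul, eval_mul, eval_C, eval_C, ← this]; ring
  rw [h1, h2]
  refine norm_sum_le_of _ _ (by positivity) fun i hi => ?_
  rw [norm_mul, norm_mul]
  have h3 : ‖w‖ * ‖(q i).eval w‖ ≤ ‖z‖ := by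
    have h4 : M0 i ≤ ∑ i ∈ Finset.range (D + 1), M0 i :=
      Finset.single_le_sum (f := M0) (fun i _ => hM0 i) hi
    calc ‖w‖ * ‖(q i).eval w‖ ≤ ‖w‖ * ∑ i ∈ Finset.range (D + 1), M0 i :=
          mul_le_mul_of_nonneg_left ((hM1 i w hw1).trans h4) (norm_nonneg _)
      _ = (‖ϖ ^ κ‖ * ∑ i ∈ Finset.range (D + 1), M0 i) * ‖z‖ := by
          rw [hw, norm_mul]; ring
      _ ≤ 1 * ‖z‖ := mul_le_mul_of_nonneg_right hκ (norm_nonneg _)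
      _ = ‖z‖ := one_mul _
  exact mul_le_mul (hGi i) h3 (by positivity) hM

end interp

end PadicSub
end

section
namespace PadicSub

section prep

open Polynomial

variable {p : ℕ} [Fact p.Prime] {Ω Ω' : Type}

/-- Generators of the simple sets on `Ω × ℚ_p` (with center `0`). -/
def LGen (A : FAlg p Ω) : Set (Set (Ω × ℚ_[p])) :=
  {C | (∃ S, DefS A S ∧ C = {z | z.1 ∈ S}) ∨
    (∃ a ∈ A, ∃ b ∈ A, ∃ i j : ℕ, C = {z | ‖a z.1 * z.2 ^ i‖ ≤ ‖b z.1 * z.2 ^ j‖}) ∨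
    (∃ (c : ℚ_[p]) (n : ℕ), 0 < n ∧ C = {z | c * z.2 ∈ Pset p n})}

/-- Simple sets on `Ω × ℚ_p` (with center `0`). -/
abbrev LSet (A : FAlg p Ω) (C : Set (Ω × ℚ_[p])) : Prop := BoolGen (LGen A) C

namespace LSet

variable {A : FAlg p Ω} {B : FAlg p Ω'}

theorem fst {S : Set Ω} (hS : DefS A S) : LSet A {z | z.1 ∈ S} :=
  BoolGen.base _ (Or.inl ⟨S, hS, rfl⟩)

theorem norm_le {a b : Ω → ℚ_[p]} (ha : a ∈ A) (hb : b ∈ A) (i j : ℕ) :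
    LSet A {z | ‖a z.1 * z.2 ^ i‖ ≤ ‖b z.1 * z.2 ^ j‖} :=
  BoolGen.base _ (Or.inr (Or.inl ⟨a, ha, b, hb, i, j, rfl⟩))

theorem norm_eq {a b : Ω → ℚ_[p]} (ha : a ∈ A) (hb : b ∈ A) (i j : ℕ) :
    LSet A {z | ‖a z.1 * z.2 ^ i‖ = ‖b z.1 * z.2 ^ j‖} := by
  have := BoolGen.and (norm_le ha hb i j) (norm_le hb ha j i)
  simpa only [← le_antisymm_iff] using this

theorem cls (c : ℚ_[p]) {n : ℕ} (hn : 0 < n) : LSet A {z | c * z.2 ∈ Pset p n} :=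
  BoolGen.base _ (Or.inr (Or.inr ⟨c, n, hn, rfl⟩))

theorem snd_eq_zero : LSet A {z | z.2 = 0} := by
  have := BoolGen.not (cls (A := A) 1 one_pos)
  simpa [mem_Pset_one] using this

theorem subst {g : Ω → ℚ_[p]} (hg : g ∈ A) {C : Set (Ω × ℚ_[p])} (hC : LSet A C) :
    DefS A {ω | (ω, g ω) ∈ C} := by
  refine BoolGen.preimage (fun ω : Ω => (ω, g ω)) ?_ hC
  rintro C (⟨S, hS, rfl⟩ | ⟨a, ha, b, hb, i, j, rfl⟩ | ⟨c, n, hn, rfl⟩)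
  · exact hS
  · exact DefS.norm_le (A.mul_mem ha (A.pow_mem hg i)) (A.mul_mem hb (A.pow_mem hg j))
  · exact DefS.cpow hg c hn

theorem tame {C : Set (Ω × ℚ_[p])} (hC : LSet A C) : ∃ K0 : ℕ, 1 ≤ K0 ∧ ∀ ω x x', App K0 x x' →
    ((ω, x) ∈ C ↔ (ω, x') ∈ C) := by
  induction hC with
  | base C hC =>
    rcases hC with ⟨S, hS, rfl⟩ | ⟨a, ha, b, hb, i, j, rfl⟩ | ⟨c, n, hn, rfl⟩
    · exact ⟨1, le_rfl, fun _ _ _ _ => Iff.rfl⟩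
    · refine ⟨1, le_rfl, fun ω x x' h => ?_⟩
      simp only [Set.mem_ofPred_eq, norm_mul, norm_pow, h.norm_eq le_rfl]
    · obtain ⟨k, hk1, hk⟩ := exists_app_Pset (p := p) n hn
      exact ⟨k, hk1, fun ω x x' h => hk _ _ (h.mul_left c)⟩
  | univ => exact ⟨1, le_rfl, fun _ _ _ _ => Iff.rfl⟩
  | compl C _ ih =>
    obtain ⟨k, hk1, hk⟩ := ih
    exact ⟨k, hk1, fun ω x x' h => not_congr (hk ω x x' h)⟩
  | inter C D _ _ ih ih' =>
    obtain ⟨k, hk1, hk⟩ := ih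
    obtain ⟨l, hl1, hl⟩ := ih'
    exact ⟨max k l, le_max_of_le_left hk1, fun ω x x' h =>
      and_congr (hk ω x x' (h.mono (le_max_left _ _))) (hl ω x x' (h.mono (le_max_right _ _)))⟩

/-- Power conditions on monomials. -/
theorem mul_pow {h : Ω → ℚ_[p]} (hh : h ∈ A) (e : ℕ) {n : ℕ} (hn : 0 < n) :
    LSet A {z | h z.1 * z.2 ^ e ∈ Pset p n} := by
  obtain ⟨L, hL, hL0, hrep⟩ := exists_reps (p := p) n hn
  have h1 : LSet A {z | z.2 = 0 ∧ h z.1 * 0 ^ e ∈ Pset p n} :=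
    BoolGen.and snd_eq_zero (fst (DefS.pow (f := fun ω => h ω * 0 ^ e)
      (A.mul_mem hh (const_mem A (0 ^ e))) hn))
  have h2 : LSet A {z | ∃ c ∈ L, c * z.2 ∈ Pset p n ∧ h z.1 * (c⁻¹) ^ e ∈ Pset p n} :=
    BoolGen.ex_mem hL fun c _ => BoolGen.and (cls c hn) (fst (DefS.pow (f := fun ω => h ω * c⁻¹ ^ e)
      (A.mul_mem hh (const_mem A (c⁻¹ ^ e))) hn))
  have key : ∀ c ∈ L, ∀ x, c * x ∈ Pset p n → ∀ a, (a * x ^ e ∈ Pset p n ↔ a * c⁻¹ ^ e ∈ Pset p n) := by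
    intro c hc x hx a
    have : SameCl n x c⁻¹ := SameCl.of_mul_inv (inv_ne_zero (hL0 c hc)) (by rwa [inv_inv, mul_comm])
    exact this.pow e a
  refine BoolGen.congr (BoolGen.or h1 h2) ?_
  rintro ⟨ω, x⟩
  simp only [Set.mem_ofPred_eq]
  constructor
  · rintro (⟨rfl, h⟩ | ⟨c, hc, hx, h⟩)
    · exact h
    · exact (key c hc x hx _).2 h
  · intro h
    by_cases hx : x = 0
    · subst hx; exact Or.inl ⟨rfl, h⟩
    · obtain ⟨c, hc, hcx⟩ := hrep x hx
      exact Or.inr ⟨c, hc, hcx, (key c hc x hcx _).1 h⟩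

end LSet

/-- `f` is prepared up to precision `k` on `D`. -/
def PrepOn {A : FAlg p Ω} (f : Polynomial A) (k : ℕ) (D : Set (Ω × ℚ_[p])) : Prop :=
  ∃ (ι : Type) (_ : Finite ι) (C : ι → Set (Ω × ℚ_[p])) (γ h : ι → Ω → ℚ_[p]) (e : ι → ℕ),
    (∀ i, LSet A (C i) ∧ γ i ∈ A ∧ h i ∈ A ∧
      ∀ ω x, (ω, x) ∈ C i → App k (ev f ω (x + γ i ω)) (h i ω * x ^ e i)) ∧
    ∀ ω t, (ω, t) ∈ D → ∃ i, (ω, t - γ i ω) ∈ C i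

namespace PrepOn

variable {A : FAlg p Ω} {f : Polynomial A} {k : ℕ} {D : Set (Ω × ℚ_[p])}

theorem mono_k {k' : ℕ} (hk : k ≤ k') (h : PrepOn f k' D) : PrepOn f k D := by
  obtain ⟨ι, hι, C, γ, h, e, H, hc⟩ := h
  exact ⟨ι, hι, C, γ, h, e, fun i => ⟨(H i).1, (H i).2.1, (H i).2.2.1,
    fun ω x hx => ((H i).2.2.2 ω x hx).mono hk⟩, hc⟩

theorem cover {κ : Type*} [Finite κ] {D' : κ → Set (Ω × ℚ_[p])} (h : ∀ j, PrepOn f k (D' j))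
    (hD : ∀ z ∈ D, ∃ j, z ∈ D' j) : PrepOn f k D := by
  -- reduce to an index in `Type`
  obtain ⟨n, ⟨eqv⟩⟩ := Finite.exists_equiv_fin κ
  have h' : ∀ j : Fin n, PrepOn f k (D' (eqv.symm j)) := fun j => h _
  choose ι hι C γ g e H hc using h'
  refine ⟨Σ j, ι j, inferInstance, fun i => C i.1 i.2, fun i => γ i.1 i.2, fun i => g i.1 i.2,
    fun i => e i.1 i.2, fun i => H i.1 i.2, fun ω t hz => ?_⟩
  obtain ⟨j, hj⟩ := hD _ hz
  obtain ⟨i, hi⟩ := hc (eqv j) ω t (by simpa using hj)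
  exact ⟨⟨_, i⟩, hi⟩

theorem subset {D' : Set (Ω × ℚ_[p])} (h : PrepOn f k D') (hD : D ⊆ D') : PrepOn f k D :=
  cover (κ := Unit) (fun _ => h) fun _ hz => ⟨(), hD hz⟩

theorem piece {C : Set (Ω × ℚ_[p])} {γ h : Ω → ℚ_[p]} {e : ℕ} (hC : LSet A C) (hγ : γ ∈ A)
    (hh : h ∈ A) (H : ∀ ω x, (ω, x) ∈ C → App k (ev f ω (x + γ ω)) (h ω * x ^ e))
    (hD : ∀ ω t, (ω, t) ∈ D → (ω, t - γ ω) ∈ C) : PrepOn f k D :=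
  ⟨Unit, inferInstance, fun _ => C, fun _ => γ, fun _ => h, fun _ => e,
    fun _ => ⟨hC, hγ, hh, H⟩, fun ω t hz => ⟨(), hD ω t hz⟩⟩

theorem piece0 {C : Set (Ω × ℚ_[p])} {h : Ω → ℚ_[p]} {e : ℕ} (hC : LSet A C)
    (hh : h ∈ A) (H : ∀ ω x, (ω, x) ∈ C → App k (ev f ω x) (h ω * x ^ e)) : PrepOn f k C := by
  refine piece (γ := 0) (e := e) hC A.zero_mem hh ?_ ?_
  · intro ω x hx; simpa using H ω x hx
  · intro ω t ht; simpa using ht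

theorem shift (γ : A) (h : PrepOn (f.comp (X + C γ)) k D) :
    PrepOn f k {z | (z.1, z.2 - γ.1 z.1) ∈ D} := by
  obtain ⟨ι, hι, C, γ', h, e, H, hc⟩ := h
  refine ⟨ι, hι, C, fun i => γ' i + γ.1, h, e, fun i => ⟨(H i).1, A.add_mem (H i).2.1 γ.2,
    (H i).2.2.1, fun ω x hx => ?_⟩, ?_⟩
  · have := (H i).2.2.2 ω x hx
    rw [ev_comp, ev_add, ev_X, ev_C] at this
    simpa [add_assoc] using this
  · intro ω t ht
    obtain ⟨i, hi⟩ := hc ω _ ht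
    refine ⟨i, ?_⟩
    simpa [sub_sub, add_comm] using hi

end PrepOn

/-- The preparation statement in degree `d`. -/
def Prep (p : ℕ) [Fact p.Prime] (d : ℕ) : Prop :=
  ∀ (Ω : Type) (A : FAlg p Ω), cl A ≤ A → ∀ f : Polynomial A, f.natDegree ≤ d →
    ∀ k, PrepOn f k Set.univ

theorem prep_zero : Prep p 0 := by
  intro Ω A _ f hf k
  refine PrepOn.piece0 (h := (f.coeff 0).1) (e := 0) BoolGen.univ (f.coeff 0).2 fun ω x _ => ?_
  rw [eq_C_of_natDegree_le_zero hf, ev_C]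
  simpa using App.refl k _

end prep

end PadicSub
end

section
namespace PadicSub

section root

open Polynomial

variable {p : ℕ} [Fact p.Prime] {Ω Ω' : Type}
local notation "ϖ" => (p : ℚ_[p])

theorem exists_reps_in (E : Set ℚ_[p]) (hE : ∀ x ∈ E, x ≠ 0) (n : ℕ) (hn : 0 < n) :
    ∃ Q : Set ℚ_[p], Q.Finite ∧ Q ⊆ E ∧ ∀ x ∈ E, ∃ c ∈ Q, x * c⁻¹ ∈ Pset p n := by
  classical
  obtain ⟨L, hL, hL0, hrep⟩ := exists_reps (p := p) n hn
  let F : ℚ_[p] → Set ℚ_[p] := fun c =>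
    if h : ∃ x ∈ E, c * x ∈ Pset p n then {h.choose} else ∅
  refine ⟨⋃ c ∈ L, F c, hL.biUnion fun c _ => ?_, ?_, ?_⟩
  · by_cases h : ∃ x ∈ E, c * x ∈ Pset p n
    · simp [F, h]
    · simp [F, h]
  · refine Set.iUnion₂_subset fun c _ => ?_
    by_cases h : ∃ x ∈ E, c * x ∈ Pset p n
    · simp only [F, dif_pos h, Set.singleton_subset_iff]
      exact h.choose_spec.1
    · simp [F, h]
  · intro x hx
    obtain ⟨c, hc, hcx⟩ := hrep x (hE x hx)
    have h : ∃ x ∈ E, c * x ∈ Pset p n := ⟨x, hx, hcx⟩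
    refine ⟨h.choose, Set.mem_iUnion₂.2 ⟨c, hc, by simp [F, h]⟩, ?_⟩
    have h1 := h.choose_spec.2
    have := mul_mem_Pset hcx (inv_mem_Pset h1)
    have hc0 := hL0 c hc
    rwa [mul_inv, mul_mul_mul_comm, mul_inv_cancel₀ hc0, one_mul] at this

theorem SameCl.inv {n : ℕ} {x y : ℚ_[p]} (h : SameCl n x y) : SameCl n x⁻¹ y⁻¹ := by
  by_cases hy : y = 0
  · have := h.zero_iff.2 hy
    subst hy; subst this; exact SameCl.refl _ _
  · have hx : x ≠ 0 := fun h0 => hy (h.zero_iff.1 h0)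
    refine SameCl.of_mul_inv (inv_ne_zero hy) ?_
    have := inv_mem_Pset (h.mul_inv_mem hy)
    rwa [mul_inv] at this

theorem SameCl.zpow {n : ℕ} {x y : ℚ_[p]} (h : SameCl n x y) (e : ℤ) :
    SameCl n (x ^ e) (y ^ e) := by
  obtain ⟨m, rfl | rfl⟩ := e.eq_nat_or_neg
  · simpa using h.pow m
  · simpa using (h.pow m).inv

theorem inv_mem_of_closed {B : FAlg p Ω} (hB : cl B ≤ B) {g : Ω → ℚ_[p]} (hg : g ∈ B) :
    (fun ω => (g ω)⁻¹) ∈ B := hB (cl_inv (le_cl _ hg))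

theorem zpow_mem_of_closed {B : FAlg p Ω} (hB : cl B ≤ B) {g : Ω → ℚ_[p]} (hg : g ∈ B) (e : ℤ) :
    (fun ω => (g ω) ^ e) ∈ B := by
  obtain ⟨m, rfl | rfl⟩ := e.eq_nat_or_neg
  · have := B.pow_mem hg m
    have e : g ^ m = fun ω => g ω ^ (m : ℤ) := by funext ω; simp
    rwa [e] at this
  · have := B.pow_mem (inv_mem_of_closed hB hg) m
    have e : (fun ω => (g ω)⁻¹) ^ m = fun ω => g ω ^ (-(m : ℤ)) := by funext ω; simp
    rwa [e] at this

/-- Data describing a root of a polynomial. -/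
structure RootData (B : FAlg p Ω) (S : Set Ω) (η : Ω → ℚ_[p]) (f : Polynomial B) : Prop where
  hS : DefS B S
  ne : ∀ ω ∈ S, η ω ≠ 0
  root : ∀ ω ∈ S, ev f ω (η ω) = 0
  H1 : ∀ (c : ℚ_[p]) (n : ℕ), 0 < n → DefS B {ω | ω ∈ S ∧ c * η ω ∈ Pset p n}
  H2 : ∃ r : ℕ, 1 ≤ r ∧ ∃ a ∈ B, ∀ ω ∈ S, ‖η ω‖ ^ r = ‖a ω‖
  H3 : ∀ k : ℕ, ∃ (k' : ℕ) (h : Ω → ℚ_[p]) (e : ℕ), h ∈ B ∧ ∀ ω ∈ S, h ω ≠ 0 ∧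
    ∀ g : ℚ_[p], App k' g (η ω) → App k (ev (derivative f) ω g) (h ω * η ω ^ e)

/-- Pullback of coefficients. -/
noncomputable def pullHom {A : FAlg p Ω} {B : FAlg p Ω'} (φ : Ω' → Ω) (h : ∀ f ∈ A, f ∘ φ ∈ B) : A →+* B where
  toFun a := ⟨a.1 ∘ φ, h a.1 a.2⟩
  map_one' := rfl
  map_mul' _ _ := rfl
  map_zero' := rfl
  map_add' _ _ := rfl

theorem ev_pull {A : FAlg p Ω} {B : FAlg p Ω'} (φ : Ω' → Ω) (h : ∀ f ∈ A, f ∘ φ ∈ B)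
    (f : Polynomial A) (ω : Ω') (t : ℚ_[p]) : ev (f.map (pullHom φ h)) ω t = ev f (φ ω) t := by
  rw [ev, eval₂_map]; rfl

theorem RootData.pull {A : FAlg p Ω} {B : FAlg p Ω'} {S : Set Ω} {η : Ω → ℚ_[p]}
    {f : Polynomial A} (H : RootData A S η f) (φ : Ω' → Ω) (h : ∀ f ∈ A, f ∘ φ ∈ B) :
    RootData B (φ ⁻¹' S) (η ∘ φ) (f.map (pullHom φ h)) where
  hS := DefS.comp h H.hS
  ne ω hω := H.ne _ hω
  root ω hω := by rw [ev_pull]; exact H.root _ hω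
  H1 c n hn := DefS.comp h (H.H1 c n hn)
  H2 := by
    obtain ⟨r, hr, a, ha, h2⟩ := H.H2
    exact ⟨r, hr, a ∘ φ, h a ha, fun ω hω => h2 _ hω⟩
  H3 k := by
    obtain ⟨k', g, e, hg, h3⟩ := H.H3 k
    refine ⟨k', g ∘ φ, e, h g hg, fun ω hω => ⟨(h3 _ hω).1, fun t ht => ?_⟩⟩
    rw [derivative_map, ev_pull]
    exact (h3 _ hω).2 t ht

namespace RootData

variable {B : FAlg p Ω} {S : Set Ω} {η : Ω → ℚ_[p]} {f : Polynomial B}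

/-- Classes of monomials in the root. -/
theorem cls_mono (H : RootData B S η f) {u : Ω → ℚ_[p]} (hu : u ∈ B) (e : ℤ) {n : ℕ} (hn : 0 < n) :
    DefS B {ω | ω ∈ S ∧ u ω * η ω ^ e ∈ Pset p n} := by
  obtain ⟨L, hL, hL0, hrep⟩ := exists_reps (p := p) n hn
  have h1 : DefS B {ω | ∃ c ∈ L, (ω ∈ S ∧ c * η ω ∈ Pset p n) ∧ u ω * c⁻¹ ^ e ∈ Pset p n} :=
    BoolGen.ex_mem hL fun c _ => BoolGen.and (H.H1 c n hn)
      (DefS.pow (f := fun ω => u ω * c⁻¹ ^ e) (B.mul_mem hu (const_mem B (c⁻¹ ^ e))) hn)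
  have key : ∀ c ∈ L, ∀ x, c * x ∈ Pset p n → ∀ a, (a * x ^ e ∈ Pset p n ↔ a * c⁻¹ ^ e ∈ Pset p n) := by
    intro c hc x hx a
    have : SameCl n x c⁻¹ := SameCl.of_mul_inv (inv_ne_zero (hL0 c hc)) (by rwa [inv_inv, mul_comm])
    exact this.zpow e a
  refine BoolGen.congr h1 fun ω => ?_
  simp only [Set.mem_ofPred_eq]
  constructor
  · rintro ⟨c, hc, ⟨hS, hx⟩, h⟩
    exact ⟨hS, (key c hc _ hx _).2 h⟩
  · rintro ⟨hS, h⟩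
    obtain ⟨c, hc, hcx⟩ := hrep _ (H.ne ω hS)
    exact ⟨c, hc, ⟨hS, hcx⟩, (key c hc _ hcx _).1 h⟩

/-- Norms of monomials in the root. -/
theorem norm_mono (H : RootData B S η f) (hB : cl B ≤ B) {u v : Ω → ℚ_[p]} (hu : u ∈ B) (hv : v ∈ B)
    (e e' : ℤ) : DefS B {ω | ω ∈ S ∧ ‖u ω * η ω ^ e‖ ≤ ‖v ω * η ω ^ e'‖} := by
  obtain ⟨r, hr, a, ha, h2⟩ := H.H2
  have h1 := DefS.norm_le (B.mul_mem (B.pow_mem hu r) (zpow_mem_of_closed hB ha e))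
    (B.mul_mem (B.pow_mem hv r) (zpow_mem_of_closed hB ha e'))
  refine BoolGen.congr (BoolGen.and H.hS h1) fun ω => ?_
  simp only [Set.mem_ofPred_eq]
  refine and_congr_right fun hω => ?_
  have key : ∀ (w : Ω → ℚ_[p]) (e : ℤ), ‖(w ^ r * fun ω => a ω ^ e) ω‖ = ‖w ω * η ω ^ e‖ ^ r := by
    intro w e
    simp only [Pi.mul_apply, Pi.pow_apply, norm_mul, norm_pow, norm_zpow, ← h2 ω hω, mul_pow]
    congr 1
    rw [← zpow_natCast (‖η ω‖), ← zpow_natCast (‖η ω‖ ^ e), ← zpow_mul, ← zpow_mul, mul_comm e]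
  rw [key, key]
  exact pow_le_pow_iff_left₀ (norm_nonneg _) (norm_nonneg _) (by omega)

/-- Coverings approximating `η - g` by monomials in `η`. -/
def ACov (B : FAlg p Ω) (S : Set Ω) (η : Ω → ℚ_[p]) (k : ℕ) (g : Ω → ℚ_[p]) (T : Set Ω) : Prop :=
  ∃ (ι : Type) (_ : Finite ι) (E : ι → Set Ω) (u : ι → Ω → ℚ_[p]) (e : ι → ℤ),
    (∀ i, DefS B (E i) ∧ u i ∈ B ∧ ∀ ω ∈ E i, ω ∈ S ∧ App k (η ω - g ω) (u i ω * η ω ^ e i)) ∧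
    ∀ ω ∈ T, ∃ i, ω ∈ E i

theorem ACov.union {k : ℕ} {g : Ω → ℚ_[p]} {T T' : Set Ω} (h : ACov B S η k g T)
    (h' : ACov B S η k g T') : ACov B S η k g (T ∪ T') := by
  obtain ⟨ι, hι, E, u, e, H, hc⟩ := h
  obtain ⟨ι', hι', E', u', e', H', hc'⟩ := h'
  refine ⟨ι ⊕ ι', inferInstance, Sum.elim E E', Sum.elim u u', Sum.elim e e', ?_, ?_⟩
  · rintro (i | i)
    · exact H i
    · exact H' i
  · rintro ω (hω | hω)
    · obtain ⟨i, hi⟩ := hc ω hω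
      exact ⟨Sum.inl i, hi⟩
    · obtain ⟨i, hi⟩ := hc' ω hω
      exact ⟨Sum.inr i, hi⟩

theorem ACov.biUnion {k : ℕ} {g : Ω → ℚ_[p]} {κ : Type*} {Q : Set κ} (hQ : Q.Finite) {T : κ → Set Ω}
    (h : ∀ c ∈ Q, ACov B S η k g (T c)) : ACov B S η k g (⋃ c ∈ Q, T c) := by
  induction Q, hQ using Set.Finite.induction_on with
  | empty =>
    exact ⟨Empty, inferInstance, fun i => i.elim, fun i => i.elim, fun i => i.elim,
      fun i => i.elim, fun ω hω => by simp at hω⟩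
  | insert _ _ ih =>
    rw [Set.biUnion_insert]
    exact (h _ (Set.mem_insert _ _)).union (ih fun c hc => h c (Set.mem_insert_of_mem _ hc))

theorem ACov.single {k : ℕ} {g u : Ω → ℚ_[p]} (e : ℤ) {T : Set Ω} (hT : DefS B T) (hu : u ∈ B)
    (h : ∀ ω ∈ T, ω ∈ S ∧ App k (η ω - g ω) (u ω * η ω ^ e)) : ACov B S η k g T :=
  ⟨Unit, inferInstance, fun _ => T, fun _ => u, fun _ => e, fun _ => ⟨hT, hu, h⟩,
    fun ω hω => ⟨(), hω⟩⟩

theorem approx (H : RootData B S η f) (hB : cl B ≤ B) (k : ℕ) (hk : 1 ≤ k)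
    {g : Ω → ℚ_[p]} (hg : g ∈ B) : ACov B S η k g S := by
  classical
  obtain ⟨κ, hκ⟩ := interp (p := p) f.natDegree
  obtain ⟨k', h, e, hh, h3⟩ := H.H3 (k + κ)
  obtain ⟨r, hr, a, ha, h2⟩ := H.H2
  set K1 := max k' k
  have hK1 : k ≤ K1 := le_max_right _ _
  -- the near case
  have near : ∀ ω ∈ S, App K1 (g ω) (η ω) →
      App k (η ω - g ω) (-(ev f ω (g ω)) * (h ω)⁻¹ * η ω ^ (-(e : ℤ))) := by
    intro ω hω hnear
    obtain ⟨hh0, h4⟩ := h3 ω hω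
    have hη := H.ne ω hω
    have h5 := hκ k (f.map (evHom B ω)) ((natDegree_map_le).trans (Nat.le_succ _)) (η ω)
      (h ω * η ω ^ e) (‖ϖ ^ k'‖ * ‖η ω‖) (by
        intro x hx
        rw [derivative_map, ← ev_eq_map]
        exact h4 x hx) (η ω) (g ω) (by rw [sub_self, norm_zero]; positivity)
        (hnear.mono (le_max_left _ _))
    rw [← ev_eq_map, ← ev_eq_map, H.root ω hω, sub_zero] at h5
    have h6 := ((h5.symm hk).mul_left (-(h ω * η ω ^ e)⁻¹))
    have hne : h ω * η ω ^ e ≠ 0 := mul_ne_zero hh0 (pow_ne_zero _ hη)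
    have e1 : -(h ω * η ω ^ e)⁻¹ * (h ω * η ω ^ e * (g ω - η ω)) = η ω - g ω := by
      rw [← mul_assoc, neg_mul, inv_mul_cancel₀ hne]; ring
    have e2 : -(h ω * η ω ^ e)⁻¹ * ev f ω (g ω) = -(ev f ω (g ω)) * (h ω)⁻¹ * η ω ^ (-(e : ℤ)) := by
      rw [mul_inv, zpow_neg, zpow_natCast]; ring
    rwa [e1, e2] at h6
  set K2 := K1 + k
  obtain ⟨N, hN, hNapp⟩ := exists_Pset_app (p := p) K2
  obtain ⟨L, hL, hL0, hrep⟩ := exists_reps (p := p) N hN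
  obtain ⟨Q, hQ, hQE, hQrep⟩ : ∃ Q : Set ℚ_[p], Q.Finite ∧ (∀ c ∈ Q, c ≠ 0) ∧
      ∀ x : ℚ_[p], ‖ϖ ^ k‖ < ‖x‖ → ‖ϖ ^ k‖ * ‖x‖ < 1 →
        ∃ c ∈ Q, ‖x‖ = ‖c‖ ∧ x * c⁻¹ ∈ Pset p N := by
    have : ∀ s : ℤ, ∃ Q : Set ℚ_[p], Q.Finite ∧ Q ⊆ {x | x ≠ 0 ∧ ‖x‖ = ‖ϖ ^ s‖} ∧
        ∀ x ∈ {x | x ≠ 0 ∧ ‖x‖ = ‖ϖ ^ s‖}, ∃ c ∈ Q, x * c⁻¹ ∈ Pset p N :=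
      fun s => exists_reps_in _ (fun x hx => hx.1) N hN
    choose Q hQ hQE hQr using this
    refine ⟨⋃ s ∈ Set.Icc (-(k : ℤ)) k, Q s, (Set.finite_Icc _ _).biUnion fun s _ => hQ s, ?_, ?_⟩
    · intro c hc
      obtain ⟨s, _, hs⟩ := Set.mem_iUnion₂.1 hc
      exact (hQE s hs).1
    · intro x hx1 hx2
      have hx0 : x ≠ 0 := by
        rintro rfl; rw [norm_zero] at hx1; exact absurd hx1 (not_lt.2 (norm_nonneg _))
      obtain ⟨s, hs⟩ := exists_valuation_norm x hx0
      obtain ⟨c, hc, hcx⟩ := hQr s x ⟨hx0, hs⟩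
      refine ⟨c, Set.mem_iUnion₂.2 ⟨s, ?_, hc⟩, by rw [hs, (hQE s hc).2], hcx⟩
      rw [hs, ← zpow_natCast] at hx1 hx2
      rw [← norm_mul, ← zpow_add₀ p_ne_zero'] at hx2
      have h1 := norm_ppow_zlt.1 hx1
      have h2 := (norm_ppow_zlt (p := p) (e := k + s) (f := 0)).1 (by simpa using hx2)
      exact ⟨by omega, by omega⟩
  have pow_r : ∀ ω ∈ S, ∀ x : ℚ_[p], (‖η ω‖ ≤ ‖x‖ ↔ ‖a ω‖ ≤ ‖x ^ r‖) := by
    intro ω hω x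
    rw [← h2 ω hω, norm_pow, pow_le_pow_iff_left₀ (norm_nonneg _) (norm_nonneg _) (by omega)]
  have pow_r' : ∀ ω ∈ S, ∀ x : ℚ_[p], (‖x‖ ≤ ‖η ω‖ ↔ ‖x ^ r‖ ≤ ‖a ω‖) := by
    intro ω hω x
    rw [← h2 ω hω, norm_pow, pow_le_pow_iff_left₀ (norm_nonneg _) (norm_nonneg _) (by omega)]
  -- part 1
  have P1 : ACov B S η k g {ω | ω ∈ S ∧ ‖a ω‖ ≤ ‖(ϖ ^ k * g ω) ^ r‖} := by
    refine ACov.single (u := -g) 0 ?_ (B.neg_mem hg) ?_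
    · exact BoolGen.and H.hS (DefS.norm_le ha (B.pow_mem (B.mul_mem (const_mem B _) hg) r))
    · rintro ω ⟨hω, h1⟩
      rw [← pow_r ω hω] at h1
      refine ⟨hω, ?_⟩
      have := App.of_small (k := k) (y := -g ω) (z := η ω) (by rwa [norm_neg, ← norm_mul])
      simpa [sub_eq_add_neg, add_comm] using this
  have P2 : ACov B S η k g {ω | ω ∈ S ∧ ‖(ϖ ^ (-(k : ℤ)) * g ω) ^ r‖ ≤ ‖a ω‖} := by
    refine ACov.single (u := 1) 1 ?_ B.one_mem ?_
    · exact BoolGen.and H.hS (DefS.norm_le (B.pow_mem (B.mul_mem (const_mem B _) hg) r) ha)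
    · rintro ω ⟨hω, h1⟩
      rw [← pow_r' ω hω] at h1
      refine ⟨hω, ?_⟩
      have := App.of_small (k := k) (y := η ω) (z := -g ω) (by
        rw [norm_neg]
        rw [norm_mul, zpow_neg, norm_inv, zpow_natCast] at h1
        rwa [inv_mul_le_iff₀ (norm_ppow_pos k)] at h1)
      simpa [sub_eq_add_neg] using this
  have P3 : ACov B S η k g (⋃ c ∈ Q, {ω | ω ∈ S ∧ ‖η ω‖ = ‖g ω * c‖ ∧ g ω ≠ 0 ∧
      η ω * (g ω * c)⁻¹ ∈ Pset p N}) := by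
    refine ACov.biUnion hQ fun c hc => ?_
    have hc0 := hQE c hc
    have hT : DefS B {ω | ω ∈ S ∧ ‖η ω‖ = ‖g ω * c‖ ∧ g ω ≠ 0 ∧
        η ω * (g ω * c)⁻¹ ∈ Pset p N} := by
      have h1 : DefS B {ω | ω ∈ S ∧ ‖a ω‖ = ‖(g ω * c) ^ r‖} := BoolGen.and H.hS
        (DefS.norm_eq ha (B.pow_mem (B.mul_mem hg (const_mem B c)) r))
      have h4 : DefS B {ω | g ω * c ≠ 0} := DefS.ne_zero (B.mul_mem hg (const_mem B c))
      have h5 := H.cls_mono (inv_mem_of_closed hB (B.mul_mem hg (const_mem B c))) 1 hN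
      refine BoolGen.congr (BoolGen.and (BoolGen.and h1 h4) h5) fun ω => ?_
      simp only [Set.mem_ofPred_eq, Pi.mul_apply, zpow_one, mul_comm (g ω * c)⁻¹ (η ω)]
      constructor
      · rintro ⟨⟨⟨h1, h2⟩, h3⟩, -, h4⟩
        refine ⟨h1, le_antisymm ((pow_r ω h1 _).2 h2.le) ((pow_r' ω h1 _).2 h2.ge), ?_, h4⟩
        rintro h0; exact h3 (by simp [h0])
      · rintro ⟨h1, h2, h3, h4⟩
        exact ⟨⟨⟨h1, le_antisymm ((pow_r ω h1 _).1 h2.le) ((pow_r' ω h1 _).1 h2.ge)⟩,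
          mul_ne_zero h3 hc0⟩, h1, h4⟩
    by_cases hnear : ‖1 - c‖ ≤ ‖ϖ ^ K1‖ * ‖c‖
    · refine ACov.single (u := fun ω => -(ev f ω (g ω)) * (h ω)⁻¹) (-(e : ℤ)) hT ?_ ?_
      · exact B.mul_mem (B.neg_mem (ev_mem le_rfl f hg)) (inv_mem_of_closed hB hh)
      · rintro ω ⟨hω, hn, hg0, hcl⟩
        refine ⟨hω, near ω hω ?_⟩
        have h7 : App K1 (η ω) (g ω * c) := (hNapp _ _ hn hcl).mono (Nat.le_add_right _ _)
        refine App.trans ?_ (h7.symm (hk.trans hK1))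
        have h8 : App K1 (1 : ℚ_[p]) c := hnear
        simpa using h8.mul_left (g ω)
    · refine ACov.single (u := fun ω => g ω * (c - 1)) 0 hT (B.mul_mem hg (const_mem B _)) ?_
      rintro ω ⟨hω, hn, hg0, hcl⟩
      refine ⟨hω, ?_⟩
      have h7 : App K2 (η ω) (g ω * c) := hNapp _ _ hn hcl
      have h8 : ‖η ω - g ω * c‖ ≤ ‖ϖ ^ k‖ * ‖g ω * (c - 1)‖ := by
        refine le_trans (show _ ≤ _ from h7) ?_
        rw [not_le, norm_sub_rev] at hnear
        rw [norm_mul, norm_mul, pow_add, norm_mul]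
        calc _ = ‖ϖ ^ k‖ * (‖g ω‖ * (‖ϖ ^ K1‖ * ‖c‖)) := by ring
          _ ≤ _ := by gcongr
      have := App.of_small h8
      have e3 : g ω * (c - 1) + (η ω - g ω * c) = η ω - g ω := by ring
      rw [e3] at this
      simpa using this
  obtain ⟨ι, hι, E, u, e', HE, hc⟩ := (P1.union P2).union P3
  refine ⟨ι, hι, E, u, e', HE, fun ω hω => hc ω ?_⟩
  by_cases h4 : ‖a ω‖ ≤ ‖(ϖ ^ k * g ω) ^ r‖
  · exact Or.inl (Or.inl ⟨hω, h4⟩)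
  by_cases h5 : ‖(ϖ ^ (-(k : ℤ)) * g ω) ^ r‖ ≤ ‖a ω‖
  · exact Or.inl (Or.inr ⟨hω, h5⟩)
  right
  rw [← pow_r ω hω, not_le, norm_mul] at h4
  rw [← pow_r' ω hω, not_le, norm_mul, zpow_neg, norm_inv, zpow_natCast,
    lt_inv_mul_iff₀ (norm_ppow_pos k)] at h5
  have hg0 : g ω ≠ 0 := by
    intro h0; rw [h0, norm_zero] at h5
    exact absurd h5 (not_lt.2 (by positivity))
  have hgp : 0 < ‖g ω‖ := norm_pos_iff.2 hg0
  obtain ⟨c, hcQ, hcn, hcc⟩ := hQrep (η ω / g ω) (by rwa [norm_div, lt_div_iff₀ hgp])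
    (by rw [norm_div, ← mul_div_assoc, div_lt_one hgp]; exact h5)
  refine Set.mem_iUnion₂.2 ⟨c, hcQ, hω, ?_, hg0, ?_⟩
  · rw [norm_mul, ← hcn, norm_div]; field_simp
  · rw [mul_inv, ← mul_assoc]; exact hcc

/-- Simple conditions on `η - g` are definable. -/
theorem defS_LSet (H : RootData B S η f) (hB : cl B ≤ B) {g : Ω → ℚ_[p]} (hg : g ∈ B)
    {C : Set (Ω × ℚ_[p])} (hC : LSet B C) : DefS B {ω | ω ∈ S ∧ (ω, η ω - g ω) ∈ C} := by
  induction hC with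
  | univ => simpa using H.hS
  | compl C _ ih =>
    refine BoolGen.congr (BoolGen.diff H.hS ih) fun ω => ?_
    simp only [Set.mem_sdiff, Set.mem_ofPred_eq, Set.mem_compl_iff]
    tauto
  | inter C D _ _ ih ih' =>
    refine BoolGen.congr (BoolGen.inter _ _ ih ih') fun ω => ?_
    simp only [Set.mem_inter_iff, Set.mem_ofPred_eq]
    tauto
  | base C hC =>
    rcases hC with ⟨T, hT, rfl⟩ | ⟨a, ha, b, hb, i, j, rfl⟩ | ⟨c, n, hn, rfl⟩
    · exact BoolGen.and H.hS hT
    · obtain ⟨ι, hι, E, u, e, HE, hc⟩ := H.approx hB 1 le_rfl hg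
      have h1 : DefS B {ω | ∃ i', ω ∈ E i' ∧ (ω ∈ S ∧ ‖(a ω * u i' ω ^ i) * η ω ^ (e i' * i)‖ ≤
          ‖(b ω * u i' ω ^ j) * η ω ^ (e i' * j)‖)} := BoolGen.ex_finite fun i' =>
        BoolGen.and (HE i').1 (H.norm_mono hB (B.mul_mem ha (B.pow_mem (HE i').2.1 i))
          (B.mul_mem hb (B.pow_mem (HE i').2.1 j)) _ _)
      have key : ∀ i', ∀ ω ∈ E i', ∀ (a : ℚ_[p]) (i : ℕ),
          ‖(a * u i' ω ^ i) * η ω ^ (e i' * i)‖ = ‖a * (η ω - g ω) ^ i‖ := by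
        intro i' ω hω a i
        have := ((HE i').2.2 ω hω).2.norm_eq le_rfl
        rw [norm_mul a, norm_pow, this, ← norm_pow, ← norm_mul, mul_pow, ← zpow_natCast (η ω ^ e i'),
          ← zpow_mul, mul_assoc]
      refine BoolGen.congr h1 fun ω => ?_
      simp only [Set.mem_ofPred_eq]
      constructor
      · rintro ⟨i', hi', hS, h⟩
        rw [key i' ω hi', key i' ω hi'] at h
        exact ⟨hS, h⟩
      · rintro ⟨hS, h⟩
        obtain ⟨i', hi'⟩ := hc ω hS
        refine ⟨i', hi', hS, ?_⟩
        rwa [key i' ω hi', key i' ω hi']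
    · obtain ⟨k, hk1, hk⟩ := exists_app_Pset (p := p) n hn
      obtain ⟨ι, hι, E, u, e, HE, hc⟩ := H.approx hB k hk1 hg
      have h1 : DefS B {ω | ∃ i', ω ∈ E i' ∧ (ω ∈ S ∧ (c * u i' ω) * η ω ^ (e i') ∈ Pset p n)} :=
        BoolGen.ex_finite fun i' => BoolGen.and (HE i').1
          (H.cls_mono (B.mul_mem (const_mem B c) (HE i').2.1) _ hn)
      refine BoolGen.congr h1 fun ω => ?_
      simp only [Set.mem_ofPred_eq]
      have key : ∀ i', ω ∈ E i' → (c * u i' ω * η ω ^ (e i') ∈ Pset p n ↔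
          c * (η ω - g ω) ∈ Pset p n) := by
        intro i' hω
        rw [mul_assoc]
        exact (hk _ _ (((HE i').2.2 ω hω).2.mul_left c)).symm
      constructor
      · rintro ⟨i', hi', hS, h⟩
        exact ⟨hS, (key i' hi').1 h⟩
      · rintro ⟨hS, h⟩
        obtain ⟨i', hi'⟩ := hc ω hS
        exact ⟨i', hi', hS, (key i' hi').2 h⟩

theorem defS_ev (H : RootData B S η f) (hB : cl B ≤ B) {d : ℕ} (hprep : Prep p d)
    (hf : f.natDegree ≤ d + 1) (G : Polynomial B) {n : ℕ} (hn : 0 < n) :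
    DefS B {ω | ω ∈ S ∧ ev G ω (η ω) ∈ Pset p n} := by
  classical
  obtain ⟨k, hk1, hk⟩ := exists_app_Pset (p := p) n hn
  -- polynomials of small degree
  have small : ∀ G : Polynomial B, G.natDegree ≤ d →
      DefS B {ω | ω ∈ S ∧ ev G ω (η ω) ∈ Pset p n} := by
    intro G hG
    obtain ⟨ι, hι, C, γ, h, e, HC, hc⟩ := hprep Ω B hB G hG k
    have h1 : DefS B {ω | ∃ i, ω ∈ S ∧ (ω, η ω - γ i ω) ∈ C i ∩ {z | h i z.1 * z.2 ^ e i ∈ Pset p n}} :=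
      BoolGen.ex_finite fun i => H.defS_LSet hB (HC i).2.1
        (BoolGen.inter _ _ (HC i).1 (LSet.mul_pow (HC i).2.2.1 (e i) hn))
    refine BoolGen.congr h1 fun ω => ?_
    simp only [Set.mem_ofPred_eq, Set.mem_inter_iff]
    have key : ∀ i, (ω, η ω - γ i ω) ∈ C i → (ev G ω (η ω) ∈ Pset p n ↔
        h i ω * (η ω - γ i ω) ^ e i ∈ Pset p n) := by
      intro i hi
      have := (HC i).2.2.2 ω _ hi
      rw [sub_add_cancel] at this
      exact hk _ _ this
    constructor
    · rintro ⟨i, hS, hi, h⟩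
      exact ⟨hS, (key i hi).2 h⟩
    · rintro ⟨hS, h⟩
      obtain ⟨i, hi⟩ := hc ω (η ω) (Set.mem_univ _)
      exact ⟨i, hS, hi, (key i hi).1 h⟩
  -- split according to the degree
  let Sm : Fin (d + 1) → Set Ω := fun m =>
    {ω | (f.coeff (m + 1)).1 ω ≠ 0 ∧ ∀ j : Fin (d + 2), m.1 + 1 < j.1 → (f.coeff j).1 ω = 0}
  have hSm : ∀ m, DefS B (Sm m) := fun m => BoolGen.and (DefS.ne_zero (f.coeff (m + 1)).2)
    (BoolGen.all_finite fun j => BoolGen.imp (BoolGen.const _) (DefS.eq_zero (f.coeff j).2))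
  let ft : Fin (d + 1) → Polynomial B := fun m => X ^ (m.1 + 1) + ∑ j : Fin (m.1 + 1),
    C (f.coeff j * ⟨_, inv_mem_of_closed hB (f.coeff (m + 1)).2⟩) * X ^ j.1
  have hdeg : ∀ m : Fin (d + 1), (∑ j : Fin (m.1 + 1),
      C (f.coeff j * ⟨_, inv_mem_of_closed hB (f.coeff (m + 1)).2⟩) * X ^ j.1 : Polynomial B).degree
        < ((m.1 + 1 : ℕ) : WithBot ℕ) := by
    intro m
    refine lt_of_le_of_lt (degree_sum_le _ _) ?_
    rw [Finset.sup_lt_iff (WithBot.bot_lt_coe _)]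
    intro j _
    refine lt_of_le_of_lt (degree_C_mul_X_pow_le _ _) ?_
    exact_mod_cast j.2
  have hmonic : ∀ m, (ft m).Monic := fun m => monic_X_pow_add (hdeg m)
  have hftev : ∀ m, ∀ ω ∈ S, ω ∈ Sm m → ev (ft m) ω (η ω) = 0 := by
    intro m ω hωS hω
    have h0 := H.root ω hωS
    have e1 : ev f ω (η ω) = ∑ j ∈ Finset.range (d + 2), (f.coeff j).1 ω * η ω ^ j := by
      rw [ev, eval₂_eq_sum_range' _ (show f.natDegree < d + 2 by omega)]
      rfl
    have e2 : ev f ω (η ω) = ∑ j ∈ Finset.range (m.1 + 2), (f.coeff j).1 ω * η ω ^ j := by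
      rw [e1]
      symm
      refine Finset.sum_subset (fun j hj => ?_) ?_
      · simp only [Finset.mem_range] at *; have := m.2; omega
      · intro j hj hj'
        simp only [Finset.mem_range] at *
        rw [hω.2 ⟨j, hj⟩ (by simp only; omega), zero_mul]
    have e3 : ev (ft m) ω (η ω) = ((f.coeff (m + 1)).1 ω)⁻¹ * ev f ω (η ω) := by
      rw [e2, Finset.sum_range_succ, ← Fin.sum_univ_eq_sum_range
        (fun j => (f.coeff j).1 ω * η ω ^ j)]
      simp only [ft, ev_add, ev_pow, ev_X]
      rw [mul_add, Finset.mul_sum, add_comm, inv_mul_cancel_left₀ hω.1]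
      congr 1
      have : ev (∑ j : Fin (m.1 + 1),
          C (f.coeff j * ⟨_, inv_mem_of_closed hB (f.coeff (m + 1)).2⟩) * X ^ j.1) ω (η ω) =
          ∑ j : Fin (m.1 + 1), ev (C (f.coeff j * ⟨_, inv_mem_of_closed hB (f.coeff (m + 1)).2⟩)
            * X ^ j.1) ω (η ω) := by
        simp only [ev, eval₂_finsetSum]
      rw [this]
      refine Finset.sum_congr rfl fun j _ => ?_
      rw [ev_mul, ev_pow, ev_X, ev_C]
      change (f.coeff j).1 ω * ((f.coeff (m + 1)).1 ω)⁻¹ * _ = _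
      ring
    rw [e3, h0, mul_zero]
  have hcov : ∀ ω ∈ S, ∃ m, ω ∈ Sm m := by
    intro ω hω
    by_contra hcon
    push Not at hcon
    have hz : ∀ n, ∀ j, n ≤ j → j ≤ d + 1 → 1 ≤ j → (f.coeff j).1 ω = 0 := by
      intro n
      induction hn' : d + 1 - n generalizing n with
      | zero =>
        intro j h1 h2 h3
        have hj : j = d + 1 := by omega
        subst hj
        by_contra h0
        refine hcon ⟨d, by omega⟩ ⟨h0, fun j hj => ?_⟩
        have := j.2; simp only at hj; omega
      | succ s ih =>
        intro j h1 h2 h3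
        have ih' := ih (n + 1) (by omega)
        rcases Nat.lt_or_ge n j with h | h
        · exact ih' j h h2 h3
        · have : j = n := by omega
          subst this
          by_contra h0
          refine hcon ⟨j - 1, by omega⟩ ⟨by rwa [Nat.sub_add_cancel h3], fun j' hj' => ?_⟩
          simp only at hj'
          exact ih' j' (by omega) (by have := j'.2; omega) (by omega)
    obtain ⟨k', h, e, hh, h3⟩ := H.H3 1
    obtain ⟨hne, h4⟩ := h3 ω hω
    have h5 := h4 (η ω) (App.refl _ _)
    have h6 : ev (derivative f) ω (η ω) = 0 := by
      rw [ev, eval₂_eq_sum_range]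
      refine Finset.sum_eq_zero fun j _ => ?_
      rw [coeff_derivative]
      have h7 : (f.coeff (j + 1)).1 ω = 0 := by
        by_cases hj : j + 1 ≤ d + 1
        · exact hz 0 _ (by omega) hj (by omega)
        · rw [coeff_eq_zero_of_natDegree_lt (by omega)]; rfl
      rw [map_mul, evHom_apply, h7]; ring
    rw [h6] at h5
    exact mul_ne_zero hne (pow_ne_zero _ (H.ne ω hω)) ((h5.eq_zero_iff le_rfl).1 rfl)
  have h1 : DefS B {ω | ∃ m, ω ∈ Sm m ∧ (ω ∈ S ∧ ev (G %ₘ ft m) ω (η ω) ∈ Pset p n)} := by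
    refine BoolGen.ex_finite fun m => BoolGen.and (hSm m) (small _ ?_)
    by_cases hnt : Nontrivial B
    · have hdX : (ft m).degree = ((m.1 + 1 : ℕ) : WithBot ℕ) := by
        simp only [ft]
        rw [degree_add_eq_left_of_degree_lt (by rw [degree_X_pow]; exact hdeg m), degree_X_pow]
      have h3 := natDegree_modByMonic_lt G (hmonic m) (by
        intro h1
        have := congrArg Polynomial.degree h1
        rw [hdX, degree_one] at this
        exact absurd this (by exact_mod_cast Nat.succ_ne_zero m.1))
      have h4 : (ft m).natDegree = m.1 + 1 := natDegree_eq_of_degree_eq_some hdX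
      have := m.2
      omega
    · have : Subsingleton B := not_nontrivial_iff_subsingleton.1 hnt
      rw [Subsingleton.elim (G %ₘ ft m) 0]; simp
  refine BoolGen.congr h1 fun ω => ?_
  simp only [Set.mem_ofPred_eq]
  have key : ∀ m, ω ∈ S → ω ∈ Sm m → ev (G %ₘ ft m) ω (η ω) = ev G ω (η ω) := by
    intro m hS hm
    conv_rhs => rw [← modByMonic_add_div G (ft m)]
    rw [ev_add, ev_mul, hftev m ω hS hm, zero_mul, add_zero]
  constructor
  · rintro ⟨m, hm, hS, h⟩
    exact ⟨hS, by rwa [← key m hS hm]⟩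
  · rintro ⟨hS, h⟩
    obtain ⟨m, hm⟩ := hcov ω hS
    exact ⟨m, hm, hS, by rwa [key m hS hm]⟩

/-- Roots are strongly definable. -/
theorem mem_cl (H : RootData B S η f) {d : ℕ} (hprep : Prep p d)
    (hf : f.natDegree ≤ d + 1) (hoff : ∀ ω, ω ∉ S → η ω = 0) : η ∈ cl B := by
  refine mem_cl_of_ev fun Ω' φ B' hB' hφ G n hn => ?_
  have H' := H.pull φ hφ
  have h1 := H'.defS_ev hB' hprep ((natDegree_map_le).trans hf) G hn
  have h2 : DefS B' {ω | ev G ω 0 ∈ Pset p n} := DefS.ev le_rfl G (g := fun _ => 0) (const_mem _ 0) hn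
  refine BoolGen.congr (BoolGen.or h1 (BoolGen.and (BoolGen.not H'.hS) h2)) fun ω => ?_
  simp only [Set.mem_ofPred_eq]
  by_cases hω : φ ω ∈ S
  · constructor
    · rintro (h | h)
      · exact h.2
      · exact absurd hω h.1
    · intro h
      exact Or.inl ⟨hω, h⟩
  · constructor
    · rintro (h | h)
      · exact absurd h.1 hω
      · rw [hoff _ hω]; exact h.2
    · intro h
      rw [hoff _ hω] at h
      exact Or.inr ⟨hω, h⟩

end RootData

end root

end PadicSub
end

section
namespace PadicSub

section prepstep

open Polynomial

variable {p : ℕ} [Fact p.Prime] {Ω Ω' : Type}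
local notation "ϖ" => (p : ℚ_[p])

theorem exists_fine (r : ℕ) (hr : 1 ≤ r) : ∃ K : ℕ, 1 ≤ K ∧ ∀ ζ : ℚ_[p], ζ ^ r = 1 → App K ζ 1 → ζ = 1 := by
  have hr0 : (r : ℚ_[p]) ≠ 0 := by exact_mod_cast (by omega : r ≠ 0)
  obtain ⟨K, -, hK⟩ := exists_ppow_lt (p := p) (norm_pos_iff.2 hr0)
  refine ⟨K + 1, by omega, fun ζ h1 h2 => ?_⟩
  by_contra hne
  have h3 : (∑ i ∈ Finset.range r, ζ ^ i) * (ζ - 1) = 0 := by rw [geom_sum_mul, h1, sub_self]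
  have h4 : ∑ i ∈ Finset.range r, ζ ^ i = 0 := by
    rcases mul_eq_zero.1 h3 with h | h
    · exact h
    · exact absurd (sub_eq_zero.1 h) hne
  have h5 : ∑ i ∈ Finset.range r, (1 - ζ ^ i) = r := by
    rw [Finset.sum_sub_distrib, h4]; simp
  have h6 : ‖∑ i ∈ Finset.range r, (1 - ζ ^ i)‖ ≤ ‖ϖ ^ K‖ := by
    refine norm_sum_le_of _ _ (norm_nonneg _) fun i _ => ?_
    have h7 := (h2.mono (Nat.le_succ K)).pow i
    rw [norm_sub_rev]
    have h8 : ‖ζ ^ i - 1 ^ i‖ ≤ _ := h7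
    simpa using h8
  rw [h5] at h6
  exact absurd hK (not_lt.2 h6)

/-- Root functions. -/
theorem exists_root_fn {A : FAlg p Ω} (hA : cl A ≤ A) {d : ℕ} (hprep : Prep p d) {r : ℕ} (hr : 1 ≤ r)
    (hrd : r ≤ d + 1) {b : Ω → ℚ_[p]} (hb : b ∈ A) {N : ℕ} (hN : 0 < N)
    (hfine : ∀ ζ : ℚ_[p], ζ ^ r = 1 → ζ ∈ Pset p N → ζ = 1) {l : ℚ_[p]} (hl : l ≠ 0) :
    ∃ y ∈ A, ∀ ω, l ^ r * b ω ∈ Pset p (r * N) → (y ω) ^ r = b ω ∧ l * y ω ∈ Pset p N := by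
  classical
  set S : Set Ω := {ω | l ^ r * b ω ∈ Pset p (r * N)} with hS
  have hrN : 0 < r * N := by positivity
  have ex : ∀ ω ∈ S, ∃ y : ℚ_[p], y ^ r = b ω ∧ l * y ∈ Pset p N := by
    rintro ω ⟨z, hz, hzb⟩
    refine ⟨z ^ N * l⁻¹, ?_, z, hz, by field_simp⟩
    rw [mul_pow, ← pow_mul, mul_comm N r, hzb, mul_right_comm, inv_pow, mul_inv_cancel₀ (pow_ne_zero _ hl),
      one_mul]
  choose! y0 hy0 using ex
  let y : Ω → ℚ_[p] := fun ω => if ω ∈ S then y0 ω else 0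
  have hy : ∀ ω ∈ S, y ω ^ r = b ω ∧ l * y ω ∈ Pset p N := fun ω hω => by
    simp only [y, if_pos hω]; exact hy0 ω hω
  have hne : ∀ ω ∈ S, y ω ≠ 0 := fun ω hω h0 => by
    have := ne_zero_of_mem_Pset (hy ω hω).2
    rw [h0, mul_zero] at this
    exact this rfl
  have hSdef : DefS A S := DefS.cpow hb (l ^ r) hrN
  have H : RootData A S y (X ^ r - C ⟨b, hb⟩) := by
    refine ⟨hSdef, hne, ?_, ?_, ⟨r, hr, b, hb, ?_⟩, ?_⟩
    · intro ω hω
      rw [ev_sub, ev_pow, ev_X, ev_C, (hy ω hω).1]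
      exact sub_self _
    · intro c n hn
      obtain ⟨L, hL, hL0, hrep⟩ := exists_reps (p := p) (N * n) (by positivity)
      have h1 : DefS A {ω | ω ∈ S ∧ ∃ ρ ∈ L, (l * ρ⁻¹ ∈ Pset p N ∧ c * ρ⁻¹ ∈ Pset p n) ∧
          ρ ^ r * b ω ∈ Pset p (r * (N * n))} :=
        BoolGen.and hSdef (BoolGen.ex_mem hL fun ρ _ => BoolGen.and (BoolGen.const _)
          (DefS.cpow hb _ (by positivity)))
      refine BoolGen.congr h1 fun ω => ?_
      simp only [Set.mem_ofPred_eq]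
      refine and_congr_right fun hω => ?_
      constructor
      · rintro ⟨ρ, hρ, ⟨h2, h3⟩, z, hz, hzb⟩
        have hρ0 := hL0 ρ hρ
        set y' := z ^ (N * n) * ρ⁻¹ with hy'
        have h4 : ρ * y' = z ^ (N * n) := by rw [hy']; field_simp
        have h5 : y' ^ r = b ω := by
          have : ρ ^ r * y' ^ r = ρ ^ r * b ω := by
            rw [← mul_pow, h4, ← pow_mul, ← hzb, mul_comm (N * n) r]
          exact mul_left_cancel₀ (pow_ne_zero _ hρ0) this
        have h6 : ρ * y' ∈ Pset p (N * n) := ⟨z, hz, h4.symm⟩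
        have h7 : l * y' ∈ Pset p N := by
          have := mul_mem_Pset h2 (Pset_dvd (Dvd.intro _ rfl) h6)
          rwa [mul_assoc, inv_mul_cancel_left₀ hρ0] at this
        have h8 : y' = y ω := by
          have := hfine (y' * (y ω)⁻¹) (by
            rw [mul_pow, h5, inv_pow, (hy ω hω).1]
            exact mul_inv_cancel₀ (by rw [← (hy ω hω).1]; exact pow_ne_zero _ (hne ω hω))) (by
            have := mul_mem_Pset h7 (inv_mem_Pset (hy ω hω).2)
            rwa [mul_inv, mul_mul_mul_comm, mul_inv_cancel₀ hl, one_mul] at this)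
          rwa [mul_inv_eq_one₀ (hne ω hω)] at this
        rw [← h8]
        have := mul_mem_Pset h3 (Pset_dvd (Dvd.intro_left _ rfl) h6)
        rwa [mul_assoc, inv_mul_cancel_left₀ hρ0] at this
      · intro hc
        obtain ⟨ρ, hρ, hρy⟩ := hrep (y ω) (hne ω hω)
        have hρ0 := hL0 ρ hρ
        refine ⟨ρ, hρ, ⟨?_, ?_⟩, ?_⟩
        · have := mul_mem_Pset (hy ω hω).2 (inv_mem_Pset (Pset_dvd (Dvd.intro _ rfl) hρy))
          rwa [mul_inv, mul_mul_mul_comm, mul_inv_cancel₀ (hne ω hω), mul_one] at this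
        · have := mul_mem_Pset hc (inv_mem_Pset (Pset_dvd (Dvd.intro_left _ rfl) hρy))
          rwa [mul_inv, mul_mul_mul_comm, mul_inv_cancel₀ (hne ω hω), mul_one] at this
        · obtain ⟨z, hz, hzy⟩ := hρy
          exact ⟨z, hz, by rw [← (hy ω hω).1, ← mul_pow, ← hzy, ← pow_mul, mul_comm]⟩
    · intro ω hω
      rw [← norm_pow, (hy ω hω).1]
    · intro k
      refine ⟨k, fun _ => (r : ℚ_[p]), r - 1, const_mem A _, fun ω hω => ⟨?_, fun g hg => ?_⟩⟩
      · change (r : ℚ_[p]) ≠ 0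
        exact_mod_cast (by omega : r ≠ 0)
      · have e1 : ev (derivative (X ^ r - C (⟨b, hb⟩ : A))) ω g = r * g ^ (r - 1) := by
          rw [derivative_sub, derivative_C, sub_zero, derivative_X_pow, ev_mul, ev_pow, ev_X, ev_C]
          rfl
        rw [e1]
        exact (hg.pow _).mul_left _
  refine ⟨y, hA (H.mem_cl hprep ?_ ?_), fun ω hω => hy ω hω⟩
  · refine le_trans (natDegree_sub_le _ _) ?_
    rw [natDegree_C, max_eq_left (Nat.zero_le _)]
    exact (natDegree_X_pow_le r).trans hrd
  · intro ω hω
    simp only [y, if_neg hω]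

theorem ev_continuous {A : FAlg p Ω} (F : Polynomial A) (ω : Ω) : Continuous fun t => ev F ω t := by
  simp only [ev_eq_map]
  exact (F.map (evHom A ω)).continuous

/-- The conclusion of `interp`. -/
def Interp (p : ℕ) [Fact p.Prime] (d k κ : ℕ) : Prop :=
  ∀ f : ℚ_[p][X], f.natDegree ≤ d + 1 → ∀ (y c : ℚ_[p]) (ρ : ℝ),
    (∀ x, ‖x - y‖ ≤ ρ → App (k + κ) ((derivative f).eval x) c) →
    ∀ s t, ‖s - y‖ ≤ ρ → ‖t - y‖ ≤ ρ → App k (f.eval t - f.eval s) (c * (t - s))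

theorem prep_ball {A : FAlg p Ω} (hA : cl A ≤ A) {d : ℕ} (hprep : Prep p d) {k κ : ℕ} (hk : 1 ≤ k)
    (hκ : Interp p d k κ)
    {F : Polynomial A} (hF : F.natDegree ≤ d + 1) {C : Set (Ω × ℚ_[p])} (hC : LSet A C)
    {h : Ω → ℚ_[p]} (hh : h ∈ A) {e : ℕ}
    (hFC : ∀ ω x, (ω, x) ∈ C → App (k + κ) (ev (derivative F) ω x) (h ω * x ^ e))
    {K0 : ℕ} (hK0 : k + κ ≤ K0)
    (htame : ∀ ω x x', App K0 x x' → ((ω, x) ∈ C ↔ (ω, x') ∈ C))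
    {S : Set Ω} (hS : DefS A S) {y : Ω → ℚ_[p]} (hy : y ∈ A) (hy0 : ∀ ω ∈ S, y ω ≠ 0) :
    PrepOn F k {z | z ∈ C ∧ z.1 ∈ S ∧ App (K0 + k) z.2 (y z.1)} := by
  classical
  set q : Ω → ℚ_[p] := fun ω => h ω * y ω ^ e with hq
  have hqA : q ∈ A := A.mul_mem hh (A.pow_mem hy e)
  have hFy : (fun ω => ev F ω (y ω)) ∈ A := ev_mem le_rfl F hy
  have hS' : DefS A {ω | ω ∈ S ∧ (ω, y ω) ∈ C} := BoolGen.and hS (hC.subst hy)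
  have hpqy : (fun ω => ϖ ^ K0 * q ω * y ω) ∈ A :=
    A.mul_mem (A.mul_mem (const_mem A _) hqA) hy
  -- derivative on the ball
  have hder : ∀ ω, ω ∈ S → (ω, y ω) ∈ C → ∀ x, App K0 x (y ω) →
      App (k + κ) (ev (derivative F) ω x) (q ω) := by
    intro ω hω hωC x hx
    have h1 : (ω, x) ∈ C := (htame ω _ _ hx).2 hωC
    exact (hFC ω x h1).trans (((hx.mono hK0).pow e).mul_left _)
  have hlin : ∀ ω, ω ∈ S → (ω, y ω) ∈ C → ∀ s t, App K0 s (y ω) → App K0 t (y ω) →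
      App k (ev F ω t - ev F ω s) (q ω * (t - s)) := by
    intro ω hω hωC s t hs ht
    rw [ev_eq_map, ev_eq_map]
    refine hκ (F.map (evHom A ω)) ((natDegree_map_le).trans hF) (y ω) (q ω)
      (‖ϖ ^ K0‖ * ‖y ω‖) (fun x hx => ?_) s t hs ht
    rw [derivative_map, ← ev_eq_map]
    exact hder ω hω hωC x hx
  -- first case
  set T1 : Set Ω := {ω | (ω ∈ S ∧ (ω, y ω) ∈ C) ∧ ‖ϖ ^ K0 * q ω * y ω‖ ≤ ‖ev F ω (y ω)‖}
  have hT1 : DefS A T1 := BoolGen.and hS' (DefS.norm_le hpqy hFy)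
  set T2 : Set Ω := {ω | (ω ∈ S ∧ (ω, y ω) ∈ C) ∧ ‖ev F ω (y ω)‖ < ‖ϖ ^ K0 * q ω * y ω‖}
  have hT2 : DefS A T2 := BoolGen.and hS' (DefS.norm_lt hFy hpqy)
  have hball : ∀ (T : Set Ω), DefS A T → ∀ K : ℕ,
      LSet A {z | z.1 ∈ T ∧ ‖z.2‖ ≤ ‖ϖ ^ K * y z.1‖} := by
    intro T hT K
    have := LSet.norm_le A.one_mem (A.mul_mem (const_mem A (ϖ ^ K)) hy) 1 0
    refine BoolGen.and (LSet.fst hT) ?_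
    simpa using this
  have P1 : PrepOn F k {z | z.1 ∈ T1 ∧ App (K0 + k) z.2 (y z.1)} := by
    refine PrepOn.piece (γ := y) (e := 0) (hball T1 hT1 (K0 + k)) hy hFy ?_ ?_
    · rintro ω x ⟨⟨⟨hω, hωC⟩, hn⟩, hx⟩
      simp only at hω hωC hn hx
      have h1 : App (K0 + k) (x + y ω) (y ω) := by
        change ‖_‖ ≤ _; rw [← norm_mul]; simpa using hx
      have h2 := hlin ω hω hωC (y ω) (x + y ω) (App.refl _ _) (h1.mono (Nat.le_add_right _ _))
      rw [add_sub_cancel_right] at h2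
      have h3 := h2.norm_eq hk
      have h4 : ‖ev F ω (x + y ω) - ev F ω (y ω)‖ ≤ ‖ϖ ^ k‖ * ‖ev F ω (y ω)‖ := by
        rw [h3]
        refine le_trans ?_ (mul_le_mul_of_nonneg_left hn (norm_nonneg _))
        rw [pow_add] at hx
        simp only [norm_mul] at hx ⊢
        calc ‖q ω‖ * ‖x‖ ≤ ‖q ω‖ * (‖ϖ ^ K0‖ * ‖ϖ ^ k‖ * ‖y ω‖) := by gcongr
          _ = _ := by ring
      rw [pow_zero, mul_one]
      exact h4
    · rintro ω t ⟨hω, ht⟩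
      refine ⟨hω, ?_⟩
      rw [norm_mul]; exact ht
  -- second case
  let xs : ℕ → Ω → ℚ_[p] := fun j => Nat.rec y (fun _ x ω => x ω - ev F ω (x ω) * (q ω)⁻¹) j
  have xs_succ : ∀ j ω, xs (j + 1) ω = xs j ω - ev F ω (xs j ω) * (q ω)⁻¹ := fun j ω => rfl
  have hxsA : ∀ j, xs j ∈ A := by
    intro j
    induction j with
    | zero => exact hy
    | succ j ih => exact A.sub_mem ih (A.mul_mem (ev_mem le_rfl F ih) (inv_mem_of_closed hA hqA))
  have hq0 : ∀ ω ∈ T2, q ω ≠ 0 := by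
    rintro ω ⟨_, h1⟩ h0
    rw [h0, mul_zero, zero_mul, norm_zero] at h1
    exact absurd h1 (not_lt.2 (norm_nonneg _))
  have hK01 : 1 ≤ K0 := by omega
  have hstep : ∀ ω ∈ T2, ∀ j, App K0 (xs j ω) (y ω) ∧
      ‖xs (j + 1) ω - xs j ω‖ ≤ ‖ϖ ^ j‖ * (‖ϖ ^ K0‖ * ‖y ω‖) := by
    intro ω hω j
    have hωq := hq0 ω hω
    induction j with
    | zero =>
      refine ⟨App.refl _ _, ?_⟩
      rw [xs_succ, sub_sub_cancel_left, norm_neg, norm_mul, norm_inv, pow_zero, norm_one, one_mul]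
      have h1 := hω.2.le
      rw [mul_inv_le_iff₀ (norm_pos_iff.2 hωq)]
      rw [norm_mul, norm_mul] at h1
      calc _ ≤ _ := h1
        _ = _ := by ring
    | succ j ih =>
      have h1 : App K0 (xs (j + 1) ω) (y ω) := by
        have e1 : xs (j + 1) ω - y ω = (xs (j + 1) ω - xs j ω) + (xs j ω - y ω) := by ring
        change ‖_‖ ≤ _
        rw [e1]
        refine (na_add _ _).trans (max_le (ih.2.trans ?_) ih.1)
        exact mul_le_of_le_one_left (by positivity) (norm_ppow_le_one _)
      refine ⟨h1, ?_⟩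
      have h2 := hlin ω hω.1.1 hω.1.2 _ _ ih.1 h1
      have e2 : xs (j + 1 + 1) ω - xs (j + 1) ω =
          -((ev F ω (xs (j + 1) ω) - ev F ω (xs j ω) - q ω * (xs (j + 1) ω - xs j ω)) * (q ω)⁻¹) := by
        rw [xs_succ (j + 1)]
        have e3 : ev F ω (xs j ω) = q ω * (xs j ω - xs (j + 1) ω) := by
          rw [xs_succ j]; field_simp; ring
        rw [e3]; field_simp; ring
      rw [e2, norm_neg, norm_mul, norm_inv, mul_inv_le_iff₀ (norm_pos_iff.2 hωq)]
      refine le_trans (show _ ≤ _ from h2) ?_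
      rw [norm_mul]
      calc ‖ϖ ^ k‖ * (‖q ω‖ * ‖xs (j + 1) ω - xs j ω‖)
          ≤ ‖ϖ ^ 1‖ * (‖q ω‖ * (‖ϖ ^ j‖ * (‖ϖ ^ K0‖ * ‖y ω‖))) := by
            gcongr ?_ * (_ * ?_)
            · exact norm_ppow_anti hk
            · exact ih.2
        _ = _ := by rw [pow_succ ϖ j, norm_mul (ϖ ^ j), pow_one]; ring
  have hdiff : ∀ ω ∈ T2, ∀ j i, ‖xs (j + i) ω - xs j ω‖ ≤ ‖ϖ ^ j‖ * (‖ϖ ^ K0‖ * ‖y ω‖) := by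
    intro ω hω j i
    induction i with
    | zero => simp only [add_zero, sub_self, norm_zero]; positivity
    | succ i ih =>
      have e1 : xs (j + (i + 1)) ω - xs j ω = (xs (j + i + 1) ω - xs (j + i) ω) + (xs (j + i) ω - xs j ω) := by
        rw [← add_assoc]; ring
      rw [e1]
      refine (na_add _ _).trans (max_le (((hstep ω hω (j + i)).2).trans ?_) ih)
      gcongr ?_ * _
      exact norm_ppow_anti (Nat.le_add_right _ _)
  have hlim : ∀ ω ∈ T2, ∃ l, Filter.Tendsto (fun j => xs j ω) Filter.atTop (nhds l) := by
    intro ω hω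
    refine cauchySeq_tendsto_of_complete (cauchySeq_of_le_geometric ‖ϖ‖ (‖ϖ ^ K0‖ * ‖y ω‖)
      norm_p_lt_one fun j => ?_)
    rw [dist_eq_norm, norm_sub_rev, mul_comm, ← norm_pow]
    exact (hstep ω hω j).2
  choose! η0 hη0 using hlim
  let η : Ω → ℚ_[p] := fun ω => if ω ∈ T2 then η0 ω else 0
  have hη : ∀ ω ∈ T2, Filter.Tendsto (fun j => xs j ω) Filter.atTop (nhds (η ω)) := fun ω hω => by
    simp only [η, if_pos hω]; exact hη0 ω hω
  have happ0 : ∀ ω ∈ T2, ∀ j, ‖η ω - xs j ω‖ ≤ ‖ϖ ^ j‖ * (‖ϖ ^ K0‖ * ‖y ω‖) := by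
    intro ω hω j
    refine le_of_tendsto (((hη ω hω).sub_const _).norm) ?_
    filter_upwards [Filter.eventually_ge_atTop j] with i hi
    obtain ⟨i, rfl⟩ := Nat.exists_eq_add_of_le hi
    exact hdiff ω hω j i
  have hηy : ∀ ω ∈ T2, App K0 (η ω) (y ω) := by
    intro ω hω
    have := happ0 ω hω 0
    rw [pow_zero, norm_one, one_mul] at this
    exact this
  have hηn : ∀ ω ∈ T2, ‖η ω‖ = ‖y ω‖ := fun ω hω => (hηy ω hω).norm_eq hK01
  have happ : ∀ ω ∈ T2, ∀ j, App j (xs j ω) (η ω) := by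
    intro ω hω j
    change ‖_‖ ≤ _
    rw [norm_sub_rev, hηn ω hω]
    refine (happ0 ω hω j).trans ?_
    gcongr
    exact mul_le_of_le_one_left (norm_nonneg _) (norm_ppow_le_one _)
  have hroot : ∀ ω ∈ T2, ev F ω (η ω) = 0 := by
    intro ω hω
    have h1 : Filter.Tendsto (fun j => ev F ω (xs j ω)) Filter.atTop (nhds (ev F ω (η ω))) :=
      ((ev_continuous F ω).tendsto _).comp (hη ω hω)
    have h2 : Filter.Tendsto (fun j => q ω * (xs j ω - xs (j + 1) ω)) Filter.atTop (nhds (q ω * (η ω - η ω))) :=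
      ((hη ω hω).sub ((Filter.tendsto_add_atTop_iff_nat 1).2 (hη ω hω))).const_mul _
    rw [sub_self, mul_zero] at h2
    refine tendsto_nhds_unique h1 (h2.congr fun j => ?_)
    rw [xs_succ]
    have := hq0 ω hω
    field_simp; ring
  have hder' : ∀ ω ∈ T2, ∀ x, App K0 x (y ω) → ‖ev (derivative F) ω x‖ = ‖q ω‖ := fun ω hω x hx =>
    (hder ω hω.1.1 hω.1.2 x hx).norm_eq (by omega)
  have H : RootData A T2 η F := by
    refine ⟨hT2, ?_, hroot, ?_, ⟨1, le_rfl, y, hy, fun ω hω => by rw [pow_one]; exact hηn ω hω⟩, ?_⟩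
    · intro ω hω h0
      have := hηn ω hω
      rw [h0, norm_zero] at this
      exact hy0 ω hω.1.1 (norm_eq_zero.1 this.symm)
    · intro c n hn
      obtain ⟨j, hj1, hj⟩ := exists_app_Pset (p := p) n hn
      refine BoolGen.congr (BoolGen.and hT2 (DefS.cpow (hxsA j) c hn)) fun ω => ?_
      simp only [Set.mem_ofPred_eq]
      exact and_congr_right fun hω => hj _ _ ((happ ω hω j).mul_left c)
    · intro k2
      obtain ⟨κ', hκ'⟩ := lipschitz_ball (p := p) d
      set k3 := k2 + 1
      have hnear : ∀ ω ∈ T2, ∀ g, App (K0 + κ' + k3) g (η ω) →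
          App k3 (ev (derivative F) ω g) (ev (derivative F) ω (η ω)) := by
        intro ω hω g hg
        have hy0' := hy0 ω hω.1.1
        have hτ0 : ϖ ^ K0 * y ω ≠ 0 := mul_ne_zero (pow_ne_zero _ p_ne_zero') hy0'
        have hpk : ϖ ^ κ' ≠ 0 := pow_ne_zero _ p_ne_zero'
        set z := (g - η ω) / (ϖ ^ κ' * (ϖ ^ K0 * y ω)) with hz
        have hzn : ‖z‖ ≤ ‖ϖ ^ k3‖ := by
          rw [hz, norm_div, div_le_iff₀ (norm_pos_iff.2 (mul_ne_zero hpk hτ0))]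
          refine le_trans (show _ ≤ _ from hg) ?_
          rw [hηn ω hω, pow_add, pow_add]
          simp only [norm_mul]
          exact le_of_eq (by ring)
        have e1 : g = η ω + (ϖ ^ κ' * z) * (ϖ ^ K0 * y ω) := by
          have := div_mul_cancel₀ (g - η ω) (mul_ne_zero hpk hτ0)
          rw [← hz] at this
          linear_combination -this
        have h1 := hκ' ((derivative F).map (evHom A ω)) ((natDegree_map_le).trans
          ((natDegree_derivative_le _).trans (by omega))) (η ω) (ϖ ^ K0 * y ω) ‖q ω‖
          (norm_nonneg _) (fun x hx => by
            rw [← ev_eq_map]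
            refine (hder' ω hω x ?_).le
            have e2 : x - y ω = (x - η ω) + (η ω - y ω) := by ring
            change ‖_‖ ≤ _
            rw [e2]
            rw [norm_mul] at hx
            exact (na_add _ _).trans (max_le hx (hηy ω hω))) z (hzn.trans (norm_ppow_le_one _))
        rw [← ev_eq_map, ← ev_eq_map, ← e1] at h1
        change ‖_‖ ≤ _
        rw [hder' ω hω _ (hηy ω hω), mul_comm]
        exact h1.trans (mul_le_mul_of_nonneg_left hzn (norm_nonneg _))
      refine ⟨K0 + κ' + k3, fun ω => ev (derivative F) ω (xs (K0 + κ' + k3) ω), 0,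
        ev_mem le_rfl _ (hxsA (K0 + κ' + k3)), fun ω hω => ⟨?_, fun g hg => ?_⟩⟩
      · have h1 := hder' ω hω _ (hstep ω hω (K0 + κ' + k3)).1
        rw [← norm_ne_zero_iff, h1, norm_ne_zero_iff]
        exact hq0 ω hω
      · rw [pow_zero, mul_one]
        have h1 := (hnear ω hω g hg).trans ((hnear ω hω _ (happ ω hω (K0 + κ' + k3))).symm (by omega))
        exact h1.mono (Nat.le_succ _)
  have hηA : η ∈ A := hA (H.mem_cl hprep hF fun ω hω => by simp only [η, if_neg hω])
  have P2 : PrepOn F k {z | z.1 ∈ T2 ∧ App (K0 + k) z.2 (y z.1)} := by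
    refine PrepOn.piece (γ := η) (e := 1) (hball T2 hT2 K0) hηA hqA ?_ ?_
    · rintro ω x ⟨hω, hx⟩
      simp only at hω hx
      have h1 : App K0 (x + η ω) (y ω) := by
        have e2 : x + η ω - y ω = x + (η ω - y ω) := by ring
        change ‖_‖ ≤ _
        rw [e2]
        rw [norm_mul] at hx
        exact (na_add _ _).trans (max_le hx (hηy ω hω))
      have h2 := hlin ω hω.1.1 hω.1.2 _ _ (hηy ω hω) h1
      rw [hroot ω hω, sub_zero, add_sub_cancel_right] at h2
      rwa [pow_one]
    · rintro ω t ⟨hω, ht⟩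
      refine ⟨hω, ?_⟩
      simp only at ht ⊢
      have e2 : t - η ω = (t - y ω) - (η ω - y ω) := by ring
      rw [e2, norm_mul]
      exact (na_sub _ _).trans (max_le (ht.mono (Nat.le_add_right _ _)) (hηy ω hω))
  refine PrepOn.cover (κ := Bool) (D' := fun b => if b then
      {z | z.1 ∈ T1 ∧ App (K0 + k) z.2 (y z.1)} else {z | z.1 ∈ T2 ∧ App (K0 + k) z.2 (y z.1)})
      (fun b => ?_) ?_
  · cases b
    · exact P2
    · exact P1
  · rintro ⟨ω, x⟩ ⟨hx, hω, happ⟩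
    simp only at hω happ
    have h1 : (ω, y ω) ∈ C := (htame ω _ _ (happ.mono (Nat.le_add_right _ _))).1 hx
    by_cases h2 : ‖ϖ ^ K0 * q ω * y ω‖ ≤ ‖ev F ω (y ω)‖
    · exact ⟨true, ⟨⟨hω, h1⟩, h2⟩, happ⟩
    · exact ⟨false, ⟨⟨hω, h1⟩, not_le.1 h2⟩, happ⟩

theorem prep_power {A : FAlg p Ω} (hA : cl A ≤ A) {d : ℕ} (hprep : Prep p d) {k κ : ℕ} (hk : 1 ≤ k)
    (hκ : Interp p d k κ)
    {F : Polynomial A} (hF : F.natDegree ≤ d + 1) {C : Set (Ω × ℚ_[p])} (hC : LSet A C)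
    {h : Ω → ℚ_[p]} (hh : h ∈ A) {e : ℕ}
    (hFC : ∀ ω x, (ω, x) ∈ C → App (k + κ) (ev (derivative F) ω x) (h ω * x ^ e))
    {b : Ω → ℚ_[p]} (hb : b ∈ A) {r : ℕ} (hr : 1 ≤ r) (hrd : r ≤ d + 1) :
    PrepOn F k {z | z ∈ C ∧ z.2 ≠ 0 ∧ ‖z.2 ^ r‖ = ‖b z.1‖} := by
  obtain ⟨K1, hK1, htame⟩ := hC.tame
  set K0 := max K1 (k + κ)
  obtain ⟨K2, hK2, hfine⟩ := exists_fine (p := p) r hr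
  obtain ⟨N, hN, hNapp⟩ := exists_Pset_app (p := p) (max (K0 + k) K2)
  obtain ⟨L, hL, hL0, hrep⟩ := exists_reps (p := p) N hN
  obtain ⟨Q, hQ, hQE, hQrep⟩ := exists_reps_in (p := p) {u | ‖u‖ = 1}
    (fun x hx h0 => by rw [h0] at hx; simp at hx) (r * N) (by positivity)
  have hfine' : ∀ ζ : ℚ_[p], ζ ^ r = 1 → ζ ∈ Pset p N → ζ = 1 := by
    intro ζ h1 h2
    refine hfine ζ h1 ((hNapp ζ 1 ?_ (by simpa using h2)).mono (le_max_right _ _))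
    have := congrArg norm h1
    rw [norm_pow, norm_one] at this
    rw [norm_one]
    exact (pow_eq_one_iff_of_nonneg (norm_nonneg _) (by omega)).1 this
  have hLf : Finite L := hL
  have hQf : Finite Q := hQ
  refine PrepOn.cover (κ := L × Q) (D' := fun lc => {z | (z ∈ C ∧ z.2 ≠ 0 ∧ ‖z.2 ^ r‖ = ‖b z.1‖) ∧
    lc.1.1 * z.2 ∈ Pset p N ∧ lc.1.1 ^ r * (b z.1 * lc.2.1⁻¹) ∈ Pset p (r * N)}) ?_ ?_
  · rintro ⟨⟨l, hl⟩, ⟨c, hc⟩⟩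
    have hl0 := hL0 l hl
    have hc1 : ‖c‖ = 1 := hQE hc
    have hbc : (fun ω => b ω * c⁻¹) ∈ A := A.mul_mem hb (const_mem A _)
    obtain ⟨y, hy, hyS⟩ := exists_root_fn hA hprep hr hrd hbc hN hfine' hl0
    have hS : DefS A {ω | l ^ r * (b ω * c⁻¹) ∈ Pset p (r * N)} := DefS.cpow hbc _ (by positivity)
    refine (prep_ball hA hprep hk hκ hF hC hh hFC (K0 := K0) (le_max_right _ _)
      (fun ω x x' hx => htame ω x x' (hx.mono (le_max_left _ _))) hS hy ?_).subset ?_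
    · intro ω hω h0
      have := ne_zero_of_mem_Pset (hyS ω hω).2
      rw [h0, mul_zero] at this
      exact this rfl
    · rintro ⟨ω, x⟩ ⟨⟨hx, hx0, hxb⟩, hlx, hω⟩
      simp only at hx0 hxb hlx hω
      refine ⟨hx, hω, ?_⟩
      obtain ⟨h1, h2⟩ := hyS ω hω
      refine (hNapp _ _ ?_ ?_).mono (le_max_left _ _)
      · have h3 : ‖x‖ ^ r = ‖y ω‖ ^ r := by
          rw [← norm_pow, hxb, ← norm_pow, h1, norm_mul, norm_inv, hc1]; simp
        exact (pow_left_inj₀ (norm_nonneg _) (norm_nonneg _) (by omega)).1 h3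
      · have := mul_mem_Pset hlx (inv_mem_Pset h2)
        rwa [mul_inv, mul_mul_mul_comm, mul_inv_cancel₀ hl0, one_mul] at this
  · rintro ⟨ω, x⟩ ⟨hx, hx0, hxb⟩
    simp only at hx0 hxb
    obtain ⟨l, hl, hlx⟩ := hrep x hx0
    obtain ⟨c, hc, hcx⟩ := hQrep (b ω * (x ^ r)⁻¹) (by
      change ‖_‖ = 1
      rw [norm_mul, norm_inv, hxb]
      exact mul_inv_cancel₀ (by rw [← hxb]; exact norm_ne_zero_iff.2 (pow_ne_zero _ hx0)))
    refine ⟨⟨⟨l, hl⟩, ⟨c, hc⟩⟩, ⟨hx, hx0, hxb⟩, hlx, ?_⟩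
    obtain ⟨z, hz, hzx⟩ := hlx
    have h1 : (l * x) ^ r ∈ Pset p (r * N) := ⟨z, hz, by rw [← hzx, ← pow_mul, mul_comm]⟩
    have h2 := mul_mem_Pset h1 hcx
    have e1 : (l * x) ^ r * (b ω * (x ^ r)⁻¹ * c⁻¹) = l ^ r * (b ω * c⁻¹) := by
      rw [mul_pow]; field_simp
    rwa [e1] at h2

theorem prep_succ {d : ℕ} (hprep : Prep p d) : Prep p (d + 1) := by
  intro Ω A hA f hf k0
  obtain ⟨κ, hκ⟩ := interp (p := p) d
  refine PrepOn.mono_k (le_max_left k0 1) ?_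
  set k := max k0 1
  have hk : 1 ≤ k := le_max_right _ _
  obtain ⟨ι, hι, C, γ, h, e, HC, hcov⟩ := hprep Ω A hA (derivative f)
    ((natDegree_derivative_le _).trans (by omega)) (k + κ)
  refine PrepOn.cover (κ := ι) (D' := fun i => {z | (z.1, z.2 - γ i z.1) ∈ C i}) (fun i => ?_)
    fun z _ => hcov z.1 z.2 (Set.mem_univ _)
  obtain ⟨hC, hγ, hh, happ⟩ := HC i
  refine PrepOn.shift ⟨γ i, hγ⟩ ?_
  set F := f.comp (X + Polynomial.C (⟨γ i, hγ⟩ : A)) with hFdef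
  have hF : F.natDegree ≤ d + 1 := by
    refine natDegree_comp_le.trans ?_
    calc _ ≤ (d + 1) * 1 := Nat.mul_le_mul hf ((natDegree_add_le _ _).trans (by
        rw [natDegree_C]; exact max_le natDegree_X_le (Nat.zero_le _)))
      _ = _ := mul_one _
  have hFC : ∀ ω x, (ω, x) ∈ C i → App (k + κ) (ev (derivative F) ω x) (h i ω * x ^ e i) := by
    intro ω x hx
    have := happ ω x hx
    rw [hFdef, derivative_comp, ev_mul, ev_comp, ev_add, ev_X, ev_C, derivative_add, derivative_X,
      derivative_C, add_zero]
    have e1 : ev (1 : Polynomial A) ω x = 1 := by simp [ev]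
    rwa [e1, one_mul]
  have hev : ∀ ω x, ev F ω x = ∑ j : Fin (d + 2), (F.coeff j).1 ω * x ^ j.1 := by
    intro ω x
    rw [ev, eval₂_eq_sum_range' _ (show F.natDegree < d + 2 by omega), ← Fin.sum_univ_eq_sum_range
      (fun j => evHom A ω (F.coeff j) * x ^ j)]
    rfl
  -- the pieces
  let bb : Fin (d + 2) → Fin (d + 2) → Set.Icc (-(k : ℤ)) k → Ω → ℚ_[p] := fun i j s ω =>
    ϖ ^ s.1 * (F.coeff j).1 ω * ((F.coeff i).1 ω)⁻¹
  have hbb : ∀ i j s, bb i j s ∈ A := fun i j s =>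
    A.mul_mem (A.mul_mem (const_mem A _) (F.coeff j).2) (inv_mem_of_closed hA (F.coeff i).2)
  let D' : (Unit ⊕ Fin (d + 2)) ⊕ (Fin (d + 2) × Fin (d + 2) × Set.Icc (-(k : ℤ)) k) → Set (Ω × ℚ_[p]) :=
    Sum.elim (Sum.elim (fun _ => {z | z.2 = 0}) (fun m => {z | ∀ j : Fin (d + 2), j ≠ m →
      ‖(F.coeff j).1 z.1 * z.2 ^ j.1‖ ≤ ‖ϖ ^ k * (F.coeff m).1 z.1 * z.2 ^ m.1‖}))
      (fun q => {z | q.2.1 < q.1 ∧ z ∈ C i ∧ z.2 ≠ 0 ∧ ‖z.2 ^ (q.1.1 - q.2.1.1)‖ = ‖bb q.1 q.2.1 q.2.2 z.1‖})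
  refine PrepOn.cover (D' := D') ?_ ?_
  · rintro ((_ | m) | ⟨i', j, s⟩)
    · refine PrepOn.piece0 (h := (F.coeff 0).1) (e := 0) LSet.snd_eq_zero (F.coeff 0).2 ?_
      rintro ω x (rfl : x = 0)
      have : ev F ω 0 = (F.coeff 0).1 ω := by
        rw [ev, eval₂_at_zero]; rfl
      rw [this, pow_zero, mul_one]
      exact App.refl _ _
    · refine PrepOn.piece0 (h := (F.coeff m).1) (e := m.1) ?_ (F.coeff m).2 ?_
      · exact BoolGen.all_finite fun j => BoolGen.imp (BoolGen.const _)
          (LSet.norm_le (F.coeff j).2 (A.mul_mem (const_mem A _) (F.coeff m).2) _ _)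
      · intro ω x hx
        rw [hev, ← Finset.add_sum_erase _ _ (Finset.mem_univ m)]
        refine App.of_small ?_
        refine norm_sum_le_of _ _ (by positivity) fun j hj => ?_
        rw [← norm_mul, ← mul_assoc]
        exact hx j (Finset.ne_of_mem_erase hj)
    · by_cases hij : j < i'
      · have hij' : j.1 < i'.1 := hij
        refine (prep_power hA hprep hk (fun f hf => hκ k f hf) hF hC hh hFC (hbb i' j s)
          (r := i'.1 - j.1) (by omega) (by have := i'.2; omega)).subset ?_
        rintro z ⟨-, hz⟩
        exact hz
      · refine (PrepOn.piece0 (C := ∅) (h := 0) (e := 0) BoolGen.empty A.zero_mem (by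
          intro ω x hx; exact hx.elim)).subset ?_
        rintro z ⟨hz, -⟩
        exact absurd hz hij
  · rintro ⟨ω, x⟩ hx
    by_cases hx0 : x = 0
    · exact ⟨Sum.inl (Sum.inl ()), hx0⟩
    obtain ⟨m, -, hm⟩ := Finset.exists_max_image Finset.univ
      (fun j : Fin (d + 2) => ‖(F.coeff j).1 ω * x ^ j.1‖) ⟨0, Finset.mem_univ _⟩
    by_cases hA' : ∀ j : Fin (d + 2), j ≠ m →
      ‖(F.coeff j).1 ω * x ^ j.1‖ ≤ ‖ϖ ^ k * (F.coeff m).1 ω * x ^ m.1‖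
    · exact ⟨Sum.inl (Sum.inr m), hA'⟩
    push Not at hA'
    obtain ⟨j, hjm, hj⟩ := hA'
    have hjm' := hm j (Finset.mem_univ _)
    set aj := (F.coeff j).1 ω with haj
    set am := (F.coeff m).1 ω with ham
    have hj0 : aj * x ^ j.1 ≠ 0 := norm_pos_iff.1 (lt_of_le_of_lt (norm_nonneg _) hj)
    have hm0 : am * x ^ m.1 ≠ 0 := norm_pos_iff.1 (lt_of_lt_of_le (norm_pos_iff.2 hj0) hjm')
    have haj0 : aj ≠ 0 := left_ne_zero_of_mul hj0
    have ham0 : am ≠ 0 := left_ne_zero_of_mul hm0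
    obtain ⟨s, hs⟩ := exists_valuation_norm (aj * x ^ j.1 * (am * x ^ m.1)⁻¹)
      (mul_ne_zero hj0 (inv_ne_zero hm0))
    have hs' : ‖aj * x ^ j.1‖ = ‖ϖ ^ s * (am * x ^ m.1)‖ := by
      rw [norm_mul (ϖ ^ s), ← hs, ← norm_mul, inv_mul_cancel_right₀ hm0]
    have hmp := norm_pos_iff.2 hm0
    have hs1 : s ≤ k := by
      rw [hs', mul_assoc, norm_mul, norm_mul _ (am * _), mul_lt_mul_iff_left₀ hmp, ← zpow_natCast] at hj
      exact (norm_ppow_zlt.1 hj).le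
    have hs2 : 0 ≤ s := by
      rw [hs', norm_mul] at hjm'
      have h1 : ‖ϖ ^ s‖ ≤ ‖ϖ ^ (0 : ℤ)‖ := by
        rw [zpow_zero, norm_one]
        exact (mul_le_iff_le_one_left hmp).1 hjm'
      exact norm_ppow_zle.1 h1
    have hpp : ∀ s : ℤ, ϖ ^ s ≠ 0 := fun s => zpow_ne_zero _ p_ne_zero'
    rcases lt_or_gt_of_ne hjm with hlt | hlt
    · have hlt' : j.1 < m.1 := hlt
      refine ⟨Sum.inr ⟨m, j, ⟨-s, by constructor <;> omega⟩⟩, hlt, hx, hx0, ?_⟩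
      simp only [bb]
      rw [← haj, ← ham]
      rw [← pow_sub_mul_pow x hlt'.le] at hs'
      have h0 : x ^ j.1 ≠ 0 := pow_ne_zero _ hx0
      simp only [norm_mul, norm_inv, zpow_neg] at hs' ⊢
      have n1 := norm_ne_zero_iff.2 (hpp s)
      have n2 := norm_ne_zero_iff.2 ham0
      have n3 := norm_ne_zero_iff.2 h0
      field_simp
      refine mul_right_cancel₀ n3 ?_
      rw [hs']; ring
    · have hlt' : m.1 < j.1 := hlt
      refine ⟨Sum.inr ⟨j, m, ⟨s, by constructor <;> omega⟩⟩, hlt, hx, hx0, ?_⟩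
      simp only [bb]
      rw [← haj, ← ham]
      rw [← pow_sub_mul_pow x hlt'.le] at hs'
      have h0 : x ^ m.1 ≠ 0 := pow_ne_zero _ hx0
      simp only [norm_mul, norm_inv] at hs' ⊢
      have n2 := norm_ne_zero_iff.2 haj0
      have n3 := norm_ne_zero_iff.2 h0
      field_simp
      refine mul_right_cancel₀ n3 ?_
      linear_combination hs'

theorem prep_all (d : ℕ) : Prep p d := by
  induction d with
  | zero => exact prep_zero
  | succ d ih => exact prep_succ ih

end prepstep

end PadicSub
end

section
/-! ## Spaces: sets with a closed algebra of functions -/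

namespace PadicSub
section
variable {p : ℕ} [Fact p.Prime] {Ω Ω' : Type}

/-- Pull-back of an algebra of functions. -/
def pull (φ : Ω' → Ω) (A : FAlg p Ω) : FAlg p Ω' where
  carrier := {f | ∃ g ∈ A, g ∘ φ = f}
  mul_mem' := by
    rintro _ _ ⟨g, hg, rfl⟩ ⟨h, hh, rfl⟩
    exact ⟨_, A.mul_mem hg hh, rfl⟩
  one_mem' := ⟨_, A.one_mem, rfl⟩
  add_mem' := by
    rintro _ _ ⟨g, hg, rfl⟩ ⟨h, hh, rfl⟩
    exact ⟨_, A.add_mem hg hh, rfl⟩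
  zero_mem' := ⟨_, A.zero_mem, rfl⟩
  algebraMap_mem' c := ⟨_, A.algebraMap_mem c, rfl⟩

theorem mem_pull {φ : Ω' → Ω} {A : FAlg p Ω} {g : Ω → ℚ_[p]} (hg : g ∈ A) : g ∘ φ ∈ pull φ A :=
  ⟨g, hg, rfl⟩

theorem DefS.exists_pull {φ : Ω' → Ω} {A : FAlg p Ω} {S : Set Ω'} (hS : DefS (pull φ A) S) :
    ∃ T, DefS A T ∧ S = φ ⁻¹' T := by
  induction hS with
  | base S h =>
    obtain ⟨_, ⟨g, hg, rfl⟩, n, hn, rfl⟩ := h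
    exact ⟨_, DefS.pow hg hn, rfl⟩
  | univ => exact ⟨_, BoolGen.univ, rfl⟩
  | compl S h ih => obtain ⟨T, hT, rfl⟩ := ih; exact ⟨_, BoolGen.compl _ hT, rfl⟩
  | inter S T hS hT ih1 ih2 =>
    obtain ⟨T1, hT1, rfl⟩ := ih1
    obtain ⟨T2, hT2, rfl⟩ := ih2
    exact ⟨_, BoolGen.inter _ _ hT1 hT2, rfl⟩

theorem cl_glue {A : FAlg p Ω} {ι : Type*} [Finite ι] {S : ι → Set Ω} (hS : ∀ i, DefS A (S i))
    (hcov : ∀ ω, ∃ i, ω ∈ S i) {g : Ω → ℚ_[p]}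
    (h : ∀ i, (fun s : S i => g s) ∈ cl (pull (Subtype.val : S i → Ω) A)) : g ∈ cl A := by
  refine mem_cl_of_ev fun Ω' φ B hBc hB F n hn => ?_
  have key : ∀ i, ∃ T, DefS B T ∧ ∀ ω, φ ω ∈ S i → (ev F ω (g (φ ω)) ∈ Pset p n ↔ ω ∈ T) := by
    intro i
    let φi : {ω // φ ω ∈ S i} → S i := fun s => ⟨φ s.1, s.2⟩
    have h1 : (fun s : S i => g s) ∘ φi ∈ cl (pull (Subtype.val : {ω // φ ω ∈ S i} → Ω') B) := by
      refine cl_comp ?_ (h i)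
      rintro _ ⟨f, hf, rfl⟩
      exact le_cl _ ⟨f ∘ φ, hB f hf, rfl⟩
    have h2 : DefS (pull (Subtype.val : {ω // φ ω ∈ S i} → Ω') B)
        {s : {ω // φ ω ∈ S i} | ev F s.1 (g (φ s.1)) ∈ Pset p n} := by
      refine DefS.of_cl (DefS.pow (f := fun s : {ω // φ ω ∈ S i} => ev F s.1 (g (φ s.1))) ?_ hn)
      clear h
      induction F using Polynomial.induction_on' with
      | add F G hF hG => simp only [ev_add]; exact Subalgebra.add_mem _ hF hG
      | monomial n a =>
        have : (fun s : {ω // φ ω ∈ S i} => ev (Polynomial.monomial n a) s.1 (g (φ s.1))) =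
            (a.1 ∘ Subtype.val) * ((fun s : S i => g s) ∘ φi) ^ n := by
          funext ω; simp [ev, φi]
        rw [this]
        exact Subalgebra.mul_mem _ (le_cl _ (mem_pull a.2)) (Subalgebra.pow_mem _ h1 n)
    obtain ⟨T, hT, he⟩ := h2.exists_pull
    refine ⟨T, hT, fun ω hω => ?_⟩
    have := Set.ext_iff.1 he ⟨ω, hω⟩
    simpa using this
  choose T hT he using key
  have : DefS B {ω | ∃ i, φ ω ∈ S i ∧ ω ∈ T i} :=
    BoolGen.ex_finite fun i => BoolGen.and (DefS.comp hB (hS i)) (hT i)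
  refine this.congr fun ω => ?_
  constructor
  · rintro ⟨i, h1, h2⟩
    exact (he i ω h1).2 h2
  · intro h1
    obtain ⟨i, hi⟩ := hcov (φ ω)
    exact ⟨i, hi, (he i ω hi).1 h1⟩

/-- A set with a closed algebra of functions on it. -/
structure Sp (p : ℕ) [Fact p.Prime] where
  /-- the underlying set -/
  T : Type
  /-- the algebra of functions -/
  A : FAlg p T
  closed : cl A ≤ A

/-- Morphisms of spaces. -/
def Mor (X Y : Sp p) (φ : X.T → Y.T) : Prop := ∀ f ∈ Y.A, f ∘ φ ∈ X.A

theorem Mor.id (X : Sp p) : Mor X X id := fun _ hf => hf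

theorem Mor.comp {X Y Z : Sp p} {φ : X.T → Y.T} {ψ : Y.T → Z.T} (hψ : Mor Y Z ψ) (hφ : Mor X Y φ) :
    Mor X Z (ψ ∘ φ) := fun f hf => hφ _ (hψ f hf)

theorem Mor.def {X Y : Sp p} {φ : X.T → Y.T} (hφ : Mor X Y φ) {S : Set Y.T} (hS : DefS Y.A S) :
    DefS X.A (φ ⁻¹' S) := DefS.comp hφ hS

/-- Isomorphic spaces. -/
def Iso (X Y : Sp p) : Prop := ∃ e : X.T ≃ Y.T, Mor X Y e ∧ Mor Y X e.symm

theorem Iso.refl (X : Sp p) : Iso X X := ⟨Equiv.refl _, Mor.id X, Mor.id X⟩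

theorem Iso.symm {X Y : Sp p} : Iso X Y → Iso Y X
  | ⟨e, h1, h2⟩ => ⟨e.symm, h2, h1⟩

theorem Iso.trans {X Y Z : Sp p} : Iso X Y → Iso Y Z → Iso X Z
  | ⟨e, h1, h2⟩, ⟨e', h1', h2'⟩ => ⟨e.trans e', h1'.comp h1, h2.comp h2'⟩

theorem Iso.of_inv {X Y : Sp p} {φ : X.T → Y.T} {ψ : Y.T → X.T} (hφ : Mor X Y φ) (hψ : Mor Y X ψ)
    (h1 : ∀ x, ψ (φ x) = x) (h2 : ∀ y, φ (ψ y) = y) : Iso X Y :=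
  ⟨⟨φ, ψ, h1, h2⟩, hφ, hψ⟩

/-- The space generated by an algebra. -/
def Sp.mk' (A : FAlg p Ω) : Sp p := ⟨Ω, cl A, cl_idem A⟩

theorem mor_mk' {X : Sp p} {A : FAlg p Ω} {φ : X.T → Ω} (h : ∀ f ∈ A, f ∘ φ ∈ X.A) :
    Mor X (Sp.mk' A) φ := fun _ hf => X.closed (cl_comp (fun g hg => le_cl _ (h g hg)) hf)

/-- Subspaces. -/
def Sp.sub (X : Sp p) (S : Set X.T) : Sp p := Sp.mk' (pull (Subtype.val : S → X.T) X.A)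

theorem mor_val (X : Sp p) (S : Set X.T) : Mor (X.sub S) X (Subtype.val : S → X.T) := fun _ hf =>
  le_cl _ (mem_pull hf)

theorem mor_sub {X Y : Sp p} {S : Set Y.T} {φ : X.T → S} (h : Mor X Y (fun x => (φ x).1)) :
    Mor X (Y.sub S) φ := by
  refine mor_mk' ?_
  rintro _ ⟨f, hf, rfl⟩
  exact h f hf

theorem mor_glue {X Y : Sp p} {ι : Type*} [Finite ι] {S : ι → Set X.T} (hS : ∀ i, DefS X.A (S i))
    (hcov : ∀ ω, ∃ i, ω ∈ S i) {φ : X.T → Y.T}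
    (h : ∀ i, Mor (X.sub (S i)) Y (fun s : S i => φ s)) : Mor X Y φ := fun f hf =>
  X.closed (cl_glue hS hcov fun i => h i f hf)

theorem def_sub {X : Sp p} {S : Set X.T} {T : Set S} (h : DefS (X.sub S).A T) :
    ∃ T', DefS X.A T' ∧ T = Subtype.val ⁻¹' T' := (DefS.of_cl h).exists_pull

theorem Iso.of_maps {X Y : Sp p} {S : Set X.T} {S' : Set Y.T} {φ : X.T → Y.T} {ψ : Y.T → X.T}
    (hφ : Mor X Y φ) (hψ : Mor Y X ψ) (h1 : ∀ x ∈ S, φ x ∈ S' ∧ ψ (φ x) = x)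
    (h2 : ∀ y ∈ S', ψ y ∈ S ∧ φ (ψ y) = y) : Iso (X.sub S) (Y.sub S') :=
  Iso.of_inv (X := X.sub S) (Y := Y.sub S') (φ := fun x : S => (⟨φ x, (h1 x x.2).1⟩ : S'))
    (ψ := fun x : S' => (⟨ψ x, (h2 x x.2).1⟩ : S)) (mor_sub (hφ.comp (mor_val _ _)))
    (mor_sub (hψ.comp (mor_val _ _)))
    (fun x : S => Subtype.ext (h1 x.1 x.2).2) (fun x : S' => Subtype.ext (h2 x.1 x.2).2)

/-- Disjoint sums. -/
def Sp.sum (X Y : Sp p) : Sp p where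
  T := X.T ⊕ Y.T
  A :=
  { carrier := {f | f ∘ Sum.inl ∈ X.A ∧ f ∘ Sum.inr ∈ Y.A}
    mul_mem' := fun h h' => ⟨X.A.mul_mem h.1 h'.1, Y.A.mul_mem h.2 h'.2⟩
    one_mem' := ⟨X.A.one_mem, Y.A.one_mem⟩
    add_mem' := fun h h' => ⟨X.A.add_mem h.1 h'.1, Y.A.add_mem h.2 h'.2⟩
    zero_mem' := ⟨X.A.zero_mem, Y.A.zero_mem⟩
    algebraMap_mem' := fun c => ⟨X.A.algebraMap_mem c, Y.A.algebraMap_mem c⟩ }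
  closed := by
    intro f hf
    refine ⟨X.closed (cl_comp (fun g hg => le_cl _ ?_) hf),
      Y.closed (cl_comp (fun g hg => le_cl _ ?_) hf)⟩
    · exact hg.1
    · exact hg.2

theorem mor_inl (X Y : Sp p) : Mor X (X.sum Y) Sum.inl := fun _ hf => hf.1
theorem mor_inr (X Y : Sp p) : Mor Y (X.sum Y) Sum.inr := fun _ hf => hf.2
theorem mor_sum {X Y Z : Sp p} {φ : (X.sum Y).T → Z.T} (h1 : Mor X Z (fun x => φ (Sum.inl x)))
    (h2 : Mor Y Z (fun x => φ (Sum.inr x))) : Mor (X.sum Y) Z φ := fun f hf => ⟨h1 f hf, h2 f hf⟩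

theorem mor_sum_map {X Y X' Y' : Sp p} {φ : X.T → X'.T} {ψ : Y.T → Y'.T} (h1 : Mor X X' φ)
    (h2 : Mor Y Y' ψ) : Mor (X.sum Y) (X'.sum Y') (Sum.map φ ψ) :=
  fun f hf => ⟨h1 _ (mor_inl X' Y' f hf), h2 _ (mor_inr X' Y' f hf)⟩

theorem Iso.sum {X Y X' Y' : Sp p} : Iso X X' → Iso Y Y' → Iso (X.sum Y) (X'.sum Y')
  | ⟨e, h1, h2⟩, ⟨e', h1', h2'⟩ =>
    ⟨Equiv.sumCongr e e', mor_sum_map h1 h1', mor_sum_map h2 h2'⟩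

/-- The empty space. -/
noncomputable def Sp.emp : Sp p := ⟨Empty, ⊤, le_top⟩

theorem iso_add_comm (X Y : Sp p) : Iso (X.sum Y) (Y.sum X) :=
  ⟨Equiv.sumComm _ _, fun _ hf => ⟨hf.2, hf.1⟩, fun _ hf => ⟨hf.2, hf.1⟩⟩

theorem iso_add_assoc (X Y Z : Sp p) : Iso ((X.sum Y).sum Z) (X.sum (Y.sum Z)) :=
  ⟨Equiv.sumAssoc _ _ _, fun _ hf => ⟨⟨hf.1, hf.2.1⟩, hf.2.2⟩, fun _ hf => ⟨hf.1.1, ⟨hf.1.2, hf.2⟩⟩⟩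

theorem iso_add_zero (X : Sp p) : Iso (X.sum Sp.emp) X :=
  ⟨Equiv.sumEmpty _ Empty, fun _ hf => ⟨hf, trivial⟩, fun _ hf => hf.1⟩

theorem mor_glue2 {X Y : Sp p} {S S' : Set X.T} (hS : DefS X.A S) (hS' : DefS X.A S')
    (hcov : ∀ x, x ∈ S ∨ x ∈ S') {φ : X.T → Y.T} {φ1 : S → Y.T} {φ2 : S' → Y.T}
    (h1 : Mor (X.sub S) Y φ1) (h2 : Mor (X.sub S') Y φ2) (e1 : ∀ s : S, φ s.1 = φ1 s)
    (e2 : ∀ s : S', φ s.1 = φ2 s) : Mor X Y φ := by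
  refine mor_glue (ι := Bool) (S := fun b => if b then S else S') ?_ ?_ ?_
  · rintro (_ | _)
    · exact hS'
    · exact hS
  · intro x
    rcases hcov x with h | h
    · exact ⟨true, h⟩
    · exact ⟨false, h⟩
  · rintro (_ | _)
    · have : (fun s : S' => φ s.1) = φ2 := funext e2
      rw [← this] at h2
      exact h2
    · have : (fun s : S => φ s.1) = φ1 := funext e1
      rw [← this] at h1
      exact h1

theorem mor_subsub {X : Sp p} {U S : Set X.T} {V : Set U} (h : ∀ s : V, s.1.1 ∈ S) :
    Mor ((X.sub U).sub V) (X.sub S) (fun s : V => (⟨s.1.1, h s⟩ : S)) :=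
  have h0 : Mor ((X.sub U).sub V) X (fun s : V => s.1.1) :=
    Mor.comp (X := (X.sub U).sub V) (Y := X.sub U) (φ := (fun s : V => s.1)) (ψ := (fun s : U => s.1))
      (mor_val X U) (mor_val (X.sub U) V)
  mor_sub (X := (X.sub U).sub V) (Y := X) (S := S) (φ := fun s : V => (⟨s.1.1, h s⟩ : S)) h0

theorem iso_union (X : Sp p) {S S' : Set X.T} (hS : DefS X.A S) (hS' : DefS X.A S')
    (hd : ∀ x ∈ S, x ∉ S') : Iso (X.sub (S ∪ S')) ((X.sub S).sum (X.sub S')) := by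
  classical
  let φ : S ⊕ S' → (S ∪ S' : Set X.T) := fun x => x.elim (fun s : S => ⟨s.1, Or.inl s.2⟩)
      (fun s : S' => ⟨s.1, Or.inr s.2⟩)
  let ψ : (S ∪ S' : Set X.T) → S ⊕ S' := fun x => if h : x.1 ∈ S then (Sum.inl ⟨x.1, h⟩ : S ⊕ S')
      else Sum.inr ⟨x.1, x.2.resolve_left h⟩
  have hφ : Mor ((X.sub S).sum (X.sub S')) (X.sub (S ∪ S')) φ :=
    mor_sub (X := (X.sub S).sum (X.sub S')) (mor_sum (mor_val X S) (mor_val X S'))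
  have hψ : Mor (X.sub (S ∪ S')) ((X.sub S).sum (X.sub S')) ψ := by
    refine mor_glue2 (X := X.sub (S ∪ S')) (S := {x : (S ∪ S' : Set X.T) | x.1 ∈ S})
      (S' := {x : (S ∪ S' : Set X.T) | x.1 ∈ S'}) ((mor_val X (S ∪ S')).def hS)
      ((mor_val X (S ∪ S')).def hS') (fun x : (S ∪ S' : Set X.T) => x.2)
      ((mor_inl (X.sub S) (X.sub S')).comp (mor_subsub fun s => s.2))
      ((mor_inr (X.sub S) (X.sub S')).comp (mor_subsub fun s => s.2)) ?_ ?_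
    · rintro ⟨x, hx⟩
      exact dif_pos hx
    · rintro ⟨x, hx⟩
      exact dif_neg (fun h => hd _ h hx)
  refine Iso.symm ⟨⟨φ, ψ, ?_, ?_⟩, hφ, hψ⟩
  · rintro (⟨x, hx⟩ | ⟨x, hx⟩)
    · exact dif_pos hx
    · exact dif_neg (fun h => hd _ h hx)
  · rintro ⟨x, hx⟩
    by_cases h : x ∈ S
    · exact congrArg φ (dif_pos h : ψ ⟨x, hx⟩ = _)
    · exact congrArg φ (dif_neg h : ψ ⟨x, hx⟩ = _)

/-! ### The monoid of isomorphism classes -/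

instance spSetoid (p : ℕ) [Fact p.Prime] : Setoid (Sp p) :=
  ⟨Iso, Iso.refl, Iso.symm, Iso.trans⟩

/-- Isomorphism classes of spaces. -/
def Q (p : ℕ) [Fact p.Prime] := Quotient (spSetoid p)

/-- The class of a space. -/
def Sp.q (X : Sp p) : Q p := Quotient.mk _ X

theorem q_eq {X Y : Sp p} : X.q = Y.q ↔ Iso X Y := Quotient.eq

noncomputable instance : Add (Q p) := ⟨Quotient.map₂ Sp.sum (fun _ _ h _ _ h' => Iso.sum h h')⟩
noncomputable instance : Zero (Q p) := ⟨Sp.q Sp.emp⟩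

noncomputable instance : AddCommMonoid (Q p) where
  add_assoc a b c := by
    induction a using Quotient.inductionOn
    induction b using Quotient.inductionOn
    induction c using Quotient.inductionOn
    exact Quotient.sound (iso_add_assoc _ _ _)
  add_comm a b := by
    induction a using Quotient.inductionOn
    induction b using Quotient.inductionOn
    exact Quotient.sound (iso_add_comm _ _)
  add_zero a := by
    induction a using Quotient.inductionOn
    exact Quotient.sound (iso_add_zero _)
  zero_add a := by
    induction a using Quotient.inductionOn
    exact Quotient.sound ((iso_add_comm _ _).trans (iso_add_zero _))
  nsmul := nsmulRec

theorem q_sum (X Y : Sp p) : (X.sum Y).q = X.q + Y.q := rfl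

/-- The class of a subset. -/
def Sp.c (X : Sp p) (S : Set X.T) : Q p := (X.sub S).q

theorem c_union (X : Sp p) {S S' : Set X.T} (hS : DefS X.A S) (hS' : DefS X.A S')
    (hd : ∀ x ∈ S, x ∉ S') : X.c (S ∪ S') = X.c S + X.c S' :=
  q_eq.2 (iso_union X hS hS' hd)

theorem c_split (X : Sp p) {S S1 S2 : Set X.T} (hS1 : DefS X.A S1) (hS2 : DefS X.A S2)
    (hd : ∀ x, x ∈ S1 → x ∈ S2 → False) (h : ∀ x, x ∈ S ↔ x ∈ S1 ∨ x ∈ S2) :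
    X.c S = X.c S1 + X.c S2 := by
  rw [← c_union X hS1 hS2 hd]
  congr 1
  exact Set.ext h

theorem c_empty (X : Sp p) {S : Set X.T} (h : ∀ x, x ∉ S) : X.c S = 0 := by
  refine q_eq.2 ⟨⟨fun x : S => (h x.1 x.2).elim, fun x => x.elim, fun x => (h x.1 x.2).elim,
    fun x => x.elim⟩, ?_, fun _ _ => trivial⟩
  intro f hf
  have : f ∘ (fun x : S => (h x.1 x.2).elim) = fun _ : S => 0 := by
    funext x; exact (h x.1 x.2).elim
  exact (congrArg (· ∈ (X.sub S).A) this).mpr (const_mem _ 0)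

theorem c_univ (X : Sp p) {S : Set X.T} (h : ∀ x, x ∈ S) : X.c S = X.q :=
  q_eq.2 (Iso.of_inv (X := X.sub S) (Y := X) (φ := Subtype.val) (ψ := fun x => (⟨x, h x⟩ : S))
    (mor_val X S) (mor_sub (Mor.id X)) (fun _ => rfl) (fun _ => rfl))

theorem c_fiber (X : Sp p) {ι : Type*} (s : Finset ι) {S : Set X.T} {T : ι → Set X.T}
    (hT : ∀ i ∈ s, DefS X.A (T i)) (hsub : ∀ i ∈ s, ∀ x ∈ T i, x ∈ S)
    (hd : ∀ i ∈ s, ∀ j ∈ s, ∀ x, x ∈ T i → x ∈ T j → i = j)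
    (hcov : ∀ x ∈ S, ∃ i ∈ s, x ∈ T i) : X.c S = ∑ i ∈ s, X.c (T i) := by
  classical
  induction s using Finset.induction_on generalizing S with
  | empty => simpa using c_empty X (fun x hx => by simpa using hcov x hx)
  | insert a s ha ih =>
    rw [Finset.sum_insert ha, ← ih (S := {x | ∃ i ∈ s, x ∈ T i})]
    · refine c_split X (hT a (by simp)) (BoolGen.ex_mem (s := (s : Set ι)) s.finite_toSet
        (fun i hi => hT i (by simp at hi; simp [hi]))) ?_ ?_
      · rintro x hx ⟨i, hi, hxi⟩
        have := hd a (by simp) i (by simp [hi]) x hx hxi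
        exact ha (this ▸ hi)
      · intro x
        constructor
        · intro hx
          obtain ⟨i, hi, hxi⟩ := hcov x hx
          rcases Finset.mem_insert.1 hi with rfl | hi
          · exact Or.inl hxi
          · exact Or.inr ⟨i, hi, hxi⟩
        · rintro (hx | ⟨i, hi, hx⟩)
          · exact hsub a (by simp) x hx
          · exact hsub i (by simp [hi]) x hx
    · exact fun i hi => hT i (by simp [hi])
    · exact fun i hi x hx => ⟨i, hi, hx⟩
    · exact fun i hi j hj => hd i (by simp [hi]) j (by simp [hj])
    · rintro x ⟨i, hi, hx⟩
      exact ⟨i, hi, hx⟩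

/-! ### Products with the line -/

/-- The product of a space with the affine line. -/
noncomputable def Sp.poly (X : Sp p) : Sp p := Sp.mk' (adj (pull (Prod.fst : X.T × ℚ_[p] → X.T) X.A) Prod.snd)

theorem poly_fst {X : Sp p} : Mor X.poly X (Prod.fst : X.T × ℚ_[p] → X.T) := fun _ hf =>
  le_cl _ (le_adj _ _ (mem_pull hf))

theorem poly_snd {X : Sp p} : (Prod.snd : X.T × ℚ_[p] → ℚ_[p]) ∈ X.poly.A :=
  le_cl _ (mem_adj _ _)

theorem poly_fst' {X : Sp p} {f : X.T → ℚ_[p]} (hf : f ∈ X.A) :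
    (fun z : X.T × ℚ_[p] => f z.1) ∈ X.poly.A := poly_fst f hf

theorem mor_poly {X Y : Sp p} {φ : Y.T → X.T × ℚ_[p]} (h1 : Mor Y X (fun y => (φ y).1))
    (h2 : (fun y => (φ y).2) ∈ Y.A) : Mor Y X.poly φ := by
  refine mor_mk' ?_
  intro f hf
  induction hf using Algebra.adjoin_induction with
  | mem x hx =>
    rcases hx with rfl | ⟨g, hg, rfl⟩
    · exact h2
    · exact h1 g hg
  | algebraMap r => exact Y.A.algebraMap_mem r
  | add x y _ _ hx hy => exact Y.A.add_mem hx hy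
  | mul x y _ _ hx hy => exact Y.A.mul_mem hx hy

/-- Change of variables over the base. -/
theorem c_poly_eq {X : Sp p} {S S' : Set (X.T × ℚ_[p])} {g h : X.T × ℚ_[p] → ℚ_[p]}
    (hg : g ∈ X.poly.A) (hh : h ∈ X.poly.A)
    (h1 : ∀ ω x, (ω, x) ∈ S → (ω, g (ω, x)) ∈ S' ∧ h (ω, g (ω, x)) = x)
    (h2 : ∀ ω x, (ω, x) ∈ S' → (ω, h (ω, x)) ∈ S ∧ g (ω, h (ω, x)) = x) :
    X.poly.c S = X.poly.c S' := by
  refine q_eq.2 (Iso.of_maps (X := X.poly) (Y := X.poly) (φ := fun z : X.T × ℚ_[p] => (z.1, g z))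
    (ψ := fun z : X.T × ℚ_[p] => (z.1, h z)) (mor_poly poly_fst hg) (mor_poly poly_fst hh) ?_ ?_)
  · rintro ⟨ω, x⟩ hx
    exact ⟨(h1 ω x hx).1, Prod.ext rfl (h1 ω x hx).2⟩
  · rintro ⟨ω, x⟩ hx
    exact ⟨(h2 ω x hx).1, Prod.ext rfl (h2 ω x hx).2⟩

theorem poly_inv {X : Sp p} {f : X.T → ℚ_[p]} (hf : f ∈ X.A) : (fun x => (f x)⁻¹) ∈ X.A :=
  X.closed (cl_inv (le_cl _ hf))

end
end PadicSub
end

section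
/-! ## Classes of products with subsets of the line -/

namespace PadicSub
section
variable {p : ℕ} [Fact p.Prime]
local notation "ϖ" => (p : ℚ_[p])
open Polynomial

theorem norm_pow_sub_one {q : ℕ} (hq : ¬ p ∣ q) {z : ℚ_[p]} (hz : ‖z - 1‖ < 1) :
    ‖z ^ q - 1‖ = ‖z - 1‖ := by
  have hz1 : ‖z‖ = 1 := by
    have := norm_eq_of_sub_lt (x := z) (y := 1) (by simpa using hz)
    simpa using this
  have hq1 : ‖(q : ℚ_[p])‖ = 1 := by
    refine le_antisymm (norm_nat_le_one q) ?_
    by_contra h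
    push Not at h
    exact hq ((Padic.norm_natCast_lt_one_iff).1 h)
  have key : ∀ i : ℕ, ‖z ^ i - 1‖ < 1 := by
    intro i
    induction i with
    | zero => simp
    | succ i ih =>
      have : z ^ (i + 1) - 1 = z * (z ^ i - 1) + (z - 1) := by ring
      rw [this]
      refine lt_of_le_of_lt (na_add _ _) (max_lt ?_ hz)
      rw [norm_mul, hz1, one_mul]
      exact ih
  have h2 : ‖∑ i ∈ Finset.range q, (z ^ i - 1)‖ < 1 := by
    obtain ⟨M, hM0, hM1, hM⟩ : ∃ M : ℝ, 0 ≤ M ∧ M < 1 ∧ ∀ i ∈ Finset.range q, ‖z ^ i - 1‖ ≤ M := by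
      refine ⟨‖ϖ‖, norm_nonneg _, norm_p_lt_one, fun i _ => ?_⟩
      have := norm_lt_imp_le (x := z ^ i - 1) (y := 1) (by simpa using key i)
      simpa using this
    exact lt_of_le_of_lt (norm_sum_le_of _ _ hM0 hM) hM1
  have h3 : ∑ i ∈ Finset.range q, z ^ i = (q : ℚ_[p]) + ∑ i ∈ Finset.range q, (z ^ i - 1) := by
    simp
  rw [← geom_sum_mul, norm_mul, h3, norm_add_eq_left (by rw [hq1]; exact h2), hq1, one_mul]

theorem exists_root_near {q : ℕ} (hq : ¬ p ∣ q) {k : ℕ} (hk : 1 ≤ k) {u : ℚ_[p]} (hu : App k u 1) :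
    ∃ z : ℚ_[p], App k z 1 ∧ z ^ q = u := by
  have hu1 : ‖u - 1‖ < 1 := by
    refine lt_of_le_of_lt (show _ ≤ _ from hu) ?_
    rw [norm_one, mul_one]
    exact norm_ppow_lt_one hk
  have hun : ‖u‖ = 1 := by
    have := norm_eq_of_sub_lt (x := u) (y := 1) (by simpa using hu1)
    simpa using this
  have hq1 : ‖(q : ℤ_[p])‖ = 1 := by
    refine le_antisymm (PadicInt.norm_le_one _) ?_
    by_contra h
    push Not at h
    rw [PadicInt.norm_def] at h
    exact hq ((Padic.norm_natCast_lt_one_iff).1 (by simpa using h))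
  let u' : ℤ_[p] := ⟨u, hun.le⟩
  let F : Polynomial ℤ_[p] := X ^ q - C u'
  have hd : F.derivative.aeval (1 : ℤ_[p]) = q := by
    simp [F, Polynomial.derivative_X_pow]
  have h1 : ‖F.aeval (1 : ℤ_[p])‖ < ‖F.derivative.aeval (1 : ℤ_[p])‖ ^ 2 := by
    rw [hd, hq1, one_pow]
    have : F.aeval (1 : ℤ_[p]) = 1 - u' := by simp [F]
    rw [this, PadicInt.norm_def]
    simp only [PadicInt.coe_sub, PadicInt.coe_one]
    rw [norm_sub_rev]
    exact hu1
  obtain ⟨z, hz, hz1, -⟩ := hensels_lemma h1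
  rw [hd, hq1] at hz1
  have hzq : (z : ℚ_[p]) ^ q = u := by
    have : z ^ q = u' := by simpa [F, sub_eq_zero] using hz
    have := congrArg (fun x : ℤ_[p] => (x : ℚ_[p])) this
    simpa using this
  have hz1' : ‖(z : ℚ_[p]) - 1‖ < 1 := by
    rw [PadicInt.norm_def] at hz1
    simpa using hz1
  refine ⟨z, ?_, hzq⟩
  change ‖_‖ ≤ _
  rw [← norm_pow_sub_one hq hz1', hzq]
  exact hu

/-- `x` approximates an integral power of `p ^ M`. -/
def HS (p : ℕ) [Fact p.Prime] (M k : ℕ) : Set ℚ_[p] := {x | ∃ i : ℤ, App k x ((p : ℚ_[p]) ^ ((M : ℤ) * i))}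

theorem ppow_ne (i : ℤ) : ϖ ^ i ≠ 0 := zpow_ne_zero _ p_ne_zero'

theorem HS.ne_zero {M k : ℕ} (hk : 1 ≤ k) {x : ℚ_[p]} (h : x ∈ HS p M k) : x ≠ 0 := by
  obtain ⟨i, hi⟩ := h
  exact fun h0 => ppow_ne _ ((hi.eq_zero_iff hk).1 h0)

theorem HS.mul {M k : ℕ} {x y : ℚ_[p]} (hx : x ∈ HS p M k) (hy : y ∈ HS p M k) : x * y ∈ HS p M k := by
  obtain ⟨i, hi⟩ := hx
  obtain ⟨j, hj⟩ := hy
  refine ⟨i + j, ?_⟩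
  rw [mul_add, zpow_add₀ p_ne_zero']
  exact hi.mul hj

theorem HS.inv {M k : ℕ} (hk : 1 ≤ k) {x : ℚ_[p]} (hx : x ∈ HS p M k) : x⁻¹ ∈ HS p M k := by
  obtain ⟨i, hi⟩ := hx
  refine ⟨-i, ?_⟩
  rw [mul_neg, zpow_neg]
  exact hi.inv hk

theorem HS.zp {M k : ℕ} (i : ℤ) : ϖ ^ ((M : ℤ) * i) ∈ HS p M k := ⟨i, App.refl _ _⟩

theorem HS.mul_iff {M k : ℕ} (hk : 1 ≤ k) {x y : ℚ_[p]} (hx : x ∈ HS p M k) :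
    x * y ∈ HS p M k ↔ y ∈ HS p M k := by
  refine ⟨fun h => ?_, HS.mul hx⟩
  have := HS.mul (HS.inv hk hx) h
  rwa [inv_mul_cancel_left₀ (HS.ne_zero hk hx)] at this

theorem exists_Pset_HS (M k : ℕ) (hM : 1 ≤ M) : ∃ N, 0 < N ∧ Pset p N ⊆ HS p M k := by
  obtain ⟨N, hN, h⟩ := exists_Pset_app (p := p) k
  refine ⟨N * M, by positivity, ?_⟩
  rintro _ ⟨y, hy, rfl⟩
  obtain ⟨e, he⟩ := exists_valuation_norm y hy
  refine ⟨N * e, ?_⟩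
  have := h (y ^ N) (ϖ ^ ((N : ℤ) * e)) ?_ ⟨y * (ϖ ^ e)⁻¹, ?_, ?_⟩
  · rw [pow_mul, mul_comm, zpow_mul, zpow_natCast]
    exact this.pow M
  · rw [norm_pow, he, ← norm_pow, mul_comm, zpow_mul, zpow_natCast]
  · exact mul_ne_zero hy (inv_ne_zero (ppow_ne _))
  · rw [mul_pow, inv_pow, mul_comm (N : ℤ), zpow_mul, zpow_natCast]

/-- Subsets of the line which are definable over every space. -/
def KD (S : Set ℚ_[p]) : Prop := ∀ (X : Sp p), ∀ f ∈ X.A, DefS X.A {x | f x ∈ S}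

theorem HS.kd {M k : ℕ} (hM : 1 ≤ M) (hk : 1 ≤ k) : KD (HS p M k) := by
  obtain ⟨N, hN, h⟩ := exists_Pset_HS (p := p) M k hM
  obtain ⟨L, hL, hLE, hrep⟩ := exists_reps_in (HS p M k) (fun x hx => HS.ne_zero hk hx) N hN
  intro X f hf
  refine (BoolGen.ex_mem (P := fun c x => c⁻¹ * f x ∈ Pset p N) hL
    fun c _ => DefS.cpow hf c⁻¹ hN).congr fun x => ?_
  constructor
  · rintro ⟨c, hc, hx⟩
    exact (HS.mul_iff hk (HS.inv hk (hLE hc))).1 (h hx)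
  · intro hx
    obtain ⟨c, hc, hx⟩ := hrep _ hx
    exact ⟨c, hc, by rwa [mul_comm]⟩

theorem KD.ball (c : ℚ_[p]) : KD {x : ℚ_[p] | ‖x‖ ≤ ‖c‖} := fun X _ hf =>
  DefS.norm_le hf (const_mem X.A c)

theorem KD.inter {S T : Set ℚ_[p]} (hS : KD S) (hT : KD T) : KD (S ∩ T) := fun X f hf =>
  BoolGen.and (hS X f hf) (hT X f hf)

theorem KD.scale {S : Set ℚ_[p]} (hS : KD S) (c : ℚ_[p]) : KD {x | c * x ∈ S} := fun X _ hf =>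
  hS X _ (X.A.mul_mem (const_mem X.A c) hf)

theorem KD.app (k : ℕ) (c : ℚ_[p]) : KD {x : ℚ_[p] | App k x c} := fun X _ hf =>
  DefS.app hf (const_mem X.A c) k

theorem KD.zero : KD {x : ℚ_[p] | x = 0} := fun _ _ hf => DefS.eq_zero hf

/-- Product of a subset of the base and a subset of the line. -/
def Sp.pr (X : Sp p) (V : Set X.T) (S : Set ℚ_[p]) : Set (X.T × ℚ_[p]) := {z | z.1 ∈ V ∧ z.2 ∈ S}

theorem pr_def {X : Sp p} {V : Set X.T} (hV : DefS X.A V) {S : Set ℚ_[p]} (hS : KD S) :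
    DefS X.poly.A (X.pr V S) := BoolGen.and (poly_fst.def hV) (hS X.poly _ poly_snd)

/-- The class of a product. -/
noncomputable def Sp.pc (X : Sp p) (V : Set X.T) (S : Set ℚ_[p]) : Q p := X.poly.c (X.pr V S)

theorem pc_split {X : Sp p} {V : Set X.T} (hV : DefS X.A V) {S S1 S2 : Set ℚ_[p]} (h1 : KD S1)
    (h2 : KD S2) (hd : ∀ x, x ∈ S1 → x ∈ S2 → False) (h : ∀ x, x ∈ S ↔ x ∈ S1 ∨ x ∈ S2) :
    X.pc V S = X.pc V S1 + X.pc V S2 := by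
  refine c_split X.poly (pr_def hV h1) (pr_def hV h2) (fun x h h' => hd _ h.2 h'.2) fun x => ?_
  change (_ ∧ _) ↔ (_ ∧ _) ∨ (_ ∧ _)
  rw [h, and_or_left]

theorem pc_fiber {X : Sp p} {V : Set X.T} (hV : DefS X.A V) {ι : Type*} (s : Finset ι)
    {S : Set ℚ_[p]} {T : ι → Set ℚ_[p]} (hT : ∀ i ∈ s, KD (T i)) (hsub : ∀ i ∈ s, ∀ x ∈ T i, x ∈ S)
    (hd : ∀ i ∈ s, ∀ j ∈ s, ∀ x, x ∈ T i → x ∈ T j → i = j)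
    (hcov : ∀ x ∈ S, ∃ i ∈ s, x ∈ T i) : X.pc V S = ∑ i ∈ s, X.pc V (T i) := by
  refine c_fiber X.poly s (fun i hi => pr_def hV (hT i hi)) (fun i hi x hx => ⟨hx.1, hsub i hi _ hx.2⟩)
    (fun i hi j hj x hx hx' => hd i hi j hj _ hx.2 hx'.2) fun x hx => ?_
  obtain ⟨i, hi, h⟩ := hcov x.2 hx.2
  exact ⟨i, hi, hx.1, h⟩

theorem pc_affine {X : Sp p} {V : Set X.T} {S S' : Set ℚ_[p]} {u : ℚ_[p]} (hu : u ≠ 0) (v : ℚ_[p])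
    (h : ∀ x, u * x + v ∈ S' ↔ x ∈ S) : X.pc V S = X.pc V S' := by
  refine c_poly_eq (g := fun z => u * z.2 + v) (h := fun z => u⁻¹ * (z.2 - v)) ?_ ?_ ?_ ?_
  · exact X.poly.A.add_mem (X.poly.A.mul_mem (const_mem X.poly.A u) poly_snd) (const_mem X.poly.A v)
  · exact X.poly.A.mul_mem (const_mem X.poly.A u⁻¹) (X.poly.A.sub_mem poly_snd (const_mem X.poly.A v))
  · rintro ω x ⟨h1, h2⟩
    refine ⟨⟨h1, (h x).2 h2⟩, ?_⟩
    simp only [add_sub_cancel_right]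
    exact inv_mul_cancel_left₀ hu x
  · rintro ω x ⟨h1, h2⟩
    have : u * (u⁻¹ * (x - v)) + v = x := by rw [mul_inv_cancel_left₀ hu]; ring
    refine ⟨⟨h1, (h _).1 ?_⟩, this⟩
    rw [this]
    exact h2

/-- The bounded part of `HS`. -/
def WS (p : ℕ) [Fact p.Prime] (M k : ℕ) : Set ℚ_[p] := HS p M k ∩ {x | ‖x‖ ≤ ‖(1 : ℚ_[p])‖}

theorem WS.kd {M k : ℕ} (hM : 1 ≤ M) (hk : 1 ≤ k) : KD (WS p M k) := (HS.kd hM hk).inter (KD.ball 1)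

theorem HS.norm_mul_le {M k : ℕ} (hM : 1 ≤ M) (hk : 1 ≤ k) {x : ℚ_[p]} (hx : x ∈ HS p M k) {i : ℤ}
    (hi : App k x (ϖ ^ ((M : ℤ) * i))) : ‖x‖ ≤ ‖(1 : ℚ_[p])‖ ↔ 0 ≤ i := by
  rw [hi.norm_eq hk, ← zpow_zero ϖ, norm_ppow_zle]
  exact mul_nonneg_iff_of_pos_left (by exact_mod_cast hM)

theorem pc_pow {X : Sp p} {V : Set X.T} {M k q : ℕ} (hM : 1 ≤ M) (hk : 1 ≤ k)
    (hq : ¬ p ∣ q) : X.pc V (WS p M k) = X.pc V (WS p (M * q) k) := by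
  classical
  have hq0 : 1 ≤ q := by
    rcases Nat.eq_zero_or_pos q with rfl | h
    · simp at hq
    · exact h
  have hone : ∀ ζ : ℚ_[p], ζ ^ q = 1 → ζ ∈ HS p M k → ζ = 1 := by
    rintro ζ hζ ⟨i, hi⟩
    have hn : ‖ζ‖ = 1 := by
      have : ‖ζ‖ ^ q = 1 := by rw [← norm_pow, hζ, norm_one]
      exact (pow_eq_one_iff_of_nonneg (norm_nonneg _) (by omega)).1 this
    have h0 : ϖ ^ ((M : ℤ) * i) = 1 := by
      have h1 := hi.norm_eq hk
      rw [hn, ← norm_one (α := ℚ_[p]), ← zpow_zero ϖ] at h1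
      have h2 := norm_ppow_zle.1 h1.le
      have h3 := norm_ppow_zle.1 h1.ge
      rw [le_antisymm h2 h3, zpow_zero]
    rw [h0] at hi
    have hlt : ‖ζ - 1‖ < 1 := by
      refine lt_of_le_of_lt (show _ ≤ _ from hi) ?_
      rw [norm_one, mul_one]
      exact norm_ppow_lt_one hk
    have := norm_pow_sub_one hq hlt
    rw [hζ, sub_self, norm_zero] at this
    exact sub_eq_zero.1 (norm_eq_zero.1 this.symm)
  have hpow : ∀ x ∈ HS p M k, x ^ q ∈ HS p (M * q) k := by
    rintro x ⟨i, hi⟩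
    refine ⟨i, ?_⟩
    have := hi.pow q
    rw [← zpow_natCast, ← zpow_natCast, ← zpow_mul] at this
    rw [← zpow_natCast]
    convert this using 2
    push_cast
    ring
  have hsurj : ∀ b ∈ HS p (M * q) k, ∃ x ∈ HS p M k, x ^ q = b := by
    rintro b ⟨i, hi⟩
    have h1 : App k (b * (ϖ ^ (((M * q : ℕ) : ℤ) * i))⁻¹) 1 := by
      have := hi.mul_right (ϖ ^ (((M * q : ℕ) : ℤ) * i))⁻¹
      rwa [mul_inv_cancel₀ (ppow_ne _)] at this
    obtain ⟨z, hz, hzq⟩ := exists_root_near hq hk h1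
    refine ⟨ϖ ^ ((M : ℤ) * i) * z, ⟨i, ?_⟩, ?_⟩
    · have := hz.mul_left (ϖ ^ ((M : ℤ) * i))
      rwa [mul_one] at this
    · rw [mul_pow, hzq, ← zpow_natCast, ← zpow_mul]
      have : (M : ℤ) * i * (q : ℤ) = ((M * q : ℕ) : ℤ) * i := by push_cast; ring
      rw [this, mul_comm b, mul_inv_cancel_left₀ (ppow_ne _)]
  have hinj : ∀ x ∈ HS p M k, ∀ y ∈ HS p M k, x ^ q = y ^ q → x = y := by
    intro x hx y hy hxy
    have hy0 := HS.ne_zero hk hy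
    have : x * y⁻¹ = 1 := hone _ (by rw [mul_pow, hxy, inv_pow, mul_inv_cancel₀ (pow_ne_zero _ hy0)])
      (HS.mul hx (HS.inv hk hy))
    rwa [mul_inv_eq_one₀ hy0] at this
  obtain ⟨N, hN, hNH⟩ := exists_Pset_HS (p := p) M k hM
  obtain ⟨L, hL, hLE, hrep⟩ := exists_reps_in (HS p M k) (fun x hx => HS.ne_zero hk hx) N hN
  let h : X.T × ℚ_[p] → ℚ_[p] := fun z => if hz : ∃ x ∈ HS p M k, x ^ q = z.2 then hz.choose else 0
  have hh : ∀ ω, ∀ x ∈ HS p M k, h (ω, x ^ q) = x := by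
    intro ω x hx
    have hz : ∃ y ∈ HS p M k, y ^ q = x ^ q := ⟨x, hx, rfl⟩
    simp only [h, dif_pos hz]
    exact hinj _ hz.choose_spec.1 _ hx hz.choose_spec.2
  have hhA : h ∈ X.poly.A := by
    have := hL.to_subtype
    let SS : Option L → Set (X.T × ℚ_[p]) := fun o => o.elim {z | ¬ (z.2 ∈ HS p (M * q) k)}
      (fun l => {z | (l.1⁻¹) ^ q * z.2 ∈ Pset p (q * N)})
    refine X.poly.closed (cl_cover (S := SS) ?_ ?_ ?_)
    · rintro (_ | l)
      · exact BoolGen.not (HS.kd (by nlinarith) hk X.poly _ poly_snd)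
      · exact DefS.cpow (A := X.poly.A) poly_snd _ (by positivity)
    · rintro ⟨ω, b⟩
      by_cases hb : b ∈ HS p (M * q) k
      · obtain ⟨x, hx, rfl⟩ := hsurj b hb
        obtain ⟨c, hc, y, hy, hyx⟩ := hrep x hx
        refine ⟨some ⟨c, hc⟩, y, hy, ?_⟩
        change _ = c⁻¹ ^ q * x ^ q
        rw [← mul_pow, mul_comm c⁻¹, ← hyx, ← pow_mul, mul_comm]
      · exact ⟨none, hb⟩
    · rintro (_ | l)
      · refine ⟨fun _ => 0, const_mem _ 0, ?_⟩
        rintro ⟨ω, b⟩ hb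
        simp only [h]
        rw [dif_neg]
        rintro ⟨x, hx, rfl⟩
        exact hb (hpow x hx)
      · have hl := hLE l.2
        obtain ⟨y, hy, hyp⟩ := exists_root_fn X.poly.closed (prep_all q) hq0 (Nat.le_succ q)
          (b := (Prod.snd : X.T × ℚ_[p] → ℚ_[p])) poly_snd hN
          (fun ζ h1 h2 => hone ζ h1 (hNH h2)) (inv_ne_zero (HS.ne_zero hk hl))
        refine ⟨y, le_cl _ hy, ?_⟩
        rintro ⟨ω, b⟩ hb
        obtain ⟨h1, h2⟩ := hyp (ω, b) hb
        have h3 := (HS.mul_iff hk (HS.inv hk hl)).1 (hNH h2)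
        have := hh ω _ h3
        rw [h1] at this
        exact this
  refine c_poly_eq (g := fun z => z.2 ^ q) (h := h) (X.poly.A.pow_mem poly_snd q) hhA ?_ ?_
  · rintro ω x ⟨h1, h2, h3⟩
    refine ⟨⟨h1, hpow x h2, ?_⟩, hh ω x h2⟩
    change ‖x ^ q‖ ≤ _
    rw [norm_pow, norm_one]
    rw [Set.mem_ofPred_eq, norm_one] at h3
    exact pow_le_one₀ (norm_nonneg _) h3
  · rintro ω b ⟨h1, h2, h3⟩
    obtain ⟨x, hx, rfl⟩ := hsurj b h2
    have hhx := hh ω x hx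
    refine ⟨⟨h1, ?_⟩, ?_⟩
    swap
    · change (h (ω, x ^ q)) ^ q = _
      rw [hhx]
    rw [hhx]
    refine ⟨hx, ?_⟩
    rw [Set.mem_ofPred_eq, norm_pow, norm_one] at h3
    rw [Set.mem_ofPred_eq, norm_one]
    exact (pow_le_one_iff_of_nonneg (norm_nonneg _) (by omega)).1 h3

theorem app_inj {k : ℕ} (hk : 1 ≤ k) {x : ℚ_[p]} {a b : ℤ} (ha : App k x (ϖ ^ a))
    (hb : App k x (ϖ ^ b)) : a = b := by
  have h1 := (ha.norm_eq hk).symm.trans (hb.norm_eq hk)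
  exact le_antisymm (norm_ppow_zle.1 h1.ge) (norm_ppow_zle.1 h1.le)

theorem HS.scale_iff {k : ℕ} {a : ℤ} {x : ℚ_[p]} {b : ℤ} :
    App k (ϖ ^ (-a) * x) (ϖ ^ b) ↔ App k x (ϖ ^ (a + b)) := by
  constructor
  · intro h
    have := h.mul_left (ϖ ^ a)
    rwa [← mul_assoc, ← zpow_add₀ p_ne_zero', add_neg_cancel, zpow_zero, one_mul,
      ← zpow_add₀ p_ne_zero'] at this
  · intro h
    have := h.mul_left (ϖ ^ (-a))
    rwa [← zpow_add₀ p_ne_zero', neg_add_cancel_left] at this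

theorem mem_WS {M k : ℕ} (hM : 1 ≤ M) (hk : 1 ≤ k) {x : ℚ_[p]} :
    x ∈ WS p M k ↔ ∃ i : ℕ, App k x (ϖ ^ ((M : ℤ) * i)) := by
  constructor
  · rintro ⟨⟨i, hi⟩, h⟩
    have := (HS.norm_mul_le hM hk ⟨i, hi⟩ hi).1 h
    lift i to ℕ using this
    exact ⟨i, hi⟩
  · rintro ⟨i, hi⟩
    exact ⟨⟨i, hi⟩, (HS.norm_mul_le hM hk ⟨i, hi⟩ hi).2 (by positivity)⟩

theorem pc_mul {X : Sp p} {V : Set X.T} (hV : DefS X.A V) {M k q : ℕ} (hM : 1 ≤ M) (hk : 1 ≤ k)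
    (hq : 1 ≤ q) : X.pc V (WS p M k) = q • X.pc V (WS p (M * q) k) := by
  have hMq : 1 ≤ M * q := by nlinarith
  have h1 : ∀ j : ℕ, X.pc V {x | ϖ ^ (-((M : ℤ) * j)) * x ∈ WS p (M * q) k} =
      X.pc V (WS p (M * q) k) := fun j => pc_affine (ppow_ne (-((M : ℤ) * j))) 0 fun x => by
        rw [add_zero]; rfl
  rw [pc_fiber hV (Finset.range q) (T := fun j : ℕ =>
    {x | ϖ ^ (-((M : ℤ) * j)) * x ∈ WS p (M * q) k}), Finset.sum_congr rfl fun j _ => h1 j]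
  · simp
  · exact fun i _ => (WS.kd hMq hk).scale _
  · rintro j _ x hx
    obtain ⟨i, hi⟩ := (mem_WS hMq hk).1 hx
    refine (mem_WS hM hk).2 ⟨j + q * i, ?_⟩
    rw [HS.scale_iff] at hi
    convert hi using 2
    push_cast; ring
  · intro j hj j' hj' x hx hx'
    obtain ⟨i, hi⟩ := (mem_WS hMq hk).1 hx
    obtain ⟨i', hi'⟩ := (mem_WS hMq hk).1 hx'
    rw [HS.scale_iff] at hi hi'
    have h := app_inj hk hi hi'
    have h2 : j + q * i = j' + q * i' := by
      have : (M : ℤ) * (j + q * i) = M * (j' + q * i') := by push_cast at h; linarith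
      have := mul_left_cancel₀ (by exact_mod_cast (by omega : M ≠ 0)) this
      exact_mod_cast this
    have h3 := congrArg (· % q) h2
    simp only [Nat.add_mul_mod_self_left] at h3
    rwa [Nat.mod_eq_of_lt (Finset.mem_range.1 hj), Nat.mod_eq_of_lt (Finset.mem_range.1 hj')] at h3
  · intro x hx
    obtain ⟨i, hi⟩ := (mem_WS hM hk).1 hx
    refine ⟨i % q, Finset.mem_range.2 (Nat.mod_lt _ hq), (mem_WS hMq hk).2 ⟨i / q, ?_⟩⟩
    rw [HS.scale_iff]
    convert hi using 2
    have := Nat.mod_add_div i q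
    conv_rhs => rw [← this]
    push_cast; ring

theorem w_idem {X : Sp p} {V : Set X.T} (hV : DefS X.A V) {M k : ℕ} (hM : 1 ≤ M) (hk : 1 ≤ k) :
    X.pc V (WS p M k) + X.pc V (WS p M k) = X.pc V (WS p M k) := by
  have hp := (Fact.out : p.Prime)
  have hpp : ¬ p ∣ p + 1 := by
    intro h
    have := (Nat.dvd_add_right (dvd_refl p)).1 h
    exact hp.one_lt.ne' (Nat.dvd_one.1 this)
  have h1 : ∀ M, 1 ≤ M → X.pc V (WS p M k) = (p + 1) • X.pc V (WS p M k) := by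
    intro M hM
    conv_lhs => rw [pc_mul hV hM hk (Nat.succ_pos p)]
    rw [← pc_pow hM hk hpp]
  have h2 := pc_mul hV hM hk hp.one_lt.le
  have h3 := h1 (M * p) (by nlinarith [hp.one_lt])
  rw [succ_nsmul, ← h2] at h3
  obtain ⟨r, hr⟩ : ∃ r, p = r + 1 := ⟨p - 1, by have := hp.one_lt; omega⟩
  have h4 : X.pc V (WS p M k) = r • X.pc V (WS p (M * p) k) + X.pc V (WS p (M * p) k) := by
    refine h2.trans ?_
    rw [← succ_nsmul]
    exact congrArg (fun n : ℕ => n • X.pc V (WS p (M * p) k)) hr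
  calc X.pc V (WS p M k) + X.pc V (WS p M k) =
      r • X.pc V (WS p (M * p) k) + X.pc V (WS p (M * p) k) + X.pc V (WS p M k) := by rw [← h4]
    _ = r • X.pc V (WS p (M * p) k) + (X.pc V (WS p M k) + X.pc V (WS p (M * p) k)) := by
      rw [add_assoc, add_comm (X.pc V (WS p (M * p) k))]
    _ = X.pc V (WS p M k) := by rw [← h3, ← h4]

theorem nsmul_idem {G : Type*} [AddCommMonoid G] {a : G} (h : a + a = a) {n : ℕ} (hn : 1 ≤ n) :
    n • a = a := by
  induction n, hn using Nat.le_induction with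
  | base => simp
  | succ n _ ih => rw [succ_nsmul, ih, h]

theorem w_one {X : Sp p} {V : Set X.T} (hV : DefS X.A V) {M k : ℕ} (hM : 1 ≤ M) (hk : 1 ≤ k) :
    X.pc V (WS p M k) = X.pc V (WS p 1 k) := by
  have h := pc_mul hV le_rfl hk hM
  rw [one_mul, nsmul_idem (w_idem hV hM hk) hM] at h
  exact h.symm

/-- The unit ball. -/
def ZS (p : ℕ) [Fact p.Prime] : Set ℚ_[p] := {x | ‖x‖ ≤ ‖(1 : ℚ_[p])‖}

theorem z_unit {X : Sp p} {V : Set X.T} (k : ℕ) :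
    X.pc V {x | App k x 1} = X.pc V (ZS p) := by
  refine (pc_affine (u := ϖ ^ k) (pow_ne_zero _ p_ne_zero') 1 fun x => ?_).symm
  simp only [Set.mem_ofPred_eq, App, add_sub_cancel_right, norm_mul, ZS]
  exact mul_le_mul_iff_right₀ (norm_ppow_pos k)

theorem w_eq {X : Sp p} {V : Set X.T} (hV : DefS X.A V) {M k : ℕ} (hM : 1 ≤ M) (hk : 1 ≤ k) :
    X.pc V (WS p M k) = X.pc V (ZS p) + X.pc V (WS p M k) := by
  have h1 : X.pc V {x | ϖ ^ (-((M : ℤ) * 1)) * x ∈ WS p M k} =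
      X.pc V (WS p M k) := pc_affine (ppow_ne (-((M : ℤ) * 1))) 0 fun x => by
        rw [add_zero]; rfl
  conv_lhs => rw [pc_split hV (KD.app k 1) ((WS.kd hM hk).scale (ϖ ^ (-((M : ℤ) * 1)))) (S := WS p M k)
    (by
      intro x hx hx'
      obtain ⟨i, hi⟩ := (mem_WS hM hk).1 hx'
      rw [HS.scale_iff] at hi
      have hx : App k x (ϖ ^ (0 : ℤ)) := by simpa using hx
      have := app_inj hk hx hi
      nlinarith)
    (by
      intro x
      rw [mem_WS hM hk, Set.mem_ofPred_eq, Set.mem_ofPred_eq, mem_WS hM hk]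
      constructor
      · rintro ⟨i, hi⟩
        rcases i with _ | i
        · left; simpa using hi
        · right
          refine ⟨i, ?_⟩
          rw [HS.scale_iff]
          convert hi using 2
          push_cast; ring
      · rintro (h | ⟨i, hi⟩)
        · exact ⟨0, by simpa using h⟩
        · refine ⟨i + 1, ?_⟩
          rw [HS.scale_iff] at hi
          convert hi using 2
          push_cast; ring)]
  rw [z_unit, h1]

theorem z_eq {X : Sp p} {V : Set X.T} (hV : DefS X.A V) {k : ℕ} (hk : 1 ≤ k) :
    X.pc V (ZS p) = X.pc V {x | x = 0} + X.pc V (WS p 1 k) := by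
  have hp := (Fact.out : p.Prime)
  classical
  let s : Finset ℕ := (Finset.range (p ^ k)).filter (fun j => ¬ p ∣ j)
  have hs : ∀ j ∈ s, ‖(j : ℚ_[p])‖ = 1 := by
    intro j hj
    refine le_antisymm (norm_nat_le_one j) ?_
    by_contra h
    push Not at h
    exact (Finset.mem_filter.1 hj).2 ((Padic.norm_natCast_lt_one_iff).1 h)
  have hs0 : ∀ j ∈ s, (j : ℚ_[p]) ≠ 0 := by
    intro j hj h
    have := hs j hj
    rw [h, norm_zero] at this
    exact zero_ne_one this
  have h2 : ∀ j ∈ s, X.pc V {x | (j : ℚ_[p])⁻¹ * x ∈ WS p 1 k} = X.pc V (WS p 1 k) := fun j hj =>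
    pc_affine (inv_ne_zero (hs0 j hj)) 0 fun x => by rw [add_zero]; rfl
  have h3 : X.pc V {x | x ≠ 0 ∧ ‖x‖ ≤ ‖(1 : ℚ_[p])‖} = X.pc V (WS p 1 k) := by
    rw [pc_fiber hV s (T := fun j : ℕ => {x | (j : ℚ_[p])⁻¹ * x ∈ WS p 1 k}),
      Finset.sum_congr rfl h2, Finset.sum_const, nsmul_idem (w_idem hV le_rfl hk)]
    · refine Finset.card_pos.2 ⟨1, Finset.mem_filter.2 ⟨Finset.mem_range.2 (Nat.one_lt_pow (by omega) hp.one_lt), ?_⟩⟩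
      exact fun h => hp.one_lt.ne' (Nat.dvd_one.1 h)
    · exact fun j _ => (WS.kd le_rfl hk).scale _
    · intro j hj x hx
      have h4 := HS.ne_zero hk hx.1
      have h5 := hx.2
      rw [Set.mem_ofPred_eq, norm_mul, norm_inv, hs j hj, inv_one, one_mul] at h5
      exact ⟨right_ne_zero_of_mul h4, h5⟩
    · intro j hj j' hj' x hx hx'
      obtain ⟨i, hi⟩ := (mem_WS le_rfl hk).1 hx
      obtain ⟨i', hi'⟩ := (mem_WS le_rfl hk).1 hx'
      have a1 := hi.mul_left (j : ℚ_[p])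
      have a2 := hi'.mul_left (j' : ℚ_[p])
      rw [mul_inv_cancel_left₀ (hs0 j hj)] at a1
      rw [mul_inv_cancel_left₀ (hs0 j' hj')] at a2
      have e1 := a1.norm_eq hk
      have e2 := a2.norm_eq hk
      rw [norm_mul, hs j hj, one_mul] at e1
      rw [norm_mul, hs j' hj', one_mul] at e2
      have e3 := e1.symm.trans e2
      have e4 : (1 : ℕ) * (i : ℤ) = ((1 : ℕ) : ℤ) * i' := le_antisymm (norm_ppow_zle.1 e3.ge) (norm_ppow_zle.1 e3.le)
      rw [← e4] at a2
      have a3 := ((a1.symm hk).trans a2).mul_right (ϖ ^ ((1 : ℕ) * (i : ℤ)))⁻¹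
      rw [mul_inv_cancel_right₀ (ppow_ne _), mul_inv_cancel_right₀ (ppow_ne _)] at a3
      have a4 : ‖((j : ℤ) - (j' : ℤ) : ℤ)‖ ≤ (0 : ℝ) ∨ True := Or.inr trivial
      have a5 : ‖(((j : ℤ) - j' : ℤ) : ℚ_[p])‖ ≤ (p : ℝ) ^ (-k : ℤ) := by
        have := (show _ ≤ _ from a3)
        rw [hs j' hj', mul_one, norm_pow, Padic.norm_p, inv_pow] at this
        rw [zpow_neg, zpow_natCast]
        exact_mod_cast this
      rw [Padic.norm_int_le_pow_iff_dvd] at a5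
      have b1 := Finset.mem_range.1 (Finset.mem_filter.1 hj).1
      have b2 := Finset.mem_range.1 (Finset.mem_filter.1 hj').1
      have := Int.eq_zero_of_abs_lt_dvd a5 (by
        rw [abs_lt]; push_cast; constructor <;> [skip; skip] <;>
        · have : ((j : ℤ) < (p : ℤ) ^ k) ∧ ((j' : ℤ) < (p : ℤ) ^ k) := by
            constructor <;> exact_mod_cast (by assumption)
          omega)
      omega
    · rintro x ⟨hx0, hx1⟩
      obtain ⟨e, he⟩ := exists_valuation_norm x hx0
      have he0 : 0 ≤ e := by
        rw [he, ← zpow_zero ϖ] at hx1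
        exact norm_ppow_zle.1 hx1
      lift e to ℕ using he0
      have hu1 : ‖x * (ϖ ^ (e : ℤ))⁻¹‖ = 1 := by
        rw [norm_mul, norm_inv, he, mul_inv_cancel₀ (norm_ne_zero_iff.2 (ppow_ne _))]
      let u : ℤ_[p] := ⟨x * (ϖ ^ (e : ℤ))⁻¹, hu1.le⟩
      have hj := PadicInt.appr_spec k u
      rw [← PadicInt.norm_le_pow_iff_mem_span_pow, PadicInt.norm_def] at hj
      set j := u.appr k
      have hj2 : ‖x * (ϖ ^ (e : ℤ))⁻¹ - j‖ ≤ ‖ϖ ^ k‖ := by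
        rw [norm_pow, Padic.norm_p, inv_pow]
        rw [PadicInt.coe_sub, PadicInt.coe_natCast, zpow_neg, zpow_natCast] at hj
        exact hj
      have hjn : ‖(j : ℚ_[p])‖ = 1 := by
        rw [← hu1]
        refine norm_eq_of_sub_lt ?_
        rw [norm_sub_rev, hu1]
        exact lt_of_le_of_lt hj2 (norm_ppow_lt_one hk)
      have hj0 : (j : ℚ_[p]) ≠ 0 := by
        intro h
        rw [h, norm_zero] at hjn
        exact zero_ne_one hjn
      refine ⟨j, Finset.mem_filter.2 ⟨Finset.mem_range.2 (PadicInt.appr_lt _ _), fun h => ?_⟩,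
        (mem_WS le_rfl hk).2 ⟨e, ?_⟩⟩
      · have := (Padic.norm_natCast_lt_one_iff).2 h
        rw [hjn] at this
        exact lt_irrefl _ this
      · have a1 : App k (x * (ϖ ^ (e : ℤ))⁻¹) j := by
          change _ ≤ _
          rwa [hjn, mul_one]
        have a2 := (a1.mul_right (ϖ ^ (e : ℤ))).mul_left (j : ℚ_[p])⁻¹
        rw [inv_mul_cancel_right₀ (ppow_ne _), inv_mul_cancel_left₀ hj0] at a2
        simpa using a2
  rw [← h3]
  refine pc_split hV KD.zero (fun X f hf => BoolGen.and (DefS.ne_zero hf) (KD.ball 1 X f hf))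
    (fun x h h' => h'.1 h) fun x => ?_
  simp only [ZS, Set.mem_ofPred_eq]
  by_cases h : x = 0
  · simp [h]
  · simp [h]

theorem w_eq_z {X : Sp p} {V : Set X.T} (hV : DefS X.A V) {M k : ℕ} (hM : 1 ≤ M) (hk : 1 ≤ k) :
    X.pc V (WS p M k) = X.pc V (ZS p) := by
  rw [w_one hV hM hk]
  have h1 := w_eq hV le_rfl hk
  have h2 := z_eq hV hk
  rw [h1]
  conv_lhs => rw [h2, add_assoc, w_idem hV le_rfl hk]
  exact h2.symm

theorem z_idem {X : Sp p} {V : Set X.T} (hV : DefS X.A V) :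
    X.pc V (ZS p) + X.pc V (ZS p) = X.pc V (ZS p) := by
  rw [← w_eq_z hV le_rfl le_rfl]
  exact w_idem hV le_rfl le_rfl

theorem z_add_pt {X : Sp p} {V : Set X.T} (hV : DefS X.A V) :
    X.pc V {x | x = 0} + X.pc V (ZS p) = X.pc V (ZS p) := by
  rw [← w_eq_z hV le_rfl le_rfl]
  conv_rhs => rw [w_eq_z hV le_rfl le_rfl, z_eq hV le_rfl]

theorem poly_lin {X : Sp p} {f : X.T → ℚ_[p]} (hf : f ∈ X.A) :
    (fun z : X.T × ℚ_[p] => f z.1 * z.2) ∈ X.poly.A :=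
  X.poly.A.mul_mem (poly_fst' hf) poly_snd

theorem annulus_def {X : Sp p} {V : Set X.T} (hV : DefS X.A V) {M k : ℕ} (hM : 1 ≤ M) (hk : 1 ≤ k)
    {b : X.T → ℚ_[p]} (hb : b ∈ X.A) :
    DefS X.poly.A {z : X.T × ℚ_[p] | z.1 ∈ V ∧ z.2 ∈ WS p M k ∧ ‖b z.1‖ < ‖z.2‖} :=
  BoolGen.and (poly_fst.def hV) (BoolGen.and (WS.kd hM hk X.poly _ poly_snd)
    (DefS.norm_lt (poly_fst' hb) poly_snd))

theorem annulus_add {X : Sp p} {V : Set X.T} (hV : DefS X.A V) {M k : ℕ} (hM : 1 ≤ M) (hk : 1 ≤ k)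
    {b : X.T → ℚ_[p]} (hb : b ∈ X.A) (hbH : ∀ ω ∈ V, b ω ∈ HS p M k ∧ ‖b ω‖ ≤ 1) :
    X.pc V (ZS p) = X.poly.c {z : X.T × ℚ_[p] | z.1 ∈ V ∧ z.2 ∈ WS p M k ∧ ‖b z.1‖ < ‖z.2‖} +
      X.pc V (ZS p) := by
  have e := c_split X.poly (S := X.pr V (WS p M k)) (annulus_def hV hM hk hb)
    (S2 := {z : X.T × ℚ_[p] | z.1 ∈ V ∧ z.2 ∈ HS p M k ∧ ‖z.2‖ ≤ ‖b z.1‖})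
    (BoolGen.and (poly_fst.def hV) (BoolGen.and (HS.kd hM hk X.poly _ poly_snd)
    (DefS.norm_le poly_snd (poly_fst' hb)))) ?_ ?_
  · have e1 : X.pc V (ZS p) = X.poly.c (X.pr V (WS p M k)) := (w_eq_z hV hM hk).symm
    refine e1.trans (e.trans (congrArg _ (Eq.trans ?_ e1.symm)))
    refine c_poly_eq (g := fun z => (b z.1)⁻¹ * z.2) (h := fun z => b z.1 * z.2) ?_ ?_ ?_ ?_
    · exact poly_lin (f := fun ω => (b ω)⁻¹) (poly_inv hb)
    · exact poly_lin hb
    · rintro ω x ⟨h1, h2, h3⟩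
      have hb1 := (hbH ω h1).1
      have hb0 := HS.ne_zero hk hb1
      refine ⟨⟨h1, HS.mul (HS.inv hk hb1) h2, ?_⟩, mul_inv_cancel_left₀ hb0 x⟩
      change ‖_‖ ≤ _
      rw [norm_mul, norm_inv, norm_one, inv_mul_le_iff₀ (norm_pos_iff.2 hb0), mul_one]
      exact h3
    · rintro ω x ⟨h1, h2, h3⟩
      have hb1 := (hbH ω h1).1
      have hb0 := HS.ne_zero hk hb1
      refine ⟨⟨h1, HS.mul hb1 h2, ?_⟩, inv_mul_cancel_left₀ hb0 x⟩
      change ‖_ * _‖ ≤ _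
      rw [norm_mul]
      rw [Set.mem_ofPred_eq, norm_one] at h3
      exact mul_le_of_le_one_right (norm_nonneg _) h3
  · rintro x ⟨_, _, h⟩ ⟨_, _, h'⟩
    exact absurd h (not_lt.2 h')
  · rintro ⟨ω, x⟩
    constructor
    · rintro ⟨h1, h2⟩
      rcases lt_or_ge ‖b ω‖ ‖x‖ with h | h
      · exact Or.inl ⟨h1, h2, h⟩
      · exact Or.inr ⟨h1, h2.1, h⟩
    · rintro (⟨h1, h2, h3⟩ | ⟨h1, h2, h3⟩)
      · exact ⟨h1, h2⟩
      · refine ⟨h1, h2, ?_⟩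
        rw [Set.mem_ofPred_eq, norm_one]
        exact (show ‖x‖ ≤ ‖b ω‖ from h3).trans (hbH ω h1).2

theorem annulus_scale {X : Sp p} {V : Set X.T} {S : Set ℚ_[p]} {b : X.T → ℚ_[p]} {P : ℚ_[p]} (hP0 : P ≠ 0) :
    X.poly.c {z : X.T × ℚ_[p] | z.1 ∈ V ∧ P⁻¹ * z.2 ∈ S ∧ ‖b z.1‖ < ‖P⁻¹ * z.2‖} =
        X.poly.c {z : X.T × ℚ_[p] | z.1 ∈ V ∧ z.2 ∈ S ∧ ‖b z.1‖ < ‖z.2‖} := by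
  refine c_poly_eq (g := fun z => P⁻¹ * z.2) (h := fun z => P * z.2)
    (poly_lin (f := fun _ => P⁻¹) (const_mem X.A P⁻¹)) (poly_lin (f := fun _ => P) (const_mem X.A P)) ?_ ?_
  · rintro ω x ⟨h1, h2, h3⟩
    exact ⟨⟨h1, h2, h3⟩, mul_inv_cancel_left₀ hP0 x⟩
  · rintro ω x ⟨h1, h2, h3⟩
    have hxx : P⁻¹ * (P * x) = x := inv_mul_cancel_left₀ hP0 x
    refine ⟨⟨h1, ?_, ?_⟩, hxx⟩
    · change P⁻¹ * (P * x) ∈ S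
      rw [hxx]; exact h2
    · change _ < ‖P⁻¹ * (P * x)‖
      rw [hxx]; exact h3

theorem annulus_scale_def {X : Sp p} {V : Set X.T} (hV : DefS X.A V) {S : Set ℚ_[p]} (hS : KD S)
    {b : X.T → ℚ_[p]} (hb : b ∈ X.A) (P : ℚ_[p]) :
    DefS X.poly.A {z : X.T × ℚ_[p] | z.1 ∈ V ∧ P * z.2 ∈ S ∧ ‖b z.1‖ < ‖P * z.2‖} :=
  BoolGen.and (poly_fst.def hV) (BoolGen.and (hS.scale P X.poly _ poly_snd)
      (DefS.norm_lt (poly_fst' hb) (poly_lin (f := fun _ => P) (const_mem X.A P))))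

/-- Annuli with varying inner radius. -/
theorem annulus {X : Sp p} {V : Set X.T} (hV : DefS X.A V) {M k : ℕ} (hM : 1 ≤ M) (hk : 1 ≤ k)
    {a : X.T → ℚ_[p]} (ha : a ∈ X.A) (haH : ∀ ω ∈ V, a ω ∈ HS p M k ∧ ‖a ω‖ < 1) :
    X.poly.c {z : X.T × ℚ_[p] | z.1 ∈ V ∧ z.2 ∈ WS p M k ∧ ‖a z.1‖ < ‖z.2‖} = X.pc V (ZS p) := by
  obtain ⟨P, hP⟩ : ∃ P : ℚ_[p], P = ϖ ^ ((M : ℤ) * 1) := ⟨_, rfl⟩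
  have hP0 : P ≠ 0 := hP ▸ ppow_ne _
  have hPH : P ∈ HS p M k := hP ▸ HS.zp 1
  have hlt : ∀ x ∈ HS p M k, ‖x‖ < 1 → ‖x‖ ≤ ‖P‖ := by
    rintro x ⟨i, hi⟩ h
    rw [hi.norm_eq hk] at h ⊢
    rw [← norm_one (α := ℚ_[p]), ← zpow_zero ϖ, norm_ppow_zlt] at h
    rw [hP, norm_ppow_zle]
    have : 0 < i := pos_of_mul_pos_right h (by positivity)
    nlinarith
  have hP1 : ‖P‖ < 1 := by
    rw [hP, ← norm_one (α := ℚ_[p]), ← zpow_zero ϖ, norm_ppow_zlt]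
    push_cast; omega
  have hbA : (fun ω => P⁻¹ * a ω) ∈ X.A := X.A.mul_mem (const_mem _ _) ha
  have hPa : ∀ ω x, ‖P⁻¹ * a ω‖ < ‖P⁻¹ * x‖ ↔ ‖a ω‖ < ‖x‖ := by
    intro ω x
    rw [norm_mul, norm_mul]
    exact mul_lt_mul_iff_right₀ (norm_pos_iff.2 (inv_ne_zero hP0))
  have hsc : ∀ x, P⁻¹ * x ∈ WS p M k ↔ x ∈ HS p M k ∧ ‖x‖ < 1 := by
    intro x
    constructor
    · rintro ⟨h1, h2⟩
      have h3 := (HS.mul_iff hk (HS.inv hk hPH)).1 h1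
      refine ⟨h3, ?_⟩
      rw [Set.mem_ofPred_eq, norm_one, norm_mul, norm_inv, inv_mul_le_iff₀ (norm_pos_iff.2 hP0),
        mul_one] at h2
      exact h2.trans_lt hP1
    · rintro ⟨h1, h2⟩
      refine ⟨HS.mul (HS.inv hk hPH) h1, ?_⟩
      rw [Set.mem_ofPred_eq, norm_one, norm_mul, norm_inv, inv_mul_le_iff₀ (norm_pos_iff.2 hP0),
        mul_one]
      exact hlt x h1 h2
  have e := c_split X.poly (S := {z : X.T × ℚ_[p] | z.1 ∈ V ∧ z.2 ∈ WS p M k ∧ ‖a z.1‖ < ‖z.2‖})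
    (pr_def hV (KD.app k 1)) (S2 := {z : X.T × ℚ_[p] | z.1 ∈ V ∧
    P⁻¹ * z.2 ∈ WS p M k ∧ ‖P⁻¹ * a z.1‖ < ‖P⁻¹ * z.2‖})
    (annulus_scale_def (b := fun ω => P⁻¹ * a ω) hV (WS.kd hM hk) hbA P⁻¹) ?_ ?_
  · refine e.trans ?_
    have e1 : X.poly.c (X.pr V {x | App k x 1}) = X.pc V (ZS p) := z_unit k
    rw [e1, annulus_scale (b := fun ω => P⁻¹ * a ω) hP0, add_comm]
    refine (annulus_add (b := fun ω => P⁻¹ * a ω) hV hM hk hbA fun ω hω => ⟨HS.mul (HS.inv hk hPH) (haH ω hω).1, ?_⟩).symm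
    rw [norm_mul, norm_inv, inv_mul_le_iff₀ (norm_pos_iff.2 hP0), mul_one]
    exact hlt _ (haH ω hω).1 (haH ω hω).2
  · rintro ⟨ω, x⟩ ⟨h1, h2⟩ ⟨_, h3, _⟩
    have h4 := ((hsc x).1 h3).2
    have h5 := (show App k x 1 from h2).norm_eq hk
    rw [norm_one] at h5
    exact h4.ne h5
  · rintro ⟨ω, x⟩
    constructor
    · rintro ⟨h1, h2, h3⟩
      rcases lt_or_ge ‖x‖ 1 with h | h
      · exact Or.inr ⟨h1, (hsc x).2 ⟨h2.1, h⟩, (hPa ω x).2 h3⟩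
      · refine Or.inl ⟨h1, ?_⟩
        obtain ⟨i, hi⟩ := (mem_WS hM hk).1 h2
        rcases i with _ | i
        · simpa using hi
        · exfalso
          rw [hi.norm_eq hk, ← norm_one (α := ℚ_[p]), ← zpow_zero ϖ, norm_ppow_zle] at h
          push_cast at h
          have : (1 : ℤ) ≤ M := by exact_mod_cast hM
          nlinarith
    · rintro (⟨h1, h2⟩ | ⟨h1, h2, h3⟩)
      · have h5 := (show App k x 1 from h2).norm_eq hk
        rw [norm_one] at h5
        refine ⟨h1, (mem_WS hM hk).2 ⟨0, by simpa using h2⟩, ?_⟩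
        change _ < ‖x‖
        rw [h5]
        exact (haH ω h1).2
      · obtain ⟨h4, h5⟩ := (hsc x).1 h2
        refine ⟨h1, ⟨h4, ?_⟩, (hPa ω x).1 h3⟩
        rw [Set.mem_ofPred_eq, norm_one]
        exact h5.le

end
end PadicSub
end

section
/-! ## Decomposition of definable sets into simple pieces -/

namespace PadicSub
section
variable {p : ℕ} [Fact p.Prime] {Ω : Type}
local notation "ϖ" => (p : ℚ_[p])
open Polynomial

/-- Classes of simple pieces over `X`. -/
noncomputable def MX (X : Sp p) : AddSubmonoid (Q p) := AddSubmonoid.closure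
  {q | ∃ V, DefS X.A V ∧ (q = X.pc V {x | x = 0} ∨ q = X.pc V (ZS p))}

theorem MX.pt {X : Sp p} {V : Set X.T} (hV : DefS X.A V) : X.pc V {x | x = 0} ∈ MX X :=
  AddSubmonoid.subset_closure ⟨V, hV, Or.inl rfl⟩

theorem MX.z {X : Sp p} {V : Set X.T} (hV : DefS X.A V) : X.pc V (ZS p) ∈ MX X :=
  AddSubmonoid.subset_closure ⟨V, hV, Or.inr rfl⟩

/-- Splitting a set by finitely many conditions. -/
theorem split_by (Y : Sp p) (W : AddSubmonoid (Q p)) {ι : Type*} [Finite ι] {B : ι → Set Y.T}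
    (hB : ∀ i, DefS Y.A (B i)) {T : Set Y.T} (hT : DefS Y.A T)
    (h : ∀ z ∈ T, Y.c {y | y ∈ T ∧ ∀ i, y ∈ B i ↔ z ∈ B i} ∈ W) : Y.c T ∈ W := by
  classical
  have := Fintype.ofFinite ι
  have hdef : ∀ σ : Finset ι, DefS Y.A {y | y ∈ T ∧ ∀ i, y ∈ B i ↔ i ∈ σ} := fun σ =>
    BoolGen.and hT (BoolGen.all_finite fun i => BoolGen.iff (hB i) (BoolGen.const _))
  rw [c_fiber Y (Finset.univ : Finset (Finset ι)) (T := fun σ => {y | y ∈ T ∧ ∀ i, y ∈ B i ↔ i ∈ σ})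
    (fun σ _ => hdef σ) (fun σ _ y hy => hy.1)
    (fun σ _ τ _ y hy hy' => Finset.ext fun i => (hy.2 i).symm.trans (hy'.2 i))
    (fun y hy => ⟨Finset.univ.filter (fun i => y ∈ B i), Finset.mem_univ _, hy, fun i => by simp⟩)]
  refine AddSubmonoid.sum_mem _ fun σ _ => ?_
  by_cases hne : ∃ z, z ∈ {y | y ∈ T ∧ ∀ i, y ∈ B i ↔ i ∈ σ}
  · obtain ⟨z, hz, hzB⟩ := hne
    have := h z hz
    simp only [hzB] at this
    exact this
  · push Not at hne
    rw [c_empty Y hne]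
    exact W.zero_mem

theorem exists_ev_of_mem_poly {A : FAlg p Ω} {f : Ω × ℚ_[p] → ℚ_[p]}
    (hf : f ∈ adj (pull (Prod.fst : Ω × ℚ_[p] → Ω) A) Prod.snd) :
    ∃ F : Polynomial A, ∀ ω t, f (ω, t) = ev F ω t := by
  unfold adj at hf
  induction hf using Algebra.adjoin_induction with
  | mem x hx =>
    rcases hx with rfl | ⟨g, hg, rfl⟩
    · exact ⟨Polynomial.X, fun ω t => (ev_X _ _).symm⟩
    · exact ⟨Polynomial.C ⟨g, hg⟩, fun ω t => (ev_C _ _ (⟨g, hg⟩ : A)).symm⟩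
  | algebraMap r => exact ⟨Polynomial.C (algebraMap _ _ r), fun ω t => (ev_C _ _ (algebraMap _ A r)).symm⟩
  | add x y _ _ ihx ihy =>
    obtain ⟨F, hF⟩ := ihx
    obtain ⟨G, hG⟩ := ihy
    exact ⟨F + G, fun ω t => by rw [ev_add, ← hF, ← hG]; rfl⟩
  | mul x y _ _ ihx ihy =>
    obtain ⟨F, hF⟩ := ihx
    obtain ⟨G, hG⟩ := ihy
    exact ⟨F * G, fun ω t => by rw [ev_mul, ← hF, ← hG]; rfl⟩

theorem shiftNear {A : FAlg p Ω} (hA : cl A ≤ A) {C : Set (Ω × ℚ_[p])} (hC : LSet A C)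
    {δ : Ω → ℚ_[p]} (hδ : δ ∈ A) :
    LSet A {z | ‖z.2‖ ≤ ‖z.2 + δ z.1‖ ∧ (z.1, z.2 + δ z.1) ∈ C} := by
  obtain ⟨K0, hK1, hK⟩ := hC.tame
  obtain ⟨N, hN, hNapp⟩ := exists_Pset_app (p := p) K0
  have hinv : ∀ {f : Ω → ℚ_[p]}, f ∈ A → (fun ω => (f ω)⁻¹) ∈ A := fun hf => hA (cl_inv (le_cl _ hf))
  -- representatives
  obtain ⟨Q, hQ, hQE, hrep⟩ : ∃ Q : Set ℚ_[p], Q.Finite ∧ (∀ c ∈ Q, ‖c‖ ≤ ‖c + 1‖) ∧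
      ∀ u : ℚ_[p], ‖ϖ ^ (K0 : ℤ)‖ < ‖u‖ → ‖u‖ < ‖ϖ ^ (-(K0 : ℤ))‖ →
        ‖u‖ ≤ ‖u + 1‖ → ∃ c ∈ Q, ‖u‖ = ‖c‖ ∧ u * c⁻¹ ∈ Pset p N := by
    have hE : ∀ j : ℤ, ∃ Q : Set ℚ_[p], Q.Finite ∧ Q ⊆ {u : ℚ_[p] | ‖u‖ = ‖ϖ ^ j‖ ∧ ‖u‖ ≤ ‖u + 1‖} ∧
        ∀ x ∈ {u : ℚ_[p] | ‖u‖ = ‖ϖ ^ j‖ ∧ ‖u‖ ≤ ‖u + 1‖}, ∃ c ∈ Q, x * c⁻¹ ∈ Pset p N := by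
      intro j
      refine exists_reps_in _ ?_ N hN
      rintro x ⟨hx, _⟩ rfl
      rw [norm_zero] at hx
      exact ppow_ne j (norm_eq_zero.1 hx.symm)
    choose Qj h1 h2 h3 using hE
    refine ⟨⋃ j ∈ Set.Icc (-(K0 : ℤ)) K0, Qj j, (Set.finite_Icc _ _).biUnion fun j _ => h1 j, ?_, ?_⟩
    · intro c hc
      simp only [Set.mem_iUnion] at hc
      obtain ⟨j, _, hc⟩ := hc
      exact (h2 j hc).2
    · intro u hu1 hu2 hu3
      have hu0 : u ≠ 0 := by
        rintro rfl
        rw [norm_zero] at hu1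
        exact absurd hu1 (not_lt.2 (norm_nonneg _))
      obtain ⟨e, he⟩ := exists_valuation_norm u hu0
      obtain ⟨c, hc, hcu⟩ := h3 e u ⟨he, hu3⟩
      refine ⟨c, ?_, ?_, hcu⟩
      · simp only [Set.mem_iUnion]
        rw [he, norm_ppow_zlt] at hu1 hu2
        exact ⟨e, ⟨by omega, by omega⟩, hc⟩
      · exact he.trans (h2 e hc).1.symm
  have ha : LSet A {z | ‖z.2‖ ≤ ‖ϖ ^ K0 * δ z.1‖ ∧ (z.1, δ z.1) ∈ C} := by
    refine BoolGen.and ?_ (LSet.fst (hC.subst hδ))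
    have := LSet.norm_le (A := A) (const_mem A 1) (A.mul_mem (const_mem A (ϖ ^ K0)) hδ) 1 0
    refine BoolGen.congr this fun z => ?_
    simp
  have hb : LSet A {z | ‖δ z.1‖ ≤ ‖ϖ ^ K0 * z.2‖ ∧ z ∈ C} := by
    refine BoolGen.and ?_ hC
    have := LSet.norm_le (A := A) hδ (const_mem A (ϖ ^ K0)) 0 1
    refine BoolGen.congr this fun z => ?_
    simp
  have hc : LSet A {z | ∃ c ∈ Q, δ z.1 ≠ 0 ∧ ‖z.2‖ = ‖δ z.1 * c‖ ∧ (δ z.1 * c)⁻¹ * z.2 ^ 1 ∈ Pset p N ∧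
      (z.1, δ z.1 * (c + 1)) ∈ C} := by
    refine BoolGen.ex_mem hQ fun c _ => BoolGen.and (LSet.fst (DefS.ne_zero hδ)) (BoolGen.and ?_
      (BoolGen.and ?_ (LSet.fst (hC.subst (A.mul_mem hδ (const_mem A (c + 1)))))))
    · have := LSet.norm_eq (A := A) (const_mem A 1) (A.mul_mem hδ (const_mem A c)) 1 0
      refine BoolGen.congr this fun z => ?_
      simp
    · exact LSet.mul_pow (h := fun ω => (δ ω * c)⁻¹) (hinv (A.mul_mem hδ (const_mem A c))) 1 hN
  refine BoolGen.congr (BoolGen.or ha (BoolGen.or hb hc)) ?_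
  rintro ⟨ω, x⟩
  simp only [Set.mem_ofPred_eq]
  have appA : ‖x‖ ≤ ‖ϖ ^ K0 * δ ω‖ → App K0 (x + δ ω) (δ ω) := by
    intro h
    change ‖_‖ ≤ _
    rw [add_sub_cancel_right, ← norm_mul]
    exact h
  have appB : ‖δ ω‖ ≤ ‖ϖ ^ K0 * x‖ → App K0 (x + δ ω) x := by
    intro h
    change ‖_‖ ≤ _
    rw [add_sub_cancel_left, ← norm_mul]
    exact h
  have appC : ∀ c : ℚ_[p], c ≠ 0 → ‖c‖ ≤ ‖c + 1‖ → δ ω ≠ 0 → ‖x‖ = ‖δ ω * c‖ →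
      (δ ω * c)⁻¹ * x ^ 1 ∈ Pset p N → App K0 (x + δ ω) (δ ω * (c + 1)) := by
    intro c hc0 hc1 hd hn hP
    have h1 : App K0 x (δ ω * c) := hNapp _ _ hn (by rwa [pow_one, mul_comm] at hP)
    change ‖_‖ ≤ _
    have e : x + δ ω - δ ω * (c + 1) = x - δ ω * c := by ring
    rw [e]
    refine le_trans (show _ ≤ _ from h1) ?_
    refine mul_le_mul_of_nonneg_left ?_ (norm_nonneg _)
    rw [norm_mul, norm_mul]
    exact mul_le_mul_of_nonneg_left hc1 (norm_nonneg _)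
  constructor
  · rintro (⟨h, hm⟩ | ⟨h, hm⟩ | ⟨c, hc, hd, hn, hP, hm⟩)
    · have h1 := appA h
      refine ⟨?_, (hK _ _ _ h1).2 hm⟩
      rw [h1.norm_eq hK1]
      refine h.trans ?_
      rw [norm_mul]
      exact mul_le_of_le_one_left (norm_nonneg _) (norm_ppow_le_one _)
    · have h1 := appB h
      exact ⟨(h1.norm_eq hK1).ge, (hK _ _ _ h1).2 hm⟩
    · have hc0 : c ≠ 0 := by
        rintro rfl
        rw [mul_zero, inv_zero, zero_mul] at hP
        exact ne_zero_of_mem_Pset hP rfl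
      have h1 := appC c hc0 (hQE c hc) hd hn hP
      refine ⟨?_, (hK _ _ _ h1).2 hm⟩
      rw [h1.norm_eq hK1, hn, norm_mul, norm_mul]
      exact mul_le_mul_of_nonneg_left (hQE c hc) (norm_nonneg _)
  · rintro ⟨hle, hm⟩
    by_cases h1 : ‖x‖ ≤ ‖ϖ ^ K0 * δ ω‖
    · exact Or.inl ⟨h1, (hK _ _ _ (appA h1)).1 hm⟩
    by_cases h2 : ‖δ ω‖ ≤ ‖ϖ ^ K0 * x‖
    · exact Or.inr (Or.inl ⟨h2, (hK _ _ _ (appB h2)).1 hm⟩)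
    push Not at h1 h2
    have hd : δ ω ≠ 0 := by
      intro h
      rw [h, norm_zero] at h2
      exact absurd h2 (not_lt.2 (norm_nonneg _))
    have hx : x ≠ 0 := by
      intro h
      rw [h, norm_zero] at h1
      exact absurd h1 (not_lt.2 (norm_nonneg _))
    have hdp := norm_pos_iff.2 hd
    have hK0p := norm_ppow_pos (p := p) K0
    obtain ⟨c, hc, hcn, hcP⟩ := hrep (x * (δ ω)⁻¹)
      (by
        rw [zpow_natCast, norm_mul x, norm_inv, ← div_eq_mul_inv, lt_div_iff₀ hdp, ← norm_mul]
        exact h1)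
      (by
        rw [zpow_neg, zpow_natCast, norm_inv, norm_mul x, norm_inv, ← div_eq_mul_inv, div_lt_iff₀ hdp,
          ← div_eq_inv_mul, lt_div_iff₀ hK0p, mul_comm, ← norm_mul]
        exact h2)
      (by
        have : x * (δ ω)⁻¹ + 1 = (x + δ ω) * (δ ω)⁻¹ := by rw [add_mul, mul_inv_cancel₀ hd]
        rw [this, norm_mul, norm_mul]
        exact mul_le_mul_of_nonneg_right hle (norm_nonneg _))
    have hc0 : c ≠ 0 := by
      rintro rfl
      rw [inv_zero, mul_zero] at hcP
      exact ne_zero_of_mem_Pset hcP rfl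
    have e1 : ‖x‖ = ‖δ ω * c‖ := by
      rw [norm_mul, ← hcn, norm_mul, norm_inv]
      field_simp
    have e2 : (δ ω * c)⁻¹ * x ^ 1 ∈ Pset p N := by
      rw [pow_one, mul_inv, mul_comm, ← mul_assoc]
      exact hcP
    exact Or.inr (Or.inr ⟨c, hc, hd, e1, e2, (hK _ _ _ (appC c hc0 (hQE c hc) hd e1 e2)).1 hm⟩)

/-- `γ z.1` is the nearest to `z.2 + γ z.1` among the functions in `Γ`. -/
def Near (Γ : Set (Ω → ℚ_[p])) (γ : Ω → ℚ_[p]) : Set (Ω × ℚ_[p]) :=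
  {z | ∀ γ' ∈ Γ, ‖z.2‖ ≤ ‖z.2 + (γ - γ') z.1‖}

theorem Near.lset {A : FAlg p Ω} (hA : cl A ≤ A) {Γ : Set (Ω → ℚ_[p])} (hΓ : Γ.Finite)
    (hΓA : Γ ⊆ A) {γ : Ω → ℚ_[p]} (hγ : γ ∈ A) : LSet A (Near Γ γ) := by
  refine BoolGen.all_mem hΓ (P := fun γ' (z : Ω × ℚ_[p]) => ‖z.2‖ ≤ ‖z.2 + (γ - γ') z.1‖) fun γ' hγ' => ?_
  refine BoolGen.congr (shiftNear hA BoolGen.univ (A.sub_mem hγ (hΓA hγ'))) fun z => ?_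
  simp

/-- `T` becomes simple near every center. -/
def GoodT (A : FAlg p Ω) (Γ : Set (Ω → ℚ_[p])) (T : Set (Ω × ℚ_[p])) : Prop :=
  ∀ γ ∈ A, LSet A {z | z ∈ Near Γ γ ∧ (z.1, z.2 + γ z.1) ∈ T}

namespace GoodT
variable {A : FAlg p Ω} {Γ Γ' : Set (Ω → ℚ_[p])} {T T' : Set (Ω × ℚ_[p])}

theorem mono (hA : cl A ≤ A) (hΓ : Γ'.Finite) (hΓA : Γ' ⊆ A) (h : Γ ⊆ Γ') (hT : GoodT A Γ T) :
    GoodT A Γ' T := by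
  intro γ hγ
  refine BoolGen.congr (BoolGen.and (Near.lset hA hΓ hΓA hγ) (hT γ hγ)) fun z => ?_
  constructor
  · rintro ⟨h1, h2, h3⟩
    exact ⟨h1, h3⟩
  · rintro ⟨h1, h3⟩
    exact ⟨h1, fun γ' hγ' => h1 γ' (h hγ'), h3⟩

theorem compl (hA : cl A ≤ A) (hΓ : Γ.Finite) (hΓA : Γ ⊆ A) (hT : GoodT A Γ T) : GoodT A Γ Tᶜ := by
  intro γ hγ
  refine BoolGen.congr (BoolGen.and (Near.lset hA hΓ hΓA hγ) (BoolGen.not (hT γ hγ))) fun z => ?_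
  constructor
  · rintro ⟨h1, h2⟩
    exact ⟨h1, fun h => h2 ⟨h1, h⟩⟩
  · rintro ⟨h1, h3⟩
    exact ⟨h1, fun h => h3 h.2⟩

theorem inter (hT : GoodT A Γ T) (hT' : GoodT A Γ T') : GoodT A Γ (T ∩ T') := by
  intro γ hγ
  refine BoolGen.congr (BoolGen.and (hT γ hγ) (hT' γ hγ)) fun z => ?_
  constructor
  · rintro ⟨⟨h1, h2⟩, _, h3⟩
    exact ⟨h1, h2, h3⟩
  · rintro ⟨h1, h2, h3⟩
    exact ⟨⟨h1, h2⟩, h1, h3⟩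

theorem univ (hA : cl A ≤ A) (hΓ : Γ.Finite) (hΓA : Γ ⊆ A) : GoodT A Γ Set.univ := fun γ hγ =>
  BoolGen.congr (Near.lset hA hΓ hΓA hγ) fun z => by simp

theorem boolGen (hA : cl A ≤ A) (hΓ : Γ.Finite) (hΓA : Γ ⊆ A) {G : Set (Set (Ω × ℚ_[p]))}
    (hG : ∀ T ∈ G, GoodT A Γ T) (hT : BoolGen G T) : GoodT A Γ T := by
  induction hT with
  | base T h => exact hG T h
  | univ => exact univ hA hΓ hΓA
  | compl T _ ih => exact ih.compl hA hΓ hΓA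
  | inter T T' _ _ ih ih' => exact ih.inter ih'

/-- Comparison of distances to the centers. -/
theorem cmp (hA : cl A ≤ A) (hΓ : Γ.Finite) (hΓA : Γ ⊆ A) {γ₁ γ₂ : Ω → ℚ_[p]} (h1 : γ₁ ∈ Γ)
    (h2 : γ₂ ∈ Γ) : GoodT A Γ {z | ‖z.2 - γ₁ z.1‖ ≤ ‖z.2 - γ₂ z.1‖} := by
  intro γ hγ
  have e1 := A.sub_mem hγ (hΓA h1)
  have e2 := A.sub_mem hγ (hΓA h2)
  have l1 : LSet A {z | ‖(γ - γ₁) z.1‖ ≤ ‖z.2‖} := by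
    have := LSet.norm_le (A := A) e1 (const_mem A 1) 0 1
    refine BoolGen.congr this fun z => ?_
    simp
  refine BoolGen.congr (BoolGen.and (Near.lset hA hΓ hΓA hγ) (BoolGen.or l1
    (LSet.fst (DefS.norm_le e1 e2)))) ?_
  rintro ⟨ω, x⟩
  refine and_congr_right fun hN => ?_
  have n1 := hN γ₁ h1
  have n2 := hN γ₂ h2
  have key : ∀ d : ℚ_[p], ‖x‖ ≤ ‖x + d‖ → ‖x + d‖ = max ‖x‖ ‖d‖ := by
    intro d hd
    rcases eq_or_ne ‖x‖ ‖d‖ with h | h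
    · refine le_antisymm (na_add _ _) ?_
      rwa [← h, max_self]
    · exact Padic.add_eq_max_of_ne h
  have k1 := key _ n1
  have k2 := key _ n2
  have s1 : x + γ ω - γ₁ ω = x + (γ - γ₁) ω := by rw [Pi.sub_apply]; ring
  have s2 : x + γ ω - γ₂ ω = x + (γ - γ₂) ω := by rw [Pi.sub_apply]; ring
  simp only [Set.mem_ofPred_eq, s1, s2]
  rw [k1, k2, max_le_iff, le_max_iff, le_max_iff]
  simp

end GoodT

theorem exists_goodT {X : Sp p} {T : Set (X.T × ℚ_[p])} (hT : DefS X.poly.A T) :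
    ∃ Γ : Set (X.T → ℚ_[p]), Γ.Finite ∧ Γ ⊆ X.A ∧ GoodT X.A Γ T := by
  have hT' := DefS.of_cl hT
  have hA := X.closed
  clear hT
  induction hT' with
  | base T h =>
    obtain ⟨f, hf, n, hn, rfl⟩ := h
    obtain ⟨F, hF⟩ := exists_ev_of_mem_poly hf
    obtain ⟨k, hk1, hk⟩ := exists_app_Pset (p := p) n hn
    obtain ⟨ι, hι, C, γ', h, e, H, hc⟩ := prep_all F.natDegree X.T X.A hA F le_rfl k
    refine ⟨Set.range γ', Set.finite_range _, by rintro _ ⟨i, rfl⟩; exact (H i).2.1, fun γ hγ => ?_⟩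
    have hE : ∀ i, LSet X.A {z | z ∈ C i ∧ h i z.1 * z.2 ^ e i ∈ Pset p n} := fun i =>
      BoolGen.and (H i).1 (LSet.mul_pow (H i).2.2.1 _ hn)
    have hN := Near.lset hA (Γ := Set.range γ') (Set.finite_range _)
      (by rintro _ ⟨i, rfl⟩; exact (H i).2.1) hγ
    refine BoolGen.congr (BoolGen.and hN (BoolGen.ex_finite fun i =>
      shiftNear hA (hE i) (X.A.sub_mem hγ (H i).2.1))) ?_
    rintro ⟨ω, x⟩
    refine and_congr_right fun hNx => ?_
    have hs : ∀ i, x + (γ - γ' i) ω + γ' i ω = x + γ ω := by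
      intro i; rw [Pi.sub_apply]; ring
    constructor
    · rintro ⟨i, _, h1, h2⟩
      have := (H i).2.2.2 ω _ h1
      change f _ ∈ Pset p n
      rw [hF, ← hs i]
      exact (hk _ _ this).2 h2
    · intro hm
      change f _ ∈ Pset p n at hm
      rw [hF] at hm
      obtain ⟨i, hi⟩ := hc ω (x + γ ω) trivial
      have e1 : x + γ ω - γ' i ω = x + (γ - γ' i) ω := by rw [Pi.sub_apply]; ring
      rw [e1] at hi
      have := (H i).2.2.2 ω _ hi
      rw [hs i] at this
      exact ⟨i, hNx _ ⟨i, rfl⟩, hi, (hk _ _ this).1 hm⟩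
  | univ => exact ⟨∅, Set.finite_empty, Set.empty_subset _, GoodT.univ hA Set.finite_empty (Set.empty_subset _)⟩
  | compl T _ ih =>
    obtain ⟨Γ, h1, h2, h3⟩ := ih
    exact ⟨Γ, h1, h2, h3.compl hA h1 h2⟩
  | inter T T' _ _ ih ih' =>
    obtain ⟨Γ, h1, h2, h3⟩ := ih
    obtain ⟨Γ', h1', h2', h3'⟩ := ih'
    have a := h1.union h1'
    have b := Set.union_subset h2 h2'
    exact ⟨Γ ∪ Γ', a, b, (h3.mono hA a b Set.subset_union_left).inter
      (h3'.mono hA a b Set.subset_union_right)⟩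

end
end PadicSub
end

section
/-! ## Cell decomposition -/

namespace PadicSub
section
variable {p : ℕ} [Fact p.Prime] {Ω : Type}
local notation "ϖ" => (p : ℚ_[p])
open Polynomial

theorem BoolGen.finite_supp {α : Type*} {G : Set (Set α)} {S : Set α} (hS : BoolGen G S) :
    ∃ F ⊆ G, F.Finite ∧ ∀ x y, (∀ T ∈ F, x ∈ T ↔ y ∈ T) → (x ∈ S ↔ y ∈ S) := by
  induction hS with
  | base S h => exact ⟨{S}, by simpa using h, Set.finite_singleton _, fun x y hxy => hxy S rfl⟩
  | univ => exact ⟨∅, Set.empty_subset _, Set.finite_empty, fun x y _ => by simp⟩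
  | compl S _ ih =>
    obtain ⟨F, h1, h2, h3⟩ := ih
    exact ⟨F, h1, h2, fun x y hxy => not_congr (h3 x y hxy)⟩
  | inter S S' _ _ ih ih' =>
    obtain ⟨F, h1, h2, h3⟩ := ih
    obtain ⟨F', h1', h2', h3'⟩ := ih'
    exact ⟨F ∪ F', Set.union_subset h1 h1', h2.union h2', fun x y hxy =>
      and_congr (h3 x y fun T hT => hxy T (Or.inl hT)) (h3' x y fun T hT => hxy T (Or.inr hT))⟩

/-- Choosing functions on a finite cover. -/
theorem exists_cover {A : FAlg p Ω} (hA : cl A ≤ A) {ι : Type*} {I : Set ι} (hI : I.Finite)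
    {S : ι → Set Ω} (hS : ∀ i ∈ I, DefS A (S i)) (hcov : ∀ ω, ∃ i ∈ I, ω ∈ S i)
    {P : Ω → ℚ_[p] → Prop} (h : ∀ i ∈ I, ∃ g ∈ A, ∀ ω ∈ S i, P ω (g ω)) : ∃ g ∈ A, ∀ ω, P ω (g ω) := by
  classical
  have key : ∀ J : Set ι, J.Finite → J ⊆ I → ∃ g ∈ A, ∀ i ∈ J, ∀ ω ∈ S i, P ω (g ω) := by
    intro J hJ
    induction J, hJ using Set.Finite.induction_on with
    | empty => exact fun _ => ⟨0, A.zero_mem, by simp⟩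
    | insert _ _ ih =>
      rename_i a J _ _
      intro hJI
      obtain ⟨g, hg, H⟩ := ih fun x hx => hJI (Or.inr hx)
      obtain ⟨g', hg', H'⟩ := h a (hJI (Or.inl rfl))
      refine ⟨_, hA (cl_ite (hS a (hJI (Or.inl rfl))) (le_cl _ hg') (le_cl _ hg)), ?_⟩
      intro i hi ω hω
      by_cases hωa : ω ∈ S a
      · simpa only [if_pos hωa] using H' ω hωa
      · rcases hi with rfl | hi
        · exact absurd hω hωa
        · simpa only [if_neg hωa] using H i hi ω hω
  obtain ⟨g, hg, H⟩ := key I hI le_rfl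
  exact ⟨g, hg, fun ω => by
    obtain ⟨i, hi, hω⟩ := hcov ω
    exact H i hi ω hω⟩

theorem exists_ceil {r : ℕ} (hr : 1 ≤ r) (e : ℤ) : ∃ t : ℤ, ∀ j : ℤ, e ≤ r * j ↔ t ≤ j := by
  refine ⟨-((-e) / r), fun j => ?_⟩
  have h := Int.le_ediv_iff_mul_le (a := -j) (b := -e) (c := (r : ℤ)) (by exact_mod_cast hr)
  constructor
  · intro h1
    have := h.2 (by linarith)
    linarith
  · intro h1
    have := h.1 (by linarith)
    linarith

theorem exists_ball_root {r : ℕ} (hr : 1 ≤ r) {μ : ℚ_[p]} (hμ : μ ≠ 0) :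
    ∃ t : ℤ, ∀ u : ℚ_[p], ‖u‖ ^ r ≤ ‖μ‖ ↔ ‖u‖ ≤ ‖ϖ ^ t‖ := by
  obtain ⟨e, he⟩ := exists_valuation_norm μ hμ
  obtain ⟨t, ht⟩ := exists_ceil hr e
  refine ⟨t, fun u => ?_⟩
  by_cases hu : u = 0
  · subst hu
    rw [norm_zero, zero_pow (by omega)]
    exact iff_of_true (norm_nonneg _) (norm_nonneg _)
  obtain ⟨j, hj⟩ := exists_valuation_norm u hu
  rw [he, hj, norm_ppow_zle, ← norm_pow, ← zpow_natCast, ← zpow_mul, norm_ppow_zle, ← ht, mul_comm]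

theorem exists_norm_root {A : FAlg p Ω} (hA : cl A ≤ A) {c : Ω → ℚ_[p]} (hc : c ∈ A) {r : ℕ} (hr : 1 ≤ r) :
    ∃ b ∈ A, ∀ (ω : Ω) (x : ℚ_[p]), ‖x‖ ^ r ≤ ‖c ω‖ ↔ ‖x‖ ≤ ‖b ω‖ := by
  obtain ⟨K, hK1, hK⟩ := exists_fine (p := p) r hr
  obtain ⟨N, hN, hNK⟩ := exists_Pset_app (p := p) K
  have hfine : ∀ ζ : ℚ_[p], ζ ^ r = 1 → ζ ∈ Pset p N → ζ = 1 := fun ζ h1 h2 => hK ζ h1 (hNK _ _ (by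
    rw [norm_one]
    exact (pow_eq_one_iff_of_nonneg (norm_nonneg _) (show r ≠ 0 by omega)).1 (by rw [← norm_pow, h1, norm_one]))
    (by simpa using h2))
  have hrN : 0 < r * N := by positivity
  obtain ⟨L, hL, hL0, hrep⟩ := exists_reps (p := p) (r * N) hrN
  refine exists_cover hA (I := insert 0 L) (hL.insert _) (S := fun ρ => {ω | (ρ = 0 ∧ c ω = 0) ∨ ρ * c ω ∈ Pset p (r * N)})
    (P := fun ω b => ∀ x : ℚ_[p], ‖x‖ ^ r ≤ ‖c ω‖ ↔ ‖x‖ ≤ ‖b‖) ?_ ?_ ?_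
  · exact fun ρ _ => BoolGen.or (BoolGen.and (BoolGen.const _) (DefS.eq_zero hc))
      (DefS.pow (A.mul_mem (const_mem A ρ) hc) hrN)
  · intro ω
    by_cases h : c ω = 0
    · exact ⟨0, Or.inl rfl, Or.inl ⟨rfl, h⟩⟩
    · obtain ⟨ρ, hρ, h1⟩ := hrep _ h
      exact ⟨ρ, Or.inr hρ, Or.inr h1⟩
  · intro ρ _
    by_cases hρ : ρ = 0
    · subst hρ
      refine ⟨0, A.zero_mem, ?_⟩
      rintro ω (⟨_, h⟩ | h) x
      · rw [h, Pi.zero_apply, norm_zero]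
        constructor
        · intro h
          exact (pow_eq_zero_iff (by omega)).1 (le_antisymm h (by positivity)) |>.le
        · intro h
          rw [le_antisymm h (norm_nonneg _), zero_pow (by omega)]
      · rw [zero_mul] at h
        exact absurd rfl (ne_zero_of_mem_Pset h)
    obtain ⟨y, hy, H⟩ := exists_root_fn hA (prep_all r) hr (by omega) (A.mul_mem (const_mem A ρ) hc) hN hfine
      (one_ne_zero)
    obtain ⟨t, ht⟩ := exists_ball_root hr (inv_ne_zero hρ)
    refine ⟨_, A.mul_mem (const_mem A (ϖ ^ t)) hy, ?_⟩
    rintro ω (⟨h, _⟩ | h) x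
    · exact absurd h hρ
    have h1 := (H ω (by simpa using h)).1
    have hc0 : c ω ≠ 0 := fun h0 => ne_zero_of_mem_Pset h (by rw [h0, mul_zero])
    have h1' : y ω ^ r = ρ * c ω := h1
    have hy0 : y ω ≠ 0 := by
      intro h0
      rw [h0, zero_pow (by omega)] at h1'
      exact mul_ne_zero hρ hc0 h1'.symm
    have hyp := norm_pos_iff.2 hy0
    have e1 : c ω = ρ⁻¹ * y ω ^ r := by rw [h1']; field_simp
    have := ht (x * (y ω)⁻¹)
    rw [norm_mul, norm_inv, ← div_eq_mul_inv, div_pow, div_le_iff₀ (pow_pos hyp r), div_le_iff₀ hyp, ← norm_pow (y ω),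
      ← norm_mul, ← e1, ← norm_mul] at this
    exact this

/-- Simpler generators. -/
def LGen' (A : FAlg p Ω) : Set (Set (Ω × ℚ_[p])) :=
  {C | ∃ (S : Set Ω) (b : Ω → ℚ_[p]) (c : ℚ_[p]) (n : ℕ), DefS A S ∧ b ∈ A ∧ 0 < n ∧
    (C = {z | z.1 ∈ S} ∨ C = {z | ‖z.2‖ ≤ ‖b z.1‖} ∨ C = {z | c * z.2 ∈ Pset p n})}

theorem LSet.simple {A : FAlg p Ω} (hA : cl A ≤ A) {L : Set (Ω × ℚ_[p])} (hL : LSet A L) :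
    BoolGen (LGen' A) L := by
  have gS : ∀ {S : Set Ω}, DefS A S → BoolGen (LGen' A) {z | z.1 ∈ S} := fun {S} hS =>
    BoolGen.base _ ⟨S, 0, 0, 1, hS, A.zero_mem, one_pos, Or.inl rfl⟩
  have gb : ∀ {b : Ω → ℚ_[p]}, b ∈ A → BoolGen (LGen' A) {z | ‖z.2‖ ≤ ‖b z.1‖} := fun {b} hb =>
    BoolGen.base _ ⟨Set.univ, b, 0, 1, BoolGen.univ, hb, one_pos, Or.inr (Or.inl rfl)⟩
  have gc : ∀ (c : ℚ_[p]) {n : ℕ}, 0 < n → BoolGen (LGen' A) {z | c * z.2 ∈ Pset p n} := fun c n hn =>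
    BoolGen.base _ ⟨Set.univ, 0, c, n, BoolGen.univ, A.zero_mem, hn, Or.inr (Or.inr rfl)⟩
  have g0 : BoolGen (LGen' A) {z | z.2 ≠ 0} := by
    have := gc 1 one_pos
    simpa [mem_Pset_one] using this
  have hinv : ∀ {f : Ω → ℚ_[p]}, f ∈ A → (fun ω => (f ω)⁻¹) ∈ A := fun hf => hA (cl_inv (le_cl _ hf))
  refine BoolGen.mono ?_ hL
  rintro C (⟨S, hS, rfl⟩ | ⟨a, ha, b, hb, i, j, rfl⟩ | ⟨c, n, hn, rfl⟩)
  · exact gS hS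
  · -- the value at zero
    have h00 : BoolGen (LGen' A) {z | ‖a z.1 * 0 ^ i‖ ≤ ‖b z.1 * 0 ^ j‖} :=
      gS (S := {ω | ‖a ω * 0 ^ i‖ ≤ ‖b ω * 0 ^ j‖}) (DefS.norm_le (f := fun ω => a ω * 0 ^ i) (g := fun ω => b ω * 0 ^ j)
        (A.mul_mem ha (const_mem A _)) (A.mul_mem hb (const_mem A _)))
    suffices h : ∃ D, BoolGen (LGen' A) D ∧ ∀ ω x, x ≠ 0 →
        ((ω, x) ∈ D ↔ ‖a ω * x ^ i‖ ≤ ‖b ω * x ^ j‖) by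
      obtain ⟨D, hD, h⟩ := h
      refine BoolGen.congr (BoolGen.or (BoolGen.and (BoolGen.not g0) h00) (BoolGen.and g0 hD)) ?_
      rintro ⟨ω, x⟩
      by_cases hx : x = 0
      · subst hx; simp
      · have := h ω x hx
        simp only [Set.mem_ofPred_eq, hx, ne_eq, not_false_eq_true, not_true_eq_false, false_and, true_and, false_or]
        exact this
    rcases le_or_gt j i with hji | hij
    · obtain ⟨r, rfl⟩ := Nat.exists_eq_add_of_le hji
      rcases Nat.eq_zero_or_pos r with rfl | hr
      · refine ⟨_, gS (DefS.norm_le ha hb), fun ω x hx => ?_⟩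
        rw [add_zero, norm_mul, norm_mul]
        exact (mul_le_mul_iff_left₀ (norm_pos_iff.2 (pow_ne_zero _ hx))).symm
      · obtain ⟨β, hβ, H⟩ := exists_norm_root hA (A.mul_mem hb (hinv ha)) hr
        refine ⟨_, BoolGen.or (gS (DefS.eq_zero ha)) (gb hβ), fun ω x hx => ?_⟩
        by_cases h0 : a ω = 0
        · exact iff_of_true (Or.inl h0) (by rw [h0, zero_mul, norm_zero]; exact norm_nonneg _)
        have hap := norm_pos_iff.2 h0
        simp only [Set.mem_ofPred_eq, h0, false_or]
        rw [← H, Pi.mul_apply, norm_mul, norm_inv, ← div_eq_mul_inv, le_div_iff₀ hap, pow_add, norm_mul, norm_mul,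
          norm_mul, mul_left_comm, mul_comm ‖b ω‖, mul_le_mul_iff_right₀ (norm_pos_iff.2 (pow_ne_zero _ hx)), norm_pow,
          mul_comm]
    · obtain ⟨r, rfl⟩ := Nat.exists_eq_add_of_le hij.le
      have hr : 1 ≤ r := by omega
      obtain ⟨β, hβ, H⟩ := exists_norm_root hA (A.mul_mem (const_mem A ϖ) (A.mul_mem ha (hinv hb))) hr
      refine ⟨_, BoolGen.or (BoolGen.and (gS (DefS.eq_zero hb)) (gS (DefS.eq_zero ha)))
        (BoolGen.and (BoolGen.not (gS (DefS.eq_zero hb))) (BoolGen.not (gb hβ))), fun ω x hx => ?_⟩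
      by_cases h0 : b ω = 0
      · refine ⟨?_, fun h => Or.inl ⟨h0, ?_⟩⟩
        · rintro (⟨_, h⟩ | ⟨h, _⟩)
          · rw [show a ω = 0 from h, zero_mul, norm_zero]; exact norm_nonneg _
          · exact absurd h0 h
        · rw [h0, zero_mul, norm_zero, norm_le_zero_iff] at h
          exact (mul_eq_zero.1 h).resolve_right (pow_ne_zero _ hx)
      have hbp := norm_pos_iff.2 h0
      have hxp := norm_pos_iff.2 (pow_ne_zero r hx)
      simp only [Set.mem_ofPred_eq, h0, false_or, false_and, not_false_eq_true, true_and]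
      rw [← H, not_le, pow_add, norm_mul (a ω), norm_mul (b ω), norm_mul (x ^ i), mul_left_comm ‖b ω‖, mul_comm ‖a ω‖,
        mul_le_mul_iff_right₀ (norm_pos_iff.2 (pow_ne_zero _ hx)), mul_comm ‖b ω‖, ← div_le_iff₀ hbp]
      simp only [Pi.mul_apply]
      rw [norm_mul, norm_mul, norm_inv, ← div_eq_mul_inv, ← norm_pow, ← norm_div]
      constructor
      · intro h
        by_contra hcon
        push Not at hcon
        exact absurd (norm_lt_imp_le hcon) (not_le.2 h)
      · intro h
        have h1 := (norm_p_lt_one (p := p))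
        have h2 := norm_p_pos (p := p)
        nlinarith [norm_nonneg (a ω / b ω)]
  · exact gc c hn

theorem exists_reps_HS (M k : ℕ) (hM : 1 ≤ M) : ∃ L : Set ℚ_[p], L.Finite ∧ (∀ c ∈ L, c ≠ 0) ∧
    ∀ x : ℚ_[p], x ≠ 0 → ∃ c ∈ L, c * x ∈ HS p M k := by
  obtain ⟨N, hN, h⟩ := exists_Pset_HS (p := p) M k hM
  obtain ⟨L, hL, hL0, hrep⟩ := exists_reps (p := p) N hN
  refine ⟨L, hL, hL0, fun x hx => ?_⟩
  obtain ⟨c, hc, h1⟩ := hrep x hx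
  exact ⟨c, hc, h h1⟩

/-- Normalising a bound. -/
theorem exists_normal {X : Sp p} {M k : ℕ} (hM : 1 ≤ M) (hk : 1 ≤ k) {l : ℚ_[p]} (hl : l ≠ 0)
    {b : X.T → ℚ_[p]} (hb : b ∈ X.A) : ∃ b' ∈ X.A, ∀ ω, (b' ω = 0 ∨ l * b' ω ∈ HS p M k) ∧
      ∀ x, l * x ∈ HS p M k → (‖x‖ ≤ ‖b ω‖ ↔ ‖x‖ ≤ ‖b' ω‖) := by
  obtain ⟨L, hL, hL0, hrep⟩ := exists_reps_HS (p := p) M k hM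
  refine exists_cover X.closed (I := insert 0 L) (hL.insert _)
    (S := fun ρ => {ω | (ρ = 0 ∧ b ω = 0) ∨ ρ * b ω ∈ HS p M k})
    (P := fun ω b' => (b' = 0 ∨ l * b' ∈ HS p M k) ∧
      ∀ x, l * x ∈ HS p M k → (‖x‖ ≤ ‖b ω‖ ↔ ‖x‖ ≤ ‖b'‖)) ?_ ?_ ?_
  · exact fun ρ _ => BoolGen.or (BoolGen.and (BoolGen.const _) (DefS.eq_zero hb))
      (HS.kd hM hk X _ (X.A.mul_mem (const_mem X.A ρ) hb))
  · intro ω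
    by_cases h : b ω = 0
    · exact ⟨0, Or.inl rfl, Or.inl ⟨rfl, h⟩⟩
    · obtain ⟨ρ, hρ, h1⟩ := hrep _ h
      exact ⟨ρ, Or.inr hρ, Or.inr h1⟩
  · intro μ _
    by_cases hμ : μ = 0
    · subst hμ
      refine ⟨0, X.A.zero_mem, ?_⟩
      rintro ω (⟨_, h⟩ | h)
      · rw [h]
        exact ⟨Or.inl rfl, fun x _ => Iff.rfl⟩
      · rw [zero_mul] at h
        exact absurd rfl (HS.ne_zero hk h)
    obtain ⟨e, he⟩ := exists_valuation_norm (l * μ⁻¹) (mul_ne_zero hl (inv_ne_zero hμ))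
    obtain ⟨t, ht⟩ := exists_ceil hM e
    refine ⟨_, X.A.mul_mem (const_mem X.A (l⁻¹ * μ * ϖ ^ ((M : ℤ) * t))) hb, ?_⟩
    rintro ω (⟨h, _⟩ | h)
    · exact absurd h hμ
    have e1 : l * (l⁻¹ * μ * ϖ ^ ((M : ℤ) * t) * b ω) = μ * b ω * ϖ ^ ((M : ℤ) * t) := by
      field_simp
    refine ⟨Or.inr ?_, fun x hx => ?_⟩
    · change l * (l⁻¹ * μ * ϖ ^ ((M : ℤ) * t) * b ω) ∈ HS p M k
      rw [e1]
      exact HS.mul h (HS.zp t)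
    · change _ ↔ ‖x‖ ≤ ‖l⁻¹ * μ * ϖ ^ ((M : ℤ) * t) * b ω‖
      have hlp := norm_pos_iff.2 hl
      have h0 := HS.ne_zero hk h
      have hp0 := norm_pos_iff.2 h0
      obtain ⟨i, hi⟩ := HS.mul hx (HS.inv hk h)
      have hn := hi.norm_eq hk
      have e2 : ‖x‖ ≤ ‖b ω‖ ↔ ‖l * x * (μ * b ω)⁻¹‖ ≤ ‖l * μ⁻¹‖ := by
        have hmp := norm_pos_iff.2 hμ
        rw [norm_mul _ (μ * b ω)⁻¹, norm_inv (μ * b ω), ← div_eq_mul_inv, div_le_iff₀ hp0, ← norm_mul]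
        have : l * μ⁻¹ * (μ * b ω) = l * b ω := by field_simp
        rw [this, norm_mul, norm_mul, mul_le_mul_iff_right₀ hlp]
      have e3 : ‖x‖ ≤ ‖l⁻¹ * μ * ϖ ^ ((M : ℤ) * t) * b ω‖ ↔
          ‖l * x * (μ * b ω)⁻¹‖ ≤ ‖ϖ ^ ((M : ℤ) * t)‖ := by
        rw [norm_mul _ (μ * b ω)⁻¹, norm_inv (μ * b ω), ← div_eq_mul_inv, div_le_iff₀ hp0, ← norm_mul,
          mul_comm ((p : ℚ_[p]) ^ _), ← e1, norm_mul l, norm_mul l, mul_le_mul_iff_right₀ hlp]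
      rw [e2, e3, hn, he, norm_ppow_zle, norm_ppow_zle, ht, mul_le_mul_iff_of_pos_left (by exact_mod_cast hM)]

theorem LSet.def_poly {X : Sp p} {L : Set (X.T × ℚ_[p])} (hL : LSet X.A L) : DefS X.poly.A L := by
  refine BoolGen.mono ?_ hL
  rintro C (⟨S, hS, rfl⟩ | ⟨a, ha, b, hb, i, j, rfl⟩ | ⟨c, n, hn, rfl⟩)
  · exact poly_fst.def hS
  · exact DefS.norm_le (X.poly.A.mul_mem (poly_fst' ha) (X.poly.A.pow_mem poly_snd i))
      (X.poly.A.mul_mem (poly_fst' hb) (X.poly.A.pow_mem poly_snd j))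
  · exact DefS.pow (poly_lin (f := fun _ => c) (const_mem X.A c)) hn

end
end PadicSub
end

section
/-! ## The class of a bounded definable set -/

namespace PadicSub
section
variable {p : ℕ} [Fact p.Prime] {Ω : Type}

theorem MX.cell {X : Sp p} {V : Set X.T} (hV : DefS X.A V) {M k : ℕ} (hM : 1 ≤ M) (hk : 1 ≤ k) {l : ℚ_[p]}
    {α β : X.T → ℚ_[p]} (hα : α ∈ X.A) (hβ : β ∈ X.A) (hβH : ∀ ω ∈ V, l * β ω ∈ HS p M k)
    (hαH : (∀ ω ∈ V, α ω = 0) ∨ ∀ ω ∈ V, l * α ω ∈ HS p M k ∧ ‖α ω‖ < ‖β ω‖) :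
    X.poly.c {z : X.T × ℚ_[p] | z.1 ∈ V ∧ l * z.2 ∈ HS p M k ∧ ‖α z.1‖ < ‖z.2‖ ∧ ‖z.2‖ ≤ ‖β z.1‖} ∈ MX X := by
  have hβ0 : ∀ ω ∈ V, β ω ≠ 0 := fun ω hω h => HS.ne_zero hk (hβH ω hω) (by rw [h, mul_zero])
  have hγ : (fun ω => α ω * (β ω)⁻¹) ∈ X.A := X.A.mul_mem hα (poly_inv hβ)
  have e1 : X.poly.c {z : X.T × ℚ_[p] | z.1 ∈ V ∧ l * z.2 ∈ HS p M k ∧ ‖α z.1‖ < ‖z.2‖ ∧ ‖z.2‖ ≤ ‖β z.1‖} =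
      X.poly.c {z : X.T × ℚ_[p] | z.1 ∈ V ∧ z.2 ∈ WS p M k ∧ ‖α z.1 * (β z.1)⁻¹‖ < ‖z.2‖} := by
    refine c_poly_eq (g := fun z => (β z.1)⁻¹ * z.2) (h := fun z => β z.1 * z.2)
      (poly_lin (f := fun ω => (β ω)⁻¹) (poly_inv hβ)) (poly_lin hβ) ?_ ?_
    · rintro ω x ⟨hω, h1, h2, h3⟩
      have h0 := hβ0 ω hω
      have hp := norm_pos_iff.2 h0
      have : l * β ω * ((β ω)⁻¹ * x) = l * x := by field_simp
      refine ⟨⟨hω, ⟨(HS.mul_iff hk (hβH ω hω)).1 (by rw [this]; exact h1), ?_⟩, ?_⟩, ?_⟩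
      · change ‖(β ω)⁻¹ * x‖ ≤ ‖(1 : ℚ_[p])‖
        rw [norm_mul, norm_inv, norm_one, ← div_eq_inv_mul, div_le_one hp]
        exact h3
      · change ‖_‖ < ‖(β ω)⁻¹ * x‖
        rw [mul_comm, norm_mul, norm_mul]
        exact mul_lt_mul_of_pos_left h2 (norm_pos_iff.2 (inv_ne_zero h0))
      · change β ω * ((β ω)⁻¹ * x) = x
        field_simp
    · rintro ω x ⟨hω, ⟨h1, h2⟩, h3⟩
      have h0 := hβ0 ω hω
      have hp := norm_pos_iff.2 h0
      refine ⟨⟨hω, ?_, ?_, ?_⟩, ?_⟩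
      · change l * (β ω * x) ∈ _
        rw [← mul_assoc]
        exact HS.mul (hβH ω hω) h1
      · change ‖α ω‖ < ‖β ω * x‖
        have h3' : ‖α ω * (β ω)⁻¹‖ < ‖x‖ := h3
        rwa [norm_mul, norm_inv, ← div_eq_mul_inv, div_lt_iff₀ hp, mul_comm, ← norm_mul] at h3'
      · change ‖β ω * x‖ ≤ ‖β ω‖
        rw [norm_mul]
        exact mul_le_of_le_one_right (norm_nonneg _) (by simpa using h2)
      · change (β ω)⁻¹ * (β ω * x) = x
        field_simp
  rw [e1]
  rcases hαH with h | h
  · have : {z : X.T × ℚ_[p] | z.1 ∈ V ∧ z.2 ∈ WS p M k ∧ ‖α z.1 * (β z.1)⁻¹‖ < ‖z.2‖} = X.pr V (WS p M k) := by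
      ext ⟨ω, x⟩
      constructor
      · rintro ⟨h1, h2, _⟩
        exact ⟨h1, h2⟩
      · rintro ⟨h1, h2⟩
        refine ⟨h1, h2, ?_⟩
        change ‖α ω * (β ω)⁻¹‖ < ‖x‖
        rw [h ω h1, zero_mul, norm_zero]
        exact norm_pos_iff.2 (HS.ne_zero hk h2.1)
    refine Eq.subst (motive := fun s => X.poly.c s ∈ MX X) this.symm ?_
    change X.pc V (WS p M k) ∈ _
    rw [w_eq_z hV hM hk]
    exact MX.z hV
  · rw [annulus hV hM hk hγ ?_]
    · exact MX.z hV
    · intro ω hω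
      obtain ⟨h1, h2⟩ := h ω hω
      have h0 := hβ0 ω hω
      have hl : l ≠ 0 := fun h => HS.ne_zero hk h1 (by rw [h, zero_mul])
      constructor
      · have := HS.mul h1 (HS.inv hk (hβH ω hω))
        have e : l * α ω * (l * β ω)⁻¹ = α ω * (β ω)⁻¹ := by field_simp
        rwa [e] at this
      · rw [norm_mul, norm_inv, ← div_eq_mul_inv, div_lt_one (norm_pos_iff.2 h0)]
        exact h2

theorem lset_mem {X : Sp p} {L : Set (X.T × ℚ_[p])} (hL : LSet X.A L) {b₀ : X.T → ℚ_[p]} (hb₀ : b₀ ∈ X.A)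
    (hLb : ∀ z ∈ L, ‖z.2‖ ≤ ‖b₀ z.1‖) : X.poly.c L ∈ MX X := by
  classical
  have hLd := hL.def_poly
  obtain ⟨F, hFG, hF, hdata⟩ := (hL.simple X.closed).finite_supp
  have hFt := hF.to_subtype
  have hch : ∀ T : F, T.1 ∈ LGen' X.A := fun T => hFG T.2
  choose S b c n hS hb hn hform using hch
  have hfin : Fintype F := Fintype.ofFinite F
  obtain ⟨N, hN⟩ : ∃ N, N = ∏ T, n T := ⟨_, rfl⟩
  have hN1 : 1 ≤ N := by rw [hN]; exact Finset.prod_pos fun T _ => hn T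
  have hdvd : ∀ T, n T ∣ N := fun T => hN ▸ Finset.dvd_prod_of_mem n (Finset.mem_univ T)
  obtain ⟨k, hk, hkN⟩ := exists_app_Pset (p := p) N hN1
  have hHP : ∀ x ∈ HS p N k, x ∈ Pset p N := by
    rintro x ⟨i, hi⟩
    refine (hkN _ _ hi).2 ?_
    rw [mul_comm, zpow_mul, zpow_natCast]
    exact pow_mem_Pset (ppow_ne i) N
  obtain ⟨Λ, hΛ, hΛ0, hrep⟩ := exists_reps_HS (p := p) N k hN1
  have hΛt := hΛ.to_subtype
  have hlin : ∀ l : ℚ_[p], (fun z : X.T × ℚ_[p] => l * z.2) ∈ X.poly.A := fun l =>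
    poly_lin (f := fun _ => l) (const_mem X.A l)
  -- first splitting
  refine split_by X.poly (MX X) (ι := Option Λ) (B := fun o => o.elim {z | z.2 = 0} fun l => {z | l.1 * z.2 ∈ HS p N k})
    ?_ hLd fun z hz => ?_
  · rintro (_ | l)
    · exact DefS.eq_zero (poly_snd (X := X))
    · exact HS.kd hN1 hk X.poly _ (hlin l)
  by_cases hz0 : z.2 = 0
  · have hV : DefS X.A {ω | (ω, (0 : ℚ_[p])) ∈ L} := hL.subst X.A.zero_mem
    refine Eq.subst (motive := fun q => q ∈ MX X) ?_ (MX.pt hV)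
    unfold Sp.pc
    congr 1
    ext ⟨ω, x⟩
    constructor
    · rintro ⟨h1, h2⟩
      obtain rfl : x = 0 := h2
      refine ⟨h1, ?_⟩
      rintro (_ | l)
      · exact iff_of_true rfl hz0
      · exact iff_of_false (fun h => HS.ne_zero hk h (mul_zero _)) (fun h => HS.ne_zero hk h (by rw [hz0, mul_zero]))
    · rintro ⟨h1, h2⟩
      obtain rfl : x = 0 := (h2 none).2 hz0
      exact ⟨h1, rfl⟩
  obtain ⟨l, hl, hlz⟩ := hrep z.2 hz0
  have hl0 := hΛ0 l hl
  have hset : {y : X.T × ℚ_[p] | y ∈ L ∧ ∀ o : Option Λ, y ∈ (o.elim {z : X.T × ℚ_[p] | z.2 = 0}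
      fun l => {z | l.1 * z.2 ∈ HS p N k}) ↔ z ∈ (o.elim {z : X.T × ℚ_[p] | z.2 = 0}
      fun l => {z | l.1 * z.2 ∈ HS p N k})} = {y | y ∈ L ∧ l * y.2 ∈ HS p N k} := by
    ext ⟨ω, x⟩
    constructor
    · rintro ⟨h1, h2⟩
      exact ⟨h1, (h2 (some ⟨l, hl⟩)).2 hlz⟩
    · rintro ⟨h1, h2⟩
      refine ⟨h1, ?_⟩
      have hx0 : x ≠ 0 := fun h => HS.ne_zero hk h2 (by change l * x = 0; rw [h, mul_zero])
      rintro (_ | l')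
      · exact iff_of_false hx0 hz0
      · have h3 := HS.mul h2 (HS.inv hk hlz)
        have e : l'.1 * x = l * x * (l * z.2)⁻¹ * (l'.1 * z.2) := by field_simp
        change l'.1 * x ∈ HS p N k ↔ _
        rw [e]
        exact HS.mul_iff hk h3
  refine Eq.subst (motive := fun s => X.poly.c s ∈ MX X) hset.symm ?_
  clear hset
  have hdef1 : DefS X.poly.A {y | y ∈ L ∧ l * y.2 ∈ HS p N k} :=
    BoolGen.and hLd (HS.kd hN1 hk X.poly _ (hlin l))
  -- normalised bounds
  obtain ⟨bb, hbb, hbb0, hbb1, hbb2⟩ : ∃ bb : Option (Option F) → X.T → ℚ_[p], (∀ i, bb i ∈ X.A) ∧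
      (∀ ω, bb none ω = 0) ∧ (bb (some none) = b₀) ∧ ∀ T, bb (some (some T)) = b T :=
    ⟨fun o => o.elim 0 fun o => o.elim b₀ b, by rintro (_ | _ | T); exacts [X.A.zero_mem, hb₀, hb T],
      fun _ => rfl, rfl, fun _ => rfl⟩
  have hnorm := fun i => exists_normal (X := X) hN1 hk hl0 (hbb i)
  choose b' hb' hbn using hnorm
  have hb'0 : ∀ ω, b' none ω = 0 := by
    intro ω
    rcases (hbn none ω).1 with h | h
    · exact h
    · have := ((hbn none ω).2 _ h).2 le_rfl
      rw [hbb0, norm_zero] at this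
      exact norm_le_zero_iff.1 this
  refine split_by X.poly (MX X)
    (ι := F ⊕ (Option (Option F) ⊕ (Option (Option F) × Option (Option F))))
    (B := fun o => o.elim (fun T => {z : X.T × ℚ_[p] | z.1 ∈ S T}) fun o => o.elim
      (fun i => {z | ‖z.2‖ ≤ ‖b' i z.1‖}) fun ij => {z | ‖b' ij.1 z.1‖ ≤ ‖b' ij.2 z.1‖})
    ?_ hdef1 fun z hz => ?_
  · rintro (T | i | ij)
    · exact poly_fst.def (hS T)
    · exact DefS.norm_le (poly_snd (X := X)) (poly_fst' (hb' i))
    · exact DefS.norm_le (poly_fst' (hb' ij.1)) (poly_fst' (hb' ij.2))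
  clear hz0 hlz
  obtain ⟨hzL, hzl⟩ := hz
  have hz0 : z.2 ≠ 0 := fun h => HS.ne_zero hk hzl (by rw [h, mul_zero])
  have hzp := norm_pos_iff.2 hz0
  obtain ⟨iβ, hiβ, hβmin⟩ : ∃ i, ‖z.2‖ ≤ ‖b' i z.1‖ ∧ ∀ j, ‖z.2‖ ≤ ‖b' j z.1‖ → ‖b' i z.1‖ ≤ ‖b' j z.1‖ := by
    have : ((Finset.univ : Finset (Option (Option F))).filter fun i => ‖z.2‖ ≤ ‖b' i z.1‖).Nonempty :=
      ⟨some none, by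
        rw [Finset.mem_filter]
        refine ⟨Finset.mem_univ _, ((hbn _ _).2 _ hzl).1 ?_⟩
        rw [hbb1]
        exact hLb z hzL⟩
    obtain ⟨i, hi, h⟩ := Finset.exists_min_image _ (fun i => ‖b' i z.1‖) this
    exact ⟨i, (Finset.mem_filter.1 hi).2, fun j hj => h j (Finset.mem_filter.2 ⟨Finset.mem_univ _, hj⟩)⟩
  obtain ⟨iα, hiα, hαmax⟩ : ∃ i, ‖b' i z.1‖ < ‖z.2‖ ∧ ∀ j, ‖b' j z.1‖ < ‖z.2‖ → ‖b' j z.1‖ ≤ ‖b' i z.1‖ := by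
    have : ((Finset.univ : Finset (Option (Option F))).filter fun i => ‖b' i z.1‖ < ‖z.2‖).Nonempty :=
      ⟨none, by
        rw [Finset.mem_filter]
        refine ⟨Finset.mem_univ _, ?_⟩
        rw [hb'0, norm_zero]
        exact hzp⟩
    obtain ⟨i, hi, h⟩ := Finset.exists_max_image _ (fun i => ‖b' i z.1‖) this
    exact ⟨i, (Finset.mem_filter.1 hi).2, fun j hj => h j (Finset.mem_filter.2 ⟨Finset.mem_univ _, hj⟩)⟩
  obtain ⟨V, hVe⟩ : ∃ V : Set X.T, V = {ω | (∀ T, ω ∈ S T ↔ z.1 ∈ S T) ∧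
      ∀ i j, ‖b' i ω‖ ≤ ‖b' j ω‖ ↔ ‖b' i z.1‖ ≤ ‖b' j z.1‖} := ⟨_, rfl⟩
  have hV : DefS X.A V := by
    rw [hVe]
    exact BoolGen.and (BoolGen.all_finite fun T => BoolGen.iff (hS T) (BoolGen.const _))
      (BoolGen.all_finite fun i => BoolGen.all_finite fun j => BoolGen.iff (DefS.norm_le (hb' i) (hb' j))
        (BoolGen.const _))
  have hVo : ∀ ω ∈ V, ∀ i j, ‖b' i ω‖ ≤ ‖b' j ω‖ ↔ ‖b' i z.1‖ ≤ ‖b' j z.1‖ := fun ω hω => by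
    rw [hVe] at hω; exact hω.2
  have hVz : ∀ ω ∈ V, ∀ i, b' i ω = 0 ↔ b' i z.1 = 0 := by
    intro ω hω i
    have := hVo ω hω i none
    rwa [hb'0, hb'0, norm_zero, norm_le_zero_iff, norm_le_zero_iff] at this
  have hcell := MX.cell hV hN1 hk (l := l) (hb' iα) (hb' iβ)
    (fun ω hω => ((hbn iβ ω).1).resolve_left fun h => by
      rw [(hVz ω hω iβ).1 h, norm_zero] at hiβ
      exact absurd hiβ (not_le.2 hzp))
    (by
      by_cases h0 : b' iα z.1 = 0
      · exact Or.inl fun ω hω => (hVz ω hω iα).2 h0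
      · refine Or.inr fun ω hω => ⟨((hbn iα ω).1).resolve_left fun h => h0 ((hVz ω hω iα).1 h), ?_⟩
        rw [← not_le, hVo ω hω, not_le]
        exact hiα.trans_le hiβ)
  refine Eq.subst (motive := fun s => X.poly.c s ∈ MX X) ?_ hcell
  ext ⟨ω, x⟩
  constructor
  · rintro ⟨hω, h1, h2, h3⟩
    change l * x ∈ HS p N k at h1
    change ‖b' iα ω‖ < ‖x‖ at h2
    change ‖x‖ ≤ ‖b' iβ ω‖ at h3
    have hx0 : x ≠ 0 := fun h => HS.ne_zero hk h1 (by rw [h, mul_zero])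
    have hbi : ∀ i, ‖x‖ ≤ ‖b' i ω‖ ↔ ‖z.2‖ ≤ ‖b' i z.1‖ := by
      intro i
      by_cases h : ‖z.2‖ ≤ ‖b' i z.1‖
      · exact iff_of_true (h3.trans ((hVo ω hω _ _).2 (hβmin i h))) h
      · refine iff_of_false (fun h' => ?_) h
        push Not at h
        exact absurd (h'.trans ((hVo ω hω _ _).2 (hαmax i h))) (not_le.2 h2)
    have hω' : (∀ T, ω ∈ S T ↔ z.1 ∈ S T) := by
      rw [hVe] at hω; exact hω.1
    refine ⟨⟨?_, h1⟩, ?_⟩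
    · refine (hdata (ω, x) z fun T hT => ?_).2 hzL
      have key : (ω, x) ∈ T ↔ z ∈ T := by
        rcases hform ⟨T, hT⟩ with h | h | h
        · rw [show T = _ from h]
          exact hω' _
        · rw [show T = _ from h]
          change ‖x‖ ≤ _ ↔ ‖z.2‖ ≤ _
          have h4 := hbi (some (some ⟨T, hT⟩))
          have h5 := (hbn (some (some ⟨T, hT⟩)) ω).2 x h1
          have h6 := (hbn (some (some ⟨T, hT⟩)) z.1).2 z.2 hzl
          rw [hbb2] at h5 h6
          exact h5.trans (h4.trans h6.symm)
        · rw [show T = _ from h]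
          change c _ * x ∈ Pset p _ ↔ c _ * z.2 ∈ Pset p _
          have h3 := Pset_dvd (hdvd ⟨T, hT⟩) (hHP _ (HS.mul h1 (HS.inv hk hzl)))
          have e : c ⟨T, hT⟩ * x = l * x * (l * z.2)⁻¹ * (c ⟨T, hT⟩ * z.2) := by field_simp
          rw [e]
          exact mul_mem_Pset_iff h3
      exact key
    · rintro (T | i | ij)
      · exact hω' T
      · exact hbi i
      · exact hVo ω hω _ _
  · rintro ⟨⟨h1, h2⟩, h3⟩
    have hω : ω ∈ V := by
      rw [hVe]
      exact ⟨fun T => h3 (Sum.inl T), fun i j => h3 (Sum.inr (Sum.inr (i, j)))⟩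
    refine ⟨hω, h2, ?_, ?_⟩
    · change ‖b' iα ω‖ < ‖x‖
      rw [← not_le]
      intro h
      exact absurd ((h3 (Sum.inr (Sum.inl iα))).1 h) (not_le.2 hiα)
    · exact (h3 (Sum.inr (Sum.inl iβ))).2 hiβ

theorem c_mem_MX {X : Sp p} {T : Set (X.T × ℚ_[p])} (hT : DefS X.poly.A T) (hb : ∀ z ∈ T, ‖z.2‖ ≤ 1) :
    X.poly.c T ∈ MX X := by
  classical
  have hA := X.closed
  obtain ⟨Γ, hΓ, hΓA, hgood⟩ : ∃ Γ : Set (X.T → ℚ_[p]), Γ.Finite ∧ Γ ⊆ X.A ∧ Γ.Nonempty ∧ GoodT X.A Γ T := by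
    obtain ⟨Γ, hΓ, hΓA, hgood⟩ := exists_goodT hT
    have h2 : insert 0 Γ ⊆ (X.A : Set (X.T → ℚ_[p])) := Set.insert_subset X.A.zero_mem hΓA
    exact ⟨insert 0 Γ, hΓ.insert _, h2, ⟨0, Or.inl rfl⟩, hgood.mono hA (hΓ.insert _) h2 (Set.subset_insert _ _)⟩
  obtain ⟨hne, hgood⟩ := hgood
  have hΓt := hΓ.to_subtype
  have hdist : ∀ γ ∈ Γ, (fun z : X.T × ℚ_[p] => z.2 - γ z.1) ∈ X.poly.A := fun γ hγ =>
    X.poly.A.sub_mem poly_snd (poly_fst' (hΓA hγ))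
  refine split_by X.poly (MX X) (ι := Γ × Γ)
    (B := fun i => {z : X.T × ℚ_[p] | ‖z.2 - i.1.1 z.1‖ ≤ ‖z.2 - i.2.1 z.1‖})
    (fun i => DefS.norm_le (hdist _ i.1.2) (hdist _ i.2.2)) hT fun z hz => ?_
  obtain ⟨γ, hγ, hmin⟩ := Set.exists_min_image Γ (fun γ => ‖z.2 - γ z.1‖) hΓ hne
  obtain ⟨W, hW⟩ : ∃ W : Set (X.T × ℚ_[p]), W = {y | y ∈ T ∧ ∀ i : Γ × Γ,
    y ∈ {z : X.T × ℚ_[p] | ‖z.2 - i.1.1 z.1‖ ≤ ‖z.2 - i.2.1 z.1‖} ↔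
    z ∈ {z : X.T × ℚ_[p] | ‖z.2 - i.1.1 z.1‖ ≤ ‖z.2 - i.2.1 z.1‖}} := ⟨_, rfl⟩
  have hWT : ∀ y ∈ W, y ∈ T := fun y hy => by rw [hW] at hy; exact hy.1
  have hWg : GoodT X.A Γ W := by
    rw [hW]
    refine hgood.inter (GoodT.boolGen hA hΓ hΓA (G := {C | ∃ i : Γ × Γ, C =
      {z : X.T × ℚ_[p] | ‖z.2 - i.1.1 z.1‖ ≤ ‖z.2 - i.2.1 z.1‖}}) ?_ ?_)
    · rintro C ⟨i, rfl⟩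
      exact GoodT.cmp hA hΓ hΓA i.1.2 i.2.2
    · exact BoolGen.all_finite fun i => BoolGen.iff (BoolGen.base _ ⟨i, rfl⟩) (BoolGen.const _)
  refine Eq.subst (motive := fun s => X.poly.c s ∈ MX X) hW ?_
  have hnear : ∀ ω x, (ω, x + γ ω) ∈ W → (ω, x) ∈ Near Γ γ := by
    intro ω x h γ' hγ'
    rw [hW] at h
    have h1 : ‖x + γ ω - γ ω‖ ≤ ‖x + γ ω - γ' ω‖ := (h.2 (⟨γ, hγ⟩, ⟨γ', hγ'⟩)).2 (hmin γ' hγ')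
    rw [add_sub_cancel_right, add_sub_assoc] at h1
    exact h1
  have hL := hWg γ (hΓA hγ)
  have e : X.poly.c W = X.poly.c {z : X.T × ℚ_[p] | z ∈ Near Γ γ ∧ (z.1, z.2 + γ z.1) ∈ W} := by
    refine c_poly_eq (g := fun z => z.2 - γ z.1) (h := fun z => z.2 + γ z.1) (hdist γ hγ)
      (X.poly.A.add_mem poly_snd (poly_fst' (hΓA hγ))) ?_ ?_
    · intro ω x h
      have e1 : x - γ ω + γ ω = x := sub_add_cancel _ _
      have h' : (ω, x - γ ω + γ ω) ∈ W := by rw [e1]; exact h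
      exact ⟨⟨hnear ω _ h', h'⟩, e1⟩
    · rintro ω x ⟨_, h⟩
      exact ⟨h, add_sub_cancel_right _ _⟩
  rw [e]
  refine lset_mem hL (b₀ := fun ω => if ω ∈ {ω | ‖γ ω‖ ≤ ‖(1 : ℚ_[p])‖} then 1 else γ ω)
    (hA (cl_ite (DefS.norm_le (hΓA hγ) (const_mem X.A 1)) (le_cl _ (const_mem X.A 1)) (le_cl _ (hΓA hγ)))) ?_
  rintro ⟨ω, x⟩ ⟨_, h⟩
  have h1 : ‖x + γ ω‖ ≤ 1 := hb _ (hWT _ h)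
  have h2 : ‖x‖ ≤ max ‖x + γ ω‖ ‖γ ω‖ := by
    have := na_sub (x + γ ω) (γ ω)
    rwa [add_sub_cancel_right] at this
  by_cases h3 : ‖γ ω‖ ≤ ‖(1 : ℚ_[p])‖
  · change ‖x‖ ≤ ‖ite (‖γ ω‖ ≤ ‖(1 : ℚ_[p])‖) 1 (γ ω)‖
    rw [if_pos h3]
    rw [norm_one] at h3 ⊢
    exact h2.trans (max_le h1 h3)
  · change ‖x‖ ≤ ‖ite (‖γ ω‖ ≤ ‖(1 : ℚ_[p])‖) 1 (γ ω)‖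
    rw [if_neg h3]
    rw [norm_one] at h3
    push Not at h3
    exact h2.trans (max_le (h1.trans h3.le) le_rfl)

end
end PadicSub
end

section
/-! ## Standard spaces -/

namespace PadicSub
section
variable {p : ℕ} [Fact p.Prime] {Ω Ω' : Type}

theorem mor_polysub {X Y : Sp p} {S : Set (X.T × ℚ_[p])} {φ : Y.T → S}
    (h1 : Mor Y X (fun y => (φ y).1.1)) (h2 : (fun y => (φ y).1.2) ∈ Y.A) :
    Mor Y (X.poly.sub S) φ :=
  mor_sub (X := Y) (Y := X.poly) (S := S) (φ := φ)
    (mor_poly (Y := Y) (X := X) (φ := fun y => (φ y).1) h1 h2)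

theorem polysub_fst {X : Sp p} (S : Set (X.T × ℚ_[p])) :
    Mor (X.poly.sub S) X (fun s : S => s.1.1) :=
  Mor.comp (X := X.poly.sub S) (Y := X.poly) (Z := X) (φ := (Subtype.val : S → X.T × ℚ_[p])) poly_fst
    (mor_val X.poly S)

theorem polysub_snd {X : Sp p} (S : Set (X.T × ℚ_[p])) :
    (fun s : S => s.1.2) ∈ (X.poly.sub S).A :=
  mor_val X.poly S (Prod.snd : X.T × ℚ_[p] → ℚ_[p]) poly_snd

/-- The product with the unit ball. -/
abbrev Sp.U (X : Sp p) : Set (X.T × ℚ_[p]) := X.pr Set.univ (ZS p)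

/-- The product with the unit ball, as a space. -/
noncomputable def Sp.P (X : Sp p) : Sp p := X.poly.sub (X.U)

/-- A bijective morphism. -/
def Fwd (X Y : Sp p) : Prop := ∃ e : X.T ≃ Y.T, Mor X Y e

theorem Iso.fwd {X Y : Sp p} : Iso X Y → Fwd X Y
  | ⟨e, h, _⟩ => ⟨e, h⟩

theorem Fwd.trans {X Y Z : Sp p} : Fwd X Y → Fwd Y Z → Fwd X Z
  | ⟨e, h⟩, ⟨e', h'⟩ => ⟨e.trans e', h'.comp h⟩

theorem Fwd.sum {X Y X' Y' : Sp p} : Fwd X X' → Fwd Y Y' → Fwd (X.sum Y) (X'.sum Y')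
  | ⟨e, h⟩, ⟨e', h'⟩ => ⟨Equiv.sumCongr e e', mor_sum_map h h'⟩

/-- The action of the product on maps. -/
def pmap {X Y : Sp p} (φ : X.T → Y.T) (z : X.U) : Y.U :=
  ⟨(φ z.1.1, z.1.2), trivial, z.2.2⟩

theorem mor_P {X Y : Sp p} {φ : X.T → Y.T} (h : Mor X Y φ) : Mor X.P Y.P (pmap φ) :=
  mor_polysub (X := Y) (Y := X.P) (S := Y.U) (φ := pmap φ)
    (Mor.comp (X := X.P) (Y := X) (φ := fun s : X.U => s.1.1) h
      (polysub_fst (X.U))) (polysub_snd (X.U))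

/-- The action of the product on equivalences. -/
def pequiv {X Y : Sp p} (e : X.T ≃ Y.T) : X.U ≃ Y.U where
  toFun := pmap e
  invFun := pmap e.symm
  left_inv z := Subtype.ext (Prod.ext (e.symm_apply_apply z.1.1) rfl)
  right_inv z := Subtype.ext (Prod.ext (e.apply_symm_apply z.1.1) rfl)

theorem Fwd.P {X Y : Sp p} : Fwd X Y → Fwd X.P Y.P
  | ⟨e, h⟩ => ⟨pequiv e, mor_P h⟩

theorem Iso.P {X Y : Sp p} : Iso X Y → Iso X.P Y.P
  | ⟨e, h, h'⟩ => ⟨pequiv e, mor_P h, mor_P h'⟩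

/-- The product with the unit ball on classes. -/
noncomputable def Pq : Q p → Q p := Quotient.map Sp.P (fun _ _ h => Iso.P h)

theorem pc_sub (X : Sp p) (V : Set X.T) : X.pc V (ZS p) = Pq (X.c V) := by
  let φ : X.pr V (ZS p) → (X.sub V).U :=
    fun z => ⟨((⟨z.1.1, z.2.1⟩ : V), z.1.2), trivial, z.2.2⟩
  let ψ : (X.sub V).U → X.pr V (ZS p) :=
    fun z => ⟨(z.1.1.1, z.1.2), z.1.1.2, z.2.2⟩
  have h1 : Mor (X.poly.sub (X.pr V (ZS p))) (X.sub V)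
      (fun z : X.pr V (ZS p) => (⟨z.1.1, z.2.1⟩ : V)) :=
    mor_sub (X := X.poly.sub (X.pr V (ZS p))) (Y := X) (S := V)
      (φ := fun z : X.pr V (ZS p) => (⟨z.1.1, z.2.1⟩ : V)) (polysub_fst _)
  have h2 : Mor (X.sub V).P X (fun z : (X.sub V).U => z.1.1.1) :=
    Mor.comp (X := (X.sub V).P) (Y := X.sub V) (Z := X) (ψ := (Subtype.val : V → X.T))
      (φ := fun z : (X.sub V).U => z.1.1) (mor_val X V) (polysub_fst _)
  have hφ : Mor (X.poly.sub (X.pr V (ZS p))) (X.sub V).P φ :=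
    mor_polysub (X := X.sub V) (Y := X.poly.sub (X.pr V (ZS p))) (φ := φ) h1 (polysub_snd _)
  have hψ : Mor (X.sub V).P (X.poly.sub (X.pr V (ZS p))) ψ :=
    mor_polysub (X := X) (Y := (X.sub V).P) (φ := ψ) h2 (polysub_snd _)
  exact q_eq.2 ⟨⟨φ, ψ, fun _ => rfl, fun _ => rfl⟩, hφ, hψ⟩

theorem pc_pt (X : Sp p) (V : Set X.T) : X.pc V {x | x = 0} = X.c V :=
  q_eq.2 (Iso.of_maps (X := X.poly) (Y := X) (φ := Prod.fst) (ψ := fun x => ((x, 0) : X.T × ℚ_[p]))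
    poly_fst (mor_poly (Y := X) (X := X) (φ := fun x => ((x, 0) : X.T × ℚ_[p])) (Mor.id X) (const_mem X.A 0))
    (fun x hx => ⟨hx.1, Prod.ext rfl hx.2.symm⟩)
    (fun x hx => ⟨⟨hx, rfl⟩, rfl⟩))

theorem Pq_idem (q : Q p) : Pq q + Pq q = Pq q := by
  induction q using Quotient.inductionOn with
  | h X => exact z_idem (X := X) BoolGen.univ

theorem Pq_add_pt (q : Q p) : q + Pq q = Pq q := by
  induction q using Quotient.inductionOn with
  | h X =>
    have := z_add_pt (X := X) (V := Set.univ) BoolGen.univ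
    rw [pc_pt] at this
    have h2 : X.c Set.univ = X.q := c_univ X (fun _ => trivial)
    rw [h2] at this
    exact this

theorem def_inl (X Y : Sp p) : DefS (X.sum Y).A {x : X.T ⊕ Y.T | x.isLeft} := by
  have h : (fun x : X.T ⊕ Y.T => x.elim (fun _ => (0 : ℚ_[p])) (fun _ => 1)) ∈ (X.sum Y).A :=
    ⟨const_mem X.A 0, const_mem Y.A 1⟩
  refine (DefS.eq_zero h).congr fun x => ?_
  rcases x with x | x
  · exact ⟨fun _ => rfl, fun _ => rfl⟩
  · exact ⟨fun h => (one_ne_zero (α := ℚ_[p]) h).elim, fun h => (Bool.false_ne_true h).elim⟩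

theorem Pq_add (a b : Q p) : Pq (a + b) = Pq a + Pq b := by
  induction a using Quotient.inductionOn with | h X => ?_
  induction b using Quotient.inductionOn with | h Y => ?_
  have hV := def_inl X Y
  have e := c_split (X.sum Y).poly (S := (X.sum Y).U)
    (S1 := {z : (X.T ⊕ Y.T) × ℚ_[p] | z ∈ (X.sum Y).U ∧ z.1.isLeft})
    (S2 := {z : (X.T ⊕ Y.T) × ℚ_[p] | z ∈ (X.sum Y).U ∧ ¬ z.1.isLeft})
    (BoolGen.and (pr_def BoolGen.univ (KD.ball _)) (poly_fst.def hV))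
    (BoolGen.and (pr_def BoolGen.univ (KD.ball _)) (BoolGen.not (poly_fst.def hV)))
    (fun x h h' => h'.2 h.2) (fun x => by
      change _ ↔ (_ ∧ _) ∨ (_ ∧ ¬ _)
      tauto)
  refine Eq.trans e (congrArg₂ _ (q_eq.2 ?_) (q_eq.2 ?_))
  · let S := {z : (X.T ⊕ Y.T) × ℚ_[p] | z ∈ (X.sum Y).U ∧ z.1.isLeft}
    let φ : X.U → S := fun z => ⟨(Sum.inl z.1.1, z.1.2), ⟨trivial, z.2.2⟩, rfl⟩
    let ψ : S → X.U := fun z => ⟨(z.1.1.getLeft z.2.2, z.1.2), trivial, z.2.1.2⟩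
    have hφ : Mor X.P ((X.sum Y).poly.sub S) φ :=
      mor_polysub (X := X.sum Y) (Y := X.P) (φ := φ) (Mor.comp (X := X.P) (Y := X) (Z := X.sum Y)
        (φ := fun z : X.U => z.1.1) (mor_inl X Y) (polysub_fst _)) (polysub_snd _)
    have hψ0 : Mor ((X.sum Y).poly.sub S) X (fun z : S => z.1.1.getLeft z.2.2) := by
      intro f hf
      have h : (fun x : X.T ⊕ Y.T => x.elim f (fun _ => (0 : ℚ_[p]))) ∈ (X.sum Y).A :=
        ⟨hf, const_mem Y.A 0⟩
      have h2 := polysub_fst (X := X.sum Y) S _ h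
      refine Eq.subst (motive := fun s => s ∈ ((X.sum Y).poly.sub S).A) ?_ h2
      funext ⟨⟨z, t⟩, hz⟩
      rcases z with z | z
      · rfl
      · exact (Bool.false_ne_true hz.2).elim
    have hψ : Mor ((X.sum Y).poly.sub S) X.P ψ :=
      mor_polysub (X := X) (Y := (X.sum Y).poly.sub S) (φ := ψ) hψ0 (polysub_snd _)
    refine Iso.symm ⟨⟨φ, ψ, fun _ => rfl, ?_⟩, hφ, hψ⟩
    rintro ⟨⟨z | z, t⟩, hz⟩
    · rfl
    · exact (Bool.false_ne_true hz.2).elim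
  · let S := {z : (X.T ⊕ Y.T) × ℚ_[p] | z ∈ (X.sum Y).U ∧ ¬ z.1.isLeft}
    have hr : ∀ z : S, z.1.1.isRight := fun z => Sum.not_isLeft.1 (by simpa using z.2.2)
    let φ : Y.U → S := fun z =>
      ⟨(Sum.inr z.1.1, z.1.2), ⟨trivial, z.2.2⟩, Bool.false_ne_true⟩
    let ψ : S → Y.U := fun z => ⟨(z.1.1.getRight (hr z), z.1.2), trivial, z.2.1.2⟩
    have hφ : Mor Y.P ((X.sum Y).poly.sub S) φ :=
      mor_polysub (X := X.sum Y) (Y := Y.P) (φ := φ) (Mor.comp (X := Y.P) (Y := Y) (Z := X.sum Y)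
        (φ := fun z : Y.U => z.1.1) (mor_inr X Y) (polysub_fst _)) (polysub_snd _)
    have hψ0 : Mor ((X.sum Y).poly.sub S) Y (fun z : S => z.1.1.getRight (hr z)) := by
      intro f hf
      have h : (fun x : X.T ⊕ Y.T => x.elim (fun _ => (0 : ℚ_[p])) f) ∈ (X.sum Y).A :=
        ⟨const_mem X.A 0, hf⟩
      have h2 := polysub_fst (X := X.sum Y) S _ h
      refine Eq.subst (motive := fun s => s ∈ ((X.sum Y).poly.sub S).A) ?_ h2
      funext ⟨⟨z, t⟩, hz⟩
      rcases z with z | z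
      · exact (hz.2 rfl).elim
      · rfl
    have hψ : Mor ((X.sum Y).poly.sub S) Y.P ψ :=
      mor_polysub (X := Y) (Y := (X.sum Y).poly.sub S) (φ := ψ) hψ0 (polysub_snd _)
    refine Iso.symm ⟨⟨φ, ψ, fun _ => rfl, ?_⟩, hφ, hψ⟩
    rintro ⟨⟨z | z, t⟩, hz⟩
    · exact (hz.2 rfl).elim
    · rfl

theorem Pq_zero : Pq (0 : Q p) = 0 := by
  have h := pc_sub (Sp.emp : Sp p) ∅
  rw [c_empty _ (by simp)] at h
  rw [← h]
  exact c_empty _ (fun x hx => hx.1)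

/-- The standard spaces. -/
noncomputable def zz (p : ℕ) [Fact p.Prime] : ℕ → Sp p
  | 0 => ⟨Unit, ⊤, le_top⟩
  | d + 1 => (zz p d).P

/-- The standard classes. -/
inductive StdQ : Q p → Prop
  | fin (n : ℕ) : StdQ (n • (zz p 0).q)
  | z (d : ℕ) : StdQ (zz p (d + 1)).q

theorem zz_add {d e : ℕ} (h : d < e) : (zz p d).q + (zz p e).q = (zz p e).q := by
  induction e, h using Nat.le_induction with
  | base => exact Pq_add_pt (zz p d).q
  | succ e _ ih =>
    have h1 : (zz p e).q + (zz p (e + 1)).q = (zz p (e + 1)).q := Pq_add_pt (zz p e).q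
    rw [← h1, ← add_assoc, ih]

theorem zz_nsmul (n d : ℕ) : n • (zz p 0).q + (zz p (d + 1)).q = (zz p (d + 1)).q := by
  induction n with
  | zero => simp
  | succ n ih => rw [succ_nsmul, add_assoc, zz_add (Nat.succ_pos d), ih]

theorem StdQ.add {a b : Q p} (ha : StdQ a) (hb : StdQ b) : StdQ (a + b) := by
  rcases ha with n | d <;> rcases hb with m | e
  · rw [← add_nsmul]; exact .fin _
  · rw [zz_nsmul]; exact .z _
  · rw [add_comm, zz_nsmul]; exact .z _
  · rcases lt_trichotomy d e with h | h | h
    · rw [zz_add (by omega)]; exact .z _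
    · subst h
      have : (zz p (d + 1)).q + (zz p (d + 1)).q = (zz p (d + 1)).q := Pq_idem (zz p d).q
      rw [this]; exact .z _
    · rw [add_comm, zz_add (by omega)]; exact .z _

theorem StdQ.P {a : Q p} (ha : StdQ a) : StdQ (Pq a) := by
  rcases ha with n | d
  · have h : ∀ n : ℕ, Pq (n • (zz p 0).q) = n • (zz p 1).q := by
      intro n
      induction n with
      | zero => rw [zero_nsmul, zero_nsmul, Pq_zero]
      | succ n ih => rw [succ_nsmul, Pq_add, ih, succ_nsmul]; rfl
    rw [h]
    rcases Nat.eq_zero_or_pos n with rfl | hn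
    · rw [zero_nsmul, ← zero_nsmul (zz p 0).q]; exact .fin 0
    · have h1 : (zz p 1).q + (zz p 1).q = (zz p 1).q := Pq_idem (zz p 0).q
      rw [nsmul_idem h1 hn]
      exact .z 0
  · exact .z (d + 1)

/-- A class whose members map bijectively to a standard space. -/
def FSQ (q : Q p) : Prop := ∃ X Y : Sp p, X.q = q ∧ StdQ Y.q ∧ Fwd X Y

theorem FSQ.add {a b : Q p} : FSQ a → FSQ b → FSQ (a + b)
  | ⟨X, Y, h1, h2, h3⟩, ⟨X', Y', h1', h2', h3'⟩ =>
    ⟨X.sum X', Y.sum Y', by rw [q_sum, h1, h1'], by rw [q_sum]; exact h2.add h2', h3.sum h3'⟩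

theorem FSQ.P {a : Q p} : FSQ a → FSQ (Pq a)
  | ⟨X, Y, h1, h2, h3⟩ => ⟨X.P, Y.P, by rw [← h1]; rfl, h2.P, h3.P⟩

theorem StdQ.zero : StdQ (0 : Q p) := by rw [← zero_nsmul (zz p 0).q]; exact .fin 0

theorem FSQ.zero : FSQ (0 : Q p) := ⟨Sp.emp, Sp.emp, rfl, StdQ.zero, (Iso.refl _).fwd⟩

theorem FSQ.fwd {X Y : Sp p} (h : Fwd X Y) : FSQ Y.q → FSQ X.q
  | ⟨X', Y', h1, h2, h3⟩ => ⟨X, Y', rfl, h2, (h.trans (q_eq.1 h1.symm).fwd).trans h3⟩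

theorem fs_main {X : Sp p} (hX : ∀ V, DefS X.A V → FSQ (X.c V)) {T : Set (X.T × ℚ_[p])}
    (hT : DefS X.poly.A T) (hb : ∀ z ∈ T, ‖z.2‖ ≤ 1) : FSQ (X.poly.c T) := by
  have h := c_mem_MX hT hb
  generalize X.poly.c T = q at h
  induction h using AddSubmonoid.closure_induction with
  | mem q hq =>
    obtain ⟨V, hV, rfl | rfl⟩ := hq
    · rw [pc_pt]; exact hX V hV
    · rw [pc_sub]; exact (hX V hV).P
  | zero => exact FSQ.zero
  | add a b _ _ ha hb => exact ha.add hb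

theorem zz_coord (d : ℕ) : ∃ e : (zz p d).T ≃ ZpSet p d, ∀ i, (fun x => (e x).1 i) ∈ (zz p d).A := by
  induction d with
  | zero =>
    refine ⟨⟨fun _ => ⟨fun i => i.elim0, fun i => i.elim0⟩, fun _ => (), fun _ => rfl, fun x => ?_⟩,
      fun i => i.elim0⟩
    exact Subtype.ext (funext fun i => i.elim0)
  | succ d ih =>
    obtain ⟨e, he⟩ := ih
    let φ : (zz p d).U → ZpSet p (d + 1) := fun z =>
      ⟨Fin.cons z.1.2 (e z.1.1).1, fun i => by
        refine Fin.cases ?_ (fun j => ?_) i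
        · have := z.2.2
          simpa [ZS] using this
        · simpa using (e z.1.1).2 j⟩
    let ψ : ZpSet p (d + 1) → (zz p d).U := fun x =>
      ⟨(e.symm ⟨fun j => x.1 j.succ, fun j => x.2 _⟩, x.1 0), trivial, by simpa [ZS] using x.2 0⟩
    refine ⟨⟨φ, ψ, fun z => ?_, fun x => ?_⟩, fun i => ?_⟩
    · refine Subtype.ext (Prod.ext ?_ rfl)
      change e.symm ⟨fun j => (Fin.cons z.1.2 (e z.1.1).1 : Fin (d + 1) → ℚ_[p]) j.succ, _⟩ = _
      simp
    · refine Subtype.ext (funext fun i => ?_)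
      change (Fin.cons (x.1 0) (e (e.symm ⟨fun j => x.1 j.succ, _⟩)).1 : Fin (d + 1) → ℚ_[p]) i = _
      refine Fin.cases ?_ (fun j => ?_) i <;> simp
    · refine Fin.cases ?_ (fun j => ?_) i
      · have h1 : (fun s : (zz p d).U => s.1.2) ∈ (zz p d).P.A := polysub_snd _
        refine Eq.subst (motive := fun s => s ∈ (zz p d).P.A) ?_ h1
        rfl
      · have h1 : (fun x => (e x).1 j) ∘ (fun s : (zz p d).U => s.1.1) ∈
          (zz p d).P.A := polysub_fst _ _ (he j)
        refine Eq.subst (motive := fun s => s ∈ (zz p d).P.A) ?_ h1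
        rfl

theorem FSQ.extract {X : Sp p} (h : FSQ X.q) : Finite X.T ∨
    ∃ d, ∃ e : X.T ≃ ZpSet p (d + 1), ∀ i, (fun x => (e x).1 i) ∈ X.A := by
  obtain ⟨X', Y, h1, h2, h3⟩ := h
  obtain ⟨e, he⟩ := (q_eq.1 h1.symm).fwd.trans h3
  generalize hq : Y.q = q at h2
  rcases h2 with n | d
  · left
    have : ∀ n : ℕ, ∀ Y : Sp p, Y.q = n • (zz p 0).q → Finite Y.T := by
      intro n
      induction n with
      | zero =>
        intro Y hY
        rw [zero_nsmul] at hY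
        obtain ⟨e, -⟩ := q_eq.1 (hY : Y.q = Sp.emp.q)
        exact Finite.of_equiv Empty e.symm
      | succ n ih =>
        intro Y hY
        obtain ⟨W, hW⟩ : ∃ W : Sp p, W.q = n • (zz p 0).q := Quotient.exists_rep _
        rw [succ_nsmul, ← hW, ← q_sum] at hY
        obtain ⟨e, -⟩ := q_eq.1 hY
        have := ih W hW
        have h2 : Finite (zz p 0).T := (inferInstance : Finite Unit)
        exact Finite.of_equiv (W.T ⊕ (zz p 0).T) e.symm
    have := this n Y hq
    exact Finite.of_equiv _ e.symm
  · right
    obtain ⟨e', h', -⟩ := q_eq.1 hq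
    obtain ⟨e2, h2⟩ := zz_coord (p := p) (d + 1)
    exact ⟨d, (e.trans e').trans e2, fun i => (h'.comp he) _ (h2 i)⟩

end
end PadicSub
end

section
namespace PadicSub
section
variable {p : ℕ} [Fact p.Prime] {N : ℕ}
open MvPolynomial

/-- divisibility by `p ^ k` in `ℤ_p` in terms of the norm of `ℚ_p`. -/
theorem zdvd_iff {x : ℤ_[p]} {k : ℕ} :
    (p : ℤ_[p]) ^ k ∣ x ↔ ‖(x : ℚ_[p])‖ ≤ ‖(p : ℚ_[p]) ^ k‖ := by
  have h := PadicInt.norm_le_pow_iff_mem_span_pow x k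
  rw [Ideal.mem_span_singleton] at h
  rw [← h, PadicInt.norm_def, norm_pow, Padic.norm_p, zpow_neg, inv_pow, zpow_natCast]

theorem zeq_of_dvd {x y : ℤ_[p]} (h : ∀ k, (p : ℤ_[p]) ^ k ∣ x - y) : x = y := by
  by_contra hne
  have h0 : (0 : ℝ) < ‖((x - y : ℤ_[p]) : ℚ_[p])‖ := by
    rw [norm_pos_iff]
    exact fun h => hne (sub_eq_zero.1 (Subtype.ext h))
  obtain ⟨k, -, hk⟩ := exists_ppow_lt (p := p) h0
  exact absurd (zdvd_iff.1 (h k)) (not_le.2 hk)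

theorem coh_dvd {R : Type*} [CommRing R] {c : ℕ → R} {q : R} (h : ∀ k, q ^ k ∣ c (k + 1) - c k)
    {k l : ℕ} (hkl : k ≤ l) : q ^ k ∣ c l - c k := by
  induction l, hkl using Nat.le_induction with
  | base => simp
  | succ l hl ih =>
    have := dvd_add ((pow_dvd_pow q hl).trans (h l)) ih
    simpa using this

theorem exists_lim {c : ℕ → ℤ_[p]} (h : ∀ k, (p : ℤ_[p]) ^ k ∣ c (k + 1) - c k) :
    ∃ l : ℤ_[p], ∀ k, (p : ℤ_[p]) ^ k ∣ l - c k := by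
  have hc : CauchySeq c := by
    refine Metric.cauchySeq_iff'.2 fun ε hε => ?_
    obtain ⟨k, -, hk⟩ := exists_ppow_lt (p := p) hε
    refine ⟨k, fun n hn => ?_⟩
    rw [dist_eq_norm, PadicInt.norm_def]
    exact (zdvd_iff.1 (coh_dvd h hn)).trans_lt hk
  obtain ⟨l, hl⟩ := cauchySeq_tendsto_of_complete hc
  refine ⟨l, fun k => zdvd_iff.2 ?_⟩
  have h1 : Filter.Tendsto (fun n => ‖c n - c k‖) Filter.atTop (nhds ‖l - c k‖) :=
    (hl.sub_const _).norm
  have := le_of_tendsto h1 (Filter.eventually_atTop.2 ⟨k, fun n hn => by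
    rw [PadicInt.norm_def]; exact zdvd_iff.1 (coh_dvd h hn)⟩)
  rwa [PadicInt.norm_def] at this

theorem dvd_aeval_sub {R B σ : Type*} [CommRing R] [CommRing B] [Algebra R B] {c : B} {x y : σ → B}
    (h : ∀ i, c ∣ x i - y i) (q : MvPolynomial σ R) : c ∣ aeval x q - aeval y q := by
  induction q using MvPolynomial.induction_on with
  | C a => simp
  | add f g hf hg =>
    have := dvd_add hf hg
    rw [map_add, map_add]
    convert this using 1; ring
  | mul_X f i hf =>
    rw [map_mul, map_mul, aeval_X, aeval_X]
    have := dvd_add (dvd_mul_of_dvd_left hf (x i)) (dvd_mul_of_dvd_right (h i) (aeval y f))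
    convert this using 1; ring

/-- integral restricted analytic functions on `ℤ_p^N`: limits of coherent polynomials -/
def RAs (F : (Fin N → ℤ_[p]) → ℤ_[p]) (Q : ℕ → MvPolynomial (Fin N) ℤ_[p]) : Prop :=
  (∀ k, (p : MvPolynomial (Fin N) ℤ_[p]) ^ k ∣ Q (k + 1) - Q k) ∧
    ∀ k w, (p : ℤ_[p]) ^ k ∣ F w - eval w (Q k)

def RAo (F : (Fin N → ℤ_[p]) → ℤ_[p]) : Prop := ∃ Q, RAs F Q

theorem RAo.poly (q : MvPolynomial (Fin N) ℤ_[p]) : RAo (fun w => eval w q) :=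
  ⟨fun _ => q, fun k => by simp, fun k w => by simp⟩

theorem RAo.comp {M : ℕ} {F : (Fin N → ℤ_[p]) → ℤ_[p]} {G : Fin N → (Fin M → ℤ_[p]) → ℤ_[p]}
    (hF : RAo F) (hG : ∀ j, RAo (G j)) : RAo (fun w => F (fun j => G j w)) := by
  obtain ⟨Q, h1, h2⟩ := hF
  choose R h3 h4 using hG
  refine ⟨fun k => aeval (fun j => R j k) (Q k), fun k => ?_, fun k w => ?_⟩
  · have e1 := dvd_aeval_sub (fun j => h3 j k) (Q k)
    obtain ⟨d, hd⟩ := h1 k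
    have e2 : (p : MvPolynomial (Fin M) ℤ_[p]) ^ k ∣ aeval (fun j => R j (k + 1)) (Q (k + 1) - Q k) := by
      rw [hd, map_mul, map_pow, map_natCast]
      exact dvd_mul_right _ _
    have := dvd_add e2 e1
    rw [map_sub] at this
    simpa using this
  · have e1 := h2 k (fun j => G j w)
    have e2 := dvd_aeval_sub (fun j => h4 j k w) (Q k)
    have := dvd_add e1 e2
    have e3 : eval w (aeval (fun j => R j k) (Q k)) = aeval (fun j => eval w (R j k)) (Q k) := by
      rw [← MvPolynomial.coe_aeval_eq_eval, RingHom.coe_coe, ← AlgHom.comp_apply, comp_aeval]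
    rw [e3]
    simpa [coe_aeval_eq_eval] using this

theorem RAo.add {F G : (Fin N → ℤ_[p]) → ℤ_[p]} (hF : RAo F) (hG : RAo G) :
    RAo (fun w => F w + G w) := by
  have := (RAo.poly (X 0 + X 1 : MvPolynomial (Fin 2) ℤ_[p])).comp
    (G := ![F, G]) (by simp [Fin.forall_fin_two, hF, hG])
  simp only [map_add, map_mul, eval_X] at this
  exact this

theorem RAo.mul {F G : (Fin N → ℤ_[p]) → ℤ_[p]} (hF : RAo F) (hG : RAo G) :
    RAo (fun w => F w * G w) := by
  have := (RAo.poly (X 0 * X 1 : MvPolynomial (Fin 2) ℤ_[p])).comp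
    (G := ![F, G]) (by simp [Fin.forall_fin_two, hF, hG])
  simp only [map_add, map_mul, eval_X] at this
  exact this

theorem RAo.const (c : ℤ_[p]) : RAo (fun _ : Fin N → ℤ_[p] => c) := by
  simpa using RAo.poly (N := N) (C c)

theorem RAo.coord (i : Fin N) : RAo (fun w : Fin N → ℤ_[p] => w i) := by
  simpa using RAo.poly (N := N) (X i : MvPolynomial (Fin N) ℤ_[p])

variable (p N) in
/-- restricted analytic functions on `ℤ_p^N` -/
noncomputable def RA : FAlg p (Fin N → ℤ_[p]) where
  carrier := {f | ∃ (n : ℕ) (F : _), RAo F ∧ ∀ w, (p : ℚ_[p]) ^ n * f w = (F w : ℚ_[p])}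
  mul_mem' := by
    rintro f g ⟨n, F, hF, h⟩ ⟨n', G, hG, h'⟩
    refine ⟨n + n', _, hF.mul hG, fun w => ?_⟩
    rw [PadicInt.coe_mul, ← h, ← h', Pi.mul_apply]; ring
  add_mem' := by
    rintro f g ⟨n, F, hF, h⟩ ⟨n', G, hG, h'⟩
    refine ⟨n + n', _, ((RAo.const ((p : ℤ_[p]) ^ n')).mul hF).add
      ((RAo.const ((p : ℤ_[p]) ^ n)).mul hG), fun w => ?_⟩
    push_cast
    rw [← h, ← h', Pi.add_apply]; ring
  algebraMap_mem' := by
    intro c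
    obtain ⟨n, hn⟩ := exists_ppow_mul_le (p := p) ‖c‖
    rw [← norm_mul] at hn
    exact ⟨n, _, RAo.const ⟨(p : ℚ_[p]) ^ n * c, hn⟩, fun w => rfl⟩

theorem RAo.mem_RA {F : (Fin N → ℤ_[p]) → ℤ_[p]} (hF : RAo F) :
    (fun w => (F w : ℚ_[p])) ∈ RA p N := ⟨0, F, hF, fun w => by simp⟩

/-- Comparison of a power series and a polynomial congruent to it modulo `p ^ k`. -/
theorem series_core (b : (Fin N → ℕ) → ℤ_[p])
    (hb : Filter.Tendsto (fun i => (b i : ℚ_[p])) Filter.cofinite (nhds 0))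
    (Q : MvPolynomial (Fin N) ℤ_[p]) (k : ℕ)
    (hQ : ∀ i, (p : ℤ_[p]) ^ k ∣ b i - coeff (Finsupp.equivFunOnFinite.symm i) Q)
    (w : Fin N → ℤ_[p]) :
    ‖(∑' i : Fin N → ℕ, (b i : ℚ_[p]) * ∏ j, (w j : ℚ_[p]) ^ i j) - (eval w Q : ℚ_[p])‖
      ≤ ‖(p : ℚ_[p]) ^ k‖ := by
  have hw : ∀ i : Fin N → ℕ, ‖∏ j, (w j : ℚ_[p]) ^ i j‖ ≤ 1 := fun i => by
    rw [norm_prod]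
    exact Finset.prod_le_one (fun _ _ => norm_nonneg _) fun j _ => by
      rw [norm_pow]; exact pow_le_one₀ (norm_nonneg _) (w j).2
  have hs : Summable fun i : Fin N → ℕ => (b i : ℚ_[p]) * ∏ j, (w j : ℚ_[p]) ^ i j := by
    apply NonarchimedeanAddGroup.summable_of_tendsto_cofinite_zero
    refine squeeze_zero_norm (fun i => ?_) (tendsto_zero_iff_norm_tendsto_zero.1 hb)
    rw [norm_mul]
    exact mul_le_of_le_one_right (norm_nonneg _) (hw i)
  have he : HasSum (fun i : Fin N → ℕ => ((coeff (Finsupp.equivFunOnFinite.symm i) Q : ℤ_[p]) : ℚ_[p]) *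
      ∏ j, (w j : ℚ_[p]) ^ i j) (eval w Q : ℚ_[p]) := by
    rw [← Equiv.hasSum_iff (Finsupp.equivFunOnFinite : (Fin N →₀ ℕ) ≃ _)]
    rw [eval_eq']
    push_cast
    have := hasSum_sum_of_ne_finset_zero (s := Q.support) (L := SummationFilter.unconditional _)
      (f := fun d : Fin N →₀ ℕ => ((coeff d Q : ℤ_[p]) : ℚ_[p]) * ∏ j, (w j : ℚ_[p]) ^ d j)
      fun d hd => by
        rw [notMem_support_iff.1 hd]; simp
    convert this using 1
    · funext d; simp
    · rw [PadicInt.coe_sum]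
      refine Finset.sum_congr rfl fun d _ => ?_
      rw [PadicInt.coe_mul]
      exact congrArg _ (map_prod PadicInt.Coe.ringHom _ _)
  rw [← he.tsum_eq, ← hs.tsum_sub he.summable]
  refine IsUltrametricDist.norm_tsum_le_of_forall_le_of_nonneg (norm_nonneg _) fun i => ?_
  rw [← sub_mul, norm_mul, ← PadicInt.coe_sub]
  exact (mul_le_of_le_one_right (norm_nonneg _) (hw i)).trans (zdvd_iff.1 (hQ i))

theorem natp_dvd {q : MvPolynomial (Fin N) ℤ_[p]} {k : ℕ} :
    (p : MvPolynomial (Fin N) ℤ_[p]) ^ k ∣ q ↔ ∀ i, (p : ℤ_[p]) ^ k ∣ coeff i q := by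
  rw [← C_dvd_iff_dvd_coeff]; simp

theorem ranal_mem_RA (a : (Fin N → ℕ) → ℚ_[p]) (ha : IsRestrictedCoeffs p a) :
    (fun w : Fin N → ℤ_[p] => ranalFn p a (fun j => (w j : ℚ_[p]))) ∈ RA p N := by
  classical
  have hfin : ∀ ε > 0, {i | ε ≤ ‖a i‖}.Finite := fun ε hε => by
    have := (tendsto_zero_iff_norm_tendsto_zero.1 ha).eventually (gt_mem_nhds hε)
    rw [Filter.eventually_cofinite] at this
    simpa using this
  obtain ⟨n, hn⟩ : ∃ n : ℕ, ∀ i, ‖(p : ℚ_[p]) ^ n * a i‖ ≤ 1 := by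
    obtain ⟨M, hM⟩ := ((hfin 1 one_pos).image (fun i => ‖a i‖)).bddAbove
    obtain ⟨n, hn⟩ := exists_ppow_mul_le (p := p) (max M 1)
    refine ⟨n, fun i => ?_⟩
    rw [norm_mul]
    refine (mul_le_mul_of_nonneg_left ?_ (norm_nonneg _)).trans hn
    by_cases h : 1 ≤ ‖a i‖
    · exact (hM ⟨i, h, rfl⟩).trans (le_max_left _ _)
    · exact (not_le.1 h).le.trans (le_max_right _ _)
  let b : (Fin N → ℕ) → ℤ_[p] := fun i => ⟨_, hn i⟩
  have hb : Filter.Tendsto (fun i => (b i : ℚ_[p])) Filter.cofinite (nhds 0) := by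
    have := ha.const_mul ((p : ℚ_[p]) ^ n)
    rwa [mul_zero] at this
  have hbf : ∀ k : ℕ, {i | ¬ (p : ℤ_[p]) ^ k ∣ b i}.Finite := fun k => by
    have := (tendsto_zero_iff_norm_tendsto_zero.1 hb).eventually (gt_mem_nhds (norm_ppow_pos (p := p) k))
    rw [Filter.eventually_cofinite] at this
    refine this.subset fun i hi h => hi (zdvd_iff.2 h.le)
  let Q : ℕ → MvPolynomial (Fin N) ℤ_[p] := fun k =>
    ∑ i ∈ (hbf k).toFinset, monomial (Finsupp.equivFunOnFinite.symm i) (b i)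
  have hQ : ∀ k i, coeff (Finsupp.equivFunOnFinite.symm i) (Q k)
      = if (p : ℤ_[p]) ^ k ∣ b i then 0 else b i := fun k i => by
    simp only [Q, coeff_sum, coeff_monomial, EmbeddingLike.apply_eq_iff_eq, Finset.sum_ite_eq',
      Set.Finite.mem_toFinset, Set.mem_ofPred_eq, ite_not]
  have hQ' : ∀ k i, (p : ℤ_[p]) ^ k ∣ b i - coeff (Finsupp.equivFunOnFinite.symm i) (Q k) :=
    fun k i => by
      rw [hQ]; split_ifs with h
      · simpa using h
      · simp
  have hsum : ∀ w : Fin N → ℤ_[p], (p : ℚ_[p]) ^ n * ranalFn p a (fun j => (w j : ℚ_[p]))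
      = ∑' i : Fin N → ℕ, (b i : ℚ_[p]) * ∏ j, (w j : ℚ_[p]) ^ i j := fun w => by
    rw [ranalFn, if_pos fun j => (w j).2, ← tsum_mul_left]
    exact tsum_congr fun i => (mul_assoc _ _ _).symm
  have h1 : ∀ w : Fin N → ℤ_[p], ‖(p : ℚ_[p]) ^ n * ranalFn p a (fun j => (w j : ℚ_[p]))‖ ≤ 1 :=
    fun w => by
      have := series_core b hb (Q 0) 0 (hQ' 0) w
      rw [hsum]
      have h2 := (na_add _ _).trans (max_le (this.trans (by simp)) (eval w (Q 0)).2)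
      rwa [sub_add_cancel] at h2
  refine ⟨n, fun w => ⟨_, h1 w⟩, ⟨Q, fun k => natp_dvd.2 fun i => ?_, fun k w => zdvd_iff.2 ?_⟩,
    fun w => rfl⟩
  · obtain ⟨i, rfl⟩ := Finsupp.equivFunOnFinite.symm.surjective i
    rw [coeff_sub]
    have := dvd_sub (hQ' k i) ((pow_dvd_pow _ k.le_succ).trans (hQ' (k + 1) i))
    simpa using this
  · have := series_core b hb (Q k) k (hQ' k) w
    rw [← hsum] at this
    exact this

/-- Conversely integral restricted analytic functions are given by restricted power series. -/
theorem RAo.exists_coeffs {F : (Fin N → ℤ_[p]) → ℤ_[p]} (hF : RAo F) :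
    ∃ a : (Fin N → ℕ) → ℤ_[p], IsRestrictedCoeffs p (fun i => (a i : ℚ_[p])) ∧
      ∀ w, (F w : ℚ_[p]) = ranalFn p (fun i => (a i : ℚ_[p])) (fun j => (w j : ℚ_[p])) := by
  obtain ⟨Q, h1, h2⟩ := hF
  have := fun i : Fin N → ℕ => exists_lim (p := p)
    (c := fun k => coeff (Finsupp.equivFunOnFinite.symm i) (Q k)) fun k => by
      have := natp_dvd.1 (h1 k) (Finsupp.equivFunOnFinite.symm i)
      rwa [coeff_sub] at this
  choose a ha using this
  have hr : IsRestrictedCoeffs p (fun i => (a i : ℚ_[p])) := by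
    refine (tendsto_zero_iff_norm_tendsto_zero).2 (Metric.tendsto_nhds.2 fun ε hε => ?_)
    obtain ⟨k, -, hk⟩ := exists_ppow_lt (p := p) hε
    rw [Filter.eventually_cofinite]
    refine ((Q k).support.finite_toSet.image Finsupp.equivFunOnFinite).subset fun i hi => ?_
    refine ⟨Finsupp.equivFunOnFinite.symm i, ?_, by simp⟩
    rw [Finset.mem_coe, mem_support_iff]
    intro h0
    have := zdvd_iff.1 (ha i k)
    rw [h0, sub_zero] at this
    refine hi ?_
    simpa using this.trans_lt hk
  refine ⟨a, hr, fun w => ?_⟩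
  rw [ranalFn, if_pos fun j => (w j).2]
  by_contra hne
  obtain ⟨k, -, hk⟩ := exists_ppow_lt (p := p) (norm_pos_iff.2 (sub_ne_zero.2 hne))
  have e1 := series_core a hr (Q k) k (fun i => ha i k) w
  have e2 := zdvd_iff.1 (h2 k w)
  rw [PadicInt.coe_sub] at e2
  have := (na_sub _ _).trans (max_le e2 e1)
  rw [sub_sub_sub_cancel_right] at this
  exact absurd this (not_le.2 hk)

end
end PadicSub
end

section
namespace PadicSub
section
variable {p : ℕ} [Fact p.Prime] {N : ℕ}
open MvPolynomial

/-- the substitution `x_j ↦ x_j + t ^ r_j` -/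
noncomputable def gW (A : Type*) [CommRing A] (r : Fin N → ℕ) (i : Fin (N + 1)) :
    Polynomial (MvPolynomial (Fin N) A) :=
  Fin.cases Polynomial.X (fun j => Polynomial.X ^ r j + Polynomial.C (X j)) i

noncomputable def PhiW (A : Type*) [CommRing A] (r : Fin N → ℕ) :
    MvPolynomial (Fin (N + 1)) A →ₐ[A] Polynomial (MvPolynomial (Fin N) A) := aeval (gW A r)

/-- The Noether normalization trick (Nagata's exponents). -/
theorem noether {k : Type*} [Field k] (f : MvPolynomial (Fin (N + 1)) k) (hf : f ≠ 0) :
    ∃ r : Fin N → ℕ, IsUnit (PhiW k r f).leadingCoeff := by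
  obtain ⟨u, hu⟩ : ∃ u, u = 2 + f.totalDegree := ⟨_, rfl⟩
  let r : Fin N → ℕ := fun j => u ^ (j.1 + 1)
  have hr : ∀ j, r j ≠ 0 := fun j => pow_ne_zero _ (by omega)
  have hm : ∀ i, (gW k r i).Monic := fun i => by
    refine Fin.cases ?_ (fun j => ?_) i
    · exact Polynomial.monic_X
    · exact Polynomial.monic_X_pow_add_C _ (hr j)
  have hd : ∀ i : Fin (N + 1), (gW k r i).natDegree = u ^ i.1 := fun i => by
    refine Fin.cases ?_ (fun j => ?_) i
    · exact Polynomial.natDegree_X.trans (by simp)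
    · exact Polynomial.natDegree_X_pow_add_C.trans (by simp [r])
  let M : (Fin (N + 1) →₀ ℕ) → Polynomial (MvPolynomial (Fin N) k) := fun v => ∏ i, gW k r i ^ v i
  have hMm : ∀ v, (M v).Monic := fun v => Polynomial.monic_prod_of_monic _ _ fun i _ => (hm i).pow _
  have hMd : ∀ v, (M v).natDegree = ∑ i : Fin (N + 1), u ^ i.1 * v i := fun v => by
    rw [Polynomial.natDegree_prod_of_monic _ _ fun i _ => (hm i).pow _]
    refine Finset.sum_congr rfl fun i _ => ?_
    rw [(hm i).natDegree_pow, hd, mul_comm]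
  have hinj : ∀ v ∈ f.support, ∀ w ∈ f.support, (M v).natDegree = (M w).natDegree → v = w := by
    intro v hv w hw h
    have hlt : ∀ v ∈ f.support, ∀ l ∈ List.ofFn v, l < u := by
      intro v hv l hl
      obtain ⟨i, rfl⟩ := (List.mem_ofFn' _ _).1 hl
      have := (monomial_le_degreeOf i hv).trans (degreeOf_le_totalDegree f i)
      omega
    rw [hMd, hMd] at h
    refine Finsupp.ext (congrFun (List.ofFn_inj.mp ?_))
    apply Nat.ofDigits_inj_of_len_eq (b := u) (by omega) (by simp) (hlt v hv) (hlt w hw)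
    simpa only [Nat.ofDigits_eq_sum_mapIdx, List.mapIdx_eq_ofFn, List.get_ofFn, List.length_ofFn,
      Fin.val_cast, mul_comm, List.sum_ofFn] using! h
  have hsum : PhiW k r f = ∑ v ∈ f.support, Polynomial.C (C (coeff v f)) * M v := by
    rw [PhiW, aeval_def, eval₂_eq']; rfl
  obtain ⟨v, hv, hmax⟩ := Finset.exists_max_image f.support (fun v => (M v).natDegree)
    (support_nonempty.2 hf)
  have hle : (PhiW k r f).natDegree ≤ (M v).natDegree := by
    rw [hsum]
    exact Polynomial.natDegree_sum_le_of_forall_le _ _ fun w hw =>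
      (Polynomial.natDegree_C_mul_le _ _).trans (hmax w hw)
  have hco : (PhiW k r f).coeff (M v).natDegree = C (coeff v f) := by
    rw [hsum, Polynomial.finsetSum_coeff, Finset.sum_eq_single v]
    · rw [Polynomial.coeff_C_mul, (hMm v).coeff_natDegree, mul_one]
    · intro w hw hwv
      rw [Polynomial.coeff_C_mul, Polynomial.coeff_eq_zero_of_natDegree_lt, mul_zero]
      exact lt_of_le_of_ne (hmax w hw) fun h => hwv (hinj w hw v hv h)
    · exact fun h => absurd hv h
  have hne : coeff v f ≠ 0 := mem_support_iff.1 hv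
  refine ⟨r, ?_⟩
  have hu : IsUnit (C (σ := Fin N) (coeff v f)) := hne.isUnit.map C
  rwa [Polynomial.leadingCoeff, le_antisymm hle (Polynomial.le_natDegree_of_ne_zero
    (by rw [hco]; exact hu.ne_zero)), hco]

theorem PhiW_map {A B : Type*} [CommRing A] [CommRing B] (φ : A →+* B) (r : Fin N → ℕ)
    (q : MvPolynomial (Fin (N + 1)) A) :
    Polynomial.map (MvPolynomial.map φ) (PhiW A r q) = PhiW B r (MvPolynomial.map φ q) := by
  induction q using MvPolynomial.induction_on with
  | C a =>
    rw [map_C, PhiW, PhiW, aeval_C, aeval_C]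
    exact (Polynomial.map_C _).trans (congrArg _ (map_C _ _))
  | add f g hf hg => simp only [map_add, Polynomial.map_add, hf, hg]
  | mul_X f i hf =>
    rw [map_mul, Polynomial.map_mul, hf, map_mul, map_mul, map_X]
    congr 1
    rw [PhiW, PhiW, aeval_X, aeval_X]
    refine Fin.cases ?_ (fun j => ?_) i <;> simp [gW]

/-- the point substitution -/
noncomputable def ptW (r : Fin N → ℕ) (t : ℤ_[p]) (x : Fin N → ℤ_[p]) : Fin (N + 1) → ℤ_[p] :=
  fun i => Fin.cases t (fun j => t ^ r j + x j) i

/-- evaluation of a polynomial in `t` over polynomials in `x` -/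
noncomputable def evW (t : ℤ_[p]) (x : Fin N → ℤ_[p]) :
    Polynomial (MvPolynomial (Fin N) ℤ_[p]) →+* ℤ_[p] := Polynomial.eval₂RingHom (eval x) t

theorem evW_PhiW (r : Fin N → ℕ) (t : ℤ_[p]) (x : Fin N → ℤ_[p])
    (q : MvPolynomial (Fin (N + 1)) ℤ_[p]) : evW t x (PhiW _ r q) = eval (ptW r t x) q := by
  induction q using MvPolynomial.induction_on with
  | C a => rw [PhiW, aeval_C, eval_C]; exact (Polynomial.eval₂_C _ _).trans (eval_C a)
  | add f g hf hg => simp only [map_add, hf, hg]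
  | mul_X f i hf =>
    rw [map_mul, map_mul, hf, map_mul]
    congr 1
    rw [PhiW, aeval_X, eval_X]
    refine Fin.cases ?_ (fun j => ?_) i <;> simp [gW, evW, ptW]

theorem p_dvd_of_map {q : Polynomial (MvPolynomial (Fin N) ℤ_[p])}
    (h : q.map (MvPolynomial.map (PadicInt.toZMod (p := p))) = 0) :
    (p : Polynomial (MvPolynomial (Fin N) ℤ_[p])) ∣ q := by
  have : (p : Polynomial (MvPolynomial (Fin N) ℤ_[p])) = Polynomial.C (C (p : ℤ_[p])) := by simp
  rw [this, Polynomial.C_dvd_iff_dvd_coeff]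
  intro i
  rw [C_dvd_iff_dvd_coeff]
  intro m
  have h1 : coeff m ((q.map (MvPolynomial.map (PadicInt.toZMod (p := p)))).coeff i) = 0 := by
    rw [h]; simp
  rw [Polynomial.coeff_map, coeff_map] at h1
  have h2 : coeff m (q.coeff i) ∈ RingHom.ker (PadicInt.toZMod (p := p)) := h1
  rwa [PadicInt.ker_toZMod, PadicInt.maximalIdeal_eq_span_p, Ideal.mem_span_singleton] at h2

theorem map_toZMod_eq_zero {q : MvPolynomial (Fin N) ℤ_[p]}
    (h : MvPolynomial.map (PadicInt.toZMod (p := p)) q = 0) :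
    (p : MvPolynomial (Fin N) ℤ_[p]) ∣ q := by
  have := p_dvd_of_map (q := Polynomial.C q) (by rw [Polynomial.map_C, h, Polynomial.C_0])
  obtain ⟨d, hd⟩ := this
  have := congrArg (Polynomial.eval 0) hd
  exact ⟨_, by simpa using this⟩

/-- One step of the factorization lifting. -/
theorem weier_step {S : Type*} [CommRing S] {F F' U W P q A B : Polynomial S} {k : ℕ} (hk : 1 ≤ k)
    (h1 : q ^ k ∣ F - U * W) (hU : q ∣ U - 1) (hW : q ∣ W - P) (hF : q ^ k ∣ F' - F)
    (hG : ∀ G : Polynomial S, F' - U * W = q ^ k * G → G = P * A + B) :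
    q ^ (k + 1) ∣ F' - (U + q ^ k * A) * (W + q ^ k * B) := by
  obtain ⟨G, hG'⟩ := dvd_add hF h1
  have e : F' - U * W = q ^ k * G := by rw [← hG']; ring
  have := hG G e
  obtain ⟨c, hc⟩ := hU
  obtain ⟨d, hd⟩ := hW
  obtain ⟨l, rfl⟩ : ∃ l, k = l + 1 := ⟨k - 1, by omega⟩
  have e2 : F' - (U + q ^ (l + 1) * A) * (W + q ^ (l + 1) * B)
      = q ^ (l + 1) * (G - A * W - U * B - q ^ (l + 1) * A * B) := by
    rw [mul_sub, mul_sub, mul_sub, ← e]; ring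
  rw [e2, this, pow_succ q (l + 1)]
  refine mul_dvd_mul_left _ ⟨-A * d - c * B - q ^ l * A * B, ?_⟩
  have hW' : W = P + q * d := by rw [← hd]; ring
  have hU' : U = 1 + q * c := by rw [← hc]; ring
  rw [hW', hU']; ring

/-- Weierstrass preparation by successive approximation. -/
theorem weier_seq {F : ℕ → Polynomial (MvPolynomial (Fin N) ℤ_[p])}
    {P : Polynomial (MvPolynomial (Fin N) ℤ_[p])} (hP : P.Monic)
    (hc : ∀ k, (p : Polynomial (MvPolynomial (Fin N) ℤ_[p])) ^ k ∣ F (k + 1) - F k)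
    (h1 : (p : Polynomial (MvPolynomial (Fin N) ℤ_[p])) ∣ F 1 - P) :
    ∃ U W : ℕ → Polynomial (MvPolynomial (Fin N) ℤ_[p]), ∀ k,
      (p : Polynomial (MvPolynomial (Fin N) ℤ_[p])) ^ (k + 1) ∣ F (k + 1) - U k * W k ∧
      (p : Polynomial (MvPolynomial (Fin N) ℤ_[p])) ^ (k + 1) ∣ U (k + 1) - U k ∧
      (p : Polynomial (MvPolynomial (Fin N) ℤ_[p])) ^ (k + 1) ∣ W (k + 1) - W k ∧
      (p : Polynomial (MvPolynomial (Fin N) ℤ_[p])) ∣ U k - 1 ∧ (W k).natDegree ≤ P.natDegree := by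
  let Rr := Polynomial (MvPolynomial (Fin N) ℤ_[p])
  let St : ℕ → Rr × Rr → Prop := fun k z => (p : Rr) ^ (k + 1) ∣ F (k + 1) - z.1 * z.2 ∧
    (p : Rr) ∣ z.1 - 1 ∧ (p : Rr) ∣ z.2 - P ∧ z.2.natDegree ≤ P.natDegree
  have step : ∀ k (z : Rr × Rr), ∃ z' : Rr × Rr, St k z → St (k + 1) z' ∧ (p : Rr) ^ (k + 1) ∣ z'.1 - z.1 ∧
      (p : Rr) ^ (k + 1) ∣ z'.2 - z.2 := by
    intro k z
    by_cases hz : St k z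
    · obtain ⟨e1, e2, e3, e4⟩ := hz
      obtain ⟨G, hG⟩ : (p : Rr) ^ (k + 1) ∣ F (k + 2) - z.1 * z.2 := by
        have := dvd_add (hc (k + 1)) e1
        simpa using this
      have hpp : (p : Rr) ≠ 0 := by
        intro h
        have e : (p : Rr) = Polynomial.C (C (p : ℤ_[p])) := by simp
        rw [e, Polynomial.C_eq_zero, C_eq_zero] at h
        exact (Fact.out : p.Prime).ne_zero (by exact_mod_cast h)
      have hq : (p : Rr) ∣ (p : Rr) ^ (k + 1) := dvd_pow_self _ (by omega)
      refine ⟨(z.1 + (p : Rr) ^ (k + 1) * (G /ₘ P), z.2 + (p : Rr) ^ (k + 1) * (G %ₘ P)),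
        fun _ => ⟨⟨?_, ?_, ?_, ?_⟩, by simp, by simp⟩⟩
      · refine weier_step (by omega) e1 e2 e3 (hc (k + 1)) fun G' hG' => ?_
        have : G' = G := mul_left_cancel₀ (pow_ne_zero _ hpp) (hG'.symm.trans hG)
        rw [this, add_comm, Polynomial.modByMonic_add_div G P]
      · have := dvd_add e2 (hq.mul_right (G /ₘ P))
        convert this using 1; ring
      · have := dvd_add e3 (hq.mul_right (G %ₘ P))
        convert this using 1; ring
      · refine (Polynomial.natDegree_add_le _ _).trans (max_le e4 ?_)
        have : (p : Rr) ^ (k + 1) = Polynomial.C ((p : MvPolynomial (Fin N) ℤ_[p]) ^ (k + 1)) := by simp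
        rw [this]
        exact (Polynomial.natDegree_C_mul_le _ _).trans (Polynomial.natDegree_modByMonic_le _ hP)
    · exact ⟨z, fun h => absurd h hz⟩
  choose nx hnx using step
  let sq : ℕ → Rr × Rr := fun k => Nat.rec (1, P) (fun k z => nx k z) k
  have hsq : ∀ k, St k (sq k) := by
    intro k
    induction k with
    | zero => exact ⟨by simpa [sq] using h1, by simp [sq], by simp [sq], le_rfl⟩
    | succ k ih => exact (hnx k _ ih).1
  exact ⟨fun k => (sq k).1, fun k => (sq k).2, fun k => ⟨(hsq k).1, (hnx k _ (hsq k)).2.1,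
    (hnx k _ (hsq k)).2.2, (hsq k).2.1, (hsq k).2.2.2⟩⟩

end
end PadicSub
end

section
namespace PadicSub
section
variable {p : ℕ} [Fact p.Prime] {N : ℕ}
open MvPolynomial

theorem RAo_of_coh {Q : ℕ → MvPolynomial (Fin N) ℤ_[p]}
    (h : ∀ k, (p : MvPolynomial (Fin N) ℤ_[p]) ^ k ∣ Q (k + 1) - Q k) :
    ∃ F : (Fin N → ℤ_[p]) → ℤ_[p], RAs F Q := by
  have := fun w : Fin N → ℤ_[p] => exists_lim (p := p) (c := fun k => eval w (Q k)) fun k => by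
    have := map_dvd (eval w) (h k)
    simpa using this
  choose F hF using this
  exact ⟨F, h, fun k w => hF w k⟩

theorem polyA_sum {f : ℕ → (Fin N → ℤ_[p]) → ℚ_[p]} (hf : ∀ j, f j ∈ RA p N) (d : ℕ) :
    (fun z : (Fin N → ℤ_[p]) × ℚ_[p] => ∑ j ∈ Finset.range d, f j z.1 * z.2 ^ j) ∈
      (Sp.mk' (RA p N)).poly.A := by
  have := (Sp.mk' (RA p N)).poly.A.sum_mem (t := Finset.range d)
    (f := fun j => fun z : (Fin N → ℤ_[p]) × ℚ_[p] => f j z.1 * z.2 ^ j) fun j _ =>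
      (Sp.mk' (RA p N)).poly.A.mul_mem (poly_fst' (X := Sp.mk' (RA p N)) (le_cl _ (hf j)))
        ((Sp.mk' (RA p N)).poly.A.pow_mem (poly_snd (X := Sp.mk' (RA p N))) j)
  refine Eq.subst (motive := fun s => s ∈ (Sp.mk' (RA p N)).poly.A) ?_ this
  funext z
  exact Finset.sum_apply _ _ _

theorem evW_sum (t : ℤ_[p]) (x : Fin N → ℤ_[p]) (q : Polynomial (MvPolynomial (Fin N) ℤ_[p]))
    {d : ℕ} (hd : q.natDegree < d) :
    evW t x q = ∑ j ∈ Finset.range d, eval x (q.coeff j) * t ^ j :=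
  Polynomial.eval₂_eq_sum_range' _ hd _

theorem weier {F : (Fin (N + 1) → ℤ_[p]) → ℤ_[p]} {Q : ℕ → MvPolynomial (Fin (N + 1)) ℤ_[p]}
    (hF : RAs F Q) (r : Fin N → ℕ)
    (hu : IsUnit (PhiW (ZMod p) r (MvPolynomial.map PadicInt.toZMod (Q 1))).leadingCoeff) (K : ℕ) :
    ∃ H ∈ (Sp.mk' (RA p N)).poly.A, ∀ (x : Fin N → ℤ_[p]) (t : ℤ_[p]),
      App K (F (ptW r t x) : ℚ_[p]) (H ((x, (t : ℚ_[p])) : (Fin N → ℤ_[p]) × ℚ_[p])) := by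
  obtain ⟨c, hc, hc'⟩ := MvPolynomial.isUnit_iff_eq_C_of_isReduced.1 hu
  obtain ⟨u, hu'⟩ := ZMod.ringHom_surjective (PadicInt.toZMod (p := p)) c⁻¹
  have hc0 : c ≠ 0 := hc.ne_zero
  have hu0 : (u : ℚ_[p]) ≠ 0 := by
    intro h
    have : u = 0 := Subtype.ext h
    rw [this, map_zero] at hu'
    exact inv_ne_zero hc0 hu'.symm
  let Rr := Polynomial (MvPolynomial (Fin N) ℤ_[p])
  let Fk : ℕ → Rr := fun k => Polynomial.C (C u) * PhiW _ r (Q k)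
  let φ : MvPolynomial (Fin N) ℤ_[p] →+* MvPolynomial (Fin N) (ZMod p) :=
    MvPolynomial.map (PadicInt.toZMod (p := p))
  have hmapF : (Fk 1).map φ = Polynomial.C (C c⁻¹) *
      PhiW (ZMod p) r (MvPolynomial.map PadicInt.toZMod (Q 1)) := by
    rw [Polynomial.map_mul, PhiW_map, Polynomial.map_C]
    simp only [φ, map_C, hu']
  have hmon : ((Fk 1).map φ).Monic := by
    rw [hmapF, Polynomial.Monic, Polynomial.leadingCoeff_mul, Polynomial.leadingCoeff_C, hc', ← C_mul,
      inv_mul_cancel₀ hc0, C_1]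
  obtain ⟨P, hP1, hP2, hP3⟩ := Polynomial.lifts_and_natDegree_eq_and_monic
    ((Polynomial.mem_lifts _).2 ⟨Fk 1, rfl⟩) hmon
  have hcoh : ∀ k, (p : Rr) ^ k ∣ Fk (k + 1) - Fk k := fun k => by
    have := map_dvd (PhiW ℤ_[p] r) (hF.1 k)
    rw [map_pow, map_natCast, map_sub] at this
    rw [← mul_sub]
    exact this.mul_left _
  obtain ⟨U, W, hUW⟩ := weier_seq hP3 hcoh (p_dvd_of_map (by
    rw [Polynomial.map_sub, hP1, sub_self]))
  have hWc : ∀ j k, (p : MvPolynomial (Fin N) ℤ_[p]) ^ k ∣ (W (k + 1)).coeff j - (W k).coeff j := by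
    intro j k
    have := (pow_dvd_pow _ k.le_succ).trans (hUW k).2.2.1
    have e : (p : Rr) ^ k = Polynomial.C ((p : MvPolynomial (Fin N) ℤ_[p]) ^ k) := by simp
    rw [e, Polynomial.C_dvd_iff_dvd_coeff] at this
    simpa using this j
  have := fun j => RAo_of_coh (hWc j)
  choose w hw using this
  obtain ⟨d, hd⟩ : ∃ d, d = P.natDegree + 1 := ⟨_, rfl⟩
  let V : ℤ_[p] → (Fin N → ℤ_[p]) → ℤ_[p] := fun t x => ∑ j ∈ Finset.range d, w j x * t ^ j
  have hV : ∀ k t x, (p : ℤ_[p]) ^ k ∣ V t x - evW t x (W k) := fun k t x => by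
    rw [evW_sum t x (W k) (d := d) (by have := (hUW k).2.2.2.2; omega), ← Finset.sum_sub_distrib]
    refine Finset.dvd_sum fun j _ => ?_
    rw [← sub_mul]
    exact ((hw j).2 k x).mul_right _
  let M := (U K).natDegree + 1
  let H1 : (Fin N → ℤ_[p]) × ℚ_[p] → ℚ_[p] := fun z =>
    ∑ j ∈ Finset.range M, (eval z.1 ((U K).coeff j) : ℚ_[p]) * z.2 ^ j
  let H2 : (Fin N → ℤ_[p]) × ℚ_[p] → ℚ_[p] := fun z =>
    ∑ j ∈ Finset.range d, (w j z.1 : ℚ_[p]) * z.2 ^ j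
  have hH1 : H1 ∈ (Sp.mk' (RA p N)).poly.A :=
    polyA_sum (fun j => (RAo.poly ((U K).coeff j)).mem_RA) M
  have hH2 : H2 ∈ (Sp.mk' (RA p N)).poly.A :=
    polyA_sum (fun j => RAo.mem_RA ⟨_, hw j⟩) d
  refine ⟨_, (Sp.mk' (RA p N)).poly.A.smul_mem
    ((Sp.mk' (RA p N)).poly.A.mul_mem hH1 hH2) (u : ℚ_[p])⁻¹, fun x t => ?_⟩
  have e1 : H1 (x, (t : ℚ_[p])) = (evW t x (U K) : ℚ_[p]) := by
    rw [evW_sum t x (U K) (d := M) (Nat.lt_succ_self _), PadicInt.coe_sum]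
    simp [H1]
  have e2 : H2 (x, (t : ℚ_[p])) = (V t x : ℚ_[p]) := by
    rw [PadicInt.coe_sum]; simp [H2]
  have e3 : App K ((u : ℚ_[p]) * (F (ptW r t x) : ℚ_[p])) (H1 (x, (t : ℚ_[p])) * H2 (x, (t : ℚ_[p]))) := by
    rw [e1, e2]
    have hn1 : ‖(evW t x (U K) : ℚ_[p])‖ = 1 := by
      have h := map_dvd (evW t x) (hUW K).2.2.2.1
      rw [map_natCast, map_sub, map_one, ← pow_one (p : ℤ_[p]), zdvd_iff] at h
      rw [PadicInt.coe_sub] at h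
      have h2 := norm_eq_of_sub_lt (p := p) (x := (evW t x (U K) : ℚ_[p])) (y := 1)
        (h.trans_lt (by rw [norm_one]; exact norm_ppow_lt_one le_rfl))
      rw [h2, norm_one]
    unfold App
    rw [norm_mul _ ((V t x : ℤ_[p]) : ℚ_[p]), hn1, one_mul]
    by_contra hlt
    rw [not_le] at hlt
    obtain ⟨n0, -, hn0⟩ := exists_ppow_lt (p := p)
      (lt_of_le_of_lt (by positivity) hlt)
    obtain ⟨n, hn, hKn⟩ : ∃ n, n0 ≤ n ∧ K ≤ n := ⟨max n0 K, le_max_left _ _, le_max_right _ _⟩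
    have a1 : (p : ℤ_[p]) ^ n ∣ u * F (ptW r t x) - evW t x (U n) * V t x := by
      have b1 := map_dvd (evW t x) (((pow_dvd_pow _ n.le_succ).trans (hUW n).1))
      have b2 := hV n t x
      have b3 := hF.2 (n + 1) (ptW r t x)
      rw [map_pow, map_natCast, map_sub, map_mul, map_mul, evW_PhiW] at b1
      have b4 : evW t x (Polynomial.C (C u)) = u := (Polynomial.eval₂_C _ _).trans (eval_C u)
      rw [b4] at b1
      have := dvd_sub (dvd_add b1 (((pow_dvd_pow _ n.le_succ).trans b3).mul_left u))
        (b2.mul_left (evW t x (U n)))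
      convert this using 1; ring
    have a2 : (p : ℤ_[p]) ^ K ∣ evW t x (U n) - evW t x (U K) := by
      have := coh_dvd (c := U) (q := (p : Rr)) (fun k => (pow_dvd_pow _ k.le_succ).trans (hUW k).2.1) hKn
      have := map_dvd (evW t x) this
      simpa using this
    have a3 := zdvd_iff.1 a1
    have a4 := mul_le_mul_of_nonneg_right (zdvd_iff.1 a2) (norm_nonneg (V t x : ℚ_[p]))
    rw [← norm_mul] at a4
    have a5 := na_add (((u * F (ptW r t x) - evW t x (U n) * V t x : ℤ_[p])) : ℚ_[p])
      (((evW t x (U n) - evW t x (U K) : ℤ_[p]) : ℚ_[p]) * (V t x : ℚ_[p]))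
    push_cast at a5 a4 a3
    have a6 : (u : ℚ_[p]) * (F (ptW r t x) : ℚ_[p]) - (evW t x (U n) : ℚ_[p]) * (V t x : ℚ_[p]) +
        ((evW t x (U n) : ℚ_[p]) - (evW t x (U K) : ℚ_[p])) * (V t x : ℚ_[p]) =
        (u : ℚ_[p]) * (F (ptW r t x) : ℚ_[p]) - (evW t x (U K) : ℚ_[p]) * (V t x : ℚ_[p]) := by ring
    rw [a6] at a5
    have a7 := norm_ppow_anti (p := p) hn
    rcases le_max_iff.1 a5 with a | a
    · linarith
    · linarith
  have := e3.mul_left (u : ℚ_[p])⁻¹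
  rw [inv_mul_cancel_left₀ hu0] at this
  exact this

theorem RAo.normalize {F : (Fin N → ℤ_[p]) → ℤ_[p]} (hF : RAo F) :
    (∀ w, F w = 0) ∨ ∃ l F' Q', RAs F' Q' ∧ MvPolynomial.map (PadicInt.toZMod (p := p)) (Q' 1) ≠ 0 ∧
      ∀ w, F w = (p : ℤ_[p]) ^ l * F' w := by
  classical
  obtain ⟨Q, h1, h2⟩ := hF
  by_cases h : ∃ k, ¬ (p : MvPolynomial (Fin N) ℤ_[p]) ^ k ∣ Q k
  · right
    have hk := Nat.find_spec h
    obtain ⟨l, hl⟩ : ∃ l, Nat.find h = l + 1 := by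
      refine ⟨Nat.find h - 1, ?_⟩
      have : Nat.find h ≠ 0 := fun h0 => by rw [h0] at hk; simp at hk
      omega
    have hl0 : (p : MvPolynomial (Fin N) ℤ_[p]) ^ l ∣ Q l := by
      by_contra hcon
      have := Nat.find_min' h hcon
      omega
    rw [hl] at hk
    have hp0 : (p : MvPolynomial (Fin N) ℤ_[p]) ^ l ≠ 0 := by
      refine pow_ne_zero _ fun h => ?_
      have e : (p : MvPolynomial (Fin N) ℤ_[p]) = C (p : ℤ_[p]) := by simp
      rw [e, C_eq_zero] at h
      exact (Fact.out : p.Prime).ne_zero (by exact_mod_cast h)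
    have hdv : ∀ k, ∃ q, Q (k + l) = (p : MvPolynomial (Fin N) ℤ_[p]) ^ l * q := fun k => by
      have := dvd_add (coh_dvd h1 (Nat.le_add_left l k)) hl0
      rwa [sub_add_cancel] at this
    choose Q' hQ' using hdv
    have hcoh : ∀ k, (p : MvPolynomial (Fin N) ℤ_[p]) ^ k ∣ Q' (k + 1) - Q' k := fun k => by
      have := h1 (k + l)
      rw [add_right_comm, hQ', hQ', ← mul_sub, pow_add, mul_comm (_ ^ k)] at this
      exact (mul_dvd_mul_iff_left hp0).1 this
    obtain ⟨F', hF'⟩ := RAo_of_coh hcoh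
    refine ⟨l, F', Q', hF', fun h0 => hk ?_, fun w => zeq_of_dvd fun k => ?_⟩
    · rw [add_comm l 1, hQ', add_comm, pow_succ]
      exact mul_dvd_mul_left _ (map_toZMod_eq_zero h0)
    · have e1 := (pow_dvd_pow _ (Nat.le_add_right k l)).trans (h2 (k + l) w)
      have e2 := (hF'.2 k w).mul_left ((p : ℤ_[p]) ^ l)
      rw [hQ', map_mul, map_pow, map_natCast] at e1
      have := dvd_sub e1 e2
      convert this using 1; ring
  · left
    push Not at h
    intro w
    refine zeq_of_dvd fun k => ?_
    have e1 := map_dvd (eval w) (h k)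
    rw [map_pow, map_natCast] at e1
    have := dvd_add (h2 k w) e1
    simpa using this

/-- Definable sets of `ℤ_p^(N+1)` become polynomial in the last variable after a substitution. -/
theorem RA_def_poly {S : Set (Fin (N + 1) → ℤ_[p])} (hS : DefS (RA p (N + 1)) S) :
    ∃ f0 : MvPolynomial (Fin (N + 1)) (ZMod p), f0 ≠ 0 ∧ ∀ r : Fin N → ℕ,
      IsUnit (PhiW (ZMod p) r f0).leadingCoeff → ∃ T, DefS (Sp.mk' (RA p N)).poly.A T ∧
        ∀ (x : Fin N → ℤ_[p]) (t : ℤ_[p]),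
          ptW r t x ∈ S ↔ ((x, (t : ℚ_[p])) : (Fin N → ℤ_[p]) × ℚ_[p]) ∈ T := by
  induction hS with
  | base S h =>
    obtain ⟨f, ⟨m, F, hF, hfF⟩, n, hn, rfl⟩ := h
    have hpm : (p : ℚ_[p]) ^ m ≠ 0 := pow_ne_zero _ p_ne_zero'
    rcases hF.normalize with h0 | ⟨l, F', Q', hQ', hne, hl⟩
    · refine ⟨1, one_ne_zero, fun r _ => ⟨∅, BoolGen.empty, fun x t => ?_⟩⟩
      have : f (ptW r t x) = 0 := by
        have := hfF (ptW r t x)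
        rw [h0] at this
        exact (mul_eq_zero.1 this).resolve_left hpm
      simp only [Set.mem_ofPred_eq, this]
      exact ⟨fun h => ne_zero_of_mem_Pset h rfl, fun h => h.elim⟩
    · obtain ⟨K, -, hK⟩ := exists_app_Pset (p := p) n hn
      refine ⟨_, hne, fun r hr => ?_⟩
      obtain ⟨H, hH, hH'⟩ := weier hQ' r hr K
      refine ⟨_, DefS.cpow hH (((p : ℚ_[p]) ^ m)⁻¹ * (p : ℚ_[p]) ^ l) hn, fun x t => ?_⟩
      have e1 := (hH' x t).mul_left (((p : ℚ_[p]) ^ m)⁻¹ * (p : ℚ_[p]) ^ l)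
      have e2 : f (ptW r t x) = ((p : ℚ_[p]) ^ m)⁻¹ * (p : ℚ_[p]) ^ l * (F' (ptW r t x) : ℚ_[p]) := by
        have := hfF (ptW r t x)
        rw [hl] at this
        push_cast at this
        rw [mul_assoc, ← this, inv_mul_cancel_left₀ hpm]
      rw [← e2] at e1
      exact hK _ _ e1
  | univ => exact ⟨1, one_ne_zero, fun r _ => ⟨_, BoolGen.univ, fun x t => Iff.rfl⟩⟩
  | compl S _ ih =>
    obtain ⟨f0, h0, h⟩ := ih
    refine ⟨f0, h0, fun r hr => ?_⟩
    obtain ⟨T, hT, h⟩ := h r hr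
    exact ⟨_, hT.compl, fun x t => not_congr (h x t)⟩
  | inter S S' _ _ ih ih' =>
    obtain ⟨f0, h0, h⟩ := ih
    obtain ⟨f0', h0', h'⟩ := ih'
    refine ⟨f0 * f0', mul_ne_zero h0 h0', fun r hr => ?_⟩
    rw [map_mul, Polynomial.leadingCoeff_mul, IsUnit.mul_iff] at hr
    obtain ⟨T, hT, h⟩ := h r hr.1
    obtain ⟨T', hT', h'⟩ := h' r hr.2
    exact ⟨_, hT.inter _ _ hT', fun x t => and_congr (h x t) (h' x t)⟩

/-- Definable subsets of `ℤ_p^N` are standard. -/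
theorem RA_fsq (N : ℕ) : ∀ S, DefS (Sp.mk' (RA p N)).A S → FSQ ((Sp.mk' (RA p N)).c S) := by
  induction N with
  | zero =>
    intro S hS
    by_cases h : ∃ x, x ∈ S
    · obtain ⟨x, hx⟩ := h
      have hS' : ∀ y : (Fin 0 → ℤ_[p]), y ∈ S := fun y => by rwa [Subsingleton.elim y x]
      let e : S ≃ Unit := ⟨fun _ => (), fun _ => ⟨x, hx⟩, fun y => Subtype.ext (Subsingleton.elim (α := Fin 0 → ℤ_[p]) _ _),
        fun _ => rfl⟩
      refine ⟨_, zz p 0, rfl, by simpa using StdQ.fin (p := p) 1, e, ?_⟩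
      intro f _
      exact const_mem (((Sp.mk' (RA p 0)).sub S).A) (f ())
    · push Not at h
      rw [c_empty _ h]
      exact FSQ.zero
  | succ N ih =>
    intro S hS
    obtain ⟨f0, h0, h⟩ := RA_def_poly (DefS.of_cl hS)
    obtain ⟨r, hr⟩ := noether f0 h0
    obtain ⟨T, hT, h⟩ := h r hr
    let T' : Set ((Fin N → ℤ_[p]) × ℚ_[p]) := T ∩ {z | ‖z.2‖ ≤ ‖(1 : ℚ_[p])‖}
    have hT' : DefS (Sp.mk' (RA p N)).poly.A T' :=
      hT.inter _ _ (DefS.norm_le (poly_snd (X := Sp.mk' (RA p N))) (const_mem _ 1))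
    have hb : ∀ z ∈ T', ‖z.2‖ ≤ 1 := fun z hz => hz.2.trans norm_one.le
    have main := fs_main ih hT' hb
    have hpt : ∀ b : Fin (N + 1) → ℤ_[p], ptW r (b 0) (fun j => b j.succ - b 0 ^ r j) = b := fun b => by
      funext i
      refine Fin.cases ?_ (fun j => ?_) i <;> simp [ptW]
    let φ : S → T' := fun b => ⟨(fun j => b.1 j.succ - b.1 0 ^ r j, (b.1 0 : ℚ_[p])),
      (h _ _).1 (show _ ∈ S from (hpt b.1).symm ▸ b.2), (b.1 0).2.trans norm_one.ge⟩
    let ψ : T' → S := fun z => ⟨ptW r ⟨z.1.2, hb _ z.2⟩ z.1.1, (h _ _).2 z.2.1⟩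
    let e : S ≃ T' := ⟨φ, ψ, fun b => Subtype.ext (hpt b.1), fun z => by
      refine Subtype.ext (Prod.ext (funext fun j => ?_) rfl)
      exact add_sub_cancel_left _ _⟩
    refine FSQ.fwd (X := (Sp.mk' (RA p (N + 1))).sub S) (Y := (Sp.mk' (RA p N)).poly.sub T')
      ⟨e, ?_⟩ main
    have hv := mor_val (Sp.mk' (RA p (N + 1))) S
    refine mor_polysub (X := Sp.mk' (RA p N)) (Y := (Sp.mk' (RA p (N + 1))).sub S) (φ := φ) ?_ ?_
    · refine mor_mk' ?_
      rintro f ⟨m, F, hF, hfF⟩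
      refine hv (fun b => f (fun j => b j.succ - b 0 ^ r j)) (le_cl _ ⟨m, _, hF.comp
        (G := fun j b => b j.succ - b 0 ^ r j) fun j => ?_, fun b => hfF _⟩)
      have := RAo.poly (N := N + 1) (X j.succ - X 0 ^ r j : MvPolynomial (Fin (N + 1)) ℤ_[p])
      simpa only [map_sub, map_pow, eval_X] using this
    · exact hv (fun b => (b 0 : ℚ_[p])) (le_cl _ (RAo.coord 0).mem_RA)

end
end PadicSub
end

section
open MvPolynomial
namespace PadicSub
section
variable {p : ℕ} [Fact p.Prime] {m n N N' : ℕ}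
local notation "𝕍" => (Fin m → ℚ_[p])

theorem IsDFunction.of_poly2 {f g : 𝕍 → ℚ_[p]} (hf : IsDFunction p f) (hg : IsDFunction p g)
    (q : MvPolynomial (Fin 2) ℚ_[p]) : IsDFunction p (fun x => eval ![f x, g x] q) := by
  have := IsDFunction.comp _ ![f, g] (IsDFunction.poly q) (by intro i; fin_cases i <;> assumption)
  refine Eq.subst (motive := fun s => IsDFunction p s) ?_ this
  funext x
  congr 2
  funext i
  fin_cases i <;> rfl

/-- The algebra of `D`-functions. -/
noncomputable def Dalg (p : ℕ) [Fact p.Prime] (m : ℕ) : FAlg p (Fin m → ℚ_[p]) where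
  carrier := {f | IsDFunction p f}
  mul_mem' hf hg := by
    have := IsDFunction.of_poly2 hf hg (X 0 * X 1)
    simp only [map_mul, eval_X] at this
    exact this
  add_mem' hf hg := by
    have := IsDFunction.of_poly2 hf hg (X 0 + X 1)
    simp only [map_add, eval_X] at this
    exact this
  algebraMap_mem' r := by
    have := IsDFunction.poly (p := p) (m := m) (C r)
    simp only [eval_C] at this
    exact this

theorem coord_mem_Dalg (i : Fin m) : (fun x : Fin m → ℚ_[p] => x i) ∈ Dalg p m := by
  have := IsDFunction.poly (p := p) (X i : MvPolynomial (Fin m) ℚ_[p])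
  simp only [eval_X] at this
  exact this

theorem IsDFunction.inv' {f : 𝕍 → ℚ_[p]} (hf : IsDFunction p f) : IsDFunction p (fun x => (f x)⁻¹) :=
  IsDFunction.comp _ (fun _ => f) IsDFunction.inv fun _ => hf

open Classical in
/-- Truncation to `ℤ_p`. -/
noncomputable def tr (x : ℚ_[p]) : ℤ_[p] := if h : ‖x‖ ≤ 1 then ⟨x, h⟩ else 0

theorem tr_coe (x : ℤ_[p]) : tr (x : ℚ_[p]) = x := dif_pos x.2

theorem coe_tr {x : ℚ_[p]} (h : ‖x‖ ≤ 1) : (tr x : ℚ_[p]) = x := congrArg Subtype.val (dif_pos h : tr x = _)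

theorem tr_zero {x : ℚ_[p]} (h : ¬ ‖x‖ ≤ 1) : tr x = 0 := dif_neg h

theorem RA_ext {f : (Fin N → ℤ_[p]) → ℚ_[p]} (hf : f ∈ RA p N) : ∃ f', IsDFunction p f' ∧
    (∀ w : Fin N → ℤ_[p], f' (fun j => (w j : ℚ_[p])) = f w) ∧ ∀ x, ¬ (∀ j, ‖x j‖ ≤ 1) → f' x = 0 := by
  obtain ⟨n, F, hF, h⟩ := hf
  obtain ⟨a, ha, h'⟩ := hF.exists_coeffs
  refine ⟨_, (Dalg p N).smul_mem (IsDFunction.ranal _ ha) ((p : ℚ_[p]) ^ n)⁻¹, fun w => ?_, fun x hx => ?_⟩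
  · simp only [Pi.smul_apply, smul_eq_mul, ← h', ← h]
    exact inv_mul_cancel_left₀ (pow_ne_zero _ p_ne_zero') _
  · simp only [Pi.smul_apply, smul_eq_mul, ranalFn, if_neg hx, mul_zero]

theorem tr_D {f : 𝕍 → ℚ_[p]} (hf : IsDFunction p f) :
    IsDFunction p (fun x => (tr (f x) : ℚ_[p])) := by
  obtain ⟨t, ht, h, h'⟩ := RA_ext (RAo.coord (p := p) (0 : Fin 1)).mem_RA
  refine Eq.subst (motive := fun s => IsDFunction p s) ?_ (ht.comp _ (fun _ => f) fun _ => hf)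
  funext x
  by_cases hx : ‖f x‖ ≤ 1
  · have := h fun _ => tr (f x)
    simpa only [coe_tr hx] using this
  · rw [h' _ fun h => hx (h 0), tr_zero hx]
    rfl

theorem tr_cl {Ω : Type} {A : FAlg p Ω} {g : Ω → ℚ_[p]} (hg : g ∈ cl A) : (fun ω => (tr (g ω) : ℚ_[p])) ∈ cl A := by
  classical
  have := cl_ite (DefS.of_cl (DefS.norm_le hg (const_mem _ 1))) hg (const_mem _ 0)
  refine Eq.subst (motive := fun s => s ∈ cl A) ?_ this
  funext x
  by_cases hx : ‖g x‖ ≤ 1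
  · exact (if_pos (show ‖g x‖ ≤ ‖(1 : ℚ_[p])‖ by rwa [norm_one])).trans (coe_tr hx).symm
  · rw [tr_zero hx]
    exact if_neg (show ¬ ‖g x‖ ≤ ‖(1 : ℚ_[p])‖ by rwa [norm_one])

theorem RA_D {E : 𝕍 → Fin N → ℤ_[p]} (hE : ∀ i, IsDFunction p (fun x => (E x i : ℚ_[p])))
    {f : (Fin N → ℤ_[p]) → ℚ_[p]} (hf : f ∈ RA p N) : f ∘ E ∈ Dalg p m := by
  obtain ⟨t, ht, h, -⟩ := RA_ext hf
  refine Eq.subst (motive := fun s => IsDFunction p s) ?_ (ht.comp _ _ hE)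
  funext x
  exact h _

theorem RA_proj (ι : Fin N → Fin N') {f : (Fin N → ℤ_[p]) → ℚ_[p]} (hf : f ∈ RA p N) :
    f ∘ (fun b i => b (ι i)) ∈ RA p N' := by
  obtain ⟨n, F, hF, h⟩ := hf
  exact ⟨n, _, hF.comp (G := fun i b => b (ι i)) fun i => RAo.coord _, fun b => h _⟩

/-- A definable embedding into some `ℤ_p^N`. -/
structure Sys (E : 𝕍 → Fin N → ℤ_[p]) : Prop where
  d : ∀ i, IsDFunction p (fun x => (E x i : ℚ_[p]))
  inj : Function.Injective E
  rng : DefS (RA p N) (Set.range E)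

/-- `f` factors through `E`. -/
def Rep (E : 𝕍 → Fin N → ℤ_[p]) (f : 𝕍 → ℚ_[p]) : Prop :=
  ∃ φ ∈ cl (RA p N), ∀ x, f x = φ (E x)

/-- `E'` extends `E`. -/
def Ext (E : 𝕍 → Fin N → ℤ_[p]) (E' : 𝕍 → Fin N' → ℤ_[p]) : Prop :=
  ∃ ι : Fin N → Fin N', ∀ x i, E x i = E' x (ι i)

theorem Ext.refl (E : 𝕍 → Fin N → ℤ_[p]) : Ext E E := ⟨id, fun _ _ => rfl⟩

theorem Ext.trans {N'' : ℕ} {E : 𝕍 → Fin N → ℤ_[p]} {E' : 𝕍 → Fin N' → ℤ_[p]}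
    {E'' : 𝕍 → Fin N'' → ℤ_[p]} : Ext E E' → Ext E' E'' → Ext E E''
  | ⟨a, ha⟩, ⟨b, hb⟩ => ⟨b ∘ a, fun x i => (ha x i).trans (hb x _)⟩

theorem Ext.rep {E : 𝕍 → Fin N → ℤ_[p]} {E' : 𝕍 → Fin N' → ℤ_[p]} (h : Ext E E')
    {f : 𝕍 → ℚ_[p]} : Rep E f → Rep E' f := by
  rintro ⟨φ, hφ, hf⟩
  obtain ⟨ι, hι⟩ := h
  refine ⟨_, cl_comp (φ := fun b i => b (ι i)) (fun f hf => le_cl _ (RA_proj ι hf)) hφ, fun x => ?_⟩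
  rw [hf x]
  exact congrArg φ (funext (hι x))

theorem claimA {E : 𝕍 → Fin N → ℤ_[p]} (hE : Sys E) {g : Fin n → 𝕍 → ℚ_[p]}
    (hg : ∀ j, IsDFunction p (g j)) (hr : ∀ j, Rep E (g j)) :
    Sys (fun x => Fin.append (E x) (fun j => tr (g j x))) := by
  choose φ hφ h using hr
  refine ⟨fun i => ?_, fun x y hxy => hE.inj (funext fun i => ?_), ?_⟩
  · refine Fin.addCases (fun i => ?_) (fun i => ?_) i
    · simpa using hE.d i
    · simpa using tr_D (hg i)
  · simpa using congrFun hxy (Fin.castAdd n i)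
  · have hp : ∀ f ∈ RA p N, f ∘ (fun b i => b (Fin.castAdd n i)) ∈ RA p (N + n) := fun f hf => RA_proj _ hf
    have h1 := DefS.comp hp hE.rng
    have h2 : ∀ j, DefS (cl (RA p (N + n))) {b | (b (Fin.natAdd N j) : ℚ_[p]) = tr (φ j (fun i => b (Fin.castAdd n i)))} :=
      fun j => DefS.eq (le_cl _ (RAo.coord (Fin.natAdd N j)).mem_RA)
        (tr_cl (cl_comp (fun f hf => le_cl _ (hp f hf)) (hφ j)))
    refine BoolGen.congr (h1.and (DefS.of_cl (BoolGen.all_finite h2))) fun b => ⟨?_, ?_⟩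
    · rintro ⟨⟨x, hx⟩, hb⟩; replace hx := hx.symm
      refine ⟨x, funext fun i => ?_⟩
      refine Fin.addCases (fun i => ?_) (fun j => ?_) i
      · simpa using (congrFun hx i).symm
      · have := hb j
        rw [show (fun i => b (Fin.castAdd n i)) = E x from hx, ← h] at this
        simpa using (PadicInt.ext this).symm
    · rintro ⟨x, rfl⟩
      have he : (fun i => Fin.append (E x) (fun j => tr (g j x)) (Fin.castAdd n i)) = E x := by simp
      refine ⟨⟨x, he.symm⟩, fun j => ?_⟩
      rw [he, ← h]
      simp

/-- `f` becomes representable in any large enough system. -/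
def Ach (E : 𝕍 → Fin N → ℤ_[p]) (f : 𝕍 → ℚ_[p]) : Prop :=
  ∀ (N' : ℕ) (E' : 𝕍 → Fin N' → ℤ_[p]), Sys E' → Ext E E' →
    ∃ (N'' : ℕ) (E'' : 𝕍 → Fin N'' → ℤ_[p]), Sys E'' ∧ Ext E' E'' ∧ Rep E'' f

theorem Ach.family {E : 𝕍 → Fin N → ℤ_[p]} {h : Fin n → 𝕍 → ℚ_[p]}
    (H : ∀ i, Ach E (h i)) {N' : ℕ} {E' : 𝕍 → Fin N' → ℤ_[p]} (hE : Sys E') (hx : Ext E E') :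
    ∃ (N'' : ℕ) (E'' : 𝕍 → Fin N'' → ℤ_[p]), Sys E'' ∧ Ext E' E'' ∧ ∀ i, Rep E'' (h i) := by
  suffices ∀ k, ∃ (N'' : ℕ) (E'' : 𝕍 → Fin N'' → ℤ_[p]), Sys E'' ∧ Ext E' E'' ∧
      ∀ i : Fin n, i.1 < k → Rep E'' (h i) by
    obtain ⟨N1, E1, h1, h2, h3⟩ := this n
    exact ⟨N1, E1, h1, h2, fun i => h3 i i.2⟩
  intro k
  induction k with
  | zero => exact ⟨N', E', hE, Ext.refl _, fun i hi => absurd hi (Nat.not_lt_zero _)⟩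
  | succ k ih =>
    obtain ⟨N1, E1, h1, h2, h3⟩ := ih
    by_cases hk : k < n
    · obtain ⟨N2, E2, h4, h5, h6⟩ := H ⟨k, hk⟩ N1 E1 h1 (hx.trans h2)
      refine ⟨N2, E2, h4, h2.trans h5, fun i hi => ?_⟩
      rcases Nat.lt_succ_iff_lt_or_eq.1 hi with hi | hi
      · exact h5.rep (h3 i hi)
      · have : i = ⟨k, hk⟩ := Fin.ext hi
        rwa [this]
    · exact ⟨N1, E1, h1, h2, fun i _ => h3 i (by omega)⟩

theorem claimB {f : (Fin n → ℚ_[p]) → ℚ_[p]} (hf : IsDFunction p f) :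
    ∀ {m N : ℕ} (E : (Fin m → ℚ_[p]) → Fin N → ℤ_[p]) (g : Fin n → (Fin m → ℚ_[p]) → ℚ_[p]),
      (∀ j, IsDFunction p (g j)) → (∀ j, Rep E (g j)) → Ach E (fun x => f (fun j => g j x)) := by
  induction hf with
  | @ranal n a ha =>
    intro m N E g hg hr N' E' hE' hx
    classical
    have hr' := fun j => hx.rep (hr j)
    have hS := claimA hE' hg hr'
    have hxt : Ext E' (fun x => Fin.append (E' x) (fun j => tr (g j x))) := ⟨Fin.castAdd n, fun x i => by simp⟩
    refine ⟨_, _, hS, hxt, ?_⟩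
    choose φ hφ h using fun j => hxt.rep (hr' j)
    have h1 := cl_ite (DefS.of_cl (BoolGen.all_finite fun j => DefS.norm_le (hφ j) (const_mem _ 1)))
      (le_cl _ (RA_proj (Fin.natAdd N') (ranal_mem_RA a ha))) (const_mem _ 0)
    refine ⟨_, h1, fun x => ?_⟩
    by_cases hb : ∀ j, ‖g j x‖ ≤ 1
    · refine Eq.trans ?_ (if_pos (fun j => ?_)).symm
      · simp only [Function.comp, Fin.append_right, coe_tr (hb _)]
      · exact (congrArg norm (h j x)).ge.trans ((hb j).trans norm_one.ge)
    · refine (if_neg hb).trans (if_neg (fun hc => hb fun j => ?_)).symm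
      exact (congrArg norm (h j x)).le.trans ((hc j).trans norm_one.le)
  | @poly n q =>
    intro m N E g hg hr N' E' hE' hx
    refine ⟨N', E', hE', Ext.refl _, ?_⟩
    choose φ hφ h using fun j => hx.rep (hr j)
    refine ⟨aeval φ q, ?_, fun x => ?_⟩
    · have : aeval φ q = (aeval (fun j => (⟨φ j, hφ j⟩ : cl (RA p N'))) q : cl (RA p N')).1 := by
        rw [← Subalgebra.coe_val, ← AlgHom.comp_apply, comp_aeval]
        rfl
      rw [this]
      exact Subtype.prop _
    · simp only [h]
      rw [← aeval_eq_eval]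
      have := congrArg (fun F => F q) (comp_aeval (R := ℚ_[p]) (f := φ) (Pi.evalAlgHom ℚ_[p] (fun _ : Fin N' → ℤ_[p] => ℚ_[p]) (E' x)))
      exact this.symm
  | inv =>
    intro m N E g hg hr N' E' hE' hx
    refine ⟨N', E', hE', Ext.refl _, ?_⟩
    obtain ⟨φ, hφ, h⟩ := hx.rep (hr 0)
    exact ⟨_, cl_inv hφ, fun x => congrArg _ (h x)⟩
  | @comp k n f h hf hh ihf ihh =>
    intro m N E g hg hr N' E' hE' hx
    obtain ⟨N1, E1, h1, h2, h3⟩ := Ach.family (fun i => ihh i E g hg hr) hE' hx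
    obtain ⟨N2, E2, h4, h5, h6⟩ := ihf E1 (fun i x => h i (fun j => g j x)) (fun i => (hh i).comp _ _ hg) h3 N1 E1 h1 (Ext.refl _)
    exact ⟨N2, E2, h4, h2.trans h5, h6⟩

/-- The initial system. -/
theorem exists_sys (m : ℕ) : ∃ (E : (Fin m → ℚ_[p]) → Fin (m + m) → ℤ_[p]), Sys E ∧ ∀ i, Rep E (fun x => x i) := by
  classical
  let y : Fin m → (Fin (m + m) → ℤ_[p]) → ℚ_[p] := fun i b =>
    if b ∈ {b : Fin (m + m) → ℤ_[p] | (b (Fin.natAdd m i) : ℚ_[p]) = 0} then (b (Fin.castAdd m i) : ℚ_[p])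
    else (b (Fin.natAdd m i) : ℚ_[p])⁻¹
  have hc : ∀ i, (fun b : Fin (m + m) → ℤ_[p] => (b i : ℚ_[p])) ∈ cl (RA p (m + m)) :=
    fun i => le_cl _ (RAo.coord i).mem_RA
  have hy : ∀ i, y i ∈ cl (RA p (m + m)) := fun i =>
    cl_ite (DefS.of_cl (DefS.eq_zero (hc _))) (hc _) (cl_inv (hc _))
  let E : (Fin m → ℚ_[p]) → Fin (m + m) → ℤ_[p] := fun x =>
    Fin.append (fun i => tr (x i)) (fun i => tr (x i)⁻¹)
  have hyE : ∀ i x, x i = y i (E x) := fun i x => by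
    simp only [y, E, Fin.append_left, Fin.append_right, Set.mem_ofPred_eq]
    by_cases h0 : x i = 0
    · rw [h0, inv_zero]
      have : tr (0 : ℚ_[p]) = 0 := by simpa using tr_coe (0 : ℤ_[p])
      simp [this]
    by_cases h1 : ‖(x i)⁻¹‖ ≤ 1
    · rw [coe_tr h1, if_neg (inv_ne_zero h0), inv_inv]
    · rw [tr_zero h1]
      refine Eq.trans (coe_tr ?_).symm (if_pos rfl).symm
      rw [norm_inv, not_le] at h1
      exact ((one_lt_inv₀ (norm_pos_iff.2 h0)).1 h1).le
  refine ⟨E, ⟨fun i => ?_, fun x x' h => funext fun i => by rw [hyE i x, hyE i x', h], ?_⟩, fun i => ⟨_, hy i, hyE i⟩⟩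
  · refine Fin.addCases (fun i => ?_) (fun i => ?_) i
    · simpa only [E, Fin.append_left] using tr_D (coord_mem_Dalg (p := p) i)
    · simpa only [E, Fin.append_right] using tr_D (IsDFunction.inv' (coord_mem_Dalg (p := p) i))
  · refine BoolGen.congr (DefS.of_cl (BoolGen.all_finite fun i => (DefS.eq (hc (Fin.castAdd m i)) (tr_cl (hy i))).and
      (DefS.eq (hc (Fin.natAdd m i)) (tr_cl (cl_inv (hy i)))))) fun b => ⟨fun hb => ⟨fun i => y i b, funext fun i => ?_⟩, ?_⟩
    · refine Fin.addCases (fun i => ?_) (fun i => ?_) i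
      · exact (Fin.append_left _ _ i).trans (PadicInt.ext (hb i).1).symm
      · exact (Fin.append_right _ _ i).trans (PadicInt.ext (hb i).2).symm
    · rintro ⟨x, rfl⟩ i
      rw [← hyE]
      exact ⟨congrArg _ (Fin.append_left _ _ i), congrArg _ (Fin.append_right _ _ i)⟩

theorem claimC {S : Set 𝕍} (hS : DefS (Dalg p m) S) :
    ∀ {N : ℕ} {E : 𝕍 → Fin N → ℤ_[p]}, Sys E → (∀ i, Rep E (fun x => x i)) →
    ∃ (N' : ℕ) (E' : 𝕍 → Fin N' → ℤ_[p]), Sys E' ∧ Ext E E' ∧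
      ∃ T, DefS (RA p N') T ∧ S = E' ⁻¹' T := by
  induction hS with
  | base S h =>
    obtain ⟨f, hf, n, hn, rfl⟩ := h
    intro N E hE hr
    obtain ⟨N1, E1, h1, h2, φ, hφ, h3⟩ := claimB hf E (fun i x => x i) (fun i => coord_mem_Dalg i) hr N E hE (Ext.refl _)
    exact ⟨N1, E1, h1, h2, _, DefS.of_cl (DefS.pow hφ hn), by ext x; simp [h3]⟩
  | univ => exact fun hE hr => ⟨_, _, hE, Ext.refl _, Set.univ, BoolGen.univ, rfl⟩
  | compl S _ ih =>
    intro N E hE hr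
    obtain ⟨N1, E1, h1, h2, T, hT, rfl⟩ := ih hE hr
    exact ⟨N1, E1, h1, h2, _, hT.compl, rfl⟩
  | inter S S' _ _ ih ih' =>
    intro N E hE hr
    obtain ⟨N1, E1, h1, h2, T, hT, rfl⟩ := ih hE hr
    obtain ⟨N2, E2, h3, ⟨ι, hι⟩, T', hT', rfl⟩ := ih' h1 fun i => h2.rep (hr i)
    refine ⟨N2, E2, h3, h2.trans ⟨ι, hι⟩, _, (DefS.comp (fun f hf => RA_proj ι hf) hT).inter _ _ hT', ?_⟩
    rw [Set.preimage_inter, ← Set.preimage_comp]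
    congr 2
    funext x i
    exact hι x i

theorem Dalg_fsq {S : Set 𝕍} (hS : DefS (Dalg p m) S) : FSQ ((Sp.mk' (Dalg p m)).c S) := by
  obtain ⟨E0, h0, hr⟩ := exists_sys (p := p) m
  obtain ⟨N, E, hE, -, T, hT, rfl⟩ := claimC hS h0 hr
  have hT' : DefS (Sp.mk' (RA p N)).A (T ∩ Set.range E) := DefS.mono (le_cl _) (hT.inter _ _ hE.rng)
  let T' : Set (Sp.mk' (RA p N)).T := T ∩ Set.range E
  let φ : E ⁻¹' T → T' := fun x => ⟨E x.1, x.2, x.1, rfl⟩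
  have hφ : Function.Bijective φ := ⟨fun x y h => Subtype.ext (hE.inj (congrArg Subtype.val h)), by
    rintro ⟨_, h, x, rfl⟩
    exact ⟨⟨x, h⟩, rfl⟩⟩
  refine FSQ.fwd (X := (Sp.mk' (Dalg p m)).sub (E ⁻¹' T)) (Y := (Sp.mk' (RA p N)).sub T')
    ⟨Equiv.ofBijective φ hφ, ?_⟩ (RA_fsq N _ hT')
  refine mor_sub (X := (Sp.mk' (Dalg p m)).sub (E ⁻¹' T)) (Y := Sp.mk' (RA p N)) (S := T') (φ := φ) ?_
  exact Mor.comp (X := (Sp.mk' (Dalg p m)).sub (E ⁻¹' T)) (Y := Sp.mk' (Dalg p m)) (Z := Sp.mk' (RA p N)) (ψ := E)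
    (mor_mk' fun f hf => le_cl _ (RA_D hE.d hf)) (mor_val _ _)

end
end PadicSub
end

section
namespace PadicSub
section
variable {p : ℕ} [Fact p.Prime] {m : ℕ}
local notation "𝕍" => (Fin m → ℚ_[p])

/-- Atomic subanalytic sets. -/
def Atom (S : Set 𝕍) : Prop := (∃ f, IsDFunction p f ∧ S = {x | f x = 0}) ∨
  (∃ f n, IsDFunction p f ∧ 0 < n ∧ S = {x | f x ∈ Pset p n})

/-- Disjunctive normal forms. -/
def DNF (S : Set 𝕍) : Prop := ∃ (ι κ : Type) (_ : Finite ι) (_ : Finite κ)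
  (F : ι → κ → Set 𝕍), (∀ i k, Atom (F i k)) ∧ ∀ x, x ∈ S ↔ ∃ i, ∀ k, x ∈ F i k

theorem Atom.univ : Atom (Set.univ : Set 𝕍) :=
  Or.inl ⟨_, (Dalg p m).zero_mem, by ext; simp⟩

theorem DNF.union {S T : Set 𝕍} : DNF S → DNF T → DNF (S ∪ T) := by
  rintro ⟨ι, κ, _, _, F, hF, h⟩ ⟨ι', κ', _, _, F', hF', h'⟩
  refine ⟨ι ⊕ ι', κ ⊕ κ', inferInstance, inferInstance, fun i k => Sum.elim (fun i => Sum.elim (F i) (fun _ => Set.univ) k)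
    (fun i => Sum.elim (fun _ => Set.univ) (F' i) k) i, ?_, fun x => ?_⟩
  · rintro (i | i) (k | k) <;> simp [hF, hF', Atom.univ]
  · simp [h, h']

theorem DNF.inter {S T : Set 𝕍} : DNF S → DNF T → DNF (S ∩ T) := by
  rintro ⟨ι, κ, _, _, F, hF, h⟩ ⟨ι', κ', _, _, F', hF', h'⟩
  refine ⟨ι × ι', κ ⊕ κ', inferInstance, inferInstance, fun i k => Sum.elim (F i.1) (F' i.2) k, ?_, fun x => ?_⟩
  · rintro i (k | k) <;> simp [hF, hF']
  · simp only [Set.mem_inter_iff, h, h', Prod.exists, Sum.forall, Sum.elim_inl, Sum.elim_inr, exists_and_left, exists_and_right]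

theorem Atom.dnf {S : Set 𝕍} (h : Atom S) : DNF S :=
  ⟨Unit, Unit, inferInstance, inferInstance, fun _ _ => S, fun _ _ => h, fun x => by simp⟩

theorem DNF.of_def {S : Set 𝕍} (hS : DefS (Dalg p m) S) : DNF S ∧ DNF Sᶜ := by
  induction hS with
  | base S h =>
    obtain ⟨f, hf, n, hn, rfl⟩ := h
    refine ⟨Atom.dnf (Or.inr ⟨f, n, hf, hn, rfl⟩), ?_⟩
    obtain ⟨L, hL, -, h⟩ := exists_reps (p := p) n hn
    have h2 : DNF {x | ∃ c ∈ L, c ∉ Pset p n ∧ c * f x ∈ Pset p n} := by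
      refine ⟨{c // c ∈ L ∧ c ∉ Pset p n}, Unit, (hL.subset fun c (hc : c ∈ L ∧ c ∉ Pset p n) => hc.1).to_subtype,
        inferInstance, fun c _ => {x | c.1 * f x ∈ Pset p n}, fun c _ => Or.inr ⟨_, n, (Dalg p m).smul_mem hf c.1, hn, rfl⟩, fun x => ?_⟩
      simp [and_assoc]
    have h3 := (Atom.dnf (Or.inl ⟨f, hf, rfl⟩)).union h2
    convert h3 using 1
    ext x
    simp only [Set.mem_compl_iff, Set.mem_ofPred_eq, Set.mem_union]
    constructor
    · intro hx
      by_cases h0 : f x = 0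
      · exact Or.inl h0
      obtain ⟨c, hc, hcf⟩ := h _ h0
      refine Or.inr ⟨c, hc, fun hcP => hx ?_, hcf⟩
      have hc0 := ne_zero_of_mem_Pset hcP
      simpa [← mul_assoc, hc0] using mul_mem_Pset (inv_mem_Pset hcP) hcf
    · rintro (h0 | ⟨c, -, hc, hcf⟩) hx
      · exact ne_zero_of_mem_Pset hx h0
      · have hc0 := ne_zero_of_mem_Pset hx
        exact hc (by simpa [mul_assoc, hc0] using mul_mem_Pset hcf (inv_mem_Pset hx))
  | univ =>
    refine ⟨Atom.univ.dnf, Empty, Unit, inferInstance, inferInstance, fun i => i.elim, fun i => i.elim, fun x => by simp⟩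
  | compl S _ ih => exact ⟨ih.2, by rw [compl_compl]; exact ih.1⟩
  | inter S T _ _ ih ih' => exact ⟨ih.1.inter ih'.1, by rw [Set.compl_inter]; exact ih.2.union ih'.2⟩

theorem subanalytic_iff {S : Set 𝕍} : IsSubanalytic p S ↔ DefS (Dalg p m) S := by
  constructor
  · rintro ⟨r, s, F, hF, rfl⟩
    refine BoolGen.congr (BoolGen.ex_finite fun i => BoolGen.all_finite fun j => (?_ : DefS (Dalg p m) {x | x ∈ F i j}))
      (fun x => by simp)
    rcases hF i j with ⟨f, hf, h⟩ | ⟨f, n, hf, hn, h⟩ <;> rw [h]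
    · exact DefS.eq_zero (A := Dalg p m) hf
    · exact DefS.pow (A := Dalg p m) hf hn
  · intro h
    obtain ⟨ι, κ, _, _, F, hF, h⟩ := (DNF.of_def h).1
    obtain ⟨r, ⟨e⟩⟩ := Finite.exists_equiv_fin ι
    obtain ⟨s, ⟨e'⟩⟩ := Finite.exists_equiv_fin κ
    refine ⟨r, s, fun i j => F (e.symm i) (e'.symm j), fun i j => hF _ _, ?_⟩
    ext x
    simp only [h, Set.mem_iUnion, Set.mem_iInter]
    constructor
    · rintro ⟨i, hi⟩
      exact ⟨e i, fun j => by simpa using hi _⟩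
    · rintro ⟨i, hi⟩
      exact ⟨_, fun k => by simpa using hi (e' k)⟩

end
end PadicSub
end

section
open Topology
namespace PadicSub
section
variable {p : ℕ} [Fact p.Prime] {α β : Type} {k m : ℕ}

/-- Complements of countably complete ideals. -/
def Sig (B : Set α → Prop) : Prop :=
  (∀ S T, S ⊆ T → B S → B T) ∧ ∀ c : Set (Set α), c.Countable → B (⋃₀ c) → ∃ S ∈ c, B S

theorem Sig.image {B : Set α → Prop} (hB : Sig B) (φ : β → α) : Sig (fun S => B (φ '' S)) := by
  refine ⟨fun S T h => hB.1 _ _ (Set.image_mono h), fun c hc h => ?_⟩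
  obtain ⟨_, ⟨S, hS, rfl⟩, h'⟩ := hB.2 ((fun S => φ '' S) '' c) (hc.image _) (by
    refine hB.1 _ _ ?_ h
    rintro _ ⟨x, ⟨S, hS, hx⟩, rfl⟩
    exact ⟨_, ⟨S, hS, rfl⟩, x, hx, rfl⟩)
  exact ⟨S, hS, h'⟩

theorem Sig.iUnion {B : Set α → Prop} (hB : Sig B) {ι : Type*} [Countable ι] {T : Set α} {S : ι → Set α}
    (hT : B T) (h : ∀ x ∈ T, ∃ i, x ∈ S i) : ∃ i, B (S i) := by
  obtain ⟨_, ⟨i, rfl⟩, h'⟩ := hB.2 (Set.range S) (Set.countable_range S) (hB.1 _ _ (fun x hx => by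
    obtain ⟨i, hi⟩ := h x hx
    exact ⟨_, ⟨i, rfl⟩, hi⟩) hT)
  exact ⟨i, h'⟩

theorem Sig.or {B : Set α → Prop} (hB : Sig B) {T S S' : Set α} (hT : B T) (h : ∀ x ∈ T, x ∈ S ∨ x ∈ S') :
    B S ∨ B S' := by
  obtain ⟨b, hb⟩ := hB.iUnion (S := fun b : Bool => if b then S else S') hT fun x hx =>
    (h x hx).elim (fun h => ⟨true, h⟩) fun h => ⟨false, h⟩
  cases b
  · exact Or.inr hb
  · exact Or.inl hb

theorem Sig.nonempty {B : Set α → Prop} (hB : Sig B) {T : Set α} (hT : B T) : T.Nonempty := by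
  by_contra h
  rw [Set.not_nonempty_iff_eq_empty] at h
  obtain ⟨i, _⟩ := hB.iUnion (ι := Empty) (S := fun _ => ∅) hT fun x hx => by simp [h] at hx
  exact i.elim

theorem Sig.local [TopologicalSpace α] [SecondCountableTopology α] {B : Set α → Prop} (hB : Sig B) {T : Set α}
    (hT : B T) : ∃ x ∈ T, ∀ V ∈ 𝓝 x, B (T ∩ V) := by
  by_contra! h
  choose! V hV h using h
  obtain ⟨t, htT, ht, hc⟩ := TopologicalSpace.countable_cover_nhdsWithin (f := V) (s := T) fun x hx =>
    mem_nhdsWithin_of_mem_nhds (hV x hx)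
  have := ht.to_subtype
  obtain ⟨i, hi⟩ := hB.iUnion (ι := t) (S := fun x => T ∩ V x) hT fun x hx => by
    obtain ⟨y, hy, h⟩ := Set.mem_iUnion₂.1 (hc hx)
    exact ⟨⟨y, hy⟩, hx, h⟩
  exact h i (htT i.2) hi

/-- Injective analytic charts with large image. -/
structure Ch {k k' : ℕ} (B : Set (Fin k → ℚ_[p]) → Prop) (O : Set (Fin k → ℚ_[p])) (O' : Set (Fin k' → ℚ_[p]))
    (ψ : (Fin k' → ℚ_[p]) → (Fin k → ℚ_[p])) : Prop where
  op : IsOpen O'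
  an : AnalyticOnNhd ℚ_[p] ψ O'
  inj : Set.InjOn ψ O'
  maps : Set.MapsTo ψ O' O
  big : B (ψ '' O')

theorem Ch.comp {k k' k'' : ℕ} {B : Set (Fin k → ℚ_[p]) → Prop} {O : Set (Fin k → ℚ_[p])} {O' : Set (Fin k' → ℚ_[p])}
    {ψ : (Fin k' → ℚ_[p]) → (Fin k → ℚ_[p])} {O'' : Set (Fin k'' → ℚ_[p])} {θ : (Fin k'' → ℚ_[p]) → (Fin k' → ℚ_[p])}
    (h : Ch B O O' ψ) (h' : Ch (fun S => B (ψ '' S)) O' O'' θ) : Ch B O O'' (fun x => ψ (θ x)) :=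
  ⟨h'.op, h.an.comp h'.an h'.maps, h.inj.comp h'.inj h'.maps, h.maps.comp h'.maps,
    by simpa only [Set.image_image] using h'.big⟩

theorem Ch.open {B : Set (Fin k → ℚ_[p]) → Prop} {O O' : Set (Fin k → ℚ_[p])} (ho : IsOpen O') (h : O' ⊆ O) (hB : B O') :
    Ch B O O' (fun x => x) :=
  ⟨ho, analyticOnNhd_id, Set.injOn_id _, h, by simpa using hB⟩

/-- Smooth hypersurfaces. -/
theorem hyp {H : (Fin (k + 1) → ℚ_[p]) → ℚ_[p]} {x0 : Fin (k + 1) → ℚ_[p]} (hH : AnalyticAt ℚ_[p] H x0) {i : Fin (k + 1)}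
    (hi : fderiv ℚ_[p] H x0 (Pi.single i 1) ≠ 0) {V0 : Set (Fin (k + 1) → ℚ_[p])} (hV0 : V0 ∈ 𝓝 x0) :
    ∃ (V : Set (Fin (k + 1) → ℚ_[p])) (O' : Set (Fin k → ℚ_[p])) (χ : (Fin k → ℚ_[p]) → (Fin (k + 1) → ℚ_[p])),
      V ∈ 𝓝 x0 ∧ V ⊆ V0 ∧ IsOpen O' ∧ AnalyticOnNhd ℚ_[p] χ O' ∧
      (∀ w ∈ O', χ w ∈ V ∧ H (χ w) = H x0 ∧ i.removeNth (χ w) = w) ∧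
      ∀ y ∈ V, H y = H x0 → i.removeNth y ∈ O' ∧ χ (i.removeNth y) = y := by
  let L := fderiv ℚ_[p] H x0
  let G : (Fin (k + 1) → ℚ_[p]) → (Fin (k + 1) → ℚ_[p]) := fun x => Function.update x i (H x)
  let D : (Fin (k + 1) → ℚ_[p]) →L[ℚ_[p]] (Fin (k + 1) → ℚ_[p]) :=
    ContinuousLinearMap.pi fun j => if j = i then L else ContinuousLinearMap.proj j
  have hD : Function.Injective D := by
    rw [injective_iff_map_eq_zero]
    intro v hv
    have h1 : ∀ j, j ≠ i → v j = 0 := fun j hj => by simpa [D, hj] using congrFun hv j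
    have h2 : L v = 0 := by simpa [D] using congrFun hv i
    have h3 : v = v i • Pi.single i 1 := by
      funext j
      by_cases hj : j = i
      · subst hj; simp
      · simp [hj, h1 j hj]
    rw [h3, map_smul, smul_eq_mul] at h2
    rw [h3, (mul_eq_zero.1 h2).resolve_right hi, zero_smul]
  let e' : (Fin (k + 1) → ℚ_[p]) ≃L[ℚ_[p]] (Fin (k + 1) → ℚ_[p]) :=
    (LinearEquiv.ofInjectiveEndo D.toLinearMap hD).toContinuousLinearEquiv
  have he' : (e' : (Fin (k + 1) → ℚ_[p]) →L[ℚ_[p]] (Fin (k + 1) → ℚ_[p])) = D := rfl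
  have hGa : AnalyticAt ℚ_[p] G x0 := by
    refine analyticAt_pi_iff.2 fun j => ?_
    by_cases hj : j = i
    · subst hj; simpa [G] using hH
    · have : (fun x => G x j) = fun x => x j := by funext x; simp [G, hj]
      rw [this]
      exact (ContinuousLinearMap.proj (R := ℚ_[p]) (φ := fun _ : Fin (k + 1) => ℚ_[p]) j).analyticAt x0
  have hG : HasStrictFDerivAt G (e' : (Fin (k + 1) → ℚ_[p]) →L[ℚ_[p]] (Fin (k + 1) → ℚ_[p])) x0 := by
    rw [he', hasStrictFDerivAt_pi']
    intro j
    by_cases hj : j = i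
    · subst hj
      have : (ContinuousLinearMap.proj j).comp D = L := by ext v; simp [D]
      rw [this]
      simpa [G] using hH.hasStrictFDerivAt
    · have : (ContinuousLinearMap.proj j).comp D = ContinuousLinearMap.proj j := by ext v; simp [D, hj]
      have h' : (fun x => G x j) = fun x => x j := by funext x; simp [G, hj]
      rw [this, h']
      exact (ContinuousLinearMap.proj (R := ℚ_[p]) (φ := fun _ : Fin (k + 1) => ℚ_[p]) j).hasStrictFDerivAt (x := x0)
  let e0 := hG.toOpenPartialHomeomorph G
  let e := e0.restr V0
  have hsrc : x0 ∈ e.source := by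
    rw [OpenPartialHomeomorph.restr_source]
    exact ⟨hG.mem_toOpenPartialHomeomorph_source, mem_interior_iff_mem_nhds.2 hV0⟩
  have heG : ∀ x, e x = G x := fun x => rfl
  have hsym : AnalyticAt ℚ_[p] e.symm (G x0) := e.analyticAt_symm' (i := e') hsrc hGa hG.hasFDerivAt.fderiv
  let W := e.target ∩ {y | AnalyticAt ℚ_[p] e.symm y}
  have hW : IsOpen W := e.open_target.inter (isOpen_analyticAt _ _)
  have hins : Continuous fun w : Fin k → ℚ_[p] => i.insertNth (α := fun _ => ℚ_[p]) (H x0) w :=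
    continuous_const.finInsertNth i continuous_id
  have hm : ∀ w, i.insertNth (α := fun _ => ℚ_[p]) (H x0) w ∈ W →
      G (e.symm (i.insertNth (α := fun _ => ℚ_[p]) (H x0) w)) = i.insertNth (α := fun _ => ℚ_[p]) (H x0) w :=
    fun w hw => e.right_inv hw.1
  refine ⟨e.source ∩ e ⁻¹' W, (fun w => i.insertNth (α := fun _ => ℚ_[p]) (H x0) w) ⁻¹' W,
    fun w => e.symm (i.insertNth (α := fun _ => ℚ_[p]) (H x0) w), ?_, fun x hx => ?_, hW.preimage hins, ?_, fun w hw => ⟨⟨?_, ?_⟩, ?_, ?_⟩,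
    fun y hy hHy => ?_⟩
  · exact (e.isOpen_inter_preimage hW).mem_nhds ⟨hsrc, e.map_source hsrc, hsym⟩
  · have := hx.1
    rw [OpenPartialHomeomorph.restr_source] at this
    exact interior_subset this.2
  · intro w hw
    refine AnalyticAt.comp (g := e.symm) hw.2 (analyticAt_pi_iff.2 fun j => ?_)
    refine i.succAboveCases ?_ (fun j => ?_) j
    · simpa using analyticAt_const
    · simp only [Fin.insertNth_apply_succAbove]
      exact (ContinuousLinearMap.proj (R := ℚ_[p]) (φ := fun _ : Fin k => ℚ_[p]) j).analyticAt w
  · exact e.map_target hw.1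
  · rw [Set.mem_preimage, heG, hm w hw]
    exact hw
  · simpa [G] using congrFun (hm w hw) i
  · funext j
    simpa [G, Fin.removeNth] using congrFun (hm w hw) (i.succAbove j)
  · have h1 : i.insertNth (α := fun _ => ℚ_[p]) (H x0) (i.removeNth y) = e y := by
      rw [heG, Fin.insertNth_removeNth, ← hHy]
    refine ⟨?_, ?_⟩
    · rw [Set.mem_preimage, h1]
      exact hy.2
    · simp only [h1]
      exact e.left_inv hy.1

theorem eventually_zero {h : (Fin k → ℚ_[p]) → ℚ_[p]} {x : Fin k → ℚ_[p]} (ha : AnalyticAt ℚ_[p] h x)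
    (h0 : ∀ n, iteratedFDeriv ℚ_[p] n h x = 0) : ∀ᶠ y in 𝓝 x, h y = 0 := by
  obtain ⟨P, r, hP⟩ := ha
  filter_upwards [Metric.eball_mem_nhds x hP.r_pos] with y hy
  have h1 := hP.hasSum_iteratedFDeriv (y := y - x) (by simpa [edist_eq_enorm_sub] using hy)
  simp only [h0, add_sub_cancel] at h1
  exact h1.unique (by simpa using hasSum_zero)

/-- Zero sets of analytic functions. -/
theorem zeros : ∀ (k : ℕ) (B : Set (Fin k → ℚ_[p]) → Prop) (O : Set (Fin k → ℚ_[p])) (h : (Fin k → ℚ_[p]) → ℚ_[p]), Sig B →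
    IsOpen O → B O → AnalyticOnNhd ℚ_[p] h O → ∃ (k' : ℕ) (O' : Set (Fin k' → ℚ_[p])) (ψ : _), Ch B O O' ψ ∧
      ((∀ x ∈ O', h (ψ x) = 0) ∨ ∀ x ∈ O', h (ψ x) ≠ 0) := by
  intro k
  induction k with
  | zero =>
    intro B O h hB hO hBO ha
    by_cases h0 : h 0 = 0
    · exact ⟨0, O, _, Ch.open hO subset_rfl hBO, Or.inl fun x _ => by rwa [Subsingleton.elim x 0]⟩
    · exact ⟨0, O, _, Ch.open hO subset_rfl hBO, Or.inr fun x _ => by rwa [Subsingleton.elim x 0]⟩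
  | succ k ih =>
    intro B O h hB hO hBO ha
    rcases hB.or (S := O ∩ {x | h x ≠ 0}) (S' := O ∩ {x | h x = 0}) hBO (fun x hx => (em (h x = 0)).symm.imp (⟨hx, ·⟩) (⟨hx, ·⟩)) with h1 | h1
    · exact ⟨_, _, _, Ch.open (ha.continuousOn.isOpen_inter_preimage hO isOpen_compl_singleton) Set.inter_subset_left h1,
        Or.inr fun x hx => hx.2⟩
    let Z : (Σ n, (Fin n → Fin (k + 1)) × Fin (k + 1)) → Set (Fin (k + 1) → ℚ_[p]) := fun a =>
      {x | x ∈ O ∧ iteratedFDeriv ℚ_[p] a.1 h x (fun t => Pi.single (a.2.1 t) 1) = 0 ∧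
        fderiv ℚ_[p] (fun x => iteratedFDeriv ℚ_[p] a.1 h x (fun t => Pi.single (a.2.1 t) 1)) x (Pi.single a.2.2 1) ≠ 0}
    have han : ∀ n (v : Fin n → Fin (k + 1) → ℚ_[p]), AnalyticOnNhd ℚ_[p] (fun x => iteratedFDeriv ℚ_[p] n h x v) O := fun n v =>
      (ContinuousMultilinearMap.apply ℚ_[p] (fun _ : Fin n => Fin (k + 1) → ℚ_[p]) ℚ_[p] v).comp_analyticOnNhd (ha.iteratedFDeriv n)
    have hcov : ∀ x ∈ O ∩ {x | h x = 0}, x ∈ interior (O ∩ {x | h x = 0}) ∨ x ∈ ⋃ a, Z a := by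
      intro x hx
      by_cases hz : ∀ n, iteratedFDeriv ℚ_[p] n h x = 0
      · left
        rw [mem_interior_iff_mem_nhds]
        exact Filter.inter_mem (hO.mem_nhds hx.1) (eventually_zero (ha x hx.1) hz)
      · right
        push Not at hz
        classical
        have hne : ∃ n, ∃ w : Fin n → Fin (k + 1), iteratedFDeriv ℚ_[p] n h x (fun t => Pi.single (w t) 1) ≠ 0 := by
          obtain ⟨n, hn⟩ := hz
          by_contra! hall
          refine hn (ContinuousMultilinearMap.toMultilinearMap_injective
            (Module.Basis.ext_multilinear (fun _ => Pi.basisFun ℚ_[p] (Fin (k + 1))) fun v => ?_))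
          simpa using hall n v
        obtain ⟨w, hw⟩ := Nat.find_spec hne
        have hmin := fun m (hm : m < Nat.find hne) => Nat.find_min hne hm
        revert w hmin
        cases Nat.find hne with
        | zero =>
          intro w hw
          exact absurd (by simpa using hx.2) hw
        | succ n =>
          intro w hw hmin
          refine Set.mem_iUnion.2 ⟨⟨n, Fin.tail w, w 0⟩, hx.1, ?_, ?_⟩
          · have := hmin n n.lt_succ_self
            push Not at this
            exact this _
          · rw [iteratedFDeriv_succ_apply_left] at hw
            have := (((ha.iteratedFDeriv n) x hx.1).differentiableAt.hasFDerivAt.continuousMultilinear_apply_const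
              (fun t => Pi.single (Fin.tail w t) 1)).fderiv
            rw [this]
            exact hw
    rcases hB.or (S := interior (O ∩ {x | h x = 0})) (S' := ⋃ a, Z a) h1 hcov with h2 | h2
    · exact ⟨_, _, _, Ch.open isOpen_interior (interior_subset.trans Set.inter_subset_left) h2,
        Or.inl fun x hx => (interior_subset hx).2⟩
    · obtain ⟨⟨n, w, i⟩, h3⟩ := hB.iUnion h2 fun x hx => Set.mem_iUnion.1 hx
      obtain ⟨x, hx, hV⟩ := hB.local h3
      obtain ⟨V, O', χ, h4, h5, h6, h7, h8, h9⟩ := hyp (han n _ x hx.1) hx.2.2 (hO.mem_nhds hx.1)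
      have hc : Ch B O O' χ := ⟨h6, h7, fun a ha b hb hab => by rw [← (h8 a ha).2.2, hab, (h8 b hb).2.2],
        fun a ha => h5 (h8 a ha).1, hB.1 _ _ (fun y hy => ⟨_, h9 y hy.2 (hy.1.2.1.trans hx.2.1.symm)⟩) (hV V h4)⟩
      obtain ⟨k', O'', ψ, hψ, h10⟩ := ih _ O' (fun x => h (χ x)) (hB.image χ) h6 hc.big (ha.comp h7 hc.maps)
      exact ⟨k', O'', _, hc.comp hψ, h10⟩

end
end PadicSub
end

section
open Topology
namespace PadicSub
section
variable {p : ℕ} [Fact p.Prime] {k m : ℕ}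
local notation "𝕍" => (Fin m → ℚ_[p])

theorem exists_mono (n : ℕ) (i : Fin m → ℕ) : ∃ T : 𝕍[×n]→L[ℚ_[p]] ℚ_[p],
    (∀ v, ‖T v‖ ≤ ∏ t, ‖v t‖) ∧ (∑ j, i j = n → ∀ y, T (fun _ => y) = ∏ j, y j ^ i j) := by
  by_cases h : ∑ j, i j = n
  · let e : (Σ j, Fin (i j)) ≃ Fin n := Fintype.equivFinOfCardEq (by simp [h])
    let T : 𝕍[×n]→L[ℚ_[p]] ℚ_[p] := (ContinuousMultilinearMap.mkPiAlgebra ℚ_[p] (Fin n) ℚ_[p]).compContinuousLinearMap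
        fun t => ContinuousLinearMap.proj (φ := fun _ : Fin m => ℚ_[p]) (e.symm t).1
    have hT : ∀ v, T v = ∏ t, v t (e.symm t).1 := fun v => by simp [T]
    refine ⟨T, fun v => ?_, fun _ y => ?_⟩
    · rw [hT, norm_prod]
      exact Finset.prod_le_prod (fun _ _ => norm_nonneg _) fun t _ => norm_le_pi_norm _ _
    · rw [hT, Equiv.prod_comp e.symm (fun s => y s.1), Fintype.prod_sigma]
      simp
  · exact ⟨0, fun v => by simpa using Finset.prod_nonneg fun _ _ => norm_nonneg _, fun h' => absurd h' h⟩

theorem ranal_analytic_zero {a : (Fin m → ℕ) → ℚ_[p]} (ha : IsRestrictedCoeffs p a) : AnalyticAt ℚ_[p] (ranalFn p a) 0 := by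
  classical
  obtain ⟨C, hC0, hC⟩ : ∃ C, 0 ≤ C ∧ ∀ i, ‖a i‖ ≤ C := by
    have h1 := (tendsto_zero_iff_norm_tendsto_zero.1 ha).eventually (gt_mem_nhds zero_lt_one)
    rw [Filter.eventually_cofinite] at h1
    obtain ⟨M, hM⟩ := (h1.image fun i => ‖a i‖).bddAbove
    refine ⟨max 1 M, by positivity, fun i => ?_⟩
    by_cases hi : ‖a i‖ < 1
    · exact hi.le.trans (le_max_left _ _)
    · exact (hM ⟨i, hi, rfl⟩).trans (le_max_right _ _)
  choose T hT hT' using exists_mono (p := p) (m := m)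
  let P : FormalMultilinearSeries ℚ_[p] (Fin m → ℚ_[p]) ℚ_[p] := fun n =>
    ∑ i ∈ Finset.piAntidiag Finset.univ n, a i • T n i
  have hP : ∀ n v, P n v = ∑ i ∈ Finset.piAntidiag Finset.univ n, a i * T n i v := fun n v => by
    simp [P]
  refine ⟨P, 1, ⟨?_, one_pos, fun {y} hy => ?_⟩⟩
  · refine P.le_radius_of_bound (r := 1) C fun n => ?_
    rw [NNReal.coe_one, one_pow, mul_one]
    refine ContinuousMultilinearMap.opNorm_le_bound hC0 fun v => ?_
    rw [hP]
    refine norm_sum_le_of _ _ (mul_nonneg hC0 (Finset.prod_nonneg fun _ _ => norm_nonneg _)) fun i _ => ?_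
    rw [norm_mul]
    exact mul_le_mul (hC i) (hT n i v) (norm_nonneg _) hC0
  · have hy1 : ∀ j, ‖y j‖ ≤ 1 := fun j => by
      refine (norm_le_pi_norm y j).trans ?_
      rw [mem_eball_zero_iff, ← ofReal_norm, ENNReal.ofReal_lt_one] at hy
      exact hy.le
    have hs : Summable fun i : Fin m → ℕ => a i * ∏ j, y j ^ i j := by
      apply NonarchimedeanAddGroup.summable_of_tendsto_cofinite_zero
      refine squeeze_zero_norm (fun i => ?_) (tendsto_zero_iff_norm_tendsto_zero.1 ha)
      rw [norm_mul, norm_prod]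
      refine mul_le_of_le_one_right (norm_nonneg _) (Finset.prod_le_one (fun _ _ => norm_nonneg _) fun j _ => ?_)
      rw [norm_pow]
      exact pow_le_one₀ (norm_nonneg _) (hy1 j)
    rw [zero_add, ranalFn, if_pos hy1]
    have h2 := (Equiv.sigmaFiberEquiv fun i : Fin m → ℕ => ∑ j, i j).hasSum_iff.2 hs.hasSum
    refine h2.sigma fun n => ?_
    have h3 : P n (fun _ => y) = ∑ i ∈ Finset.piAntidiag Finset.univ n, a i * ∏ j, y j ^ i j := by
      rw [hP]
      exact Finset.sum_congr rfl fun i hi => by rw [hT' n i (Finset.mem_piAntidiag.1 hi).1]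
    rw [h3]
    have h4 := hasSum_sum_of_ne_finset_zero (f := Set.indicator {i : Fin m → ℕ | ∑ j, i j = n} fun i => a i * ∏ j, y j ^ i j)
      (s := Finset.piAntidiag Finset.univ n) (L := .unconditional _) fun i hi => Set.indicator_of_notMem (fun h => hi (by simpa using h)) _
    rw [Finset.sum_congr rfl fun i hi => Set.indicator_of_mem (s := {i : Fin m → ℕ | ∑ j, i j = n}) (Finset.mem_piAntidiag.1 hi).1 _] at h4
    exact hasSum_subtype_iff_indicator.2 h4

theorem ranal_analytic {a : (Fin m → ℕ) → ℚ_[p]} (ha : IsRestrictedCoeffs p a) {b : Fin m → ℚ_[p]} (hb : ∀ j, ‖b j‖ ≤ 1) :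
    AnalyticAt ℚ_[p] (ranalFn p a) b := by
  obtain ⟨n, F, hF, h⟩ := ranal_mem_RA a ha
  let b' : Fin m → ℤ_[p] := fun j => ⟨b j, hb j⟩
  obtain ⟨a', ha', h'⟩ := (hF.comp fun j => (RAo.coord j).add (RAo.const (b' j))).exists_coeffs
  have h1 : AnalyticAt ℚ_[p] (fun x => ((p : ℚ_[p]) ^ n)⁻¹ * ranalFn p (fun i => (a' i : ℚ_[p])) (x - b)) b := by
    refine analyticAt_const.mul (AnalyticAt.fun_comp (g := ranalFn p (fun i => (a' i : ℚ_[p]))) (f := fun x => x - b) ?_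
      (analyticAt_id.sub analyticAt_const))
    rw [sub_self]
    exact ranal_analytic_zero ha'
  refine h1.congr ?_
  filter_upwards [Metric.ball_mem_nhds b one_pos] with x hx
  have hx1 : ∀ j, ‖(x - b) j‖ ≤ 1 := fun j => (norm_le_pi_norm _ j).trans (by simpa [dist_eq_norm] using hx.le)
  let u : Fin m → ℤ_[p] := fun j => ⟨(x - b) j, hx1 j⟩
  have e1 := h' u
  have hx2 : ∀ j, ‖x j‖ ≤ 1 := fun j => by
    have := na_add ((x - b) j) (b j)
    simp only [Pi.sub_apply, sub_add_cancel] at this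
    exact this.trans (max_le (hx1 j) (hb j))
  have e2 := h (fun j => ⟨x j, hx2 j⟩)
  have e3 : (fun j => u j + b' j) = fun j => ⟨x j, hx2 j⟩ := by
    funext j
    exact Subtype.ext (sub_add_cancel (x j) (b j))
  rw [e3, ← e2] at e1
  have e4 : ranalFn p (fun i => (a' i : ℚ_[p])) (x - b) = (p : ℚ_[p]) ^ n * ranalFn p a x := e1.symm
  rw [e4, inv_mul_cancel_left₀ (pow_ne_zero _ p_ne_zero')]

/-- D-functions are piecewise analytic. -/
theorem lemD {f : 𝕍 → ℚ_[p]} (hf : IsDFunction p f) : ∀ (k : ℕ) (B : Set (Fin k → ℚ_[p]) → Prop) (O : Set (Fin k → ℚ_[p]))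
    (g : Fin m → (Fin k → ℚ_[p]) → ℚ_[p]), Sig B → IsOpen O → B O → (∀ j, AnalyticOnNhd ℚ_[p] (g j) O) →
    ∃ (k' : ℕ) (O' : Set (Fin k' → ℚ_[p])) (ψ : _), Ch B O O' ψ ∧ AnalyticOnNhd ℚ_[p] (fun x => f (fun j => g j (ψ x))) O' := by
  induction hf with
  | @ranal m a ha =>
    intro k B O g hB hO hBO hg
    have hgc : ContinuousOn (fun x j => g j x) O := continuousOn_pi.2 fun j => (hg j).continuousOn
    have hcl : IsClopen {y : Fin m → ℚ_[p] | ∀ j, ‖y j‖ ≤ 1} := by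
      have : {y : Fin m → ℚ_[p] | ∀ j, ‖y j‖ ≤ 1} = Metric.closedBall 0 1 := by
        ext y
        simp [pi_norm_le_iff_of_nonneg zero_le_one]
      rw [this]
      exact IsUltrametricDist.isClopen_closedBall _ one_ne_zero
    rcases hB.or (S := O ∩ (fun x j => g j x) ⁻¹' {y | ∀ j, ‖y j‖ ≤ 1}) (S' := O ∩ (fun x j => g j x) ⁻¹' {y | ∀ j, ‖y j‖ ≤ 1}ᶜ) hBO
      (fun x hx => (em _).imp (⟨hx, ·⟩) (⟨hx, ·⟩)) with h1 | h1
    · refine ⟨_, _, _, Ch.open (hgc.isOpen_inter_preimage hO hcl.isOpen) Set.inter_subset_left h1, fun x hx => ?_⟩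
      exact AnalyticAt.fun_comp (g := ranalFn p a) (f := fun x j => g j x) (ranal_analytic ha hx.2) (analyticAt_pi_iff.2 fun j => hg j x hx.1)
    · have ho := hgc.isOpen_inter_preimage hO hcl.compl.isOpen
      refine ⟨_, _, _, Ch.open ho Set.inter_subset_left h1, fun x hx => ?_⟩
      refine (analyticAt_const (v := (0 : ℚ_[p]))).congr ?_
      filter_upwards [ho.mem_nhds hx] with y hy
      exact (if_neg hy.2).symm
  | poly q =>
    intro k B O g hB hO hBO hg
    refine ⟨_, _, _, Ch.open hO subset_rfl hBO, ?_⟩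
    have := AnalyticOnNhd.aeval_mvPolynomial (f := fun x j => g j x) hg q
    exact this
  | inv =>
    intro k B O g hB hO hBO hg
    obtain ⟨k', O', ψ, hψ, h | h⟩ := zeros k B O (g 0) hB hO hBO (hg 0)
    · refine ⟨k', O', ψ, hψ, fun x hx => (analyticAt_const (v := (0 : ℚ_[p]))).congr ?_⟩
      filter_upwards [hψ.op.mem_nhds hx] with y hy
      rw [h y hy, inv_zero]
    · exact ⟨k', O', ψ, hψ, ((hg 0).comp hψ.an hψ.maps).inv h⟩
  | @comp m n f g hf hg ih ihg =>
    intro k B O γ hB hO hBO hγ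
    have key : ∀ r ≤ n, ∃ (k' : ℕ) (O' : Set (Fin k' → ℚ_[p])) (ψ : _), Ch B O O' ψ ∧
        ∀ i : Fin n, i.1 < r → AnalyticOnNhd ℚ_[p] (fun x => g i (fun j => γ j (ψ x))) O' := by
      intro r
      induction r with
      | zero => exact fun _ => ⟨_, _, _, Ch.open hO subset_rfl hBO, fun i hi => absurd hi (Nat.not_lt_zero _)⟩
      | succ r ihr =>
        intro hr
        obtain ⟨k', O', ψ, hψ, h⟩ := ihr (by omega)
        obtain ⟨k'', O'', θ, hθ, h'⟩ := ihg ⟨r, by omega⟩ k' _ O' (fun j x => γ j (ψ x)) (hB.image ψ) hψ.op hψ.big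
          (fun j => (hγ j).comp hψ.an hψ.maps)
        refine ⟨k'', O'', _, hψ.comp hθ, fun i hi => ?_⟩
        rcases Nat.lt_succ_iff_lt_or_eq.1 hi with h1 | rfl
        · exact (h i h1).comp hθ.an hθ.maps
        · exact h'
    obtain ⟨k', O', ψ, hψ, h⟩ := key n le_rfl
    obtain ⟨k'', O'', θ, hθ, h'⟩ := ih k' _ O' (fun i x => g i (fun j => γ j (ψ x))) (hB.image ψ) hψ.op hψ.big (fun i => h i i.2)
    exact ⟨k'', O'', _, hψ.comp hθ, h'⟩

/-- Subanalytic sets can be decided on charts. -/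
theorem lemS {S : Set 𝕍} (hS : DefS (Dalg p m) S) : ∀ (k : ℕ) (B : Set (Fin k → ℚ_[p]) → Prop) (O : Set (Fin k → ℚ_[p]))
    (g : Fin m → (Fin k → ℚ_[p]) → ℚ_[p]), Sig B → IsOpen O → B O → (∀ j, AnalyticOnNhd ℚ_[p] (g j) O) →
    ∃ (k' : ℕ) (O' : Set (Fin k' → ℚ_[p])) (ψ : _), Ch B O O' ψ ∧
      ((∀ x ∈ O', (fun j => g j (ψ x)) ∈ S) ∨ ∀ x ∈ O', (fun j => g j (ψ x)) ∉ S) := by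
  induction hS with
  | base S h =>
    intro k B O g hB hO hBO hg
    obtain ⟨f, hf, n, hn, rfl⟩ := h
    obtain ⟨k1, O1, ψ, hψ, h1⟩ := lemD hf k B O g hB hO hBO hg
    obtain ⟨k2, O2, θ, hθ, h2 | h2⟩ := zeros k1 _ O1 _ (hB.image ψ) hψ.op hψ.big h1
    · exact ⟨k2, O2, _, hψ.comp hθ, Or.inr fun x hx h => ne_zero_of_mem_Pset h (h2 x hx)⟩
    have hc := hψ.comp hθ
    have hcont : ContinuousOn (fun x => f (fun j => g j (ψ (θ x)))) O2 := (h1.comp hθ.an hθ.maps).continuousOn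
    obtain ⟨κ, hκ1, hκ⟩ := exists_app_Pset (p := p) n hn
    have hop : ∀ T : Set ℚ_[p], (∀ y ∈ T, y ≠ 0) → (∀ x y, App κ x y → y ∈ T → x ∈ T) → IsOpen T := fun T h0 hT => by
      refine Metric.isOpen_iff.2 fun y hy => ⟨‖(p : ℚ_[p]) ^ κ‖ * ‖y‖, mul_pos (norm_ppow_pos κ) (norm_pos_iff.2 (h0 y hy)), fun x hx => ?_⟩
      exact hT x y (by simpa [App, dist_eq_norm] using (Metric.mem_ball.1 hx).le) hy
    have ho1 : IsOpen (Pset p n) := hop _ (fun y hy => ne_zero_of_mem_Pset hy) fun x y h => (hκ x y h).2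
    have ho2 : IsOpen {y : ℚ_[p] | y ≠ 0 ∧ y ∉ Pset p n} := hop _ (fun y hy => hy.1) fun x y h hy =>
      ⟨fun h0 => hy.1 (by
        subst h0
        by_contra hy0
        have h3 : ‖(0 : ℚ_[p]) - y‖ ≤ ‖(p : ℚ_[p]) ^ κ‖ * ‖y‖ := h
        rw [zero_sub, norm_neg] at h3
        exact absurd h3 (not_le.2 (mul_lt_of_lt_one_left (norm_pos_iff.2 hy0) (norm_ppow_lt_one hκ1)))), fun h' => hy.2 ((hκ x y h).1 h')⟩
    have hB2 := (hB.image fun x => ψ (θ x))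
    rcases hB2.or (S := O2 ∩ (fun x => f (fun j => g j (ψ (θ x)))) ⁻¹' Pset p n)
      (S' := O2 ∩ (fun x => f (fun j => g j (ψ (θ x)))) ⁻¹' {y | y ≠ 0 ∧ y ∉ Pset p n}) hc.big
      (fun x hx => (em _).imp (⟨hx, ·⟩) (⟨hx, h2 x hx, ·⟩)) with h3 | h3
    · exact ⟨_, _, _, hc.comp (Ch.open (hcont.isOpen_inter_preimage hc.op ho1) Set.inter_subset_left h3), Or.inl fun x hx => hx.2⟩
    · exact ⟨_, _, _, hc.comp (Ch.open (hcont.isOpen_inter_preimage hc.op ho2) Set.inter_subset_left h3), Or.inr fun x hx => hx.2.2⟩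
  | univ =>
    intro k B O g hB hO hBO hg
    exact ⟨_, _, _, Ch.open hO subset_rfl hBO, Or.inl fun x _ => trivial⟩
  | compl S h ih =>
    intro k B O g hB hO hBO hg
    obtain ⟨k', O', ψ, hψ, h | h⟩ := ih k B O g hB hO hBO hg
    · exact ⟨k', O', ψ, hψ, Or.inr fun x hx h' => h' (h x hx)⟩
    · exact ⟨k', O', ψ, hψ, Or.inl h⟩
  | inter S T hS hT ihS ihT =>
    intro k B O g hB hO hBO hg
    obtain ⟨k', O', ψ, hψ, h | h⟩ := ihS k B O g hB hO hBO hg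
    · obtain ⟨k'', O'', θ, hθ, h' | h'⟩ := ihT k' _ O' (fun j x => g j (ψ x)) (hB.image ψ) hψ.op hψ.big
        (fun j => (hg j).comp hψ.an hψ.maps)
      · exact ⟨k'', O'', _, hψ.comp hθ, Or.inl fun x hx => ⟨h _ (hθ.maps hx), h' x hx⟩⟩
      · exact ⟨k'', O'', _, hψ.comp hθ, Or.inr fun x hx h0 => h' x hx h0.2⟩
    · exact ⟨k', O', ψ, hψ, Or.inr fun x hx h0 => h x hx h0.1⟩

end
end PadicSub
end

section
open Topology
namespace PadicSub
section
variable {p : ℕ} [Fact p.Prime] {k d n : ℕ}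
local notation "ϖ" => (p : ℚ_[p])

theorem count_le {f : (Fin k → ℚ_[p]) → (Fin d → ℚ_[p])} {x0 : Fin k → ℚ_[p]} {y0 : Fin d → ℚ_[p]} {L : NNReal} {e a : ℕ}
    (hL : LipschitzOnWith L f (Metric.closedBall x0 ‖ϖ ^ e‖))
    (h : Metric.closedBall y0 ‖ϖ ^ a‖ ⊆ f '' Metric.closedBall x0 ‖ϖ ^ e‖) : d ≤ k := by
  have hpe := norm_ppow_pos (p := p) e
  have hpa := norm_ppow_pos (p := p) a
  have hp1 : 1 < p := (Fact.out : p.Prime).one_lt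
  obtain ⟨c, hc⟩ := exists_ppow_mul_le (p := p) (L * ‖ϖ ^ e‖ / ‖ϖ ^ a‖)
  have hnorm : ∀ N : ℕ, ‖ϖ ^ N‖ = (p : ℝ) ^ (-N : ℤ) := fun N => by
    rw [norm_pow, Padic.norm_p, zpow_neg, zpow_natCast, inv_pow]
  by_contra! hdk
  let M := c * k + 1
  have hM0 : NeZero (p ^ M) := ⟨pow_ne_zero _ (by omega)⟩
  have hN0 : NeZero (p ^ (M + c)) := ⟨pow_ne_zero _ (by omega)⟩
  have hex : ∀ t : Fin d → ZMod (p ^ M), ∃ x ∈ Metric.closedBall x0 ‖ϖ ^ e‖,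
      f x = fun j => y0 j + ϖ ^ a * ((t j).val : ℚ_[p]) := fun t => by
    refine h (mem_closedBall_iff_norm.2 ((pi_norm_le_iff_of_nonneg hpa.le).2 fun j => ?_))
    rw [Pi.sub_apply, add_sub_cancel_left, norm_mul]
    exact mul_le_of_le_one_right hpa.le (norm_nat_le_one _)
  choose x hx hfx using hex
  have hu : ∀ t j, ‖(x t j - x0 j) / ϖ ^ e‖ ≤ 1 := fun t j => by
    rw [norm_div, div_le_one hpe]
    exact (norm_le_pi_norm (x t - x0) j).trans (mem_closedBall_iff_norm.1 (hx t))
  let u : (Fin d → ZMod (p ^ M)) → Fin k → ℤ_[p] := fun t j => ⟨_, hu t j⟩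
  have hinj : Function.Injective fun t j => PadicInt.toZModPow (M + c) (u t j) := by
    intro t s hts
    have h1 : ‖x t - x s‖ ≤ ‖ϖ ^ e‖ * ‖ϖ ^ (M + c)‖ := by
      refine (pi_norm_le_iff_of_nonneg (by positivity)).2 fun j => ?_
      have h2 : u t j - u s j ∈ RingHom.ker (PadicInt.toZModPow (p := p) (M + c)) := by
        rw [RingHom.mem_ker, map_sub, sub_eq_zero]
        exact congrFun hts j
      rw [PadicInt.ker_toZModPow, ← PadicInt.norm_le_pow_iff_mem_span_pow, ← hnorm, ← PadicInt.padic_norm_e_of_padicInt,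
        PadicInt.coe_sub] at h2
      have h3 : x t j - x s j = ϖ ^ e * ((u t j : ℚ_[p]) - u s j) := by
        have : ϖ ^ e ≠ 0 := pow_ne_zero _ p_ne_zero'
        change _ = ϖ ^ e * ((x t j - x0 j) / ϖ ^ e - (x s j - x0 j) / ϖ ^ e)
        field_simp
        ring
      rw [Pi.sub_apply, h3, norm_mul]
      exact mul_le_mul_of_nonneg_left h2 hpe.le
    have h4 := hL.norm_sub_le (hx t) (hx s)
    funext j
    have h5 : ‖ϖ ^ a‖ * ‖(((s j).val - (t j).val : ℤ) : ℚ_[p])‖ ≤ L * (‖ϖ ^ e‖ * ‖ϖ ^ (M + c)‖) := by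
      refine le_trans ?_ (h4.trans (mul_le_mul_of_nonneg_left h1 L.2))
      rw [← norm_mul, norm_sub_rev]
      refine le_trans (le_of_eq ?_) (norm_le_pi_norm (f (x s) - f (x t)) j)
      rw [hfx, hfx, Pi.sub_apply]
      push_cast
      congr 1
      ring
    have h6 : ‖(((s j).val - (t j).val : ℤ) : ℚ_[p])‖ ≤ ‖ϖ ^ M‖ := by
      have hMc : ‖ϖ ^ (M + c)‖ = ‖ϖ ^ M‖ * ‖ϖ ^ c‖ := by rw [pow_add, norm_mul]
      rw [hMc] at h5
      have h7 := mul_le_mul_of_nonneg_right hc (norm_ppow_pos (p := p) M).le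
      have h8 : ‖ϖ ^ a‖ * (‖ϖ ^ c‖ * (L * ‖ϖ ^ e‖ / ‖ϖ ^ a‖) * ‖ϖ ^ M‖) =
          L * (‖ϖ ^ e‖ * (‖ϖ ^ M‖ * ‖ϖ ^ c‖)) := by
        field_simp
      rw [← h8] at h5
      linarith [le_of_mul_le_mul_left h5 hpa]
    rw [hnorm, Padic.norm_int_le_pow_iff_dvd] at h6
    have h9 := (ZMod.intCast_eq_intCast_iff_dvd_sub (t j).val (s j).val (p ^ M)).2 (by exact_mod_cast h6)
    simpa using h9
  have hcard := Fintype.card_le_of_injective _ hinj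
  simp only [Fintype.card_fun, ZMod.card, Fintype.card_fin, ← pow_mul] at hcard
  have := (Nat.pow_le_pow_iff_right hp1).1 hcard
  have h6 : M * (k + 1) ≤ M * d := Nat.mul_le_mul_left _ hdk
  simp only [M] at *
  nlinarith

theorem sig_meagre {α β : Type} [TopologicalSpace β] (f : α → β) : Sig fun S : Set α => ¬ IsMeagre (f '' S) := by
  refine ⟨fun S T h hS hT => hS (hT.mono (Set.image_mono h)), fun c hc h => ?_⟩
  by_contra! h'
  refine h ?_
  rw [Set.sUnion_eq_biUnion, Set.image_iUnion₂]
  exact isMeagre_biUnion hc h'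

theorem meagre_image {f : (Fin k → ℚ_[p]) → (Fin d → ℚ_[p])} {O : Set (Fin k → ℚ_[p])} (hO : IsOpen O)
    (hf : AnalyticOnNhd ℚ_[p] f O) (h : ¬ IsMeagre (f '' O)) : d ≤ k := by
  obtain ⟨x, hx, hV⟩ := (sig_meagre f).local h
  obtain ⟨L, V, hV1, hL⟩ := (hf x hx).hasStrictFDerivAt.exists_lipschitzOnWith
  obtain ⟨ε, hε, hε'⟩ := Metric.mem_nhds_iff.1 hV1
  obtain ⟨e, -, he⟩ := exists_ppow_lt (p := p) hε
  have hL' := hL.mono ((Metric.closedBall_subset_ball he).trans hε')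
  have hK : IsCompact (f '' Metric.closedBall x ‖ϖ ^ e‖) := (isCompact_closedBall _ _).image_of_continuousOn hL'.continuousOn
  have hne : (interior (f '' Metric.closedBall x ‖ϖ ^ e‖)).Nonempty := by
    rw [Set.nonempty_iff_ne_empty, Ne, ← hK.isClosed.isNowhereDense_iff]
    exact fun h' => hV _ (Metric.closedBall_mem_nhds x (norm_ppow_pos e)) (h'.isMeagre.mono (Set.image_mono Set.inter_subset_right))
  obtain ⟨y, hy⟩ := hne
  obtain ⟨δ, hδ, hδ'⟩ := Metric.mem_nhds_iff.1 (mem_interior_iff_mem_nhds.1 hy)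
  obtain ⟨a, -, ha⟩ := exists_ppow_lt (p := p) hδ
  exact count_le hL' ((Metric.closedBall_subset_ball ha).trans hδ')

theorem eventually_const {h : (Fin k → ℚ_[p]) → ℚ_[p]} {x : Fin k → ℚ_[p]} (ha : AnalyticAt ℚ_[p] h x)
    (h0 : ∀ᶠ y in 𝓝 x, fderiv ℚ_[p] h y = 0) : ∀ᶠ y in 𝓝 x, h y = h x := by
  have h1 : ∀ n, iteratedFDeriv ℚ_[p] n (fun y => h y - h x) x = 0 := by
    intro n
    cases n with
    | zero => ext v; simp
    | succ n =>
      ext v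
      rw [iteratedFDeriv_succ_apply_right]
      have h2 : (fun y => fderiv ℚ_[p] (fun y => h y - h x) y) =ᶠ[𝓝 x] fun _ => 0 := by
        filter_upwards [h0] with y hy
        rw [fderiv_sub_const, hy]
      rw [(h2.iteratedFDeriv ℚ_[p] n).eq_of_nhds]
      simp
  filter_upwards [eventually_zero (ha.sub analyticAt_const) h1] with y hy
  exact sub_eq_zero.1 hy

theorem fderiv_inj : ∀ (k : ℕ) (f : (Fin k → ℚ_[p]) → (Fin n → ℚ_[p])) (O : Set (Fin k → ℚ_[p])), IsOpen O → O.Nonempty →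
    AnalyticOnNhd ℚ_[p] f O → Set.InjOn f O → ∃ x ∈ O, Function.Injective (fderiv ℚ_[p] f x) := by
  intro k
  induction k with
  | zero => exact fun f O _ ⟨x, hx⟩ _ _ => ⟨x, hx, Function.injective_of_subsingleton _⟩
  | succ k ih =>
    intro f O hO hne hf hinj
    have hfj : ∀ j, AnalyticOnNhd ℚ_[p] (fun x => f x j) O := fun j x hx => analyticAt_pi_iff.1 (hf x hx) j
    have hpr : ∀ x ∈ O, ∀ v j, fderiv ℚ_[p] (fun x => f x j) x v = fderiv ℚ_[p] f x v j := fun x hx v j => by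
      rw [fderiv_pi fun j => (hfj j x hx).differentiableAt]; rfl
    have hex : ∃ x0 ∈ O, ∃ j i, fderiv ℚ_[p] (fun x => f x j) x0 (Pi.single i 1) ≠ 0 := by
      by_contra! hall
      obtain ⟨x, hx⟩ := hne
      have h1 : ∀ j, ∀ᶠ y in 𝓝 x, f y j = f x j := fun j => by
        refine eventually_const (hfj j x hx) ?_
        filter_upwards [hO.mem_nhds hx] with y hy
        refine ContinuousLinearMap.coe_injective ((Pi.basisFun ℚ_[p] (Fin (k + 1))).ext fun i => ?_)
        simpa using hall y hy j i
      have h2 : (𝓝[≠] x).NeBot := Module.punctured_nhds_neBot ℚ_[p] _ x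
      have h3 : ∀ᶠ y in 𝓝[≠] x, y ≠ x := eventually_mem_nhdsWithin
      obtain ⟨y, ⟨hy, hyO⟩, hyx⟩ := ((((Filter.eventually_all.2 h1).and (hO.mem_nhds hx)).filter_mono nhdsWithin_le_nhds).and h3).exists
      exact hyx (hinj hyO hx (funext hy))
    obtain ⟨x0, hx0, j, i, hij⟩ := hex
    have hcd : ContinuousOn (fun x => fderiv ℚ_[p] (fun x => f x j) x (Pi.single i 1)) O :=
      fun x hx => ((hfj j x hx).fderiv.continuousAt.clm_apply continuousAt_const).continuousWithinAt
    obtain ⟨V, O', χ, h4, h5, h6, h7, h8, h9⟩ := hyp (hfj j x0 hx0) hij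
      ((hcd.isOpen_inter_preimage hO isOpen_compl_singleton).mem_nhds ⟨hx0, hij⟩)
    have hmaps : Set.MapsTo χ O' O := fun w hw => (h5 (h8 w hw).1).1
    obtain ⟨w, hw, hwi⟩ := ih (fun w => f (χ w)) O' h6 ⟨_, (h9 x0 (mem_of_mem_nhds h4) rfl).1⟩ (hf.comp h7 hmaps)
      (hinj.comp (fun a ha b hb hab => by rw [← (h8 a ha).2.2, hab, (h8 b hb).2.2]) hmaps)
    have hx := hmaps hw
    refine ⟨χ w, hx, ?_⟩
    have hχ := (h7 w hw).differentiableAt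
    have e1 : ∀ u, fderiv ℚ_[p] (fun w => f (χ w)) w u = fderiv ℚ_[p] f (χ w) (fderiv ℚ_[p] χ w u) := fun u => by
      rw [show (fun w => f (χ w)) = f ∘ χ from rfl, fderiv_comp w (hf _ hx).differentiableAt hχ]; rfl
    have e2 : ∀ u, fderiv ℚ_[p] f (χ w) (fderiv ℚ_[p] χ w u) j = 0 := fun u => by
      have h10 : (fun w => f (χ w) j) =ᶠ[𝓝 w] fun _ => f x0 j := by
        filter_upwards [h6.mem_nhds hw] with y hy using (h8 y hy).2.1
      have h11 := h10.fderiv_eq (𝕜 := ℚ_[p])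
      rw [show (fun w => f (χ w) j) = (fun x => f x j) ∘ χ from rfl, fderiv_comp w (hfj j _ hx).differentiableAt hχ,
        fderiv_const_apply] at h11
      rw [← hpr _ hx]
      exact DFunLike.congr_fun h11 u
    have e3 : ∀ u s, fderiv ℚ_[p] χ w u (i.succAbove s) = u s := fun u s => by
      have h10 : (fun w => χ w (i.succAbove s)) =ᶠ[𝓝 w] fun w => w s := by
        filter_upwards [h6.mem_nhds hw] with y hy using congrFun (h8 y hy).2.2 s
      have h11 := h10.fderiv_eq (𝕜 := ℚ_[p])
      have h12 : HasFDerivAt (fun w : Fin k → ℚ_[p] => w s) (ContinuousLinearMap.proj (R := ℚ_[p]) (φ := fun _ : Fin k => ℚ_[p]) s) w :=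
        (ContinuousLinearMap.proj (R := ℚ_[p]) (φ := fun _ : Fin k => ℚ_[p]) s).hasFDerivAt
      rw [h12.fderiv] at h11
      have h13 := (hasFDerivAt_pi'.1 hχ.hasFDerivAt (i.succAbove s)).fderiv
      rw [h13] at h11
      exact DFunLike.congr_fun h11 u
    rw [injective_iff_map_eq_zero]
    intro v hv
    let u : Fin k → ℚ_[p] := i.removeNth v
    have h10 : v - fderiv ℚ_[p] χ w u = (v - fderiv ℚ_[p] χ w u) i • Pi.single i 1 := by
      funext s
      refine i.succAboveCases ?_ (fun s => ?_) s
      · simp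
      · simp [e3, u, Fin.removeNth]
    have h11 : fderiv ℚ_[p] f (χ w) (v - fderiv ℚ_[p] χ w u) j = 0 := by
      rw [map_sub, hv, Pi.sub_apply, e2]; simp
    rw [h10, map_smul, Pi.smul_apply, ← hpr _ hx, smul_eq_mul] at h11
    replace h11 := (mul_eq_zero.1 h11).resolve_right (h5 (h8 w hw).1).2
    rw [h11, zero_smul, sub_eq_zero] at h10
    have h12 : u = 0 := (injective_iff_map_eq_zero _).1 hwi u (by rw [e1, ← h10, hv])
    rw [h10, h12, map_zero]

theorem dim_image {f : (Fin k → ℚ_[p]) → (Fin n → ℚ_[p])} {O : Set (Fin k → ℚ_[p])} (hO : IsOpen O) (hne : O.Nonempty)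
    (hf : AnalyticOnNhd ℚ_[p] f O) (hinj : Set.InjOn f O) :
    ∃ (π : (Fin n → ℚ_[p]) →ₗ[ℚ_[p]] (Fin k → ℚ_[p])) (U : Set (Fin k → ℚ_[p])), U.Nonempty ∧ U ⊆ π '' (f '' O) ∧ IsOpen U := by
  obtain ⟨x, hx, hi⟩ := fderiv_inj k f O hO hne hf hinj
  obtain ⟨π, hπ⟩ := LinearMap.exists_leftInverse_of_injective (fderiv ℚ_[p] f x : (Fin k → ℚ_[p]) →ₗ[ℚ_[p]] (Fin n → ℚ_[p]))
    (LinearMap.ker_eq_bot.2 hi)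
  have h1 : HasStrictFDerivAt (fun y => π (f y)) ((LinearMap.toContinuousLinearMap π).comp (fderiv ℚ_[p] f x)) x :=
    (LinearMap.toContinuousLinearMap π).hasStrictFDerivAt.comp x (hf x hx).hasStrictFDerivAt
  have h2 := h1.map_nhds_eq_of_surj (LinearMap.range_eq_top.2 fun v => ⟨v, DFunLike.congr_fun hπ v⟩)
  refine ⟨π, interior (π '' (f '' O)), ⟨π (f x), ?_⟩, interior_subset, isOpen_interior⟩
  rw [mem_interior_iff_mem_nhds, ← h2, Set.image_image]
  exact Filter.image_mem_map (hO.mem_nhds hx)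

/-- Injective coordinate projections do not decrease the dimension. -/
theorem dim_le {N : ℕ} {Γ : Set (Fin N → ℚ_[p])} (hΓ : DefS (Dalg p N) Γ) (σ : Fin n → Fin N) {Y : Set (Fin n → ℚ_[p])}
    (hinj : Set.InjOn (fun z j => z (σ j)) Γ) (hY : ∀ z ∈ Γ, (fun j => z (σ j)) ∈ Y) (l : (Fin N → ℚ_[p]) →ₗ[ℚ_[p]] (Fin d → ℚ_[p]))
    {U : Set (Fin d → ℚ_[p])} (hU : U.Nonempty) (hUl : U ⊆ l '' Γ) (hUo : IsOpen U) :
    ∃ k, d ≤ k ∧ ∃ (π : (Fin n → ℚ_[p]) →ₗ[ℚ_[p]] (Fin k → ℚ_[p])) (U : Set (Fin k → ℚ_[p])), U.Nonempty ∧ U ⊆ π '' Y ∧ IsOpen U := by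
  let B : Set (Fin N → ℚ_[p]) → Prop := fun S => ¬ IsMeagre (l '' (S ∩ Γ))
  have hB : Sig B := by
    have := (sig_meagre l)
    refine ⟨fun S T h => this.1 _ _ (Set.inter_subset_inter_left _ h), fun c hc h => ?_⟩
    obtain ⟨_, ⟨S, hS, rfl⟩, h'⟩ := this.2 ((· ∩ Γ) '' c) (hc.image _) (this.1 _ _ (fun x hx => by
      obtain ⟨⟨S, hS, hxS⟩, hx⟩ := hx
      exact ⟨_, ⟨S, hS, rfl⟩, hxS, hx⟩) h)
    exact ⟨S, hS, h'⟩
  have hcoord : ∀ j, AnalyticOnNhd ℚ_[p] (fun z : Fin N → ℚ_[p] => z j) Set.univ := fun j x _ =>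
    (ContinuousLinearMap.proj (R := ℚ_[p]) (φ := fun _ : Fin N => ℚ_[p]) j).analyticAt x
  obtain ⟨k, O, ψ, hψ, h⟩ := lemS hΓ N B Set.univ (fun j z => z j) hB isOpen_univ
    (fun h => not_isMeagre_of_isOpen hUo hU (h.mono (by simpa using hUl))) hcoord
  have hon : (ψ '' O).Nonempty := hB.nonempty hψ.big
  have hO : O.Nonempty := hon.of_image
  have hin : ∀ x ∈ O, ψ x ∈ Γ := by
    rcases h with h | h
    · exact h
    · refine absurd ?_ hψ.big
      have : ψ '' O ∩ Γ = ∅ := by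
        ext z
        simp only [Set.mem_inter_iff, Set.mem_empty_iff_false, iff_false]
        rintro ⟨⟨x, hx, rfl⟩, hz⟩
        exact h x hx hz
      rw [this, Set.image_empty]
      exact IsMeagre.empty
  have hla : AnalyticOnNhd ℚ_[p] (fun x => l (ψ x)) O := fun x hx =>
    ((LinearMap.toContinuousLinearMap l).analyticAt _).comp (hψ.an x hx)
  refine ⟨k, meagre_image hψ.op hla fun h' => hψ.big (h'.mono ?_), ?_⟩
  · rintro _ ⟨_, ⟨⟨x, hx, rfl⟩, -⟩, rfl⟩
    exact ⟨x, hx, rfl⟩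
  · obtain ⟨π, U', h1, h2, h3⟩ := dim_image (f := fun x j => ψ x (σ j)) hψ.op hO
      (fun x hx => analyticAt_pi_iff.2 fun j => analyticAt_pi_iff.1 (hψ.an x hx) (σ j))
      (fun a ha b hb hab => hψ.inj ha hb (hinj (hin a ha) (hin b hb) hab))
    refine ⟨π, U', h1, h2.trans (Set.image_mono ?_), h3⟩
    rintro _ ⟨x, hx, rfl⟩
    exact hY _ (hin x hx)

end
end PadicSub
end

section
open Topology
namespace PadicSub
section
variable {p : ℕ} [Fact p.Prime] {k d m n : ℕ}

/-- The dimension set. -/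
def dimS (X : Set (Fin m → ℚ_[p])) : Set ℕ := {d : ℕ | ∃ (π : (Fin m → ℚ_[p]) →ₗ[ℚ_[p]] (Fin d → ℚ_[p]))
      (U : Set (Fin d → ℚ_[p])), U.Nonempty ∧ U ⊆ π '' X ∧ IsOpen U}

/-- Subanalytic subsets as spaces. -/
noncomputable def SpD (X : Set (Fin m → ℚ_[p])) : Sp p := (Sp.mk' (Dalg p m)).sub X

theorem dim_eq {X : Set (Fin m → ℚ_[p])} {Y : Set (Fin n → ℚ_[p])} {F : (Fin m → ℚ_[p]) → (Fin n → ℚ_[p])}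
    (hF : IsSubanalytic p (graphMap p X F)) (hb : Set.BijOn F X Y) {a b : ℕ} (ha : IsGreatest (dimS X) a)
    (hb' : IsGreatest (dimS Y) b) : a = b := by
  have hΓ := subanalytic_iff.1 hF
  have hmem : ∀ x ∈ X, Fin.append x (F x) ∈ graphMap p X F := fun x hx => ⟨by simpa using hx, by simp⟩
  have hinj : ∀ z ∈ graphMap p X F, ∀ z' ∈ graphMap p X F, (fun i => z (Fin.castAdd n i)) = (fun i => z' (Fin.castAdd n i)) → z = z' := by
    intro z hz z' hz' h
    have h2 := hz.2.symm.trans ((congrArg F h).trans hz'.2)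
    funext i
    refine Fin.addCases (fun i => congrFun h i) (fun i => congrFun h2 i) i
  refine le_antisymm ?_ ?_
  · obtain ⟨π, U, h1, h2, h3⟩ := ha.1
    obtain ⟨k, hk, h⟩ := dim_le (Y := Y) hΓ (Fin.natAdd m) (fun z hz z' hz' h => hinj z hz z' hz' (hb.injOn hz.1 hz'.1
      (hz.2.trans (Eq.trans h hz'.2.symm)))) (fun z hz => by
        have := hb.mapsTo hz.1
        rw [hz.2] at this
        exact this) (π ∘ₗ LinearMap.funLeft ℚ_[p] ℚ_[p] (Fin.castAdd n)) h1 (fun u hu => by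
        obtain ⟨x, hx, rfl⟩ := h2 hu
        refine ⟨_, hmem x hx, congrArg π ?_⟩
        funext i
        simp [LinearMap.funLeft]) h3
    exact hk.trans (hb'.2 h)
  · obtain ⟨π, U, h1, h2, h3⟩ := hb'.1
    obtain ⟨k, hk, h⟩ := dim_le (Y := X) hΓ (Fin.castAdd n) (fun z hz z' hz' h => hinj z hz z' hz' h) (fun z hz => hz.1)
      (π ∘ₗ LinearMap.funLeft ℚ_[p] ℚ_[p] (Fin.natAdd m)) h1 (fun u hu => by
        obtain ⟨y, hy, rfl⟩ := h2 hu
        obtain ⟨x, hx, rfl⟩ := hb.surjOn hy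
        refine ⟨_, hmem x hx, congrArg π ?_⟩
        funext i
        simp [LinearMap.funLeft]) h3
    exact hk.trans (ha.2 h)

theorem reindex_mem {N : ℕ} (σ : Fin m → Fin N) : ∀ f ∈ Dalg p m, f ∘ (fun z j => z (σ j)) ∈ Dalg p N := fun f hf =>
  IsDFunction.comp f _ hf fun j => coord_mem_Dalg (σ j)

theorem pull_mem {N : ℕ} {X : Set (Fin m → ℚ_[p])} {Z : Set (Fin N → ℚ_[p])} (σ : Fin m → Fin N) (h : ∀ z ∈ Z, (fun j => z (σ j)) ∈ X)
    {f : X → ℚ_[p]} (hf : f ∈ (SpD X).A) : (fun z : Z => f ⟨fun j => z.1 (σ j), h z.1 z.2⟩) ∈ (SpD Z).A := by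
  have h1 : Mor (Sp.mk' (Dalg p N)) (Sp.mk' (Dalg p m)) (fun z : Fin N → ℚ_[p] => fun j => z (σ j)) :=
    mor_mk' (X := Sp.mk' (Dalg p N)) fun f hf => le_cl _ (reindex_mem σ f hf)
  have h2 := Mor.comp (X := SpD Z) (Y := Sp.mk' (Dalg p N)) (φ := (Subtype.val : Z → _)) h1 (mor_val (Sp.mk' (Dalg p N)) Z)
  exact mor_sub (X := SpD Z) (Y := Sp.mk' (Dalg p m)) (S := X) (φ := fun z : Z => (⟨fun j => z.1 (σ j), h z.1 z.2⟩ : X)) h2 f hf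

theorem exists_bij {X : Set (Fin m → ℚ_[p])} {Y : Set (Fin n → ℚ_[p])} (hX : DefS (Dalg p m) X) (hY : DefS (Dalg p n) Y)
    (e : X ≃ ZpSet p d) (he : ∀ i, (fun x => (e x).1 i) ∈ (SpD X).A) (e' : Y ≃ ZpSet p d) (he' : ∀ i, (fun x => (e' x).1 i) ∈ (SpD Y).A) :
    ∃ F : (Fin m → ℚ_[p]) → (Fin n → ℚ_[p]), IsSubanalytic p (graphMap p X F) ∧ Set.BijOn F X Y := by
  classical
  let Z : Set (Fin (m + n) → ℚ_[p]) := {z | (fun i => z (Fin.castAdd n i)) ∈ X ∧ (fun j => z (Fin.natAdd m j)) ∈ Y}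
  have hZ : DefS (Dalg p (m + n)) Z := BoolGen.inter _ _ (DefS.comp (reindex_mem _) hX) (DefS.comp (reindex_mem _) hY)
  let F : (Fin m → ℚ_[p]) → (Fin n → ℚ_[p]) := fun x => if h : x ∈ X then (e'.symm (e ⟨x, h⟩)).1 else 0
  have hF : ∀ x (h : x ∈ X), F x = (e'.symm (e ⟨x, h⟩)).1 := fun x h => dif_pos h
  refine ⟨F, ?_, ?_, ?_, ?_⟩
  · rw [subanalytic_iff]
    let u : Fin d → Z → ℚ_[p] := fun i z => (e ⟨_, z.2.1⟩).1 i
    let v : Fin d → Z → ℚ_[p] := fun i z => (e' ⟨_, z.2.2⟩).1 i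
    have hu : ∀ i, u i ∈ (SpD Z).A := fun i => pull_mem (Fin.castAdd n) (f := fun x => (e x).1 i) (fun z hz => hz.1) (he i)
    have hv : ∀ i, v i ∈ (SpD Z).A := fun i => pull_mem (Fin.natAdd m) (f := fun x => (e' x).1 i) (fun z hz => hz.2) (he' i)
    have h1 : DefS (SpD Z).A {z : Z | ∀ i, u i z = v i z} := BoolGen.all_finite (X := Z) fun i => DefS.eq (hu i) (hv i)
    obtain ⟨T', hT', h2⟩ := def_sub (X := Sp.mk' (Dalg p (m + n))) (S := Z) h1
    refine BoolGen.congr (BoolGen.inter _ _ hZ (DefS.of_cl (A := Dalg p (m + n)) hT')) fun z => ?_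
    have key : ∀ hz : z ∈ Z, z ∈ T' ↔ e ⟨_, hz.1⟩ = e' ⟨_, hz.2⟩ := fun hz => by
      have h3 : (∀ i, u i ⟨z, hz⟩ = v i ⟨z, hz⟩) ↔ z ∈ T' := iff_of_eq (congrFun h2 ⟨z, hz⟩)
      refine h3.symm.trans ?_
      exact ⟨fun h => Subtype.ext (funext h), fun h i => congrFun (congrArg Subtype.val h) i⟩
    constructor
    · rintro ⟨hz, hzT⟩
      refine ⟨hz.1, ?_⟩
      rw [hF _ hz.1, (key hz).1 hzT, Equiv.symm_apply_apply]
    · rintro ⟨hz, h3⟩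
      rw [hF _ hz] at h3
      have hz' : z ∈ Z := ⟨hz, h3 ▸ Subtype.coe_prop _⟩
      refine ⟨hz', (key hz').2 ?_⟩
      rw [← Equiv.symm_apply_eq]
      exact Subtype.ext h3
  · intro x hx
    rw [hF x hx]
    exact Subtype.coe_prop _
  · intro x hx y hy h
    rw [hF x hx, hF y hy] at h
    exact congrArg Subtype.val (e.injective (e'.symm.injective (Subtype.ext h)))
  · intro y hy
    refine ⟨(e.symm (e' ⟨y, hy⟩)).1, Subtype.coe_prop _, ?_⟩
    rw [hF _ (Subtype.coe_prop _)]
    simp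

theorem zp_def : DefS (Dalg p d) (ZpSet p d) := by
  have := BoolGen.all_finite fun i : Fin d => DefS.norm_le (coord_mem_Dalg (p := p) i) (const_mem (Dalg p d) 1)
  simpa [ZpSet] using this

theorem zp_dim : IsGreatest (dimS (ZpSet p d)) d := by
  constructor
  · have : ZpSet p d = Metric.closedBall 0 1 := by
      ext y
      simp [ZpSet, pi_norm_le_iff_of_nonneg zero_le_one]
    exact ⟨LinearMap.id, ZpSet p d, ⟨0, fun j => by simp⟩, by simp, by
      rw [this]
      exact IsUltrametricDist.isOpen_closedBall _ one_ne_zero⟩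
  · rintro k ⟨π, U, h1, h2, h3⟩
    exact meagre_image (f := π) isOpen_univ ((LinearMap.toContinuousLinearMap π).analyticOnNhd _)
      fun h => not_isMeagre_of_isOpen h3 h1 (h.mono (h2.trans (Set.image_mono (Set.subset_univ _))))

theorem exists_code {X : Set (Fin m → ℚ_[p])} (hX : DefS (Dalg p m) X) (hinf : X.Infinite) {a : ℕ} (ha : IsGreatest (dimS X) a) :
    ∃ e : X ≃ ZpSet p a, ∀ i, (fun x => (e x).1 i) ∈ (SpD X).A := by
  rcases FSQ.extract (X := SpD X) (Dalg_fsq hX) with h | ⟨d, e, he⟩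
  · exact absurd (Set.finite_coe_iff.1 h) hinf
  · have h1 : ∀ i, (fun x : ZpSet p (d + 1) => (Equiv.refl (ZpSet p (d + 1)) x).1 i) ∈ (SpD (ZpSet p (d + 1))).A := fun i =>
      mor_val (Sp.mk' (Dalg p (d + 1))) (ZpSet p (d + 1)) (fun x => x i) (le_cl _ (coord_mem_Dalg i))
    obtain ⟨F, hF, hb⟩ := exists_bij hX zp_def e he _ h1
    obtain rfl := dim_eq hF hb ha zp_dim
    exact ⟨e, he⟩

end
end PadicSub
end

open PadicSub in
/-- **Classification of subanalytic sets** (Theorem 2/Theorem 6 of the paper).  Two infinite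
subanalytic sets `X ⊆ ℚ_p^m`, `Y ⊆ ℚ_p^n` admit a subanalytic bijection between them if and
only if they have the same dimension, where the dimension of a subanalytic set `X ⊆ ℚ_p^m` is
the largest `d` such that some `ℚ_p`-linear map `π : ℚ_p^m → ℚ_p^d` satisfies that `π(X)`
contains a nonempty open subset of `ℚ_p^d`. -/
theorem subanalytic_classification
    (p : ℕ) [Fact p.Prime] (m n : ℕ)
    (X : Set (Fin m → ℚ_[p])) (Y : Set (Fin n → ℚ_[p]))
    (hX : IsSubanalytic p X) (hY : IsSubanalytic p Y)
    (hXinf : X.Infinite) (hYinf : Y.Infinite)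
    (dX dY : ℕ)
    (hdX : IsGreatest {d : ℕ | ∃ (π : (Fin m → ℚ_[p]) →ₗ[ℚ_[p]] (Fin d → ℚ_[p]))
      (U : Set (Fin d → ℚ_[p])), U.Nonempty ∧ U ⊆ π '' X ∧ IsOpen U} dX)
    (hdY : IsGreatest {d : ℕ | ∃ (π : (Fin n → ℚ_[p]) →ₗ[ℚ_[p]] (Fin d → ℚ_[p]))
      (U : Set (Fin d → ℚ_[p])), U.Nonempty ∧ U ⊆ π '' Y ∧ IsOpen U} dY) :
    (∃ F : (Fin m → ℚ_[p]) → (Fin n → ℚ_[p]),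
        IsSubanalytic p (graphMap p X F) ∧ Set.BijOn F X Y) ↔ dX = dY := by
  have hX' := subanalytic_iff.1 hX
  have hY' := subanalytic_iff.1 hY
  refine ⟨fun ⟨F, hF, hb⟩ => dim_eq hF hb hdX hdY, fun h => ?_⟩
  subst h
  obtain ⟨e, he⟩ := exists_code hX' hXinf hdX
  obtain ⟨e', he'⟩ := exists_code hY' hYinf hdY
  exact exists_bij hX' hY' e he e' he'
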